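/- Zero-measure spectrum in the critical region: Let t ∈ (−1,1), λ₁ = λ₂ ∈ (0, (1−t²)/(1+t²)), Φ irrational, and θ ∈ ℝ. Then the spectrum Σ of the quantum-walk operator W = W_{λ₁,λ₁,Φ,θ} (a subset of the unit circle in ℂ) has zero Lebesgue arc-length measure: the set {s ∈ [0,1) : e^{2πis} ∈ Σ} has Lebesgue measure zero. -/

import Mathlib

open MeasureTheory

noncomputable section

/-- `λ' = √(1 - λ²)`. -/
def sq1 (l : ℝ) : ℝ := Real.sqrt (1 - l ^ 2)

/-- The sampling function `f(x) = (1/k)(2 t λ₂ cos(2πx) + (t²−1) λ₂′)` with `k = −(1+t²)`. -/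
def fS (t l x : ℝ) : ℝ :=
  (1 / (-(1 + t ^ 2))) * (2 * t * l * Real.cos (2 * Real.pi * x) + (t ^ 2 - 1) * sq1 l)

/-- The sampling function `g(x) = (1/k)(−t² λ₂ e^{2πix} + λ₂ e^{−2πix} + 2 t λ₂′)`. -/
def gS (t l x : ℝ) : ℂ :=
  ((1 / (-(1 + t ^ 2)) : ℝ) : ℂ) *
    (-(((t ^ 2 * l : ℝ)) : ℂ) * Complex.exp (2 * Real.pi * x * Complex.I)
      + ((l : ℝ) : ℂ) * Complex.exp (-(2 * Real.pi * x) * Complex.I)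
      + ((2 * t * sq1 l : ℝ) : ℂ))

/-- The Hilbert space `ℓ²(ℤ; ℂ²)`. -/
abbrev H2 := lp (fun _ : ℤ => EuclideanSpace ℂ (Fin 2)) 2

/-- The `+` component of `W ψ = S_{λ₁} Q ψ` at site `n`. -/
def wPlus (t l1 l2 Φ θ : ℝ) (ψ : ℤ → EuclideanSpace ℂ (Fin 2)) (n : ℤ) : ℂ :=
  (l1 : ℂ) * ((fS t l2 (θ + ((n : ℝ) - 1) * Φ) : ℂ) * ψ (n - 1) 0
      - gS t l2 (θ + ((n : ℝ) - 1) * Φ) * ψ (n - 1) 1)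
    - (sq1 l1 : ℂ) * ((starRingEnd ℂ) (gS t l2 (θ + (n : ℝ) * Φ)) * ψ n 0
      + (fS t l2 (θ + (n : ℝ) * Φ) : ℂ) * ψ n 1)

/-- The `−` component of `W ψ = S_{λ₁} Q ψ` at site `n`. -/
def wMinus (t l1 l2 Φ θ : ℝ) (ψ : ℤ → EuclideanSpace ℂ (Fin 2)) (n : ℤ) : ℂ :=
  (l1 : ℂ) * ((starRingEnd ℂ) (gS t l2 (θ + ((n : ℝ) + 1) * Φ)) * ψ (n + 1) 0
      + (fS t l2 (θ + ((n : ℝ) + 1) * Φ) : ℂ) * ψ (n + 1) 1)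
    + (sq1 l1 : ℂ) * ((fS t l2 (θ + (n : ℝ) * Φ) : ℂ) * ψ n 0
      - gS t l2 (θ + (n : ℝ) * Φ) * ψ n 1)

/-- `ψ` is a (generalized) eigenvector of `W_{λ₁,λ₂,Φ,θ}` with eigenvalue `z`. -/
def IsEigen (t l1 l2 Φ θ : ℝ) (z : ℂ) (ψ : ℤ → EuclideanSpace ℂ (Fin 2)) : Prop :=
  ∀ n : ℤ, wPlus t l1 l2 Φ θ ψ n = z * ψ n 0 ∧ wMinus t l1 l2 Φ θ ψ n = z * ψ n 1

section

open Matrix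
open scoped Real
open Real (abs_cos_le_one abs_sin_le_one add_one_le_exp arccos cos cos_pi_sub cos_sq_add_sin_sq cos_zero exp
  exp_le_exp exp_log exp_nat_mul exp_pos exp_sum log norm_eq_abs norm_of_nonneg pi_ne_zero pi_pos sin sin_pi_sub
  sq_sqrt sqrt sqrt_le_iff sqrt_le_sqrt sqrt_mul sqrt_nonneg sqrt_sq tan)
open Complex (I I_im I_mul_I I_sq abs_im_le_norm abs_re_le_norm add_conj add_re arg conj_I conj_mul' conj_ofReal
  cos_neg exp_add exp_eq_one_iff exp_mul_I im im_ofReal_mul log_im mul_conj mul_conj' mul_im mul_re normSq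
  normSq_apply normSq_eq_norm_sq normSq_mul normSq_nonneg normSq_pos normSq_zero norm_exp norm_real ofReal_cos
  ofReal_div ofReal_im ofReal_injective ofReal_mul ofReal_ne_zero ofReal_neg ofReal_one ofReal_pow ofReal_prod
  ofReal_re ofReal_sin ofReal_sub one_im one_re re_sum sin_neg sq_norm star_def sub_im sub_re)
open ENNReal (ofReal ofReal_add ofReal_le_ofReal)
open Finset (card_range mem_erase mem_filter mem_range mem_univ mul_prod_erase prod_congr prod_const prod_eq_one
  prod_eq_zero prod_eq_zero_iff prod_le_prod prod_mul_distrib prod_nonneg prod_pos prod_range_add prod_range_succ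
  prod_range_succ' range sum_add_distrib sum_congr sum_const sum_eq_single sum_eq_zero sum_insert sum_le_sum
  sum_range univ)
open Polynomial (IsRoot coeff_C coeff_C_mul coeff_X coeff_X_pow coeff_add coeff_sub eval evalRingHom eval_C eval_X
  eval_add eval_mul)
open Set (Ico Ioc Ioi Ioo mem_ofPred_eq)
open Equiv (Perm addRight sumCongr sumSumSumComm symm_apply_apply)
open Fintype (card card_fin card_pos card_sum sum_prod_type sum_sum_type)

open Metric in
/-- A holomorphic function on the unit disc with nonnegative real part, real at the origin. -/
structure Herglotz (F : ℂ → ℂ) (c : ℝ) : Prop where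
  diff : DifferentiableOn ℂ F (ball 0 1)
  re_nonneg : ∀ z ∈ ball (0 : ℂ) 1, 0 ≤ (F z).re
  zero_eq : F 0 = c

/-- The parametrization `s ↦ e^{2πis}` of the unit circle. -/
def circ (s : ℝ) : ℂ := Complex.exp (2 * π * s * I)

lemma norm_circ (s : ℝ) : ‖circ s‖ = 1 := by
  have : circ s = Complex.exp (((2 * π * s : ℝ) : ℂ) * I) := by
    simp [circ]
  rw [this, Complex.norm_exp_ofReal_mul_I]

lemma continuous_circ : Continuous circ := by unfold circ; fun_prop

lemma circleMap_eq_circ (r s : ℝ) : circleMap 0 r (2 * π * s) = r * circ s := by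
  simp [circleMap, circ]

lemma Herglotz.add {F G : ℂ → ℂ} {c d : ℝ} (hF : Herglotz F c) (hG : Herglotz G d) :
    Herglotz (fun z => F z + G z) (c + d) where
  diff := hF.diff.add hG.diff
  re_nonneg z hz := by
    rw [add_re]; exact add_nonneg (hF.re_nonneg z hz) (hG.re_nonneg z hz)
  zero_eq := by simp [hF.zero_eq, hG.zero_eq]

lemma herglotz_zero : Herglotz (fun _ => 0) 0 where
  diff := differentiableOn_const _
  re_nonneg z _ := by simp
  zero_eq := by simp

lemma Herglotz.nonneg {F : ℂ → ℂ} {c : ℝ} (hF : Herglotz F c) : 0 ≤ c := by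
  have := hF.re_nonneg 0 (by simp)
  rwa [hF.zero_eq, ofReal_re] at this

lemma Herglotz.norm_le {F : ℂ → ℂ} {c : ℝ} (hF : Herglotz F c) {z : ℂ} (hz : ‖z‖ < 1) :
    ‖F z‖ ≤ c * ((1 + ‖z‖) / (1 - ‖z‖)) := by
  have h1 : 0 < 1 - ‖z‖ := by linarith
  have key : ∀ M : ℝ, 0 < M → ‖F z‖ ≤ 2 * M * ‖z‖ / (1 - ‖z‖) + c * (1 + ‖z‖) / (1 - ‖z‖) := by
    intro M hM
    have := Complex.borelCaratheodory (f := fun z => - F z) (R := 1) hM hF.diff.neg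
      (fun w hw => by
        have := hF.re_nonneg w hw
        simp only [mem_ofPred_eq, Complex.neg_re]; linarith) one_pos (by simpa using hz)
    simpa [hF.zero_eq, abs_of_nonneg hF.nonneg] using this
  have ht : Filter.Tendsto (fun M : ℝ => 2 * M * ‖z‖ / (1 - ‖z‖) + c * (1 + ‖z‖) / (1 - ‖z‖))
      (nhdsWithin 0 (Ioi 0)) (nhds (2 * 0 * ‖z‖ / (1 - ‖z‖) + c * (1 + ‖z‖) / (1 - ‖z‖))) := by
    apply Filter.Tendsto.mono_left _ nhdsWithin_le_nhds
    apply Continuous.tendsto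
    fun_prop
  have := ge_of_tendsto ht (Filter.eventually_of_mem self_mem_nhdsWithin
    (fun M hM => key M hM))
  simpa [mul_div_assoc] using this

lemma sqrt_norm_le_re_cpow {w : ℂ} (hw : 0 < w.re) :
    sqrt ‖w‖ ≤ sqrt 2 * (w ^ (1 / 2 : ℂ)).re := by
  have hw0 : w ≠ 0 := by rintro rfl; simp at hw
  set v := w ^ (1 / 2 : ℂ) with hv
  have hv2 : v ^ 2 = w := by
    rw [hv, ← Complex.cpow_nat_mul]; simp
  have hre : 0 ≤ v.re := by
    rw [hv, Complex.cpow_def_of_ne_zero hw0, Complex.exp_re]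
    apply mul_nonneg (Real.exp_nonneg _)
    apply Real.cos_nonneg_of_mem_Icc
    have h1 := Complex.abs_arg_le_pi w
    rw [abs_le] at h1
    have : (Complex.log w * (1 / 2)).im = arg w / 2 := by
      rw [show (1 / 2 : ℂ) = ((1 / 2 : ℝ) : ℂ) by simp, mul_comm, im_ofReal_mul,
        log_im]; ring
    rw [this]; constructor <;> linarith
  have h3 : (v ^ 2).re = v.re ^ 2 - v.im ^ 2 := by rw [sq, mul_re]; ring
  have h4 : ‖w‖ = v.re ^ 2 + v.im ^ 2 := by
    rw [← hv2, norm_pow, sq_norm, normSq_apply]; ring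
  rw [← hv2, h3] at hw
  rw [h4]
  calc sqrt (v.re ^ 2 + v.im ^ 2) ≤ sqrt (2 * v.re ^ 2) := sqrt_le_sqrt (by linarith)
    _ = _ := by rw [sqrt_mul (by norm_num), sqrt_sq hre]

lemma integral_circ_eq {h : ℂ → ℂ} (hd : DifferentiableOn ℂ h (Metric.ball 0 1)) {r : ℝ}
    (hr0 : 0 ≤ r) (hr : r < 1) : ∫ s in (0 : ℝ)..1, h (r * circ s) = h 0 := by
  have h1 : DiffContOnCl ℂ h (Metric.ball 0 |r|) := by
    apply DifferentiableOn.diffContOnCl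
    apply hd.mono
    refine (Metric.closure_ball_subset_closedBall).trans ?_
    apply Metric.closedBall_subset_ball
    rwa [abs_of_nonneg hr0]
  have h2 := h1.circleAverage
  rw [Real.circleAverage_def] at h2
  have h3 := intervalIntegral.integral_comp_mul_left (a := 0) (b := 1)
    (fun θ => h (circleMap 0 r θ)) (c := 2 * π) (by positivity)
  simp only [mul_zero, mul_one, circleMap_eq_circ] at h3
  rw [h3, h2]

/-- Kolmogorov's weak-type inequality for Herglotz functions. -/
lemma Herglotz.weak_type {F : ℂ → ℂ} {c : ℝ} (hF : Herglotz F c) {c' l : ℝ} (hc : c ≤ c')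
    (hc' : 0 < c') (hl : 0 < l) {r : ℝ} (hr0 : 0 ≤ r) (hr : r < 1) :
    volume {s : ℝ | s ∈ Ico (0 : ℝ) 1 ∧ l < ‖F (r * circ s)‖} ≤
      ofReal (2 * sqrt (c' / l)) := by
  set h : ℂ → ℂ := fun z => (F z + c') ^ (1 / 2 : ℂ) with hh
  have hpos : ∀ z ∈ Metric.ball (0 : ℂ) 1, 0 < (F z + c').re := by
    intro z hz
    have := hF.re_nonneg z hz
    simp; linarith
  have hd : DifferentiableOn ℂ h (Metric.ball 0 1) := by
    apply DifferentiableOn.cpow (hF.diff.add (differentiableOn_const _)) (differentiableOn_const _)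
    intro z hz
    exact Or.inl (hpos z hz)
  have hmem : ∀ s, (r : ℂ) * circ s ∈ Metric.ball (0 : ℂ) 1 := by
    intro s; simp [norm_circ, abs_of_nonneg hr0, hr]
  have hcont : Continuous fun s => h (r * circ s) := by
    apply hd.continuousOn.comp_continuous (by have := _root_.continuous_circ; fun_prop) hmem
  have hint := integral_circ_eq hd hr0 hr
  have hintre : ∫ s in (0 : ℝ)..1, (h (r * circ s)).re = (h 0).re := by
    rw [← hint]
    have := intervalIntegral.intervalIntegral_eq_integral_uIoc (fun s => h (r * circ s)) 0 1 volume
    exact intervalIntegral.intervalIntegral_re (𝕜 := ℂ) (hcont.intervalIntegrable 0 1)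
  have h0 : (h 0).re = sqrt (c + c') := by
    have : F 0 + c' = ((c + c' : ℝ) : ℂ) := by rw [hF.zero_eq]; push_cast; ring
    simp only [hh, this]
    rw [show (1 / 2 : ℂ) = ((1 / 2 : ℝ) : ℂ) by simp, ← Complex.ofReal_cpow (by linarith [hF.nonneg]),
      ofReal_re, Real.sqrt_eq_rpow]
  have hnn : ∀ s, 0 ≤ (h (r * circ s)).re := by
    intro s
    have := (sqrt_nonneg _).trans (sqrt_norm_le_re_cpow (hpos _ (hmem s)))
    have h2 : 0 < sqrt 2 := by positivity
    exact nonneg_of_mul_nonneg_right this h2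
  have hreg : Continuous fun s => (h (r * circ s)).re := Complex.continuous_re.comp hcont
  have hmk := mul_meas_ge_le_integral_of_nonneg (μ := volume.restrict (Ico (0:ℝ) 1))
    (f := fun s => (h (r * circ s)).re) (Filter.Eventually.of_forall hnn)
    ((hreg.integrableOn_Icc (a := 0) (b := 1)).mono_set Set.Ico_subset_Icc_self)
    (sqrt l / sqrt 2)
  rw [integral_Ico_eq_integral_Ioc, ← intervalIntegral.integral_of_le (by norm_num), hintre, h0]
    at hmk
  have hsub : {s : ℝ | s ∈ Ico (0 : ℝ) 1 ∧ l < ‖F (r * circ s)‖} ⊆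
      {s | sqrt l / sqrt 2 ≤ (h (r * circ s)).re} ∩ Ico (0:ℝ) 1 := by
    rintro s ⟨hs, hls⟩
    refine ⟨?_, hs⟩
    simp only [mem_ofPred_eq]
    rw [div_le_iff₀ (by positivity), mul_comm]
    refine le_trans (sqrt_le_sqrt ?_) (sqrt_norm_le_re_cpow (hpos _ (hmem s)))
    refine hls.le.trans ?_
    rw [← sq_le_sq₀ (norm_nonneg _) (norm_nonneg _), sq_norm, sq_norm,
      normSq_apply, normSq_apply]
    have := hF.re_nonneg _ (hmem s)
    simp only [add_re, ofReal_re, Complex.add_im, ofReal_im, add_zero]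
    nlinarith
  have hfin : volume ({s | sqrt l / sqrt 2 ≤ (h (r * circ s)).re} ∩ Ico (0:ℝ) 1) ≠ ⊤ := by
    apply measure_ne_top_of_subset Set.inter_subset_right; simp
  rw [measureReal_restrict_apply' measurableSet_Ico] at hmk
  refine (measure_mono hsub).trans ?_
  rw [← ENNReal.ofReal_toReal hfin]
  apply ofReal_le_ofReal
  have hsl : 0 < sqrt l := by positivity
  have hs2 : 0 < sqrt 2 := by positivity
  have h5 : sqrt (c + c') ≤ sqrt 2 * sqrt c' := by
    rw [← sqrt_mul (by norm_num)]; exact sqrt_le_sqrt (by linarith)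
  rw [Real.sqrt_div hc'.le]
  have h22 : sqrt 2 * sqrt 2 = 2 := Real.mul_self_sqrt (by norm_num)
  unfold Measure.real at hmk
  set X := (volume ({s | sqrt l / sqrt 2 ≤ (h (r * circ s)).re} ∩ Ico (0:ℝ) 1)).toReal
  rw [← mul_div_assoc, le_div_iff₀ hsl]
  have : sqrt l * X = sqrt 2 * (sqrt l / sqrt 2 * X) := by field_simp
  calc X * sqrt l = sqrt 2 * (sqrt l / sqrt 2 * X) := by rw [mul_comm, this]
    _ ≤ sqrt 2 * (sqrt 2 * sqrt c') :=
        mul_le_mul_of_nonneg_left (hmk.trans h5) hs2.le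
    _ = 2 * sqrt c' := by rw [← mul_assoc, h22]

/-- Measure of the set of points that eventually lie in sets of uniformly bounded measure. -/
lemma measure_eventually_le {S : ℕ → Set ℝ} {T : Set ℝ} {b : ENNReal}
    (hS : ∀ n, volume (S n) ≤ b) (hT : ∀ s ∈ T, ∀ᶠ n in Filter.atTop, s ∈ S n) :
    volume T ≤ b := by
  have h1 : T ⊆ ⋃ N, ⋂ n ∈ Set.Ici N, S n := by
    intro s hs
    obtain ⟨N, hN⟩ := Filter.eventually_atTop.1 (hT s hs)
    simp only [Set.mem_iUnion, Set.mem_iInter]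
    exact ⟨N, fun n hn => hN n hn⟩
  refine (measure_mono h1).trans ?_
  rw [Monotone.measure_iUnion]
  · apply iSup_le
    intro N
    exact (measure_mono (Set.biInter_subset_of_mem (Set.mem_Ici.2 le_rfl))).trans (hS N)
  · intro M N hMN
    apply Set.biInter_subset_biInter_left
    exact Set.Ici_subset_Ici.2 hMN

lemma tendsto_radius : Filter.Tendsto (fun n : ℕ => (1 - 1 / ((n : ℝ) + 1))) Filter.atTop (nhds 1) := by
  simpa using tendsto_one_div_add_atTop_nhds_zero_nat (𝕜 := ℝ) |>.const_sub 1

lemma radius_mem (n : ℕ) : 0 ≤ 1 - 1 / ((n : ℝ) + 1) ∧ 1 - 1 / ((n : ℝ) + 1) < 1 := by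
  have : (0:ℝ) < n + 1 := by positivity
  constructor
  · rw [sub_nonneg, div_le_one this]; linarith [(Nat.cast_nonneg n : (0:ℝ) ≤ n)]
  · have : 0 < 1 / ((n:ℝ) + 1) := by positivity
    linarith

lemma Herglotz.weak_type_sub {F G : ℂ → ℂ} {c d : ℝ} (hF : Herglotz F c) (hG : Herglotz G d)
    {c' l : ℝ} (hc : c + d ≤ c')
    (hc' : 0 < c') (hl : 0 < l) {r : ℝ} (hr0 : 0 ≤ r) (hr : r < 1) :
    volume {s : ℝ | s ∈ Ico (0 : ℝ) 1 ∧ l < ‖F (r * circ s) - G (r * circ s)‖} ≤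
      ofReal (6 * sqrt (c' / l)) := by
  have h1 := hF.weak_type (c' := c') (l := l / 2) (by linarith [hG.nonneg]) hc' (by positivity) hr0 hr
  have h2 := hG.weak_type (c' := c') (l := l / 2) (by linarith [hF.nonneg]) hc' (by positivity) hr0 hr
  refine (measure_mono ?_).trans ((measure_union_le _ _).trans ((add_le_add h1 h2).trans ?_))
  · rintro s ⟨hs, h⟩
    by_cases hh : l / 2 < ‖F (r * circ s)‖
    · exact Or.inl ⟨hs, hh⟩
    · refine Or.inr ⟨hs, ?_⟩
      have := norm_sub_le (F (r * circ s)) (G (r * circ s))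
      linarith
  · rw [← ofReal_add (by positivity) (by positivity)]
    apply ofReal_le_ofReal
    have : c' / (l / 2) = 2 * (c' / l) := by field_simp
    rw [this, sqrt_mul (by norm_num)]
    have h3 : sqrt 2 ≤ 3 / 2 := by
      rw [sqrt_le_iff]; norm_num
    nlinarith [sqrt_nonneg (c' / l)]

/-- Boundary comparison of two continuous functions whose quotient in the disc is the
exponential of a difference of Herglotz functions. -/
lemma Herglotz.boundary_comparison {F G : ℂ → ℂ} {c d : ℝ} (hF : Herglotz F c) (hG : Herglotz G d)
    {c' l : ℝ} (hc : c + d ≤ c') (hc' : 0 < c') (hl : 0 < l) {p q : ℂ → ℂ}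
    (hp : Continuous p) (hq : Continuous q)
    (hpq : ∀ z ∈ Metric.ball (0 : ℂ) 1, ‖q z‖ ≤ ‖p z‖ * exp ‖F z - G z‖) :
    volume {s : ℝ | s ∈ Ico (0 : ℝ) 1 ∧ ‖p (circ s)‖ * exp l < ‖q (circ s)‖} ≤
      ofReal (6 * sqrt (c' / l)) := by
  refine measure_eventually_le (S := fun n : ℕ => {s : ℝ | s ∈ Ico (0 : ℝ) 1 ∧
    l < ‖F (((1 - 1 / ((n : ℝ) + 1) : ℝ) : ℂ) * circ s) -
      G (((1 - 1 / ((n : ℝ) + 1) : ℝ) : ℂ) * circ s)‖}) ?_ ?_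
  · intro n
    exact hF.weak_type_sub hG hc hc' hl (radius_mem n).1 (radius_mem n).2
  · rintro s ⟨hs, h⟩
    have ht : Filter.Tendsto (fun n : ℕ => ((1 - 1 / ((n : ℝ) + 1) : ℝ) : ℂ) * circ s)
        Filter.atTop (nhds (circ s)) := by
      have := ((Complex.continuous_ofReal.tendsto 1).comp tendsto_radius).mul_const (circ s)
      simpa using this
    have h1 := ((hp.tendsto _).comp ht).norm.mul_const (exp l)
    have h2 := ((hq.tendsto _).comp ht).norm
    filter_upwards [h1.eventually_lt h2 h] with n hn
    refine ⟨hs, ?_⟩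
    set z := ((1 - 1 / ((n : ℝ) + 1) : ℝ) : ℂ) * circ s
    have hz : z ∈ Metric.ball (0 : ℂ) 1 := by
      simp only [z, mem_ball_zero_iff, norm_mul, norm_circ, mul_one, norm_real,
        norm_eq_abs, abs_of_nonneg (radius_mem n).1]
      exact (radius_mem n).2
    have h3 := hn.trans_le (hpq z hz)
    by_contra hcon
    push Not at hcon
    have : exp ‖F z - G z‖ ≤ exp l := exp_le_exp.2 hcon
    have := mul_le_mul_of_nonneg_left this (norm_nonneg (p z))
    simp only [Function.comp] at h3
    linarith

section

section PhaseRel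
variable {ι κ μ : Type*} [Fintype ι] [DecidableEq ι] [Fintype κ] [DecidableEq κ]
  [Fintype μ] [DecidableEq μ]

/-- The reversed characteristic polynomial `det (1 - z A)`. -/
def chi (A : Matrix ι ι ℂ) (z : ℂ) : ℂ := (1 - z • A).det

lemma differentiable_chi (A : Matrix ι ι ℂ) : Differentiable ℂ (chi A) := by
  unfold chi
  simp only [det_apply, Matrix.sub_apply, Matrix.smul_apply, smul_eq_mul]
  fun_prop

lemma continuous_chi (A : Matrix ι ι ℂ) : Continuous (chi A) := (differentiable_chi A).continuous

lemma chi_zero (A : Matrix ι ι ℂ) : chi A 0 = 1 := by simp [chi]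

/-- The function `q` is obtained from `p` by phase rotations of total angle `2c`. -/
def PhaseRel (p q : ℂ → ℂ) (c : ℝ) : Prop :=
  ∃ (F G : ℂ → ℂ) (a b ρ : ℝ), Herglotz F a ∧ Herglotz G b ∧ a + b ≤ c ∧
    ∀ z ∈ Metric.ball (0 : ℂ) 1, q z = p z * Complex.exp (I * (F z - G z + ρ))

lemma PhaseRel.of_eq {p q : ℂ → ℂ} (h : ∀ z, p z = q z) :
    PhaseRel p q 0 :=
  ⟨_, _, 0, 0, 0, herglotz_zero, herglotz_zero, by simp, fun z _ => by simp [h]⟩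

lemma PhaseRel.symm {p q : ℂ → ℂ} {c : ℝ} (h : PhaseRel p q c) :
    PhaseRel q p c := by
  obtain ⟨F, G, a, b, ρ, hF, hG, hab, h⟩ := h
  refine ⟨G, F, b, a, -ρ, hG, hF, by linarith, fun z hz => ?_⟩
  rw [h z hz, mul_assoc, ← exp_add]
  push_cast
  ring_nf
  simp

lemma PhaseRel.trans {p q r : ℂ → ℂ} {c d : ℝ}
    (h : PhaseRel p q c) (h' : PhaseRel q r d) : PhaseRel p r (c + d) := by
  obtain ⟨F, G, a, b, ρ, hF, hG, hab, h⟩ := h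
  obtain ⟨F', G', a', b', ρ', hF', hG', hab', h'⟩ := h'
  refine ⟨_, _, _, _, ρ + ρ', hF.add hF', hG.add hG', by linarith, fun z hz => ?_⟩
  rw [h' z hz, h z hz, mul_assoc, ← exp_add]
  congr 2
  push_cast
  ring

lemma PhaseRel.mono {p q : ℂ → ℂ} {c d : ℝ}
    (h : PhaseRel p q c) (hcd : c ≤ d) : PhaseRel p q d := by
  obtain ⟨F, G, a, b, ρ, hF, hG, hab, h⟩ := h
  exact ⟨F, G, a, b, ρ, hF, hG, hab.trans hcd, h⟩

lemma PhaseRel.nonneg {p q : ℂ → ℂ} {c : ℝ} (h : PhaseRel p q c) :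
    0 ≤ c := by
  obtain ⟨F, G, a, b, ρ, hF, hG, hab, h⟩ := h
  linarith [hF.nonneg, hG.nonneg]

lemma PhaseRel.norm_le {p q : ℂ → ℂ} {c : ℝ} (h : PhaseRel p q c)
    {z : ℂ} (hz : ‖z‖ < 1) :
    ‖q z‖ ≤ ‖p z‖ * exp (c * ((1 + ‖z‖) / (1 - ‖z‖))) := by
  obtain ⟨F, G, a, b, ρ, hF, hG, hab, h⟩ := h
  rw [h z (by simpa using hz), norm_mul, norm_exp]
  gcongr
  have h1 : (I * (F z - G z + ρ)).re ≤ ‖F z‖ + ‖G z‖ := by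
    have : (I * (F z - G z + ρ)).re = -(F z).im + (G z).im := by
      simp [mul_re]; ring
    rw [this]
    have h2 := (abs_le.1 (abs_im_le_norm (F z))).1
    have h3 := (abs_le.1 (abs_im_le_norm (G z))).2
    linarith
  refine h1.trans ((add_le_add (hF.norm_le hz) (hG.norm_le hz)).trans ?_)
  rw [← add_mul]
  have : 0 ≤ 1 - ‖z‖ := by linarith
  gcongr

lemma PhaseRel.weak_type {p q : ℂ → ℂ} {c : ℝ} (h : PhaseRel p q c)
    (hp : Continuous p) (hq : Continuous q) (hc : 0 < c) {l : ℝ} (hl : 0 < l) :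
    volume {s : ℝ | s ∈ Ico (0 : ℝ) 1 ∧ ‖p (circ s)‖ * exp l < ‖q (circ s)‖} ≤
      ofReal (6 * sqrt (c / l)) := by
  obtain ⟨F, G, a, b, ρ, hF, hG, hab, h⟩ := h
  refine hF.boundary_comparison hG hab hc hl hp hq ?_
  intro z hz
  rw [h z hz, norm_mul, norm_exp]
  gcongr
  have : (I * (F z - G z + ρ)).re = -(F z - G z).im := by
    simp [mul_re]
  rw [this]
  exact (neg_le_abs _).trans (abs_im_le_norm _)

lemma PhaseRel.mul {p q p' q' : ℂ → ℂ} {c d : ℝ} (h : PhaseRel p q c) (h' : PhaseRel p' q' d) :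
    PhaseRel (fun z => p z * p' z) (fun z => q z * q' z) (c + d) := by
  obtain ⟨F, G, a, b, ρ, hF, hG, hab, h⟩ := h
  obtain ⟨F', G', a', b', ρ', hF', hG', hab', h'⟩ := h'
  refine ⟨_, _, _, _, ρ + ρ', hF.add hF', hG.add hG', by linarith, fun z hz => ?_⟩
  simp only [h' z hz, h z hz]
  rw [mul_mul_mul_comm, ← exp_add]
  congr 2
  push_cast
  ring

lemma PhaseRel.refl (p : ℂ → ℂ) : PhaseRel p p 0 := PhaseRel.of_eq fun _ => rfl

lemma sum_normSq_mulVec {A : Matrix ι ι ℂ} (hA : Aᴴ * A = 1) (u : ι → ℂ) :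
    ∑ k, normSq ((A *ᵥ u) k) = ∑ k, normSq (u k) := by
  have key : ∀ v : ι → ℂ, ((∑ k, normSq (v k) : ℝ) : ℂ) = star v ⬝ᵥ v := by
    intro v
    simp [dotProduct, Complex.normSq_eq_conj_mul_self]
  have : star (A *ᵥ u) ⬝ᵥ (A *ᵥ u) = star u ⬝ᵥ u := by
    rw [star_mulVec, dotProduct_mulVec, vecMul_vecMul, hA, vecMul_one]
  rw [← key, ← key] at this
  exact_mod_cast this

omit [DecidableEq ι] in
lemma sum_normSq_pos {u : ι → ℂ} (hu : u ≠ 0) : 0 < ∑ k, normSq (u k) := by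
  obtain ⟨i, hi⟩ := Function.ne_iff.1 hu
  exact Finset.sum_pos' (fun k _ => normSq_nonneg _)
    ⟨i, mem_univ _, normSq_pos.2 hi⟩

lemma chi_ne_zero {A : Matrix ι ι ℂ} (hA : Aᴴ * A = 1) {z : ℂ} (hz : ‖z‖ < 1) : chi A z ≠ 0 := by
  intro h
  obtain ⟨v, hv, h⟩ := exists_mulVec_eq_zero_iff.2 h
  have h1 : v = z • (A *ᵥ v) := by
    rw [sub_mulVec, one_mulVec, smul_mulVec, sub_eq_zero] at h; exact h
  have h2 : ∑ k, normSq (v k) = ‖z‖ ^ 2 * ∑ k, normSq (v k) := by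
    conv_lhs => rw [h1]
    simp only [Pi.smul_apply, smul_eq_mul, normSq_mul, ← Finset.mul_sum,
      sum_normSq_mulVec hA]
    rw [sq_norm]
  have h3 := sum_normSq_pos hv
  have h4 : ‖z‖ ^ 2 < 1 := by nlinarith [norm_nonneg z]
  nlinarith

/-- The diagonal unitary rotating one coordinate. -/
def rot (i : ι) (τ : ℝ) : Matrix ι ι ℂ :=
  diagonal (Function.update 1 i (Complex.exp (τ * I)))

lemma resolvent_re {A : Matrix ι ι ℂ} (hA : Aᴴ * A = 1) (i : ι) {z : ℂ} (hz : ‖z‖ < 1) :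
    1 / 2 < ((1 - z • A)⁻¹ i i).re := by
  have hdet : IsUnit (1 - z • A).det := (chi_ne_zero hA hz).isUnit
  set N := (1 - z • A)⁻¹ with hN
  set u : ι → ℂ := fun k => N k i with hu
  have hNu : u = N *ᵥ Pi.single i 1 := by
    ext k; simp [hu]
  have h1 : (1 - z • A) *ᵥ u = (Pi.single i 1 : ι → ℂ) := by
    rw [hNu, mulVec_mulVec, hN, mul_nonsing_inv _ hdet, one_mulVec]
  have hu0 : u ≠ 0 := by
    intro h; rw [h, mulVec_zero] at h1
    have := congrFun h1 i
    simp at this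
  have h2 : u - Pi.single i 1 = z • (A *ᵥ u) := by
    rw [← h1, sub_mulVec, one_mulVec, smul_mulVec]; abel
  have h3 : ∑ k, normSq ((u - Pi.single i 1 : ι → ℂ) k) = ‖z‖ ^ 2 * ∑ k, normSq (u k) := by
    rw [h2]
    simp only [Pi.smul_apply, smul_eq_mul, normSq_mul, ← Finset.mul_sum,
      sum_normSq_mulVec hA]
    rw [sq_norm]
  have h4 : ∑ k, normSq ((u - Pi.single i 1 : ι → ℂ) k) =
      ∑ k, normSq (u k) + (1 - 2 * (u i).re) := by
    rw [← Finset.add_sum_erase _ _ (mem_univ i), ← Finset.add_sum_erase _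
      (fun k => normSq (u k)) (mem_univ i)]
    have : ∑ k ∈ univ.erase i, normSq ((u - Pi.single i 1 : ι → ℂ) k) =
        ∑ k ∈ univ.erase i, normSq (u k) := by
      apply sum_congr rfl
      intro k hk
      have : k ≠ i := Finset.ne_of_mem_erase hk
      simp [this]
    rw [this]
    simp only [Pi.sub_apply, Pi.single_eq_same, normSq_apply, sub_re,
      one_re, sub_im, one_im]
    ring
  have h5 := sum_normSq_pos hu0
  have h6 : ‖z‖ ^ 2 < 1 := by nlinarith [norm_nonneg z]
  have : (u i).re = (N i i).re := rfl
  rw [← this]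
  nlinarith

lemma chi_mul_rot {A : Matrix ι ι ℂ} (hA : Aᴴ * A = 1) (i : ι) (τ : ℝ) {z : ℂ} (hz : ‖z‖ < 1) :
    chi (A * rot i τ) z = chi A z *
      (1 - (Complex.exp (τ * I) - 1) * ((1 - z • A)⁻¹ i i - 1)) := by
  have hdet : IsUnit (1 - z • A).det := (chi_ne_zero hA hz).isUnit
  set N := (1 - z • A)⁻¹ with hN
  set e := Complex.exp (τ * I)
  have hNA : z • (N * A) = N - 1 := by
    have : N * (1 - z • A) = 1 := nonsing_inv_mul _ hdet
    rw [mul_sub, mul_one, Matrix.mul_smul] at this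
    rw [← this]; abel
  have hrot : rot i τ = 1 + replicateCol Unit (Pi.single i (e - 1) : ι → ℂ) *
      replicateRow Unit (Pi.single i 1 : ι → ℂ) := by
    ext a b
    simp only [rot, diagonal_apply, Matrix.add_apply, mul_apply, replicateCol_apply,
      replicateRow_apply, Finset.univ_unique, Finset.sum_singleton, one_apply]
    by_cases hab : a = b
    · subst hab
      by_cases hai : a = i
      · subst hai; simp [e]
      · simp [hai]
    · by_cases hai : a = i
      · subst hai; simp [hab, Ne.symm hab]
      · simp [hab, hai]
  have h1 : 1 - z • (A * rot i τ) = (1 - z • A) * (1 + replicateCol Unit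
      (-((N - 1) *ᵥ (Pi.single i (e - 1) : ι → ℂ))) * replicateRow Unit (Pi.single i 1 : ι → ℂ)) := by
    have h2 : (1 - z • A) * (N - 1) = z • A := by
      rw [mul_sub, hN, mul_nonsing_inv _ hdet, mul_one]; abel
    have h3 : replicateCol Unit (-((N - 1) *ᵥ (Pi.single i (e - 1) : ι → ℂ))) =
      -((N - 1) * replicateCol Unit (Pi.single i (e - 1) : ι → ℂ)) := by
      rw [← replicateCol_mulVec]; rfl
    rw [h3, mul_add, mul_one, Matrix.neg_mul, mul_neg, Matrix.mul_assoc, ← mul_assoc (1 - z • A), h2,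
      hrot, mul_add, mul_one, smul_add, smul_mul]
    abel
  unfold chi
  rw [h1, det_mul, det_one_add_replicateCol_mul_replicateRow]
  congr 1
  simp [Matrix.sub_apply]
  ring

lemma phaseRel_mul_rot {A : Matrix ι ι ℂ} (hA : Aᴴ * A = 1) (i : ι) {τ : ℝ} (h0 : 0 < τ)
    (hτ : τ ≤ π) : PhaseRel (chi A) (chi (A * rot i τ)) (τ / 2) := by
  set w : ℂ → ℂ := fun z => chi (A * rot i τ) z / chi A z * Complex.exp (-(τ / 2 : ℝ) * I)
    with hw
  have hs : 0 < sin (τ / 2) := Real.sin_pos_of_pos_of_lt_pi (by linarith) (by linarith)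
  have him : ∀ z ∈ Metric.ball (0 : ℂ) 1, (w z).im < 0 := by
    intro z hz
    have hz : ‖z‖ < 1 := by simpa using hz
    have h1 := resolvent_re hA i hz
    set n := (1 - z • A)⁻¹ i i
    have h2 : w z = cos (τ / 2) - I * sin (τ / 2) * (2 * n - 1) := by
      simp only [hw, chi_mul_rot hA i τ hz]
      rw [mul_div_cancel_left₀ _ (chi_ne_zero hA hz)]
      have e1 : Complex.exp (τ * I) = Complex.exp ((τ / 2 : ℝ) * I) *
          Complex.exp ((τ / 2 : ℝ) * I) := by
        rw [← exp_add]; congr 1; push_cast; ring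
      have e2 : Complex.exp ((τ / 2 : ℝ) * I) * Complex.exp (-(τ / 2 : ℝ) * I) = 1 := by
        rw [← exp_add]; simp
      have e3 : Complex.exp ((τ / 2 : ℝ) * I) =
          cos (τ / 2) + sin (τ / 2) * I := by
        rw [exp_mul_I, ofReal_cos, ofReal_sin]
      have e4 : Complex.exp (-(τ / 2 : ℝ) * I) =
          cos (τ / 2) - sin (τ / 2) * I := by
        rw [exp_mul_I, cos_neg, sin_neg, ofReal_cos,
          ofReal_sin]; ring
      rw [e1]
      linear_combination (-(n - 1) * Complex.exp ((τ / 2 : ℝ) * I)) * e2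
        - (n - 1) * e3 + n * e4
    rw [h2]
    have h3 : (cos (τ / 2) - I * sin (τ / 2) * (2 * n - 1)).im =
        - sin (τ / 2) * (2 * n.re - 1) := by
      simp [mul_im, -ofReal_cos, -ofReal_sin]
    rw [h3]
    nlinarith
  have hslit : ∀ z ∈ Metric.ball (0 : ℂ) 1, w z ∈ Complex.slitPlane := fun z hz =>
    Or.inr (him z hz).ne
  refine ⟨fun _ => 0, fun z => I * Complex.log (w z), 0, τ / 2, τ / 2, herglotz_zero,
    ⟨?_, ?_, ?_⟩, by simp, ?_⟩
  · apply DifferentiableOn.const_mul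
    apply DifferentiableOn.clog _ hslit
    apply DifferentiableOn.mul_const
    apply DifferentiableOn.div (differentiable_chi _).differentiableOn
      (differentiable_chi _).differentiableOn
    intro z hz
    exact chi_ne_zero hA (by simpa using hz)
  · intro z hz
    have := (Complex.arg_neg_iff.2 (him z hz))
    simp [log_im]; exact this.le
  · have : w 0 = Complex.exp ((-(τ / 2) : ℝ) * I) := by
      simp [hw, chi_zero]
    simp only [this]
    rw [Complex.log_exp (by simp; linarith) (by simp; linarith [pi_pos])]
    push_cast
    linear_combination (-(τ : ℂ) / 2) * I_sq
  · intro z hz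
    have hz' : ‖z‖ < 1 := by simpa using hz
    have h1 : I * (0 - I * Complex.log (w z) + (τ / 2 : ℝ)) =
        Complex.log (w z) + (τ / 2 : ℝ) * I := by
      linear_combination (-Complex.log (w z)) * I_sq
    rw [h1, exp_add, Complex.exp_log (Complex.slitPlane_ne_zero (hslit z hz))]
    simp only [hw]
    rw [mul_assoc, ← exp_add]
    simp [chi_ne_zero hA hz', mul_div_cancel₀]

/-- Diagonal phases. -/
def phase (a : ι → ℝ) : Matrix ι ι ℂ := diagonal fun i => Complex.exp (a i * I)

lemma phase_unitary (a : ι → ℝ) : (phase a)ᴴ * phase a = 1 := by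
  unfold phase
  rw [diagonal_conjTranspose, diagonal_mul_diagonal, ← diagonal_one]
  congr 1
  ext i
  simp only [Pi.star_apply, star_def, ← Complex.exp_conj, map_mul, conj_ofReal,
    conj_I, ← exp_add]
  simp

lemma unitary_mul {A B : Matrix ι ι ℂ} (hA : Aᴴ * A = 1) (hB : Bᴴ * B = 1) :
    (A * B)ᴴ * (A * B) = 1 := by
  rw [conjTranspose_mul, mul_assoc, ← mul_assoc Aᴴ, hA, one_mul, hB]

lemma phase_mul_rot (a : ι → ℝ) (i : ι) (τ : ℝ) :
    phase a * rot i τ = phase (Function.update a i (a i + τ)) := by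
  unfold phase rot
  rw [diagonal_mul_diagonal]
  congr 1
  ext k
  by_cases h : k = i
  · subst h; simp [← exp_add, add_mul]
  · simp [h]

lemma phaseRel_update {A : Matrix ι ι ℂ} (hA : Aᴴ * A = 1) (a : ι → ℝ) (i : ι) (x : ℝ)
    (hx : |x - a i| ≤ π) :
    PhaseRel (chi (A * phase a)) (chi (A * phase (Function.update a i x))) (|x - a i| / 2) := by
  rcases lt_trichotomy (a i) x with h | h | h
  · rw [abs_of_pos (by linarith)] at hx ⊢
    have := phaseRel_mul_rot (unitary_mul hA (phase_unitary a)) i (sub_pos.2 h) hx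
    rwa [mul_assoc, phase_mul_rot, add_sub_cancel] at this
  · subst h; simp only [Function.update_eq_self, sub_self, abs_zero, zero_div]
    exact PhaseRel.of_eq fun _ => rfl
  · rw [abs_of_neg (by linarith)] at hx ⊢
    have := phaseRel_mul_rot (unitary_mul hA (phase_unitary (Function.update a i x))) i
      (τ := -(x - a i)) (by linarith) hx
    rw [mul_assoc, phase_mul_rot] at this
    simpa using this.symm

lemma phaseRel_phase {A : Matrix ι ι ℂ} (hA : Aᴴ * A = 1) (a b : ι → ℝ)
    (hab : ∀ i, |b i - a i| ≤ π) :
    PhaseRel (chi (A * phase a)) (chi (A * phase b)) (∑ i, |b i - a i| / 2) := by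
  have key : ∀ s : Finset ι, PhaseRel (chi (A * phase a)) (chi (A * phase (s.piecewise b a)))
      (∑ i ∈ s, |b i - a i| / 2) := by
    intro s
    induction s using Finset.induction_on with
    | empty => simpa using PhaseRel.of_eq fun _ => rfl
    | insert i s hi ih =>
      rw [sum_insert hi, add_comm, Finset.piecewise_insert]
      have := phaseRel_update hA (s.piecewise b a) i (b i) (by simpa [hi] using hab i)
      simp only [Finset.piecewise_eq_of_notMem _ _ _ hi] at this
      exact ih.trans this
  simpa using key univ

lemma chi_mul_comm (A B : Matrix ι ι ℂ) (z : ℂ) : chi (A * B) z = chi (B * A) z := by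
  unfold chi
  rw [← smul_mul, ← Matrix.mul_smul, det_one_sub_mul_comm]

lemma phaseRel_sandwich {A B : Matrix ι ι ℂ} (hA : Aᴴ * A = 1) (hB : Bᴴ * B = 1) (a b : ι → ℝ)
    (hab : ∀ i, |b i - a i| ≤ π) :
    PhaseRel (chi (A * phase a * B)) (chi (A * phase b * B)) (∑ i, |b i - a i| / 2) := by
  have h := phaseRel_phase (unitary_mul hB hA) a b hab
  have h1 : ∀ a, PhaseRel (chi (A * phase a * B)) (chi (B * A * phase a)) 0 := fun a =>
    PhaseRel.of_eq fun z => by rw [chi_mul_comm, mul_assoc]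
  have := ((h1 a).trans h).trans (h1 b).symm
  simpa using this

end PhaseRel

end

section

section UnitaryDiag
variable {ι : Type*} [Fintype ι] [DecidableEq ι]

lemma exists_unit_not_root (A : Matrix ι ι ℂ) : ∃ ζ : ℂ, ‖ζ‖ = 1 ∧ (ζ • (1 : Matrix ι ι ℂ) - A).det ≠ 0 := by
  have hfin : {z : ℂ | A.charpoly.IsRoot z}.Finite :=
    Polynomial.finite_setOfPred_isRoot (charpoly_monic A).ne_zero
  have hinf : (Set.range fun n : ℕ => Complex.exp ((n : ℝ) * I)).Infinite := by
    apply Set.infinite_range_of_injective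
    intro m n h
    rw [Complex.exp_eq_exp_iff_exists_int] at h
    obtain ⟨k, hk⟩ := h
    have h1 : ((m : ℝ)) = n + k * (2 * π) := by
      have := congrArg im hk
      simpa using this
    by_contra hmn
    have hk0 : k ≠ 0 := by
      rintro rfl
      apply hmn
      have : (m : ℝ) = n := by simpa using h1
      exact_mod_cast this
    apply irrational_pi
    refine ⟨((m : ℚ) - n) / (2 * k), ?_⟩
    push_cast
    rw [h1]
    field_simp
    ring
  obtain ⟨ζ, ⟨n, rfl⟩, h⟩ := (hinf.sdiff hfin).nonempty
  refine ⟨Complex.exp ((n : ℝ) * I), Complex.norm_exp_ofReal_mul_I _, fun h0 => h ?_⟩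
  simp only [mem_ofPred_eq, IsRoot, eval_charpoly]
  rw [← h0]
  congr 1
  ext i j
  simp [scalar_apply, one_apply, diagonal_apply]

/-- Spectral theorem for unitary matrices. -/
theorem unitary_diagonalization {A : Matrix ι ι ℂ} (hA : Aᴴ * A = 1) :
    ∃ (U : Matrix ι ι ℂ) (d : ι → ℂ), Uᴴ * U = 1 ∧ U * Uᴴ = 1 ∧ (∀ i, ‖d i‖ = 1) ∧
      A = U * diagonal d * Uᴴ := by
  obtain ⟨ζ, hζ, hdet⟩ := exists_unit_not_root A
  set B := ζ • (1 : Matrix ι ι ℂ) - A with hB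
  have hu : IsUnit B.det := hdet.isUnit
  set N := B⁻¹
  have hBN : B * N = 1 := mul_nonsing_inv _ hu
  have hNB : N * B = 1 := nonsing_inv_mul _ hu
  have hζ0 : ζ ≠ 0 := by rintro rfl; simp at hζ
  have hζc : star ζ * ζ = 1 := by
    rw [star_def, ← Complex.normSq_eq_conj_mul_self, normSq_eq_norm_sq, hζ]; simp
  set H := I • ((ζ • (1 : Matrix ι ι ℂ) + A) * N) with hH
  have hkey : Bᴴ * ((-I) • (ζ • (1 : Matrix ι ι ℂ) + A)) =
      I • ((ζ • (1 : Matrix ι ι ℂ) + A)ᴴ * B) := by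
    simp only [hB, conjTranspose_sub, conjTranspose_add, conjTranspose_smul, conjTranspose_one,
      sub_mul, add_mul, mul_add, mul_sub, smul_mul_assoc, mul_smul_comm, one_mul, mul_one, hA,
      smul_smul, smul_add, smul_sub]
    ext i j
    simp only [Matrix.sub_apply, Matrix.add_apply, Matrix.smul_apply, smul_eq_mul, one_apply]
    linear_combination (-2 * I * if i = j then 1 else 0) * hζc
  have hHerm : H.IsHermitian := by
    have h1 : Hᴴ = (-I) • (Nᴴ * (ζ • (1 : Matrix ι ι ℂ) + A)ᴴ) := by
      simp [hH, conjTranspose_smul, conjTranspose_mul]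
    have hNB' : Nᴴ * Bᴴ = 1 := by rw [← conjTranspose_mul, hBN, conjTranspose_one]
    unfold Matrix.IsHermitian
    rw [h1]
    calc (-I) • (Nᴴ * (ζ • (1 : Matrix ι ι ℂ) + A)ᴴ)
        = - (Nᴴ * (I • ((ζ • (1 : Matrix ι ι ℂ) + A)ᴴ * B)) * N) := by
          rw [mul_smul_comm, smul_mul_assoc, ← mul_assoc, mul_assoc _ B N, hBN, mul_one, neg_smul]
      _ = - (Nᴴ * (Bᴴ * ((-I) • (ζ • (1 : Matrix ι ι ℂ) + A))) * N) := by rw [hkey]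
      _ = H := by
          rw [← mul_assoc, hNB', one_mul, smul_mul_assoc, neg_smul, neg_neg]
  set U : Matrix ι ι ℂ := (hHerm.eigenvectorUnitary : Matrix ι ι ℂ)
  have hU1 : Uᴴ * U = 1 := Unitary.coe_star_mul_self hHerm.eigenvectorUnitary
  have hU2 : U * Uᴴ = 1 := Unitary.coe_mul_star_self hHerm.eigenvectorUnitary
  set e := hHerm.eigenvalues
  have hspec : H = U * diagonal (fun i => (e i : ℂ)) * Uᴴ := by
    have := hHerm.spectral_theorem
    exact this
  have hne : ∀ i, (e i : ℂ) + I ≠ 0 := by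
    intro i h
    have := congrArg im h
    simp at this
  refine ⟨U, fun i => ζ * ((e i : ℂ) - I) / ((e i : ℂ) + I), hU1, hU2, ?_, ?_⟩
  · intro i
    rw [norm_div, norm_mul, hζ, one_mul]
    have : ((e i : ℂ) - I) = (starRingEnd ℂ) ((e i : ℂ) + I) := by simp [sub_eq_add_neg]
    rw [this, Complex.norm_conj, div_self]
    exact norm_ne_zero_iff.2 (hne i)
  · set d : ι → ℂ := fun i => ζ * ((e i : ℂ) - I) / ((e i : ℂ) + I)
    have hHI : H + I • (1 : Matrix ι ι ℂ) = (2 * I * ζ) • N := by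
      have : I • (1 : Matrix ι ι ℂ) = I • (B * N) := by rw [hBN]
      rw [this, hH, ← smul_add, ← add_mul, hB, add_add_sub_cancel, ← two_smul ℂ (ζ • (1 : Matrix ι ι ℂ)),
        smul_smul, smul_mul_assoc, one_mul, smul_smul]
      congr 1; ring
    have hN : N = U * diagonal (fun i => ((e i : ℂ) + I) / (2 * I * ζ)) * Uᴴ := by
      have h2 : (2 * I * ζ) ≠ 0 := by simp [hζ0]
      have : N = (2 * I * ζ)⁻¹ • (H + I • (1 : Matrix ι ι ℂ)) := by
        rw [hHI, smul_smul, inv_mul_cancel₀ h2, one_smul]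
      rw [this, hspec]
      have h1 : (1 : Matrix ι ι ℂ) = U * 1 * Uᴴ := by rw [mul_one, hU2]
      conv_lhs => rw [h1]
      rw [← smul_mul_assoc, ← mul_smul_comm, ← add_mul, ← mul_add, ← smul_mul_assoc, ← mul_smul_comm]
      congr 2
      ext i j
      by_cases hij : i = j
      · subst hij; simp; field_simp; simp
      · simp [hij]
    have hfin : (ζ • (1 : Matrix ι ι ℂ) - U * diagonal d * Uᴴ) * N = 1 := by
      have h1 : ζ • (1 : Matrix ι ι ℂ) = U * (ζ • 1) * Uᴴ := by simp [hU2]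
      rw [h1, ← sub_mul, ← mul_sub, hN]
      have : ∀ X Y : Matrix ι ι ℂ, U * X * Uᴴ * (U * Y * Uᴴ) = U * (X * Y) * Uᴴ := by
        intro X Y
        calc _ = U * X * (Uᴴ * U) * Y * Uᴴ := by simp only [mul_assoc]
          _ = _ := by rw [hU1, mul_one]; simp only [mul_assoc]
      rw [this]
      have h3 : (ζ • (1 : Matrix ι ι ℂ) - diagonal d) *
          diagonal (fun i => ((e i : ℂ) + I) / (2 * I * ζ)) = 1 := by
        rw [← diagonal_one, ← diagonal_smul, diagonal_sub, diagonal_mul_diagonal]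
        congr 1
        ext i
        have := hne i
        simp [d]
        field_simp
        ring_nf
      rw [h3, mul_one, hU2]
    have h4 : ζ • (1 : Matrix ι ι ℂ) - U * diagonal d * Uᴴ = B := by
      calc _ = (ζ • (1 : Matrix ι ι ℂ) - U * diagonal d * Uᴴ) * (N * B) := by rw [hNB, mul_one]
        _ = B := by rw [← mul_assoc, hfin, one_mul]
    exact (sub_right_injective h4).symm

lemma chi_eq_prod {A U : Matrix ι ι ℂ} {d : ι → ℂ} (hU : U * Uᴴ = 1)
    (hA : A = U * diagonal d * Uᴴ) (z : ℂ) : chi A z = ∏ i, (1 - z * d i) := by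
  have : (1 : Matrix ι ι ℂ) - z • A = U * (diagonal fun i => 1 - z * d i) * Uᴴ := by
    have h1 : (1 : Matrix ι ι ℂ) = U * 1 * Uᴴ := by rw [mul_one, hU]
    rw [hA]
    conv_lhs => rw [h1]
    rw [← smul_mul_assoc, ← mul_smul_comm, ← sub_mul, ← mul_sub]
    congr 2
    ext i j
    by_cases hij : i = j
    · subst hij; simp
    · simp [hij]
  rw [chi, this, det_mul, det_mul, det_diagonal, mul_right_comm, ← det_mul, hU, det_one, one_mul]

lemma exists_chi_eq_prod {A : Matrix ι ι ℂ} (hA : Aᴴ * A = 1) :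
    ∃ d : ι → ℂ, (∀ i, ‖d i‖ = 1) ∧ ∀ z, chi A z = ∏ i, (1 - z * d i) := by
  obtain ⟨U, d, -, h2, h3, h4⟩ := unitary_diagonalization hA
  exact ⟨d, h3, chi_eq_prod h2 h4⟩

lemma norm_one_sub_le {r : ℝ} (h0 : 0 ≤ r) {w : ℂ} (hw : ‖w‖ = 1) :
    ‖1 - w‖ ≤ 2 / (1 + r) * ‖1 - r * w‖ := by
  rw [div_mul_eq_mul_div, le_div_iff₀ (by linarith)]
  apply abs_le_of_sq_le_sq' _ (by positivity) |>.2
  rw [mul_pow, mul_pow, ← normSq_eq_norm_sq, ← normSq_eq_norm_sq]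
  have : normSq w = 1 := by rw [normSq_eq_norm_sq, hw]; norm_num
  simp only [normSq_apply, sub_re, sub_im, one_re, one_im,
    mul_re, mul_im, ofReal_re, ofReal_im] at *
  have h2 : -1 ≤ w.re := by nlinarith
  have e1 : (1 - w.re) * (1 - w.re) + (0 - w.im) * (0 - w.im) = 2 - 2 * w.re := by nlinarith
  have e2 : (1 - (r * w.re - 0 * w.im)) * (1 - (r * w.re - 0 * w.im)) +
    (0 - (r * w.im + 0 * w.re)) * (0 - (r * w.im + 0 * w.re)) = 1 + r ^ 2 - 2 * r * w.re := by
    ring_nf; nlinarith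
  nlinarith [mul_nonneg (sq_nonneg (1 - r)) (by linarith : 0 ≤ 1 + w.re)]

lemma norm_chi_le_radius {A : Matrix ι ι ℂ} (hA : Aᴴ * A = 1) {r : ℝ} (h0 : 0 ≤ r) {z : ℂ}
    (hz : ‖z‖ = 1) : ‖chi A z‖ ≤ (2 / (1 + r)) ^ card ι * ‖chi A (r * z)‖ := by
  obtain ⟨d, hd, h⟩ := exists_chi_eq_prod hA
  rw [h, h, norm_prod, norm_prod]
  calc ∏ i, ‖1 - z * d i‖ ≤ ∏ i, (2 / (1 + r)) * ‖1 - r * z * d i‖ := by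
        refine prod_le_prod (fun i _ => norm_nonneg _) fun i _ => ?_
        rw [mul_assoc (r : ℂ)]
        exact norm_one_sub_le h0 (by rw [norm_mul, hz, hd, mul_one])
    _ = _ := by rw [prod_mul_distrib, prod_const, Finset.card_univ]

lemma le_norm_chi {A : Matrix ι ι ℂ} (hA : Aᴴ * A = 1) {r : ℝ} (hr : r ≤ 1) {z : ℂ}
    (hz : ‖z‖ ≤ r) : (1 - r) ^ card ι ≤ ‖chi A z‖ := by
  obtain ⟨d, hd, h⟩ := exists_chi_eq_prod hA
  rw [h, norm_prod]
  calc (1 - r) ^ card ι = ∏ _i : ι, (1 - r) := by simp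
    _ ≤ _ := by
        refine prod_le_prod (fun i _ => by linarith) fun i _ => ?_
        have := norm_sub_norm_le 1 (z * d i)
        rw [norm_mul, hd, mul_one, norm_one] at this
        linarith

lemma norm_chi_le_two_pow {A : Matrix ι ι ℂ} (hA : Aᴴ * A = 1) {z : ℂ}
    (hz : ‖z‖ ≤ 1) : ‖chi A z‖ ≤ 2 ^ card ι := by
  obtain ⟨d, hd, h⟩ := exists_chi_eq_prod hA
  rw [h, norm_prod]
  calc _ ≤ ∏ _i : ι, (2 : ℝ) := by
        refine prod_le_prod (fun i _ => norm_nonneg _) fun i _ => ?_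
        have := norm_sub_le 1 (z * d i)
        rw [norm_mul, hd, mul_one, norm_one] at this
        linarith
    _ = _ := by simp

end UnitaryDiag

end

section

section RadiusComparison
variable {ι : Type*} [Fintype ι] [DecidableEq ι]

lemma re_inv_one_sub_pos {w : ℂ} (hw : ‖w‖ < 1) : 0 < ((1 - w)⁻¹).re := by
  have h1 : 0 < (1 - w).re := by
    have := (abs_le.1 (abs_re_le_norm w)).2
    simp; linarith
  have h2 : 1 - w ≠ 0 := by intro h; rw [h] at h1; simp at h1
  rw [Complex.inv_re]
  exact div_pos h1 (normSq_pos.2 h2)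

omit [DecidableEq ι] in
lemma exists_herglotz_sum {d : ι → ℂ} (hd : ∀ i, ‖d i‖ = 1) {k : ℝ} (hk : 0 ≤ k) :
    ∃ F, Herglotz F (sqrt 2 * k * card ι) ∧ ∀ z ∈ Metric.ball (0 : ℂ) 1,
      ∑ i, k / sqrt ‖1 - z * d i‖ ≤ ‖F z‖ := by
  have hlt : ∀ z ∈ Metric.ball (0 : ℂ) 1, ∀ i, ‖z * d i‖ < 1 := by
    intro z hz i
    rw [norm_mul, hd, mul_one]; simpa using hz
  have hle : ∀ z ∈ Metric.ball (0 : ℂ) 1, ∑ i, k / sqrt ‖1 - z * d i‖ ≤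
      (∑ i, ((sqrt 2 * k : ℝ) : ℂ) * ((1 - z * d i)⁻¹) ^ (1 / 2 : ℂ)).re := by
    intro z hz
    rw [re_sum]
    refine sum_le_sum fun i _ => ?_
    have := sqrt_norm_le_re_cpow (re_inv_one_sub_pos (hlt z hz i))
    rw [norm_inv, Real.sqrt_inv] at this
    rw [Complex.re_ofReal_mul, div_eq_mul_inv]
    calc _ ≤ k * _ := mul_le_mul_of_nonneg_left this hk
      _ = _ := by ring
  refine ⟨fun z => ∑ i, ((sqrt 2 * k : ℝ) : ℂ) * ((1 - z * d i)⁻¹) ^ (1 / 2 : ℂ),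
    ⟨?_, ?_, ?_⟩, fun z hz => (hle z hz).trans ((le_abs_self _).trans (abs_re_le_norm _))⟩
  · intro z hz
    refine DifferentiableWithinAt.fun_sum fun i _ => DifferentiableWithinAt.const_mul ?_ _
    have h1 := re_inv_one_sub_pos (hlt z hz i)
    have h2 : 1 - z * d i ≠ 0 := by intro h; rw [h] at h1; simp at h1
    have h3 : DifferentiableWithinAt ℂ (fun z : ℂ => (1 - z * d i)⁻¹) (Metric.ball 0 1) z := by
      fun_prop
    exact h3.cpow_const (Or.inl h1)
  · intro z hz
    refine le_trans (Finset.sum_nonneg fun i _ => ?_) (hle z hz)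
    positivity
  · simp; ring

lemma chi_radius_weak_type [Nonempty ι] {A : Matrix ι ι ℂ} (hA : Aᴴ * A = 1) {r l : ℝ} (hr : r < 1)
    (hl : 0 < l) :
    volume {s : ℝ | s ∈ Ico (0 : ℝ) 1 ∧
      ‖chi A (circ s)‖ * exp l < ‖chi A (r * circ s)‖} ≤
      ofReal (6 * sqrt (3 * sqrt (1 - r) * card ι / l)) := by
  obtain ⟨d, hd, h⟩ := exists_chi_eq_prod hA
  obtain ⟨F, hF, hFz⟩ := exists_herglotz_sum hd (k := 2 * sqrt (1 - r)) (by positivity)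
  refine hF.boundary_comparison herglotz_zero (c' := 3 * sqrt (1 - r) * card ι) ?_
    (by positivity) hl (continuous_chi A) (q := fun z => chi A (r * z))
    ((continuous_chi A).comp (by fun_prop)) ?_
  · have : sqrt 2 ≤ 3 / 2 := by rw [sqrt_le_iff]; norm_num
    have : 0 ≤ sqrt (1 - r) * card ι := by positivity
    nlinarith
  · intro z hz
    rw [sub_zero]
    refine le_trans ?_ (mul_le_mul_of_nonneg_left (exp_le_exp.2 (hFz z hz)) (norm_nonneg _))
    rw [h, h, norm_prod, norm_prod, exp_sum, ← prod_mul_distrib]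
    refine prod_le_prod (fun i _ => norm_nonneg _) fun i _ => ?_
    have hw : ‖z * d i‖ < 1 := by rw [norm_mul, hd, mul_one]; simpa using hz
    set w := z * d i
    rw [mul_assoc (r : ℂ)]
    have hy : 0 < ‖1 - w‖ := by
      have := norm_sub_norm_le 1 w
      rw [norm_one] at this; linarith
    have h1 : ‖1 - r * w‖ ≤ ‖1 - w‖ + (1 - r) := by
      have : (1 - r * w : ℂ) = (1 - w) + ((1 - r : ℝ) : ℂ) * w := by push_cast; ring
      rw [this]
      refine (norm_add_le _ _).trans ?_
      rw [norm_mul, norm_real, norm_of_nonneg (by linarith)]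
      nlinarith [norm_nonneg w]
    refine h1.trans ?_
    set x := sqrt (1 - r) / sqrt ‖1 - w‖ with hx
    have hx0 : 0 ≤ x := by positivity
    have h2 : ‖1 - w‖ * x ^ 2 = 1 - r := by
      rw [hx, div_pow, sq_sqrt (by linarith), sq_sqrt hy.le]; field_simp
    have h3 : 2 * sqrt (1 - r) / sqrt ‖1 - w‖ = x + x := by rw [hx]; ring
    rw [h3, Real.exp_add]
    have h4 := add_one_le_exp x
    have h5 : 1 + x ^ 2 ≤ exp x * exp x := by nlinarith
    calc ‖1 - w‖ + (1 - r) = ‖1 - w‖ * (1 + x ^ 2) := by rw [mul_add, h2, mul_one]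
      _ ≤ _ := mul_le_mul_of_nonneg_left h5 hy.le

lemma chi_lower_weak_type [Nonempty ι] {A : Matrix ι ι ℂ} (hA : Aᴴ * A = 1) {l : ℝ} (hl : 0 < l) :
    volume {s : ℝ | s ∈ Ico (0 : ℝ) 1 ∧ ‖chi A (circ s)‖ * exp l < 1} ≤
      ofReal (6 * sqrt (3 * card ι / l)) := by
  obtain ⟨d, hd, h⟩ := exists_chi_eq_prod hA
  obtain ⟨F, hF, hFz⟩ := exists_herglotz_sum hd (k := 2) (by positivity)
  have := hF.boundary_comparison herglotz_zero (c' := 3 * card ι) ?_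
    (by positivity) hl (continuous_chi A) (q := fun _ => (1 : ℂ)) continuous_const ?_
  · simpa using this
  · have : sqrt 2 ≤ 3 / 2 := by rw [sqrt_le_iff]; norm_num
    nlinarith
  · intro z hz
    rw [sub_zero, norm_one]
    refine le_trans ?_ (mul_le_mul_of_nonneg_left (exp_le_exp.2 (hFz z hz)) (norm_nonneg _))
    rw [h, norm_prod, exp_sum, ← prod_mul_distrib]
    calc (1 : ℝ) = ∏ _i : ι, (1 : ℝ) := by simp
      _ ≤ _ := ?_
    refine prod_le_prod (fun i _ => zero_le_one) fun i _ => ?_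
    have hw : ‖z * d i‖ < 1 := by rw [norm_mul, hd, mul_one]; simpa using hz
    set w := z * d i
    have hy : 0 < ‖1 - w‖ := by
      have := norm_sub_norm_le 1 w
      rw [norm_one] at this; linarith
    set y := sqrt ‖1 - w‖ with hyd
    have hy0 : 0 < y := Real.sqrt_pos.2 hy
    have hy2 : ‖1 - w‖ = y ^ 2 := (sq_sqrt hy.le).symm
    have h4 := add_one_le_exp (1 / y)
    have h5 : 1 / y ≤ exp (1 / y) := by linarith
    have h3 : (2 : ℝ) / y = 1 / y + 1 / y := by ring
    rw [hy2, h3, Real.exp_add]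
    have h6 : 1 ≤ y * exp (1 / y) := by
      rw [div_le_iff₀ hy0] at h5; linarith
    nlinarith

end RadiusComparison

end

section

section CyclicDeterminant

/-- The ordered product `C i * C (i+1) * ⋯ * C (i+k-1)`. -/
def segProd {M : Type*} [Monoid M] (C : ℕ → M) : ℕ → ℕ → M
  | _, 0 => 1
  | i, k + 1 => C i * segProd C (i + 1) k

lemma segProd_succ {M : Type*} [Monoid M] (C : ℕ → M) (i k : ℕ) :
    segProd C i (k + 1) = C i * segProd C (i + 1) k := rfl

lemma segProd_zero {M : Type*} [Monoid M] (C : ℕ → M) (i : ℕ) : segProd C i 0 = 1 := rfl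

lemma segProd_add {M : Type*} [Monoid M] (C : ℕ → M) (i k l : ℕ) :
    segProd C i (k + l) = segProd C i k * segProd C (i + k) l := by
  induction k generalizing i with
  | zero => simp [segProd_zero]
  | succ k ih =>
    rw [show k + 1 + l = (k + l) + 1 by omega, segProd_succ, segProd_succ, ih, mul_assoc,
      show i + 1 + k = i + (k + 1) by omega]

lemma segProd_congr {M : Type*} [Monoid M] {C D : ℕ → M} {i k : ℕ}
    (h : ∀ j, i ≤ j → j < i + k → C j = D j) : segProd C i k = segProd D i k := by
  induction k generalizing i with
  | zero => rfl
  | succ k ih =>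
    rw [segProd_succ, segProd_succ, h i le_rfl (by omega),
      ih fun j hj hj' => h j (by omega) (by omega)]

/-- The block cyclic shift with blocks `C`. -/
def cycShift (n : ℕ) (C : ℕ → Matrix (Fin 2) (Fin 2) ℂ) :
    Matrix (Fin (n + 1) × Fin 2) (Fin (n + 1) × Fin 2) ℂ :=
  fun a b => if finRotate (n + 1) a.1 = b.1 then C a.1 a.2 b.2 else 0

lemma det_one_sub_cycShift (n : ℕ) (C : ℕ → Matrix (Fin 2) (Fin 2) ℂ) :
    (1 - cycShift n C).det = (1 - segProd C 0 (n + 1)).det := by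
  obtain ⟨up, hup⟩ : ∃ up : Matrix (Fin (n + 1) × Fin 2) (Fin (n + 1) × Fin 2) ℂ,
    ∀ a b, up a b = if (a.1 : ℕ) + 1 = b.1 then C a.1 a.2 b.2 else 0 := ⟨fun _ _ => _, fun _ _ => rfl⟩
  obtain ⟨X, hX⟩ : ∃ X : Matrix (Fin (n + 1) × Fin 2) (Fin 2) ℂ,
    ∀ a j, X a j = segProd C a.1 (n + 1 - a.1) a.2 j := ⟨fun _ _ => _, fun _ _ => rfl⟩
  obtain ⟨V, hV⟩ : ∃ V : Matrix (Fin 2) (Fin (n + 1) × Fin 2) ℂ,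
    ∀ i b, V i b = if b.1 = 0 then (1 : Matrix (Fin 2) (Fin 2) ℂ) i b.2 else 0 :=
    ⟨fun _ _ => _, fun _ _ => rfl⟩
  have hupX : ∀ a : Fin (n + 1) × Fin 2, ∀ j, (up * X) a j =
      if (a.1 : ℕ) = n then 0 else segProd C a.1 (n + 1 - a.1) a.2 j := by
    intro a j
    simp only [mul_apply, hup, hX, sum_prod_type]
    split_ifs with h
    · refine sum_eq_zero fun b _ => sum_eq_zero fun k _ => ?_
      rw [if_neg, zero_mul]
      have := b.2; simp; omega
    · have hlt : (a.1 : ℕ) + 1 < n + 1 := by have := a.1.2; omega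
      rw [sum_eq_single (⟨a.1 + 1, hlt⟩ : Fin (n + 1))]
      · have : n + 1 - (a.1 : ℕ) = (n + 1 - (a.1 + 1)) + 1 := by omega
        rw [this, segProd_succ, mul_apply]
        simp
      · intro b _ hb
        refine sum_eq_zero fun k _ => ?_
        rw [if_neg, zero_mul]
        intro h'; apply hb; ext; exact h'.symm
      · simp
  have hfac : 1 - cycShift n C = (1 - up) * (1 - X * V) := by
    have h1 : (1 - up) * (1 - X * V) = 1 - up - (X - up * X) * V := by
      simp only [Matrix.sub_mul, mul_sub, mul_one, one_mul, Matrix.mul_assoc]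
    rw [h1, sub_sub]
    congr 1
    ext a b
    rw [Matrix.add_apply, mul_apply]
    simp only [Matrix.sub_apply, hupX, hV, hX, hup, cycShift]
    by_cases ha : (a.1 : ℕ) = n
    · have ha' : a.1 = Fin.last n := Fin.ext ha
      have h2 : ¬ ((a.1 : ℕ) + 1 = b.1) := by have := b.1.2; omega
      rw [if_neg h2, ha', finRotate_last]
      simp only [Fin.val_last, if_true]
      rw [show n + 1 - n = 0 + 1 by omega, segProd_succ, segProd_zero, mul_one]
      by_cases hb : b.1 = 0
      · simp [hb, one_apply]
      · simp [hb, Ne.symm hb]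
    · simp only [ha, if_false, sub_self, zero_mul, Finset.sum_const_zero, add_zero]
      have h3 : (finRotate (n + 1) a.1 = b.1) ↔ (a.1 : ℕ) + 1 = b.1 := by
        rw [Fin.ext_iff, coe_finRotate_of_ne_last]
        intro h; apply ha; rw [h]; rfl
      simp only [h3]
  have hdet : (1 - up).det = 1 := by
    have hbt : (1 - up).BlockTriangular (fun a : Fin (n + 1) × Fin 2 => a.1) := by
      intro a b hab
      have h1 : a ≠ b := by rintro rfl; exact lt_irrefl _ hab
      have h2 : ¬ ((a.1 : ℕ) + 1 = b.1) := by
        have : (b.1 : ℕ) < a.1 := hab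
        omega
      simp [hup, h2, one_apply_ne h1]
    rw [hbt.det]
    refine prod_eq_one fun a _ => ?_
    have : (1 - up).toSquareBlock (fun a : Fin (n + 1) × Fin 2 => a.1) a = 1 := by
      ext ⟨i, hi⟩ ⟨j, hj⟩
      have h2 : ¬ ((i.1 : ℕ) + 1 = j.1) := by rw [hi, hj]; omega
      simp [toSquareBlock_def, hup, h2, one_apply]
    rw [this, det_one]
  rw [hfac, det_mul, hdet, one_mul, det_one_sub_mul_comm]
  congr 2
  ext i j
  rw [mul_apply, sum_prod_type, sum_eq_single (0 : Fin (n + 1))]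
  · simp [hV, hX, Matrix.one_apply]
  · intro b _ hb
    simp [hV, hb]
  · simp

end CyclicDeterminant

section Blk
variable {ι : Type*} [Fintype ι] [DecidableEq ι]

/-- A sitewise `2 × 2` matrix acting on `ι ⊕ ι`. -/
def blk (a b c d : ι → ℂ) : Matrix (ι ⊕ ι) (ι ⊕ ι) ℂ :=
  fromBlocks (diagonal a) (diagonal b) (diagonal c) (diagonal d)

lemma blk_mul_blk (a b c d a' b' c' d' : ι → ℂ) : blk a b c d * blk a' b' c' d' =
    blk (a * a' + b * c') (a * b' + b * d') (c * a' + d * c') (c * b' + d * d') := by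
  simp only [blk, fromBlocks_multiply, diagonal_mul_diagonal, diagonal_add]
  rfl

omit [Fintype ι] in
lemma blk_conjTranspose (a b c d : ι → ℂ) : (blk a b c d)ᴴ =
    blk (star a) (star c) (star b) (star d) := by
  simp only [blk, fromBlocks_conjTranspose, diagonal_conjTranspose]

omit [Fintype ι] in
lemma blk_one : blk (1 : ι → ℂ) 0 0 1 = 1 := by
  rw [blk, ← fromBlocks_one]
  congr 1 <;> simp

omit [Fintype ι] in
lemma blk_phase (a : ι ⊕ ι → ℝ) : blk (fun i => Complex.exp (a (Sum.inl i) * I)) 0 0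
    (fun i => Complex.exp (a (Sum.inr i) * I)) = phase a := by
  ext i j
  rcases i with i | i <;> rcases j with j | j <;>
    simp [blk, phase, diagonal_apply]

/-- The matrix translating along `σ`. -/
def shiftMat (σ : Perm ι) : Matrix ι ι ℂ := fun n m => if σ m = n then 1 else 0

end Blk

end

section

section Walk
variable {ι : Type*} [Fintype ι] [DecidableEq ι]

/-- The conditional shift along `σ`, with the bond entering `n` carrying the angle `α n`. -/
def shiftOp (σ : Perm ι) (α : ι → ℝ) : Matrix (ι ⊕ ι) (ι ⊕ ι) ℂ :=
  fromBlocks 1 0 0 (shiftMat σ)ᵀ * blk (fun n => cos (α n)) (fun n => -sin (α n))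
    (fun n => sin (α n)) (fun n => cos (α n)) * fromBlocks (shiftMat σ) 0 0 1

/-- The coin with entries `f`, `-g`, `conj g`, `f`. -/
def coinOp (f : ι → ℝ) (g : ι → ℂ) : Matrix (ι ⊕ ι) (ι ⊕ ι) ℂ :=
  blk (fun n => f n) (fun n => -g n) (fun n => star (g n)) (fun n => f n)

lemma shiftMat_transpose_mul (σ : Perm ι) : (shiftMat σ)ᵀ * shiftMat σ = 1 := by
  ext i j
  simp [mul_apply, shiftMat, one_apply]

lemma shiftMat_mul_transpose (σ : Perm ι) : shiftMat σ * (shiftMat σ)ᵀ = 1 :=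
  mul_eq_one_comm.1 (shiftMat_transpose_mul σ)

lemma det_shiftMat (σ : Perm ι) : (shiftMat σ).det = (Perm.sign σ : ℤ) := by
  have : shiftMat σ = (σ⁻¹.permMatrix ℂ) := by
    ext i j
    simp only [shiftMat, Perm.permMatrix, PEquiv.toMatrix_apply, Equiv.toPEquiv_apply,
      Option.mem_def, Option.some.injEq]
    congr 1
    rw [Perm.inv_def, Equiv.symm_apply_eq]
    exact propext eq_comm
  rw [this, det_permutation]
  simp

/-- Pairs of components versus sum types. -/
def compEquiv (ι : Type*) : ι × Fin 2 ≃ ι ⊕ ι where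
  toFun a := if a.2 = 0 then Sum.inl a.1 else Sum.inr a.1
  invFun := Sum.elim (fun i => (i, 0)) (fun i => (i, 1))
  left_inv := by rintro ⟨i, j⟩; fin_cases j <;> simp
  right_inv := by rintro (i | i) <;> simp

lemma det_sitewise (X : ι → Matrix (Fin 2) (Fin 2) ℂ) :
    (of fun a b : ι × Fin 2 => if a.1 = b.1 then X a.1 a.2 b.2 else 0).det = ∏ i, (X i).det := by
  rw [← det_blockDiagonal, ← det_submatrix_equiv_self (Equiv.prodComm ι (Fin 2))]
  congr 1

lemma det_blk (a b c d : ι → ℂ) : (blk a b c d).det = ∏ i, (a i * d i - b i * c i) := by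
  rw [← det_submatrix_equiv_self (compEquiv ι)]
  have := det_sitewise fun i => !![a i, b i; c i, d i]
  simp only [det_fin_two_of] at this
  rw [← this]
  congr 1
  ext ⟨i, k⟩ ⟨j, l⟩
  fin_cases k <;> fin_cases l <;> simp [compEquiv, blk, diagonal_apply]

/-- The one-step transfer matrix, cleared of denominators. -/
def stepMat (s : ℝ) (g z : ℂ) : Matrix (Fin 2) (Fin 2) ℂ :=
  !![1, (s : ℂ); (s : ℂ), 1] * !![1, z * g; z * star g, z ^ 2]

lemma det_segProd (C : ℕ → Matrix (Fin 2) (Fin 2) ℂ) (i k : ℕ) :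
    (segProd C i k).det = ∏ j ∈ range k, (C (i + j)).det := by
  induction k generalizing i with
  | zero => simp [segProd_zero]
  | succ k ih =>
    rw [segProd_succ, det_mul, ih, prod_range_succ', mul_comm, add_zero]
    congr 1
    exact prod_congr rfl fun j _ => by rw [show i + 1 + j = i + (j + 1) by omega]

lemma segProd_smul (c : ℕ → ℂ) (C : ℕ → Matrix (Fin 2) (Fin 2) ℂ) (i k : ℕ) :
    segProd (fun j => c j • C j) i k = (∏ j ∈ range k, c (i + j)) • segProd C i k := by
  induction k generalizing i with
  | zero => simp [segProd_zero]
  | succ k ih =>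
    rw [segProd_succ, segProd_succ, ih, prod_range_succ', smul_mul_smul_comm, mul_comm, add_zero]
    congr 2
    exact prod_congr rfl fun j _ => by rw [show i + 1 + j = i + (j + 1) by omega]

lemma siteMat_mul_stepMat {c s f : ℝ} {g z : ℂ} (hc : c ≠ 0) (hf : f ≠ 0) (hz : z ≠ 0)
    (hcs : (c : ℂ) * c + s * s = 1) (hg : g * star g = 1 - (f : ℂ) ^ 2) :
    (!![-z * f / c, z * f * s / c; (-s - z * star g) / c, (1 + z * star g * s) / c] :
      Matrix (Fin 2) (Fin 2) ℂ) * ((1 / (c * z * f) : ℂ) • stepMat s g z) =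
      !![-1, -z * g; 0, z * f] := by
  have hc' : (c : ℂ) ≠ 0 := ofReal_ne_zero.2 hc
  have hf' : (f : ℂ) ≠ 0 := ofReal_ne_zero.2 hf
  simp only [stepMat, mul_fin_two, smul_of, smul_cons, smul_eq_mul,
    smul_empty]
  generalize star g = g' at *
  ext a b
  fin_cases a <;> fin_cases b <;> simp <;> field_simp
  · linear_combination hcs
  · linear_combination g * hcs
  · ring
  · linear_combination -z * (1 - g * g') * hcs - z * c * c * hg

theorem chi_walk_eq (n : ℕ) (α f : ℕ → ℝ) (g : ℕ → ℂ) (hfg : ∀ j, (f j) ^ 2 + ‖g j‖ ^ 2 = 1)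
    (hf : ∀ j, f j ≠ 0) (hα : ∀ j, cos (α j) ≠ 0) {z : ℂ} (hz : z ≠ 0) :
    chi (shiftOp (finRotate (n + 1)) (fun i => α i) * coinOp (fun i : Fin (n + 1) => f i) (fun i => g i)) z =
      (segProd (fun j => stepMat (sin (α j)) (g j) z) 0 (n + 1)).trace -
        2 * z ^ (n + 1) * ∏ j ∈ range (n + 1), ((cos (α j) * f j : ℝ) : ℂ) := by
  set σ := finRotate (n + 1) with hσ
  set c : Fin (n + 1) → ℂ := fun i => cos (α i) with hc
  set s : Fin (n + 1) → ℂ := fun i => sin (α i) with hs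
  have hcs : ∀ i, c i * c i + s i * s i = 1 := by
    intro i
    simp only [hc, hs]
    rw [← sq, ← sq]
    exact_mod_cast cos_sq_add_sin_sq (α i)
  have hgc : ∀ j : ℕ, g j * star (g j) = 1 - (f j : ℂ) ^ 2 := by
    intro j
    rw [star_def, mul_conj, normSq_eq_norm_sq]
    have := hfg j
    rw [← eq_sub_iff_add_eq'] at this
    rw [this]; push_cast; ring
  have hc0 : ∀ i, c i ≠ 0 := fun i => ofReal_ne_zero.2 (hα i)
  set R := blk c (-s) s c with hR
  set P := fromBlocks (shiftMat σ) 0 0 (1 : Matrix (Fin (n + 1)) (Fin (n + 1)) ℂ)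
  set P' := fromBlocks (1 : Matrix (Fin (n + 1)) (Fin (n + 1)) ℂ) 0 0 (shiftMat σ)ᵀ with hP'
  set Q := coinOp (fun i : Fin (n + 1) => f i) (fun i => g i) with hQ
  set R' := blk c s (-s) c with hR'
  have hRR' : R * R' = 1 := by
    rw [hR, hR', blk_mul_blk, ← blk_one]
    congr 1 <;> ext i <;> simp only [Pi.add_apply, Pi.mul_apply, Pi.neg_apply, Pi.one_apply, Pi.zero_apply]
    · linear_combination hcs i
    · ring
    · ring
    · linear_combination hcs i
  have hRdet : R.det = 1 := by
    rw [hR, det_blk]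
    refine prod_eq_one fun i _ => ?_
    simp; linear_combination hcs i
  set E := blk (fun i => 1 / c i) (fun i => -s i / c i) 0 1 with hE
  have hEdet : E.det = ∏ i, (1 / c i) := by rw [hE, det_blk]; simp
  have hPdet : P.det = (-1) ^ n := by
    rw [det_fromBlocks_zero₂₁, det_shiftMat, hσ, sign_finRotate]; simp
  set X : Fin (n + 1) → Matrix (Fin 2) (Fin 2) ℂ := fun i =>
    !![-z * f i / c i, z * f i * s i / c i;
      (-s i - z * star (g i)) / c i, (1 + z * star (g i) * s i) / c i] with hX
  set C : ℕ → Matrix (Fin 2) (Fin 2) ℂ := fun j =>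
    (1 / (cos (α j) * z * f j) : ℂ) • stepMat (sin (α j)) (g j) z with hC
  have hXC : ∀ i : Fin (n + 1), X i * C i = !![-1, -z * g i; 0, z * f i] := by
    intro i
    exact siteMat_mul_stepMat (hα i) (hf i) hz (hcs i) (hgc i)
  have hCscal : ∀ j, (cos (α j) * z * f j : ℂ) ≠ 0 := fun j =>
    mul_ne_zero (mul_ne_zero (ofReal_ne_zero.2 (hα j)) hz) (ofReal_ne_zero.2 (hf j))
  have hCdet : (segProd C 0 (n + 1)).det = 1 := by
    rw [det_segProd]
    refine prod_eq_one fun j _ => ?_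
    have h4 := hgc (0 + j)
    have h3 : (cos (α (0 + j)) : ℂ) ^ 2 + (sin (α (0 + j)) : ℂ) ^ 2 = 1 := by
      exact_mod_cast cos_sq_add_sin_sq (α (0 + j))
    have h5 := hCscal (0 + j)
    simp only [hC, det_smul, card_fin, stepMat, det_mul, det_fin_two_of]
    rw [div_pow, one_pow, one_div, inv_mul_eq_one₀ (pow_ne_zero 2 h5)]
    generalize star (g (0 + j)) = g' at *
    linear_combination (f (0 + j) : ℂ) ^ 2 * z ^ 2 * h3 + z ^ 2 * (1 - (sin (α (0 + j)) : ℂ) ^ 2) * h4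
  have hCtr : (segProd C 0 (n + 1)).trace *
      (z ^ (n + 1) * ∏ j ∈ range (n + 1), ((cos (α j) * f j : ℝ) : ℂ)) =
      (segProd (fun j => stepMat (sin (α j)) (g j) z) 0 (n + 1)).trace := by
    rw [hC, segProd_smul, trace_smul, smul_eq_mul, mul_right_comm]
    rw [show z ^ (n + 1) = ∏ j ∈ range (n + 1), z by simp, ← prod_mul_distrib,
      ← prod_mul_distrib, prod_eq_one, one_mul]
    intro j _
    have := hCscal (0 + j)
    rw [zero_add] at this ⊢
    push_cast
    push_cast at this
    rw [one_div, inv_mul_eq_one₀ this]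
    ring
  have hfact : (Pᵀ * (R' - z • (P * Q * P')) * E).submatrix (compEquiv _) (compEquiv _) =
      (of fun a b : Fin (n + 1) × Fin 2 => if a.1 = b.1 then X a.1 a.2 b.2 else 0) *
        (1 - cycShift n C) := by
    have hr : (of fun a b : Fin (n + 1) × Fin 2 => if a.1 = b.1 then X a.1 a.2 b.2 else 0) *
        (1 - cycShift n C) = of fun a b => (if a.1 = b.1 then X a.1 a.2 b.2 else 0) -
          (if σ a.1 = b.1 then (X a.1 * C a.1) a.2 b.2 else 0) := by
      ext ⟨i, k⟩ ⟨j, l⟩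
      rw [mul_sub, mul_one, Matrix.sub_apply, mul_apply]
      simp only [of_apply, cycShift, sum_prod_type, ← hσ]
      congr 1
      rw [sum_eq_single i]
      · by_cases h : σ i = j <;> simp [mul_apply, h]
      · intro b _ hb; simp [hb.symm]
      · simp
    have hl : Pᵀ * (R' - z • (P * Q * P')) * E = fromBlocks
        ((shiftMat σ)ᵀ - diagonal fun i : Fin (n + 1) => z * f i / c i)
        ((diagonal fun i : Fin (n + 1) => z * f i * s i / c i) + (diagonal fun i : Fin (n + 1) => z * g i) * (shiftMat σ)ᵀ)
        (diagonal fun i : Fin (n + 1) => (-s i - z * star (g i)) / c i)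
        ((diagonal fun i : Fin (n + 1) => (1 + z * star (g i) * s i) / c i) -
          (diagonal fun i : Fin (n + 1) => z * f i) * (shiftMat σ)ᵀ) := by
      have h1 : Pᵀ * (R' - z • (P * Q * P')) = Pᵀ * R' - z • (Q * P') := by
        have : Pᵀ * P = 1 := by
          rw [fromBlocks_transpose, fromBlocks_multiply, ← fromBlocks_one]
          congr 1 <;> simp [shiftMat_transpose_mul]
        rw [mul_sub, Matrix.mul_smul, mul_assoc P, ← mul_assoc Pᵀ, this,
          one_mul]
      rw [h1, fromBlocks_transpose, hR', hQ, hE, hP']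
      simp only [coinOp, blk, fromBlocks_multiply, fromBlocks_smul, sub_eq_add_neg, fromBlocks_neg,
        fromBlocks_add]
      ext a b
      rcases a with i | i <;> rcases b with j | j <;>
        simp [shiftMat, diagonal_apply]
      all_goals
        have hci := hc0 i
        have hcj := hc0 j
        have hcsi := hcs i
        by_cases hij : i = j
        · subst hij
          by_cases hs : σ i = i <;> simp only [hs, if_true, if_false] <;> field_simp <;>
            first | ring1 | linear_combination hcsi
        · by_cases hs : σ i = j <;> simp only [hij, hs, if_true, if_false] <;> field_simp <;>
            first | ring1 | simp [hcj]
    rw [hr, hl]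
    simp only [hXC]
    ext ⟨i, k⟩ ⟨j, l⟩
    fin_cases k <;> fin_cases l <;>
      simp [compEquiv, hX, shiftMat, diagonal_apply, diagonal_mul]
    all_goals split_ifs <;> ring
  have hdet := congrArg det hfact
  rw [det_submatrix_equiv_self, det_mul, det_mul, det_mul, det_sitewise, det_one_sub_cycShift,
    det_transpose, hPdet, hEdet] at hdet
  have hXdet : ∀ i, (X i).det = - (z * f i) := by
    intro i
    have h1 := hc0 i
    have h3 := hcs i
    simp only [hX, det_fin_two_of]
    field_simp
    linear_combination (f i : ℂ) * h3
  have hchi : chi (shiftOp σ (fun i => α i) * Q) z = (R' - z • (P * Q * P')).det := by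
    have h1 : shiftOp σ (fun i => α i) * Q = P' * (R * (P * Q)) := by
      rw [← mul_assoc, ← mul_assoc]
      rfl
    rw [h1, chi_mul_comm, chi, ← one_mul (R' - _).det, ← hRdet, ← det_mul, mul_sub, hRR',
      Matrix.mul_smul]
    simp only [mul_assoc]
  rw [hchi]
  have hc1 : (∏ i, (1 / c i)) * ∏ i, c i = 1 := by
    rw [← prod_mul_distrib]
    exact prod_eq_one fun i _ => one_div_mul_cancel (hc0 i)
  have hXp : ∏ i, (X i).det = (-1) ^ (n + 1) * (z ^ (n + 1) * ∏ i : Fin (n + 1), (f i : ℂ)) := by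
    simp only [hXdet, Finset.prod_neg, prod_mul_distrib]
    simp
  have hM : (1 - segProd C 0 (n + 1)).det = 2 - (segProd C 0 (n + 1)).trace := by
    rw [det_fin_two] at hCdet ⊢
    rw [trace_fin_two]
    simp
    linear_combination hCdet
  have hcf : ∏ j ∈ range (n + 1), ((cos (α j) * f j : ℝ) : ℂ) =
      (∏ i, c i) * ∏ i : Fin (n + 1), (f i : ℂ) := by
    rw [← prod_mul_distrib, Finset.prod_range]
    simp [hc]
  rw [hXp, hM] at hdet
  rw [← hCtr, hcf]
  set D := (R' - z • (P * Q * P')).det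
  have h1 : ((-1 : ℂ) ^ n) * (-1) ^ n = 1 := by rw [← mul_pow]; simp
  linear_combination ((-1) ^ n * ∏ i, c i) * hdet - D * (∏ i, (1 / c i)) * (∏ i, c i) * h1 - D * hc1
    + (∏ i, c i) * z ^ (n + 1) * (∏ i : Fin (n + 1), (f i : ℂ)) * ((segProd C 0 (n + 1)).trace - 2) * h1

end Walk

end

section

section Coin

/-- The diagonal coin entry with coin angle `β`. -/
def fA (t β x : ℝ) : ℝ :=
  (1 / (1 + t ^ 2)) * ((1 - t ^ 2) * sin β - 2 * t * cos β * cos (2 * π * x))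

/-- The off-diagonal coin entry with coin angle `β`. -/
def gA (t β x : ℝ) : ℂ :=
  (1 / (1 + t ^ 2) : ℝ) * (t ^ 2 * cos β * circ x - 2 * t * sin β
    - cos β * circ (-x))

lemma circ_add (x y : ℝ) : circ (x + y) = circ x * circ y := by
  simp only [circ, ← exp_add]; congr 1; push_cast; ring

lemma circ_neg_eq_star (x : ℝ) : circ (-x) = star (circ x) := by
  simp only [circ, star_def, ← Complex.exp_conj, map_mul, conj_ofReal, conj_I]
  congr 1
  rw [map_ofNat]
  push_cast
  ring

lemma circ_zero : circ 0 = 1 := by simp [circ]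

lemma circ_intCast (n : ℤ) : circ n = 1 := by
  rw [circ, exp_eq_one_iff]; exact ⟨n, by push_cast; ring⟩

lemma circ_mul_circ_neg (x : ℝ) : circ x * circ (-x) = 1 := by
  rw [← circ_add, add_neg_cancel, circ_zero]

lemma circ_nat_mul (n : ℕ) (x : ℝ) : circ (n * x) = circ x ^ n := by
  rw [circ, circ, ← Complex.exp_nat_mul]; congr 1; push_cast; ring

lemma circ_add_circ_neg (x : ℝ) : circ x + circ (-x) = 2 * cos (2 * π * x) := by
  rw [circ, circ]
  push_cast
  rw [Complex.cos]
  ring_nf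

lemma star_gA (t β x : ℝ) : star (gA t β x) = (1 / (1 + t ^ 2) : ℝ) *
    (t ^ 2 * cos β * circ (-x) - 2 * t * sin β - cos β * circ x) := by
  have h := circ_neg_eq_star (-x)
  rw [neg_neg] at h
  rw [gA, star_mul', star_sub, star_sub, star_mul', star_mul', star_mul', star_mul', star_mul',
    ← circ_neg_eq_star, ← h]
  simp only [star_def, map_pow, conj_ofReal, map_ofNat]

lemma fA_sq_add (t β x : ℝ) : fA t β x ^ 2 + ‖gA t β x‖ ^ 2 = 1 := by
  have h0 : (1 + t ^ 2 : ℂ) ≠ 0 := by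
    have : (1 + t ^ 2 : ℝ) ≠ 0 := by positivity
    exact_mod_cast this
  have key : ((fA t β x ^ 2 + ‖gA t β x‖ ^ 2 : ℝ) : ℂ) = 1 := by
    push_cast
    rw [← mul_conj', ← star_def, star_gA, gA, fA]
    have h1 := circ_mul_circ_neg x
    have h2 := circ_add_circ_neg x
    have h3 : (cos β : ℂ) ^ 2 + (sin β : ℂ) ^ 2 = 1 := by
      exact_mod_cast cos_sq_add_sin_sq β
    push_cast at *
    generalize circ x = u at *
    generalize circ (-x) = v at *
    have h4 : Complex.cos (2 * π * x) = (u + v) / 2 := by rw [h2]; ring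
    rw [h4]
    generalize Complex.cos β = c at *
    generalize Complex.sin β = s at *
    field_simp
    linear_combination (1 + (t : ℂ) ^ 2) ^ 2 * h3 + c ^ 2 * (1 + (t : ℂ) ^ 2) ^ 2 * h1
  exact_mod_cast key

end Coin

section Ring
variable {ι : Type*} [Fintype ι] [DecidableEq ι]

lemma blk_unitary {a b c d : ι → ℂ} (h1 : ∀ i, star (a i) * a i + star (c i) * c i = 1)
    (h2 : ∀ i, star (b i) * b i + star (d i) * d i = 1)
    (h3 : ∀ i, star (a i) * b i + star (c i) * d i = 0) :
    (blk a b c d)ᴴ * blk a b c d = 1 := by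
  rw [blk_conjTranspose, blk_mul_blk, ← blk_one]
  congr 1 <;> ext i <;> simp only [Pi.add_apply, Pi.mul_apply, Pi.star_apply, Pi.one_apply, Pi.zero_apply]
  · exact h1 i
  · exact h3 i
  · have := congrArg star (h3 i)
    simp only [star_add, star_mul', star_star, star_zero] at this
    linear_combination this
  · exact h2 i

/-- The sitewise basis change diagonalizing rotations. -/
def rotBasis (ι : Type*) [Fintype ι] [DecidableEq ι] : Matrix (ι ⊕ ι) (ι ⊕ ι) ℂ :=
  blk (fun _ => (1 / sqrt 2 : ℝ)) (fun _ => (1 / sqrt 2 : ℝ))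
    (fun _ => -I * (1 / sqrt 2 : ℝ)) (fun _ => I * (1 / sqrt 2 : ℝ))

lemma sqrt_two_inv_sq : ((1 / sqrt 2 : ℝ) : ℂ) * (1 / sqrt 2 : ℝ) = 1 / 2 := by
  norm_cast
  rw [← sq, div_pow, sq_sqrt (by norm_num)]
  norm_num

lemma rotBasis_unitary : (rotBasis ι)ᴴ * rotBasis ι = 1 := by
  have h := sqrt_two_inv_sq
  unfold rotBasis
  generalize (1 / sqrt 2 : ℝ) = r at *
  apply blk_unitary <;> intro i <;> simp only [star_def, map_mul, map_neg, conj_I, conj_ofReal]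
  · linear_combination 2 * h - (r : ℂ) ^ 2 * I_sq
  · linear_combination 2 * h - (r : ℂ) ^ 2 * I_sq
  · linear_combination (r : ℂ) ^ 2 * I_sq

lemma rotBasis_unitary' : ((rotBasis ι)ᴴ)ᴴ * (rotBasis ι)ᴴ = 1 := by
  rw [conjTranspose_conjTranspose]
  exact mul_eq_one_comm.1 rotBasis_unitary

lemma rotation_eq (a : ι → ℝ) :
    blk (fun n => (cos (a n) : ℂ)) (fun n => -sin (a n)) (fun n => sin (a n))
      (fun n => cos (a n)) =
    rotBasis ι * phase (Sum.elim a (-a)) * (rotBasis ι)ᴴ := by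
  rw [← blk_phase, rotBasis, blk_conjTranspose, blk_mul_blk, blk_mul_blk]
  have h := sqrt_two_inv_sq
  generalize (1 / sqrt 2 : ℝ) = r at h
  have hI := I_sq
  congr 1 <;> ext i <;>
    simp only [Pi.add_apply, Pi.mul_apply, Pi.star_apply, Pi.zero_apply, star_def, map_mul, map_neg, conj_I,
      conj_ofReal, Sum.elim_inl, Sum.elim_inr, Pi.neg_apply, ofReal_neg, exp_mul_I, cos_neg,
      sin_neg, ofReal_cos, ofReal_sin]
  · linear_combination (-2 * Complex.cos (a i)) * h
  · linear_combination (2 * Complex.sin (a i)) * h - 2 * (r : ℂ) ^ 2 * Complex.sin (a i) * hI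
  · linear_combination (-2 * Complex.sin (a i)) * h + 2 * (r : ℂ) ^ 2 * Complex.sin (a i) * hI
  · linear_combination (-2 * Complex.cos (a i)) * h + 2 * (r : ℂ) ^ 2 * Complex.cos (a i) * hI

/-- The left and right reflections in the coin. -/
def leftRefl (t : ℝ) (ι : Type*) [Fintype ι] [DecidableEq ι] : Matrix (ι ⊕ ι) (ι ⊕ ι) ℂ :=
  blk (fun _ => (-t / sqrt (1 + t ^ 2) : ℝ)) (fun _ => (-1 / sqrt (1 + t ^ 2) : ℝ))
    (fun _ => (-1 / sqrt (1 + t ^ 2) : ℝ)) (fun _ => (t / sqrt (1 + t ^ 2) : ℝ))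

/-- The right reflection in the coin. -/
def rightRefl (t : ℝ) (ι : Type*) [Fintype ι] [DecidableEq ι] : Matrix (ι ⊕ ι) (ι ⊕ ι) ℂ :=
  blk (fun _ => (1 / sqrt (1 + t ^ 2) : ℝ)) (fun _ => (t / sqrt (1 + t ^ 2) : ℝ))
    (fun _ => (t / sqrt (1 + t ^ 2) : ℝ)) (fun _ => (-1 / sqrt (1 + t ^ 2) : ℝ))

lemma refl_scalar (t : ℝ) : (1 / sqrt (1 + t ^ 2)) * (1 / sqrt (1 + t ^ 2)) = 1 / (1 + t ^ 2) := by
  rw [← sq, div_pow, sq_sqrt (by positivity), one_pow]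

lemma leftRefl_unitary (t : ℝ) : (leftRefl t ι)ᴴ * leftRefl t ι = 1 := by
  have h := refl_scalar t
  have h0 : (1 + t ^ 2) ≠ 0 := by positivity
  rw [eq_div_iff h0] at h
  replace h := congrArg (fun x : ℝ => (x : ℂ)) h
  push_cast at h
  unfold leftRefl
  simp only [div_eq_mul_one_div (-t), div_eq_mul_one_div t, div_eq_mul_one_div (-1 : ℝ)]
  rw [← ofReal_one, ← ofReal_div] at h
  generalize 1 / sqrt (1 + t ^ 2) = r at *
  push_cast at h
  apply blk_unitary <;> intro i <;> simp only [star_def, conj_ofReal] <;> push_cast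
  · linear_combination h
  · linear_combination h
  · ring

lemma rightRefl_unitary (t : ℝ) : (rightRefl t ι)ᴴ * rightRefl t ι = 1 := by
  have h := refl_scalar t
  have h0 : (1 + t ^ 2) ≠ 0 := by positivity
  rw [eq_div_iff h0] at h
  replace h := congrArg (fun x : ℝ => (x : ℂ)) h
  push_cast at h
  unfold rightRefl
  simp only [div_eq_mul_one_div (-t), div_eq_mul_one_div t, div_eq_mul_one_div (-1 : ℝ)]
  rw [← ofReal_one, ← ofReal_div] at h
  generalize 1 / sqrt (1 + t ^ 2) = r at *
  push_cast at h
  apply blk_unitary <;> intro i <;> simp only [star_def, conj_ofReal] <;> push_cast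
  · linear_combination h
  · linear_combination h
  · ring

lemma coin_eq (t : ℝ) (β x : ι → ℝ) :
    coinOp (fun i => fA t (β i) (x i)) (fun i => gA t (β i) (x i)) =
      leftRefl t ι * phase (Sum.elim (fun i => 2 * π * x i) 0) *
        (rotBasis ι * phase (Sum.elim (-β) (- -β)) * (rotBasis ι)ᴴ) *
        phase (Sum.elim 0 (fun i => -(2 * π * x i))) * rightRefl t ι := by
  rw [← rotation_eq, ← blk_phase, ← blk_phase, leftRefl, rightRefl, coinOp]
  simp only [blk_mul_blk]
  have h := congrArg (fun x : ℝ => (x : ℂ)) (refl_scalar t)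
  simp only [div_eq_mul_one_div (-t), div_eq_mul_one_div t, div_eq_mul_one_div (-1 : ℝ)]
  simp only [star_gA]
  simp only [fA, gA]
  generalize hk : 1 / (1 + t ^ 2) = k at *
  generalize 1 / sqrt (1 + t ^ 2) = r at *
  have hx : ∀ i, Complex.exp ((2 * π * x i : ℝ) * I) = circ (x i) := by
    intro i; simp [circ]
  have hx' : ∀ i, Complex.exp ((-(2 * π * x i) : ℝ) * I) = circ (-x i) := by
    intro i; simp [circ]
  push_cast at h
  congr 1 <;> ext i <;>
    simp only [Pi.add_apply, Pi.mul_apply, Pi.zero_apply, Sum.elim_inl, Sum.elim_inr, hx, hx', Pi.neg_apply,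
      Real.cos_neg, Real.sin_neg] <;> push_cast <;> simp only [zero_mul, Complex.exp_zero, mul_zero, add_zero, zero_add, mul_one] <;>
    have h1 := circ_mul_circ_neg (x i) <;>
    have h2 := circ_add_circ_neg (x i) <;> push_cast at h2 <;> try rw [h2.symm ▸ (by ring : Complex.cos (2 * π * x i) = (2 * Complex.cos (2 * π * x i)) / 2)]
  all_goals generalize circ (x i) = u at *
  all_goals generalize circ (-x i) = v at *
  all_goals generalize Complex.cos (β i) = c at *
  all_goals generalize Complex.sin (β i) = s at *
  · linear_combination (-((1 - (t : ℂ) ^ 2) * s - 2 * t * c * Complex.cos (2 * π * x i))) * h +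
      (r : ℂ) ^ 2 * ((t : ℂ) ^ 2 * s * h1 + t * c * h2)
  · linear_combination ((t : ℂ) ^ 2 * c * u - 2 * t * s - c * v) * h - (r : ℂ) ^ 2 * t * s * h1
  · linear_combination (-((t : ℂ) ^ 2 * c * v - 2 * t * s - c * u)) * h + (r : ℂ) ^ 2 * t * s * h1
  · linear_combination (-((1 - (t : ℂ) ^ 2) * s - 2 * t * c * Complex.cos (2 * π * x i))) * h +
      (r : ℂ) ^ 2 * (- s * h1 + t * c * h2)

end Ring

end

section

section Ring
variable {ι κ : Type*} [Fintype ι] [DecidableEq ι] [Fintype κ] [DecidableEq κ]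

lemma shiftOp_eq (σ : Perm ι) (α : ι → ℝ) : shiftOp σ α =
    fromBlocks (of fun n m => if σ m = n then (cos (α n) : ℂ) else 0)
      (diagonal fun n => -(sin (α n) : ℂ)) (diagonal fun n => (sin (α (σ n)) : ℂ))
      (of fun n m => if σ n = m then (cos (α m) : ℂ) else 0) := by
  rw [shiftOp, blk, fromBlocks_multiply, fromBlocks_multiply]
  congr 1 <;> ext i j <;>
    simp [shiftMat, mul_apply, diagonal_apply]
  · rcases eq_or_ne (σ j) i with h | h
    · simp [h]
    · simp [h, h.symm]
  · rcases eq_or_ne i j with h | h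
    · simp [h]
    · simp [h]

lemma blk_diag_unitary (A B : Matrix ι ι ℂ) (hA : Aᴴ * A = 1) (hB : Bᴴ * B = 1) :
    (fromBlocks A 0 0 B)ᴴ * fromBlocks A 0 0 B = 1 := by
  rw [fromBlocks_conjTranspose, fromBlocks_multiply]
  simp [hA, hB, fromBlocks_one]

lemma shiftMat_unitary (σ : Perm ι) : (shiftMat σ)ᴴ * shiftMat σ = 1 := by
  rw [← shiftMat_transpose_mul σ]
  congr 1
  ext i j
  simp [shiftMat, apply_ite]

lemma shiftMat_transpose_unitary (σ : Perm ι) : ((shiftMat σ)ᵀ)ᴴ * (shiftMat σ)ᵀ = 1 := by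
  rw [← shiftMat_mul_transpose σ]
  congr 1
  ext i j
  simp [shiftMat, apply_ite]

lemma shiftOp_sandwich (σ : Perm ι) : ∃ A B : Matrix (ι ⊕ ι) (ι ⊕ ι) ℂ,
    Aᴴ * A = 1 ∧ Bᴴ * B = 1 ∧ ∀ α, shiftOp σ α = A * phase (Sum.elim α (-α)) * B := by
  refine ⟨fromBlocks 1 0 0 (shiftMat σ)ᵀ * rotBasis ι,
    (rotBasis ι)ᴴ * fromBlocks (shiftMat σ) 0 0 1, ?_, ?_, fun α => ?_⟩
  · exact unitary_mul (blk_diag_unitary _ _ (by simp) (shiftMat_transpose_unitary σ)) rotBasis_unitary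
  · exact unitary_mul rotBasis_unitary' (blk_diag_unitary _ _ (shiftMat_unitary σ) (by simp))
  · rw [shiftOp, rotation_eq]
    simp only [mul_assoc]

lemma coin_beta_sandwich (t : ℝ) (x : ι → ℝ) : ∃ A B : Matrix (ι ⊕ ι) (ι ⊕ ι) ℂ,
    Aᴴ * A = 1 ∧ Bᴴ * B = 1 ∧ ∀ β : ι → ℝ, coinOp (fun i => fA t (β i) (x i)) (fun i => gA t (β i) (x i)) =
      A * phase (Sum.elim (-β) (- -β)) * B := by
  refine ⟨leftRefl t ι * phase (Sum.elim (fun i => 2 * π * x i) 0) * rotBasis ι,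
    (rotBasis ι)ᴴ * (phase (Sum.elim 0 (fun i => -(2 * π * x i))) * rightRefl t ι),
    ?_, ?_, fun β => ?_⟩
  · exact unitary_mul (unitary_mul (leftRefl_unitary t) (phase_unitary _)) rotBasis_unitary
  · exact unitary_mul rotBasis_unitary' (unitary_mul (phase_unitary _) (rightRefl_unitary t))
  · rw [coin_eq]
    simp only [mul_assoc]

lemma rotation_unitary (β : ι → ℝ) :
    (rotBasis ι * phase (Sum.elim β (-β)) * (rotBasis ι)ᴴ)ᴴ *
      (rotBasis ι * phase (Sum.elim β (-β)) * (rotBasis ι)ᴴ) = 1 :=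
  unitary_mul (unitary_mul rotBasis_unitary (phase_unitary _)) rotBasis_unitary'

lemma shiftOp_unitary (σ : Perm ι) (α : ι → ℝ) : (shiftOp σ α)ᴴ * shiftOp σ α = 1 := by
  obtain ⟨A, B, hA, hB, h⟩ := shiftOp_sandwich σ
  rw [h]
  exact unitary_mul (unitary_mul hA (phase_unitary _)) hB

lemma coinOp_unitary (t : ℝ) (β x : ι → ℝ) :
    (coinOp (fun i => fA t (β i) (x i)) (fun i => gA t (β i) (x i)))ᴴ *
      coinOp (fun i => fA t (β i) (x i)) (fun i => gA t (β i) (x i)) = 1 := by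
  obtain ⟨A, B, hA, hB, h⟩ := coin_beta_sandwich t x
  rw [h]
  exact unitary_mul (unitary_mul hA (phase_unitary _)) hB

/-- The quantum walk on a union of rings given by the cycles of `σ`. -/
def ringOp (t : ℝ) (σ : Perm ι) (α β x : ι → ℝ) : Matrix (ι ⊕ ι) (ι ⊕ ι) ℂ :=
  shiftOp σ α * coinOp (fun i => fA t (β i) (x i)) (fun i => gA t (β i) (x i))

lemma ringOp_unitary (t : ℝ) (σ : Perm ι) (α β x : ι → ℝ) :
    (ringOp t σ α β x)ᴴ * ringOp t σ α β x = 1 :=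
  unitary_mul (shiftOp_unitary σ α) (coinOp_unitary t β x)

lemma phaseRel_alpha (t : ℝ) (σ : Perm ι) (α α' β x : ι → ℝ)
    (h : ∀ i, |α' i - α i| ≤ π) :
    PhaseRel (chi (ringOp t σ α β x)) (chi (ringOp t σ α' β x)) (∑ i, |α' i - α i|) := by
  obtain ⟨A, B, hA, hB, hAB⟩ := shiftOp_sandwich σ
  have := phaseRel_sandwich hA (unitary_mul hB (coinOp_unitary t β x))
    (Sum.elim α (-α)) (Sum.elim α' (-α')) (by
      rintro (i | i)
      · exact h i
      · simp only [Sum.elim_inr, Pi.neg_apply]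
        rw [← abs_neg]; convert h i using 2; ring)
  simp only [ringOp, hAB]
  rw [mul_assoc _ B, mul_assoc _ B]
  refine this.mono (le_of_eq ?_)
  rw [sum_sum_type, ← sum_add_distrib]
  refine sum_congr rfl fun i _ => ?_
  simp only [Sum.elim_inr, Sum.elim_inl, Pi.neg_apply]
  rw [show -α' i - -α i = -(α' i - α i) by ring, abs_neg]
  ring

lemma phaseRel_x (t : ℝ) (σ : Perm ι) (α β x x' : ι → ℝ)
    (h : ∀ i, |x' i - x i| ≤ 1 / 2) :
    PhaseRel (chi (ringOp t σ α β x)) (chi (ringOp t σ α β x'))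
      (2 * π * ∑ i, |x' i - x i|) := by
  have hpi := pi_pos
  have hR := rotation_unitary (-β)
  have hS := shiftOp_unitary σ α
  set R := rotBasis ι * phase (Sum.elim (-β) (- -β)) * (rotBasis ι)ᴴ with hRdef
  have he : ∀ i, |2 * π * x' i - 2 * π * x i| = 2 * π * |x' i - x i| := fun i => by
    rw [← mul_sub, abs_mul, abs_of_pos (by positivity)]
  have hb : ∀ i, |2 * π * x' i - 2 * π * x i| ≤ π := fun i => by
    rw [he]; nlinarith [h i]
  have h1 := phaseRel_sandwich (unitary_mul hS (leftRefl_unitary t (ι := ι)))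
    (unitary_mul (unitary_mul hR (phase_unitary (Sum.elim 0 (fun i => -(2 * π * x i)))))
      (rightRefl_unitary t))
    (Sum.elim (fun i => 2 * π * x i) 0) (Sum.elim (fun i => 2 * π * x' i) 0) (by
      rintro (i | i)
      · exact hb i
      · simp [hpi.le])
  have h2 := phaseRel_sandwich (unitary_mul (unitary_mul (unitary_mul hS (leftRefl_unitary t (ι := ι)))
      (phase_unitary (Sum.elim (fun i => 2 * π * x' i) 0))) hR) (rightRefl_unitary t)
    (Sum.elim 0 (fun i => -(2 * π * x i))) (Sum.elim 0 (fun i => -(2 * π * x' i))) (by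
      rintro (i | i)
      · simp [hpi.le]
      · simp only [Sum.elim_inr]
        rw [← abs_neg]; convert hb i using 2; ring)
  simp only [ringOp, coin_eq, ← hRdef]
  simp only [Matrix.mul_assoc] at h1 h2 ⊢
  refine (h1.trans h2).mono (le_of_eq ?_)
  rw [sum_sum_type, sum_sum_type, Finset.mul_sum]
  simp only [Sum.elim_inr, Sum.elim_inl, Pi.zero_apply, sub_self, abs_zero, zero_div,
    Finset.sum_const_zero, add_zero, zero_add, he]
  rw [← sum_add_distrib]
  refine sum_congr rfl fun i _ => ?_
  rw [show -(2 * π * x' i) - -(2 * π * x i) =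
    -(2 * π * x' i - 2 * π * x i) by ring, abs_neg, he]
  ring

lemma phaseRel_perm (t : ℝ) (σ σ' : Perm ι) (α β x : ι → ℝ) (S : Finset ι)
    (hS : ∀ m, σ m ≠ σ' m → σ m ∈ S ∧ σ' m ∈ S) (hα : ∀ i, |α i - π / 2| ≤ π / 2) :
    PhaseRel (chi (ringOp t σ α β x)) (chi (ringOp t σ' α β x)) (π * S.card) := by
  have hpi := pi_pos
  set α' : ι → ℝ := S.piecewise (fun _ => π / 2) α with hα'
  have hd : ∀ i, |α' i - α i| = if i ∈ S then |α i - π / 2| else 0 := fun i => by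
    by_cases hi : i ∈ S
    · simp [hα', hi, abs_sub_comm]
    · simp [hα', hi]
  have hd' : ∀ i, |α' i - α i| ≤ π := fun i => by
    rw [hd]; split_ifs
    · linarith [hα i]
    · exact hpi.le
  have hsum : ∑ i, |α' i - α i| ≤ π / 2 * S.card := by
    simp only [hd]
    rw [Finset.sum_ite_mem, Finset.univ_inter, mul_comm, ← nsmul_eq_mul]
    exact Finset.sum_le_card_nsmul _ _ _ fun i _ => hα i
  have h1 := phaseRel_alpha t σ α α' β x hd'
  have h2 := (phaseRel_alpha t σ' α α' β x hd').symm
  have hc : ∀ i ∈ S, α' i = π / 2 := fun i hi => by simp [hα', hi]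
  have heq : shiftOp σ α' = shiftOp σ' α' := by
    rw [shiftOp_eq, shiftOp_eq]
    congr 1
    · ext n m
      simp only [of_apply]
      by_cases h : σ m = σ' m
      · rw [h]
      · obtain ⟨ha, hb⟩ := hS m h
        split_ifs with h3 h4 h4
        · rfl
        · rw [hc n (h3 ▸ ha)]; simp
        · rw [hc n (h4 ▸ hb)]; simp
        · rfl
    · congr 1
      ext n
      by_cases h : σ n = σ' n
      · rw [h]
      · obtain ⟨ha, hb⟩ := hS n h
        rw [hc _ ha, hc _ hb]
    · ext n m
      simp only [of_apply]
      by_cases h : σ n = σ' n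
      · rw [h]
      · obtain ⟨ha, hb⟩ := hS n h
        split_ifs with h3 h4 h4
        · rfl
        · rw [hc m (h3 ▸ ha)]; simp
        · rw [hc m (h4 ▸ hb)]; simp
        · rfl
  have h3 : PhaseRel (chi (ringOp t σ α' β x)) (chi (ringOp t σ' α' β x)) 0 :=
    PhaseRel.of_eq fun z => by rw [ringOp, ringOp, heq]
  refine ((h1.trans h3).trans h2).mono ?_
  linarith

lemma chi_submatrix (e : κ ≃ ι) (A : Matrix ι ι ℂ) (z : ℂ) : chi (A.submatrix e e) z = chi A z := by
  rw [chi, chi, ← det_submatrix_equiv_self e (1 - z • A)]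
  congr 1
  ext i j
  simp [one_apply, e.injective.eq_iff]

lemma ringOp_reindex (t : ℝ) (e : ι ≃ κ) (σ : Perm ι) (σ' : Perm κ) (α β x : κ → ℝ)
    (hσ : ∀ i, σ' (e i) = e (σ i)) (z : ℂ) :
    chi (ringOp t σ' α β x) z = chi (ringOp t σ (α ∘ e) (β ∘ e) (x ∘ e)) z := by
  rw [← chi_submatrix (sumCongr e e) (ringOp t σ' α β x)]
  congr 1
  rw [ringOp, ringOp, ← submatrix_mul_equiv _ _ _ (sumCongr e e), shiftOp_eq, shiftOp_eq]
  congr 1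
  · ext (i | i) (j | j) <;> simp [diagonal_apply, hσ, e.injective.eq_iff]
  · ext (i | i) (j | j) <;> simp [coinOp, blk, diagonal_apply, e.injective.eq_iff]

lemma chi_ringOp_sum (t : ℝ) (σ : Perm ι) (σ' : Perm κ) (α β x : ι ⊕ κ → ℝ) (z : ℂ) :
    chi (ringOp t (sumCongr σ σ') α β x) z =
      chi (ringOp t σ (α ∘ Sum.inl) (β ∘ Sum.inl) (x ∘ Sum.inl)) z *
      chi (ringOp t σ' (α ∘ Sum.inr) (β ∘ Sum.inr) (x ∘ Sum.inr)) z := by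
  rw [← chi_submatrix (sumSumSumComm ι ι κ κ) ]
  have : (ringOp t (sumCongr σ σ') α β x).submatrix (sumSumSumComm ι ι κ κ)
      (sumSumSumComm ι ι κ κ) = fromBlocks
        (ringOp t σ (α ∘ Sum.inl) (β ∘ Sum.inl) (x ∘ Sum.inl)) 0 0
        (ringOp t σ' (α ∘ Sum.inr) (β ∘ Sum.inr) (x ∘ Sum.inr)) := by
    rw [ringOp, ← submatrix_mul_equiv _ _ _ (sumSumSumComm ι ι κ κ)]
    have h1 : (shiftOp (sumCongr σ σ') α).submatrix (sumSumSumComm ι ι κ κ)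
      (sumSumSumComm ι ι κ κ) = fromBlocks (shiftOp σ (α ∘ Sum.inl)) 0 0
        (shiftOp σ' (α ∘ Sum.inr)) := by
      rw [shiftOp_eq, shiftOp_eq, shiftOp_eq]
      ext ((i | i) | (i | i)) ((j | j) | (j | j)) <;> simp [diagonal_apply]
    have h2 : (coinOp (fun i => fA t (β i) (x i)) (fun i => gA t (β i) (x i))).submatrix
        (sumSumSumComm ι ι κ κ) (sumSumSumComm ι ι κ κ) = fromBlocks
          (coinOp (fun i => fA t (β (Sum.inl i)) (x (Sum.inl i))) (fun i => gA t (β (Sum.inl i)) (x (Sum.inl i)))) 0 0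
          (coinOp (fun i => fA t (β (Sum.inr i)) (x (Sum.inr i))) (fun i => gA t (β (Sum.inr i)) (x (Sum.inr i)))) := by
      ext ((i | i) | (i | i)) ((j | j) | (j | j)) <;> simp [coinOp, blk, diagonal_apply]
    rw [h1, h2, fromBlocks_multiply]
    simp [ringOp]
  rw [this, chi, chi, chi, ← det_fromBlocks_zero₂₁ _ 0 _, ← fromBlocks_one, fromBlocks_smul,
    sub_eq_add_neg, fromBlocks_neg, fromBlocks_add]
  simp [sub_eq_add_neg]

end Ring

end

section RingN

lemma coe_finRotate_eq {n : ℕ} (i : Fin n) :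
    ((finRotate n i : Fin n) : ℕ) = if (i : ℕ) + 1 = n then 0 else (i : ℕ) + 1 := by
  obtain _ | n := n
  · exact i.elim0
  · rw [coe_finRotate]
    have : (i = Fin.last n) ↔ (i : ℕ) + 1 = n + 1 := by
      rw [Fin.ext_iff, Fin.val_last]; omega
    simp only [this]

/-- The walk on the ring with `n` sites. -/
def ringN (t : ℝ) (n : ℕ) (α β x : ℕ → ℝ) : Matrix (Fin n ⊕ Fin n) (Fin n ⊕ Fin n) ℂ :=
  ringOp t (finRotate n) (fun i => α i) (fun i => β i) (fun i => x i)

lemma ringN_unitary (t : ℝ) (n : ℕ) (α β x : ℕ → ℝ) :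
    (ringN t n α β x)ᴴ * ringN t n α β x = 1 := ringOp_unitary _ _ _ _ _

lemma ringN_congr {t : ℝ} {n : ℕ} {α β x α' β' x' : ℕ → ℝ} (h1 : ∀ i < n, α i = α' i)
    (h2 : ∀ i < n, β i = β' i) (h3 : ∀ i < n, x i = x' i) : ringN t n α β x = ringN t n α' β' x' := by
  unfold ringN
  congr 1 <;> ext i
  · exact h1 i i.2
  · exact h2 i i.2
  · exact h3 i i.2

lemma ringN_x {t : ℝ} {n : ℕ} {α β x x' : ℕ → ℝ} (h : ∀ i < n, |x' i - x i| ≤ 1 / 2) :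
    PhaseRel (chi (ringN t n α β x)) (chi (ringN t n α β x'))
      (2 * π * ∑ i ∈ range n, |x' i - x i|) := by
  rw [sum_range]
  exact phaseRel_x t _ _ _ _ _ fun i => h i i.2

lemma chi_ringN_zero (t : ℝ) (α β x : ℕ → ℝ) (z : ℂ) : chi (ringN t 0 α β x) z = 1 := by
  simp [chi]

/-- Splitting a ring into two rings. -/
lemma ringN_split (t : ℝ) (n m : ℕ) (α β x : ℕ → ℝ)
    (hα : ∀ i, |α i - π / 2| ≤ π / 2) :
    PhaseRel (chi (ringN t (n + m) α β x))
      (fun z => chi (ringN t n α β x) z *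
        chi (ringN t m (fun i => α (n + i)) (fun i => β (n + i)) (fun i => x (n + i))) z)
      (2 * π) := by
  set e : Fin n ⊕ Fin m ≃ Fin (n + m) := finSumFinEquiv with he
  set S : Finset (Fin (n + m)) := univ.filter fun i => (i : ℕ) = 0 ∨ (i : ℕ) = n with hS
  have hcard : S.card ≤ 2 := by
    calc S.card ≤ (({0, n} : Finset ℕ)).card := by
          refine Finset.card_le_card_of_injOn (fun i => (i : ℕ)) ?_ ?_
          · intro i hi
            simpa [hS] using hi
          · intro i _ j _ h
            exact Fin.ext h
      _ ≤ 2 := Finset.card_le_two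
  have h1 := phaseRel_perm t (finRotate (n + m))
    (e.permCongr (sumCongr (finRotate n) (finRotate m)))
    (fun i => α i) (fun i => β i) (fun i => x i) S (by
      intro k hk
      obtain ⟨i, rfl⟩ := e.surjective k
      rw [Equiv.permCongr_apply, symm_apply_apply] at hk ⊢
      rcases i with i | i
      · have hi := i.2
        have hv : ((e (Sum.inl i) : Fin (n + m)) : ℕ) = i := by simp [he]
        have hw : ((e ((sumCongr (finRotate n) (finRotate m)) (Sum.inl i)) : Fin (n + m)) : ℕ) =
          if (i : ℕ) + 1 = n then 0 else (i : ℕ) + 1 := by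
            rw [← coe_finRotate_eq]; simp [he]
        rw [Ne, Fin.ext_iff, coe_finRotate_eq, hv, hw] at hk
        simp only [hS, mem_filter, mem_univ, true_and, coe_finRotate_eq, hv, hw]
        split_ifs at hk ⊢ <;> omega
      · have hi := i.2
        have hv : ((e (Sum.inr i) : Fin (n + m)) : ℕ) = n + i := by simp [he]
        have hw : ((e ((sumCongr (finRotate n) (finRotate m)) (Sum.inr i)) : Fin (n + m)) : ℕ) =
          n + if (i : ℕ) + 1 = m then 0 else (i : ℕ) + 1 := by
            rw [← coe_finRotate_eq]; simp [he]
        rw [Ne, Fin.ext_iff, coe_finRotate_eq, hv, hw] at hk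
        simp only [hS, mem_filter, mem_univ, true_and, coe_finRotate_eq, hv, hw]
        split_ifs at hk ⊢ <;> omega) (fun i => hα i)
  have h2 : ∀ z, chi (ringOp t (e.permCongr (sumCongr (finRotate n) (finRotate m)))
      (fun i => α i) (fun i => β i) (fun i => x i)) z = chi (ringN t n α β x) z *
        chi (ringN t m (fun i => α (n + i)) (fun i => β (n + i)) (fun i => x (n + i))) z := fun z => by
    rw [ringOp_reindex t e (sumCongr (finRotate n) (finRotate m)) _ _ _ _
      (fun i => by rw [Equiv.permCongr_apply, symm_apply_apply]), chi_ringOp_sum]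
    unfold ringN
    congr 3 <;> ext i <;> simp [he]
  refine ((h1.trans (PhaseRel.of_eq h2))).mono ?_
  have hpi := pi_pos
  have : (S.card : ℝ) ≤ 2 := mod_cast hcard
  nlinarith

/-- Splitting off `k` consecutive rings of the same length. -/
lemma ringN_split_blocks (t : ℝ) (n k : ℕ) (α β x : ℕ → ℝ)
    (hα : ∀ i, |α i - π / 2| ≤ π / 2) :
    PhaseRel (chi (ringN t (k * n) α β x))
      (fun z => ∏ j ∈ range k, chi (ringN t n (fun i => α (j * n + i))
        (fun i => β (j * n + i)) (fun i => x (j * n + i))) z)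
      (2 * π * k) := by
  induction k with
  | zero =>
    simp only [zero_mul, Finset.range_zero, Finset.prod_empty, Nat.cast_zero, mul_zero]
    have h0 : ∀ m, m = 0 → ∀ z, chi (ringN t m α β x) z = 1 := by
      rintro _ rfl z
      exact chi_ringN_zero ..
    exact PhaseRel.of_eq (h0 _ (zero_mul n))
  | succ k ih =>
    rw [add_mul, one_mul]
    have h := ringN_split t (k * n) n α β x hα
    have h2 := h.trans (ih.mul (PhaseRel.refl _))
    simp only [prod_range_succ]
    refine h2.mono ?_
    push_cast
    linarith

lemma PhaseRel.prod {p q : ℕ → ℂ → ℂ} {c : ℕ → ℝ} (k : ℕ) (h : ∀ j < k, PhaseRel (p j) (q j) (c j)) :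
    PhaseRel (fun z => ∏ j ∈ range k, p j z) (fun z => ∏ j ∈ range k, q j z)
      (∑ j ∈ range k, c j) := by
  induction k with
  | zero => simpa using PhaseRel.refl _
  | succ k ih =>
    simp only [prod_range_succ, Finset.sum_range_succ]
    exact (ih fun j hj => h j (by omega)).mul (h k (by omega))

lemma cos_add_int (x : ℝ) (n : ℤ) :
    cos (2 * π * (x + n)) = cos (2 * π * x) := by
  rw [mul_add, mul_comm (2 * π) (n : ℝ)]
  exact Real.cos_add_int_mul_two_pi _ _

lemma circ_add_int (x : ℝ) (n : ℤ) : circ (x + n) = circ x := by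
  rw [circ_add, circ_intCast, mul_one]

lemma fA_add_int (t β x : ℝ) (n : ℤ) : fA t β (x + n) = fA t β x := by
  rw [fA, fA, cos_add_int]

lemma gA_add_int (t β x : ℝ) (n : ℤ) : gA t β (x + n) = gA t β x := by
  rw [gA, gA, circ_add_int, neg_add, ← Int.cast_neg, circ_add_int]

lemma ringN_add_int (t : ℝ) (n : ℕ) (α β x : ℕ → ℝ) (k : ℕ → ℤ) :
    ringN t n α β (fun i => x i + k i) = ringN t n α β x := by
  simp only [ringN, ringOp, fA_add_int, gA_add_int]

lemma ringOp_congr {ι : Type*} [Fintype ι] [DecidableEq ι] {t : ℝ} {σ : Perm ι}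
    {α β x α' β' x' : ι → ℝ} (m : ι → ℤ) (h1 : ∀ i, α i = α' i) (h2 : ∀ i, β i = β' i)
    (h3 : ∀ i, x i = x' i + m i) : ringOp t σ α β x = ringOp t σ α' β' x' := by
  obtain rfl : α = α' := funext h1
  obtain rfl : β = β' := funext h2
  obtain rfl : x = fun i => x' i + m i := funext h3
  simp only [ringOp, fA_add_int, gA_add_int]

/-- Translating a ring by one site. -/
lemma chi_ringN_translate (t : ℝ) (n : ℕ) (α β x : ℕ → ℝ) (k : ℤ) (hα : α n = α 0)
    (hβ : β n = β 0) (hx : x n = x 0 + k) (z : ℂ) :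
    chi (ringN t n (fun i => α (i + 1)) (fun i => β (i + 1)) (fun i => x (i + 1))) z =
      chi (ringN t n α β x) z := by
  have h := ringOp_reindex t (finRotate n) (finRotate n) (finRotate n)
    (fun i => α i) (fun i => β i) (fun i => x i) (fun i => rfl) z
  refine Eq.trans ?_ h.symm
  have hc : ∀ i : Fin n, ∃ m : ℤ, α (i + 1) = α (finRotate n i : Fin n) ∧
      β (i + 1) = β (finRotate n i : Fin n) ∧ x (i + 1) = x (finRotate n i : Fin n) + m := fun i => by
    rw [coe_finRotate_eq]
    split_ifs with hi
    · rw [hi]; exact ⟨k, hα, hβ, hx⟩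
    · exact ⟨0, rfl, rfl, by simp⟩
  choose m h1 h2 h3 using hc
  rw [ringN, ringOp_congr m h1 h2 h3]
  rfl

end RingN

section Interlace

/-- If between any two consecutive points of `B` the function takes both signs, and `C` has no
more points than `B` in a period, then the derivative has the same sign at all points of `B`. -/
lemma same_sign_of_gaps {e e' : ℝ → ℝ} (he : ∀ x, HasDerivAt e (e' x) x)
    (hp : ∀ x, e (x + 1) = e x) {B C : Set ℝ} (hB : ∀ x, x + 1 ∈ B ↔ x ∈ B)
    (hBC : ∀ x, e x = 0 ↔ x ∈ B ∨ x ∈ C) (he' : ∀ x ∈ B, e' x ≠ 0)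
    (hgap : ∀ x ∈ B, ∀ y ∈ B, x < y → (∀ u ∈ B, ¬ (x < u ∧ u < y)) →
      ∃ u v, x < u ∧ u < y ∧ x < v ∧ v < y ∧ e u < 0 ∧ 0 < e v) (hfin : ∀ x, (B ∩ Ico x (x + 1)).Finite)
    (hcard : ∀ x, (C ∩ Ico x (x + 1)).Finite ∧
      (C ∩ Ico x (x + 1)).ncard ≤ (B ∩ Ico x (x + 1)).ncard) :
    ∀ x ∈ B, ∀ y ∈ B, 0 < e' x * e' y := by
  have hcont : Continuous e := continuous_iff_continuousAt.2 fun x => (he x).continuousAt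
  -- successor
  have hfin' : ∀ x y : ℝ, y ≤ x + 1 → (B ∩ Ioc x y).Finite := fun x y hy => by
    refine ((hfin x).union (Set.finite_singleton (x + 1))).subset ?_
    rintro u ⟨hu, h1, h2⟩
    rcases lt_or_eq_of_le (h2.trans hy) with h | h
    · exact Or.inl ⟨hu, h1.le, h⟩
    · exact Or.inr h
  have hnext : ∀ x ∈ B, ∃ y ∈ B, x < y ∧ y ≤ x + 1 ∧ ∀ u ∈ B, ¬ (x < u ∧ u < y) := fun x hx => by
    obtain ⟨y, hy, hmin⟩ := Set.exists_min_image (B ∩ Ioc x (x + 1)) id (hfin' _ _ le_rfl)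
      ⟨x + 1, (hB x).2 hx, by simp, le_rfl⟩
    refine ⟨y, hy.1, hy.2.1, hy.2.2, fun u hu h => ?_⟩
    have := hmin u ⟨hu, h.1, h.2.le.trans hy.2.2⟩
    simp only [id] at this
    linarith [h.2]
  choose! N hN1 hN2 hN3 hN4 using hnext
  have hzero : ∀ u v, e u * e v < 0 → ∃ w, (u < w ∧ w < v ∨ v < w ∧ w < u) ∧ e w = 0 := by
    intro u v huv
    have key : ∀ u v : ℝ, u ≤ v → e u * e v < 0 → ∃ w, (u < w ∧ w < v) ∧ e w = 0 := by
      intro u v huv h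
      rcases mul_neg_iff.1 h with ⟨h1, h2⟩ | ⟨h1, h2⟩
      · obtain ⟨w, hw, hw0⟩ := intermediate_value_Ioo' huv hcont.continuousOn ⟨h2, h1⟩
        exact ⟨w, hw, hw0⟩
      · obtain ⟨w, hw, hw0⟩ := intermediate_value_Ioo huv hcont.continuousOn ⟨h1, h2⟩
        exact ⟨w, hw, hw0⟩
    rcases le_total u v with h | h
    · obtain ⟨w, hw, h0⟩ := key u v h huv; exact ⟨w, Or.inl hw, h0⟩
    · obtain ⟨w, hw, h0⟩ := key v u h (by linarith); exact ⟨w, Or.inr hw, h0⟩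
  have hgapC : ∀ x ∈ B, ∃ w ∈ C, x < w ∧ w < N x := fun x hx => by
    obtain ⟨u, v, h1, h2, h3, h4, h5, h6⟩ := hgap x hx (N x) (hN1 x hx) (hN2 x hx) (hN4 x hx)
    obtain ⟨w, hw, hw0⟩ := hzero u v (mul_neg_of_neg_of_pos h5 h6)
    have hw' : x < w ∧ w < N x := by
      rcases hw with h | h <;> constructor <;> linarith [h.1, h.2]
    rcases (hBC w).1 hw0 with h | h
    · exact absurd hw' (hN4 x hx w h)
    · exact ⟨w, h, hw'⟩
  choose! c hc1 hc2 hc3 using hgapC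
  have huniq : ∀ x ∈ B, ∀ w ∈ C, x < w → w < N x → w = c x := by
    intro x hx w hw h1 h2
    by_contra hne
    obtain ⟨hCf, hCc⟩ := hcard x
    have hmaps : ∀ y ∈ B ∩ Ico x (x + 1), c y ∈ C ∩ Ico x (x + 1) := by
      rintro y ⟨hy, hy1, hy2⟩
      refine ⟨hc1 y hy, hy1.trans (hc2 y hy).le, (hc3 y hy).trans_le ?_⟩
      by_contra hlt
      exact hN4 y hy (x + 1) ((hB x).2 hx) ⟨hy2, not_le.1 hlt⟩
    have hinj : Set.InjOn c (B ∩ Ico x (x + 1)) := by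
      have key : ∀ y ∈ B, ∀ y' ∈ B, y < y' → c y < c y' := fun y hy y' hy' hlt => by
        have : N y ≤ y' := by
          by_contra h
          exact hN4 y hy y' hy' ⟨hlt, not_le.1 h⟩
        linarith [hc3 y hy, hc2 y' hy']
      intro y hy y' hy' h
      rcases lt_trichotomy y y' with h' | h' | h'
      · exact absurd h (key y hy.1 y' hy'.1 h').ne
      · exact h'
      · exact absurd h (key y' hy'.1 y hy.1 h').ne'
    have hwnot : w ∉ c '' (B ∩ Ico x (x + 1)) := by
      rintro ⟨y, hy, rfl⟩
      rcases eq_or_lt_of_le hy.2.1 with h | h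
      · exact hne (by rw [h])
      · have : N x ≤ y := by
          by_contra h'
          exact hN4 x hx y hy.1 ⟨h, not_le.1 h'⟩
        linarith [hc2 y hy.1]
    have hsub : insert w (c '' (B ∩ Ico x (x + 1))) ⊆ C ∩ Ico x (x + 1) := by
      rintro u (rfl | ⟨y, hy, rfl⟩)
      · exact ⟨hw, h1.le, h2.trans_le (hN3 x hx)⟩
      · exact hmaps y hy
    have h3 := Set.ncard_le_ncard hsub hCf
    rw [Set.ncard_insert_of_notMem hwnot ((hfin x).image c), hinj.ncard_image] at h3
    omega
  have hsign : ∀ x ∈ B, 0 < e' x * e' (N x) := by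
    intro x hx
    by_contra hneg
    have hne : e' x * e' (N x) < 0 :=
      lt_of_le_of_ne (not_lt.1 hneg) (mul_ne_zero (he' x hx) (he' _ (hN1 x hx)))
    obtain ⟨u, v, h1, h2, h3, h4, h5, h6⟩ := hgap x hx (N x) (hN1 x hx) (hN2 x hx) (hN4 x hx)
    have e0 : ∀ y ∈ B, e y = 0 := fun y hy => (hBC y).2 (Or.inl hy)
    -- points near the ends
    have hright : ∀ y, e y = 0 → ∀ r > y, e' y ≠ 0 → ∃ p, y < p ∧ p < r ∧ 0 < e p * e' y := by
      intro y hy r hr hne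
      have h := (he y).mul_const (e' y)
      have hpos : 0 < e' y * e' y := mul_self_pos.2 hne
      have := (hasDerivAt_iff_tendsto_slope.1 h).mono_left (nhdsWithin_mono y
        (show Ioi y ⊆ {y}ᶜ from fun p (hp : y < p) => hp.ne'))
      have h7 := this.eventually (lt_mem_nhds hpos)
      have h8 : ∀ᶠ p in nhdsWithin y (Ioi y), p < r := nhdsWithin_le_nhds (Iio_mem_nhds hr)
      obtain ⟨p, ⟨hp1, hp2⟩, hp3⟩ := ((h7.and h8).and self_mem_nhdsWithin).exists
      refine ⟨p, hp3, hp2, ?_⟩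
      have hp3' : 0 < p - y := sub_pos.2 hp3
      rw [slope_def_field, hy, zero_mul, sub_zero, lt_div_iff₀ hp3', zero_mul] at hp1
      exact hp1
    have hleft : ∀ y, e y = 0 → ∀ r < y, e' y ≠ 0 → ∃ p, r < p ∧ p < y ∧ e p * e' y < 0 := by
      intro y hy r hr hne
      have h := (he y).mul_const (e' y)
      have hpos : 0 < e' y * e' y := mul_self_pos.2 hne
      have := (hasDerivAt_iff_tendsto_slope.1 h).mono_left (nhdsWithin_mono y
        (show Set.Iio y ⊆ {y}ᶜ from fun p (hp : p < y) => hp.ne))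
      have h7 := this.eventually (lt_mem_nhds hpos)
      have h8 : ∀ᶠ p in nhdsWithin y (Set.Iio y), r < p := nhdsWithin_le_nhds (Ioi_mem_nhds hr)
      obtain ⟨p, ⟨hp1, hp2⟩, hp3⟩ := ((h7.and h8).and self_mem_nhdsWithin).exists
      refine ⟨p, hp2, hp3, ?_⟩
      have hp3' : p - y < 0 := sub_neg.2 hp3
      rw [slope_def_field, hy, zero_mul, sub_zero, lt_div_iff_of_neg hp3', zero_mul] at hp1
      exact hp1
    have hopp : ∃ u, x < u ∧ u < N x ∧ e u * e' x < 0 := by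
      rcases lt_or_gt_of_ne (he' x hx) with h | h
      · exact ⟨v, h3, h4, mul_neg_of_pos_of_neg h6 h⟩
      · exact ⟨u, h1, h2, mul_neg_of_neg_of_pos h5 h⟩
    obtain ⟨m, hm1, hm2, hm3⟩ := hopp
    obtain ⟨p, hp1, hp2, hp3⟩ := hright x (e0 x hx) m hm1 (he' x hx)
    obtain ⟨r, hr1, hr2, hr3⟩ := hleft (N x) (e0 _ (hN1 x hx)) m hm2 (he' _ (hN1 x hx))
    have hs1 : e p * e m < 0 := by
      have : 0 < e' x * e' x := mul_self_pos.2 (he' x hx)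
      nlinarith [mul_neg_of_pos_of_neg hp3 hm3]
    have hs2 : e m * e r < 0 := by
      have h9 : 0 < (e m * e' x) * (e r * e' (N x)) := mul_pos_of_neg_of_neg hm3 hr3
      have : (e m * e r) * (e' x * e' (N x)) > 0 := by linarith
      by_contra h
      nlinarith [mul_nonneg (not_lt.1 h) (neg_nonneg.2 hne.le)]
    obtain ⟨w1, hw1, hw10⟩ := hzero _ _ hs1
    obtain ⟨w2, hw2, hw20⟩ := hzero _ _ hs2
    have hw1' : x < w1 ∧ w1 < m := by rcases hw1 with h | h <;> constructor <;> linarith [h.1, h.2]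
    have hw2' : m < w2 ∧ w2 < N x := by
      rcases hw2 with h | h <;> constructor <;> linarith [h.1, h.2]
    have hC : ∀ w, x < w → w < N x → e w = 0 → w ∈ C := fun w h1 h2 h0 =>
      ((hBC w).1 h0).resolve_left fun hb => hN4 x hx w hb ⟨h1, h2⟩
    have a1 := huniq x hx w1 (hC _ hw1'.1 (by linarith [hw1'.2]) hw10) hw1'.1 (by linarith [hw1'.2])
    have a2 := huniq x hx w2 (hC _ (by linarith [hw2'.1]) hw2'.2 hw20) (by linarith [hw2'.1]) hw2'.2
    linarith [hw1'.2, hw2'.1]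
  have hper : ∀ x ∈ B, e' (x + 1) = e' x := fun x hx => by
    have h1 := (he (x + 1)).comp_add_const x 1
    have h2 : (fun y => e (y + 1)) = e := funext hp
    rw [h2] at h1
    exact h1.unique (he x)
  -- all points within one period to the right
  have hperiod : ∀ x ∈ B, ∀ y ∈ B, x ≤ y → y < x + 1 → 0 < e' x * e' y := by
    intro x hx y hy hxy hyx
    by_contra hneg
    have hbad : ({y | 0 < e' x * e' y}ᶜ ∩ (B ∩ Ioc x y)).Nonempty := by
      refine ⟨y, hneg, hy, lt_of_le_of_ne hxy ?_, le_rfl⟩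
      rintro rfl
      exact hneg (mul_self_pos.2 (he' x hx))
    obtain ⟨w, hw, hmin⟩ := Set.exists_min_image _ id
      ((hfin' x y hyx.le).subset Set.inter_subset_right) hbad
    -- predecessor of `w`
    have hpf : (B ∩ Ico x w).Finite := (hfin x).subset
      (Set.inter_subset_inter_right _ (Set.Ico_subset_Ico_right (hw.2.2.2.trans hyx.le)))
    obtain ⟨v, hv, hmax⟩ := Set.exists_max_image (B ∩ Ico x w) id hpf ⟨x, hx, le_rfl, hw.2.2.1⟩
    have hNv : N v = w := by
      refine le_antisymm ?_ ?_
      · by_contra h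
        exact hN4 v hv.1 w hw.2.1 ⟨hv.2.2, not_le.1 h⟩
      · by_contra h
        have := hmax (N v) ⟨hN1 v hv.1, hv.2.1.trans (hN2 v hv.1).le, not_le.1 h⟩
        simp only [id] at this
        linarith [hN2 v hv.1]
    have h1 := hsign v hv.1
    rw [hNv] at h1
    have h2 : 0 < e' x * e' v := by
      rcases eq_or_lt_of_le hv.2.1 with h | h
      · rw [← h]; exact mul_self_pos.2 (he' x hx)
      · by_contra hcon
        have := hmin v ⟨hcon, hv.1, h, hv.2.2.le.trans hw.2.2.2⟩
        simp only [id] at this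
        linarith [hv.2.2]
    refine hw.1 ?_
    show 0 < e' x * e' w
    have h3 : 0 < (e' x * e' w) * (e' v * e' v) := by linarith [mul_pos h2 h1]
    exact pos_of_mul_pos_left h3 (mul_self_nonneg _)
  have hint : ∀ (n : ℕ) x, x ∈ B → x + n ∈ B ∧ e' (x + n) = e' x := by
    intro n x hx
    induction n with
    | zero => simpa using hx
    | succ n ih =>
      push_cast
      rw [← add_assoc]
      exact ⟨(hB _).2 ih.1, (hper _ ih.1).trans ih.2⟩
  have hle : ∀ x ∈ B, ∀ y ∈ B, x ≤ y → 0 < e' x * e' y := by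
    intro x hx y hy hxy
    obtain ⟨h1, h2⟩ := hint ⌊y - x⌋₊ x hx
    rw [← h2]
    refine hperiod _ h1 y hy ?_ ?_
    · linarith [Nat.floor_le (sub_nonneg.2 hxy)]
    · linarith [Nat.lt_floor_add_one (y - x)]
  intro x hx y hy
  rcases le_total x y with h | h
  · exact hle x hx y hy h
  · rw [mul_comm]; exact hle y hy x hx h

end Interlace

section

section Gap

variable {ι : Type*} [Fintype ι] [DecidableEq ι]

lemma chi_mul_rot_eq_sum {A U : Matrix ι ι ℂ} {d : ι → ℂ} (hA : Aᴴ * A = 1) (hU : U * Uᴴ = 1)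
    (hU' : Uᴴ * U = 1) (hd : ∀ k, ‖d k‖ = 1) (hAU : A = U * diagonal d * Uᴴ) (i : ι) (τ : ℝ) {z : ℂ} (hz : ‖z‖ ≤ 1) :
    chi (A * rot i τ) z = ∏ k, (1 - z * d k) - (Complex.exp (τ * I) - 1) *
      ∑ j, (normSq (U i j) : ℂ) * (z * d j) * ∏ k ∈ univ.erase j, (1 - z * d k) := by
  have hball : ∀ z : ℂ, ‖z‖ < 1 → chi (A * rot i τ) z = ∏ k, (1 - z * d k) -
      (Complex.exp (τ * I) - 1) * ∑ j, (normSq (U i j) : ℂ) * (z * d j) *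
        ∏ k ∈ univ.erase j, (1 - z * d k) := by
    intro z hz
    have hne : ∀ k, 1 - z * d k ≠ 0 := fun k h => by
      have : ‖z * d k‖ = 1 := by rw [← sub_eq_zero.1 h]; simp
      rw [norm_mul, hd, mul_one] at this
      linarith
    have hinv : (1 - z • A)⁻¹ = U * diagonal (fun k => (1 - z * d k)⁻¹) * Uᴴ := by
      apply inv_eq_right_inv
      have h1 : 1 - z • A = U * diagonal (fun k => 1 - z * d k) * Uᴴ := by
        have : (diagonal fun k => 1 - z * d k) = 1 - z • diagonal d := by
          ext a b
          by_cases h : a = b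
          · subst h; simp
          · simp [h]
        rw [this, mul_sub, sub_mul, mul_one, hU, hAU]
        simp
      rw [h1]
      calc U * diagonal (fun k => 1 - z * d k) * Uᴴ * (U * diagonal (fun k => (1 - z * d k)⁻¹) * Uᴴ)
          = U * diagonal (fun k => 1 - z * d k) * (Uᴴ * U) * diagonal (fun k => (1 - z * d k)⁻¹) * Uᴴ := by
            noncomm_ring
        _ = 1 := by
            rw [hU', mul_one, mul_assoc U, diagonal_mul_diagonal]
            simp only [mul_inv_cancel₀ (hne _), diagonal_one, mul_one, hU]
    have hone : ∑ j, (normSq (U i j) : ℂ) = 1 := by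
      have := congrFun (congrFun hU i) i
      rw [mul_apply] at this
      simpa [mul_conj] using this
    have hent : (1 - z • A)⁻¹ i i - 1 = ∑ j, (normSq (U i j) : ℂ) * (z * d j) * (1 - z * d j)⁻¹ := by
      rw [hinv, mul_apply]
      refine (congrArg (_ - ·) hone.symm).trans ?_
      rw [← Finset.sum_sub_distrib]
      refine sum_congr rfl fun j _ => ?_
      rw [mul_diagonal, conjTranspose_apply, ← mul_conj, star_def]
      field_simp [hne j]
      ring
    rw [chi_mul_rot hA i τ hz, hent, chi_eq_prod hU hAU, mul_sub, mul_one, mul_left_comm, Finset.mul_sum]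
    congr 2
    refine sum_congr rfl fun j _ => ?_
    rw [← mul_prod_erase univ _ (mem_univ j)]
    field_simp [hne j]
  have hcl : Set.EqOn (chi (A * rot i τ)) (fun z => ∏ k, (1 - z * d k) -
      (Complex.exp (τ * I) - 1) * ∑ j, (normSq (U i j) : ℂ) * (z * d j) *
        ∏ k ∈ univ.erase j, (1 - z * d k)) (closure (Metric.ball 0 1)) := by
    apply Set.EqOn.closure
    · intro z hz
      exact hball z (by simpa using hz)
    · exact continuous_chi _
    · fun_prop
  rw [closure_ball _ one_ne_zero] at hcl
  exact hcl (by simpa using hz)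

lemma one_sub_circ (u : ℝ) : 1 - circ u =
    -2 * I * Complex.exp (π * u * I) * (sin (π * u) : ℂ) := by
  have h : circ u = Complex.exp (π * u * I) * Complex.exp (π * u * I) := by
    rw [circ, ← exp_add]; congr 1; ring
  rw [h, exp_mul_I]
  push_cast
  linear_combination (-1 : ℂ) * Complex.sin_sq_add_cos_sq (π * u : ℂ) +
    Complex.sin (π * u) ^ 2 * I_sq

lemma exists_circ_eq {d : ℂ} (hd : ‖d‖ = 1) (x : ℝ) : ∃ X ∈ Ico x (x + 1), d = circ (-X) := by
  obtain ⟨s, hs⟩ : ∃ s : ℝ, d = circ (-s) := by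
    refine ⟨-(arg d / (2 * π)), ?_⟩
    have h := Complex.norm_mul_exp_arg_mul_I d
    rw [hd, ofReal_one, one_mul] at h
    refine h.symm.trans ?_
    rw [circ]
    congr 1
    have : (π : ℂ) ≠ 0 := mod_cast pi_ne_zero
    push_cast
    field_simp
  refine ⟨toIcoMod one_pos x s, toIcoMod_mem_Ico _ _ _, ?_⟩
  rw [hs, toIcoMod, neg_sub, sub_eq_neg_add, circ_add]
  simp [circ_intCast]

lemma hasDerivAt_prod_one_sub (d : ι → ℂ) (j : ι) (z : ℂ) :
    HasDerivAt (fun z => ∏ k, (1 - z * d k)) (-d j * ∏ k ∈ univ.erase j, (1 - z * d k) +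
      (1 - z * d j) * deriv (fun z => ∏ k ∈ univ.erase j, (1 - z * d k)) z) z := by
  have h1 : HasDerivAt (fun z : ℂ => 1 - z * d j) (-d j) z := by
    simpa using ((hasDerivAt_id z).mul_const (d j)).const_sub 1
  have h2 : DifferentiableAt ℂ (fun z => ∏ k ∈ univ.erase j, (1 - z * d k)) z := by fun_prop
  refine (h1.mul h2.hasDerivAt).congr_of_eventuallyEq (Filter.Eventually.of_forall fun w => ?_)
  exact (mul_prod_erase univ _ (mem_univ j)).symm

/-- Strict interlacing for a rank one perturbation without common roots. -/
lemma exists_root_between {A : Matrix ι ι ℂ} (hA : Aᴴ * A = 1) (hι : 1 < card ι) (i : ι)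
    (τ : ℝ) (hsimple : ∀ s, chi A (circ s) = 0 → deriv (chi A) (circ s) ≠ 0)
    (hne : ∀ s, chi A (circ s) = 0 → chi (A * rot i τ) (circ s) ≠ 0)
    {x y : ℝ} (hxy : x < y) (hx : chi A (circ x) = 0) (hy : chi A (circ y) = 0)
    (hno : ∀ u, x < u → u < y → chi A (circ u) ≠ 0) :
    ∃ w, x < w ∧ w < y ∧ chi (A * rot i τ) (circ w) = 0 := by
  obtain ⟨U, d, hU', hU, hd, hAU⟩ := unitary_diagonalization hA
  have hprod : ∀ z, chi A z = ∏ k, (1 - z * d k) := fun z => chi_eq_prod hU hAU z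
  choose X hX hdX using fun k => exists_circ_eq (hd k) x
  have hroot : ∀ k, chi A (circ (X k)) = 0 := fun k => by
    rw [hprod, prod_eq_zero_iff]
    exact ⟨k, mem_univ _, by rw [hdX k, circ_mul_circ_neg]; simp⟩
  have hinj : Function.Injective d := fun a b hab => by
    by_contra hne
    refine hsimple (X a) (hroot a) ?_
    have h0 : 1 - circ (X a) * d a = 0 := by rw [hdX a, circ_mul_circ_neg]; simp
    rw [funext hprod, (hasDerivAt_prod_one_sub d a (circ (X a))).deriv, h0, zero_mul, add_zero, prod_eq_zero
      (mem_erase.2 ⟨Ne.symm hne, mem_univ b⟩) (by rw [← hab, h0]), mul_zero]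
  have hexist : ∀ s, chi A (circ s) = 0 → ∃ k, ∃ m : ℤ, s = X k + m := fun s hs => by
    rw [hprod, prod_eq_zero_iff] at hs
    obtain ⟨k, -, hk⟩ := hs
    rw [hdX k, ← circ_add, sub_eq_zero, circ, eq_comm, exp_eq_one_iff] at hk
    obtain ⟨m, hm⟩ := hk
    refine ⟨k, m, ?_⟩
    have : ((s + -X k : ℝ) : ℂ) = ((m : ℝ) : ℂ) := by
      have h2 : (2 * (π : ℂ) * I) ≠ 0 := by simp [pi_ne_zero]
      apply mul_left_cancel₀ h2
      push_cast at hm ⊢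
      linear_combination hm
    have := ofReal_injective this
    linarith
  have hXinj : Function.Injective X := fun a b h => hinj (by rw [hdX a, hdX b, h])
  obtain ⟨j, hj⟩ : ∃ j, X j = x := by
    obtain ⟨k, m, hm⟩ := hexist x hx
    refine ⟨k, ?_⟩
    have h1 := (hX k).1
    have h2 := (hX k).2
    have : m = 0 := by
      have h3 : (-1 : ℝ) < m := by linarith
      have h4 : (m : ℝ) < 1 := by linarith
      have h3' : (-1 : ℤ) < m := mod_cast h3
      have h4' : m < 1 := mod_cast h4
      omega
    simp [hm, this]
  have hyX : ∀ k, k ≠ j → y ≤ X k := fun k hk => by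
    by_contra! h
    refine hno (X k) (lt_of_le_of_ne (hX k).1 fun h' => hk (hXinj (by rw [← h', hj]))) h (hroot k)
  have hy1 : y < x + 1 := by
    obtain ⟨k, hk⟩ := Fintype.exists_ne_of_one_lt_card hι j
    exact (hyX k hk).trans_lt (hX k).2
  obtain ⟨l, hl⟩ : ∃ l, X l = y := by
    obtain ⟨k, m, hm⟩ := hexist y hy
    refine ⟨k, ?_⟩
    have h1 := (hX k).1
    have h2 := (hX k).2
    have : m = 0 := by
      have h3 : (-1 : ℝ) < m := by linarith
      have h4 : (m : ℝ) < 1 := by linarith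
      have h3' : (-1 : ℤ) < m := mod_cast h3
      have h4' : m < 1 := mod_cast h4
      omega
    simp [hm, this]
  have hlj : l ≠ j := fun h => by rw [h, hj] at hl; exact hxy.ne hl
  set S : ι → ℝ → ℝ := fun k u => sin (π * (u - X k)) with hS
  set μ : ι → ℝ := fun k => normSq (U i k) with hμ
  set H : ℝ → ℝ := fun u => cos (τ / 2) * ∏ k, S k u + sin (τ / 2) *
    ∑ m, μ m * cos (π * (u - X m)) * ∏ k ∈ univ.erase m, S k u with hH
  have hHc : Continuous H := by rw [hH, hS]; fun_prop
  have hone : ∑ m, (μ m : ℂ) = 1 := by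
    have := congrFun (congrFun hU i) i
    rw [mul_apply] at this
    simpa [mul_conj, hμ] using this
  have hchi : ∀ u, ∃ c : ℂ, c ≠ 0 ∧ chi (A * rot i τ) (circ u) = c * H u := fun u => by
    set ε : ι → ℂ := fun k => Complex.exp (π * (u - X k : ℝ) * I) with hε
    refine ⟨(∏ k, (-2 * I * ε k)) * Complex.exp ((τ / 2 : ℝ) * I), ?_, ?_⟩
    · refine mul_ne_zero (Finset.prod_ne_zero_iff.2 fun k _ => ?_) (Complex.exp_ne_zero _)
      simp [hε, Complex.exp_ne_zero]
    rw [chi_mul_rot_eq_sum hA hU hU' hd hAU i τ (norm_circ u).le]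
    have h1 : ∀ k, 1 - circ u * d k = (-2 * I * ε k) * (S k u : ℂ) := fun k => by
      rw [hdX k, ← circ_add, ← sub_eq_add_neg, one_sub_circ]
    have h2 : ∀ k, circ u * d k = ε k * ε k := fun k => by
      rw [hdX k, ← circ_add, circ, hε, ← exp_add]; congr 1; push_cast; ring
    have h3 : ∀ k, ε k = (cos (π * (u - X k)) : ℂ) + S k u * I := fun k => by
      rw [hε, hS]; simp only; rw [exp_mul_I]; push_cast; rfl
    have h4 : Complex.exp (τ * I) = Complex.exp ((τ / 2 : ℝ) * I) ^ 2 := by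
      rw [← Complex.exp_nat_mul]; congr 1; push_cast; ring
    have h5 : Complex.exp ((τ / 2 : ℝ) * I) = cos (τ / 2) + sin (τ / 2) * I := by
      rw [exp_mul_I]; push_cast; rfl
    simp only [h1]
    simp only [h2]
    set E := ∏ k, (-2 * I * ε k) with hE
    set R : ι → ℂ := fun m => ∏ k ∈ univ.erase m, (S k u : ℂ) with hR
    have h6 : ∀ m, (μ m : ℂ) * (ε m * ε m) * ∏ k ∈ univ.erase m, (-2 * I * ε k * (S k u : ℂ))
        = E * (I / 2) * ((μ m : ℂ) * cos (π * (u - X m)) * R m + μ m * I * ∏ k, (S k u : ℂ)) := fun m => by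
      rw [prod_mul_distrib, hE, ← mul_prod_erase univ (fun k => -2 * I * ε k) (mem_univ m),
        ← mul_prod_erase univ (fun k => (S k u : ℂ)) (mem_univ m)]
      simp only [hR]
      generalize (∏ k ∈ univ.erase m, (S k u : ℂ)) = a
      generalize (∏ k ∈ univ.erase m, (-2 * I * ε k)) = b
      have := h3 m
      generalize ε m = e at *
      linear_combination (μ m : ℂ) * e * b * a * this + (e * b * a * (μ m : ℂ) * (cos (π * (u - X m)) + S m u * I)) * (I_sq)
    have h7 : ∑ m, (μ m : ℂ) * (ε m * ε m) * ∏ k ∈ univ.erase m, (-2 * I * ε k * (S k u : ℂ))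
        = E * (I / 2) * (∑ m, (μ m : ℂ) * cos (π * (u - X m)) * R m + I * ∏ k, (S k u : ℂ)) := by
      rw [sum_congr rfl fun m _ => h6 m, ← Finset.mul_sum, sum_add_distrib, ← Finset.sum_mul, ← Finset.sum_mul, hone, one_mul]
    simp only [hμ] at h7
    have hcast : (H u : ℂ) = (cos (τ / 2) : ℂ) * ∏ k, (S k u : ℂ) + (sin (τ / 2) : ℂ) *
        ∑ m, (normSq (U i m) : ℂ) * cos (π * (u - X m)) * R m := by
      simp only [hH, hR, hμ]; push_cast; rfl
    have h8 : (cos (τ / 2) : ℂ) ^ 2 + (sin (τ / 2) : ℂ) ^ 2 = 1 := by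
      have := cos_sq_add_sin_sq (τ / 2); exact_mod_cast this
    have alg : ∀ a b p q : ℂ, p ^ 2 + q ^ 2 = 1 → E * a - ((p + q * I) ^ 2 - 1) *
        (E * (I / 2) * (b + I * a)) = E * (p + q * I) * (p * a + q * b) := by
      intro a b p q h
      linear_combination (-(E / 2) * (I * b + a)) * h - (E / 2) * ((p ^ 2 + 2 * p * q * I - 1) * a
        + q ^ 2 * I * b + q ^ 2 * (I ^ 2 - 1) * a + 2 * p * q * b) * I_sq
    rw [h7, prod_mul_distrib, ← hE, hcast, h4, h5]
    exact alg _ _ _ _ h8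
  have hH0 : ∀ s, chi A (circ s) = 0 → H s ≠ 0 := fun s hs h => by
    obtain ⟨c, -, hc⟩ := hchi s
    exact hne s hs (by rw [hc, h]; simp)
  have hHX : ∀ m, H (X m) = sin (τ / 2) * (μ m * ∏ k ∈ univ.erase m, S k (X m)) := fun m => by
    have h0 : S m (X m) = 0 := by simp [hS]
    simp only [hH]
    rw [prod_eq_zero (mem_univ m) h0, mul_zero, zero_add, sum_eq_single m]
    · simp
    · intro b _ hb
      rw [prod_eq_zero (mem_erase.2 ⟨hb.symm, mem_univ m⟩) h0, mul_zero]
    · simp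
  have hneg : H x * H y ≤ 0 := by
    rw [← hj, ← hl, hHX, hHX, ← mul_prod_erase (univ.erase j) _ (mem_erase.2 ⟨hlj, mem_univ l⟩),
      ← mul_prod_erase (univ.erase l) _ (mem_erase.2 ⟨hlj.symm, mem_univ j⟩), Finset.erase_right_comm]
    have hpos : 0 ≤ (∏ k ∈ (univ.erase l).erase j, S k (X j)) * ∏ k ∈ (univ.erase l).erase j, S k (X l) := by
      rw [← prod_mul_distrib]
      refine prod_nonneg fun k hk => ?_
      simp only [mem_erase, mem_univ, and_true] at hk
      have h1 := hyX k hk.1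
      have h2 := (hX k).2
      have h3 : ∀ v, -1 ≤ v - X k → v - X k ≤ 0 → S k v ≤ 0 := fun v h4 h5 =>
        Real.sin_nonpos_of_nonpos_of_neg_pi_le (by nlinarith [pi_pos]) (by nlinarith [pi_pos])
      exact mul_nonneg_of_nonpos_of_nonpos (h3 _ (by linarith) (by linarith)) (h3 _ (by linarith) (by linarith))
    have hs : S l (X j) * S j (X l) ≤ 0 := by
      have : S l (X j) = - S j (X l) := by
        simp only [hS]; rw [← Real.sin_neg]; congr 1; ring
      rw [this]; nlinarith [sq_nonneg (S j (X l))]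
    have hμ0 : 0 ≤ μ j * μ l := mul_nonneg (normSq_nonneg _) (normSq_nonneg _)
    have := mul_nonneg (mul_nonneg (sq_nonneg (sin (τ / 2))) hμ0) (mul_nonneg hpos (neg_nonneg.2 hs))
    nlinarith [this]
  have hlt : H x * H y < 0 := lt_of_le_of_ne hneg (mul_ne_zero (hH0 x hx) (hH0 y hy))
  obtain ⟨w, hw, hw0⟩ : ∃ w ∈ Ioo x y, H w = 0 := by
    rcases mul_neg_iff.1 hlt with ⟨h1, h2⟩ | ⟨h1, h2⟩
    · exact intermediate_value_Ioo' hxy.le hHc.continuousOn ⟨h2, h1⟩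
    · exact intermediate_value_Ioo hxy.le hHc.continuousOn ⟨h1, h2⟩
  obtain ⟨c, -, hc⟩ := hchi w
  exact ⟨w, hw.1, hw.2, by rw [hc, hw0]; simp⟩

end Gap

end

section

section Level

variable {ι : Type*} [Fintype ι] [DecidableEq ι]

lemma circ_eq_one_iff {s : ℝ} : circ s = 1 ↔ ∃ m : ℤ, s = m := by
  rw [circ, exp_eq_one_iff]
  have h2 : (2 * (π : ℂ) * I) ≠ 0 := by simp [pi_ne_zero]
  constructor
  · rintro ⟨m, hm⟩
    refine ⟨m, ?_⟩
    have : ((s : ℝ) : ℂ) = ((m : ℝ) : ℂ) := by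
      apply mul_left_cancel₀ h2
      push_cast at hm ⊢
      linear_combination hm
    exact ofReal_injective this
  · rintro ⟨m, rfl⟩
    exact ⟨m, by push_cast; ring⟩

lemma eq_of_circ_eq {x y a : ℝ} (hx : x ∈ Ico a (a + 1)) (hy : y ∈ Ico a (a + 1))
    (h : circ x = circ y) : x = y := by
  have h1 : circ (x - y) = 1 := by
    rw [sub_eq_add_neg, circ_add, h, circ_mul_circ_neg]
  obtain ⟨m, hm⟩ := circ_eq_one_iff.1 h1
  have h3 : (-1 : ℝ) < m := by rw [← hm]; linarith [hx.1, hy.2]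
  have h4 : (m : ℝ) < 1 := by rw [← hm]; linarith [hx.2, hy.1]
  have h3' : (-1 : ℤ) < m := mod_cast h3
  have h4' : m < 1 := mod_cast h4
  have : m = 0 := by omega
  rw [this] at hm
  simp at hm
  linarith

lemma circ_eq_of_root {x y : ℝ} (h : 1 - circ x * circ (-y) = 0) : circ x = circ y := by
  have h1 : circ (-y) * circ y = 1 := by rw [mul_comm, circ_mul_circ_neg]
  calc circ x = circ x * (circ (-y) * circ y) := by rw [h1, mul_one]
    _ = circ x * circ (-y) * circ y := by ring
    _ = circ y := by rw [← sub_eq_zero.1 h, one_mul]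

omit [DecidableEq ι] in
lemma exists_roots_eq_range {d : ι → ℂ} (hd : ∀ k, ‖d k‖ = 1) (a : ℝ) :
    ∃ X : ι → ℝ, (∀ k, d k = circ (-X k)) ∧
      {x | ∏ k, (1 - circ x * d k) = 0} ∩ Ico a (a + 1) = Set.range X := by
  choose X hX hdX using fun k => exists_circ_eq (hd k) a
  refine ⟨X, hdX, ?_⟩
  ext x
  simp only [Set.mem_inter_iff, mem_ofPred_eq, Set.mem_range, prod_eq_zero_iff]
  constructor
  · rintro ⟨⟨k, -, hk⟩, hx⟩
    rw [hdX k] at hk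
    exact ⟨k, (eq_of_circ_eq hx (hX k) (circ_eq_of_root hk)).symm⟩
  · rintro ⟨k, rfl⟩
    exact ⟨⟨k, mem_univ _, by rw [hdX k, circ_mul_circ_neg]; simp⟩, hX k⟩

lemma hasDerivAt_circ (x : ℝ) : HasDerivAt circ (2 * π * I * circ x) x := by
  have h : HasDerivAt (fun x : ℝ => 2 * (π : ℂ) * (x : ℂ) * I) (2 * π * I) x := by
    have := ((Complex.ofRealCLM.hasDerivAt (x := x)).const_mul (2 * (π : ℂ))).mul_const I
    simpa using this
  refine h.cexp.congr_deriv ?_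
  rw [circ, mul_comm]

lemma weights_mul_pos {d1 d2 : ι → ℂ} (hd1 : ∀ k, ‖d1 k‖ = 1) (hd2 : ∀ k, ‖d2 k‖ = 1)
    {h1 : ι → ℝ} {c : ℝ} (hc : c ≠ 0) {n : ℕ} {e : ℝ → ℝ} {T : ℂ → ℂ}
    (he : ∀ x, (e x : ℂ) * circ x ^ n = (∏ k, (1 - circ x * d1 k)) * ∏ k, (1 - circ x * d2 k))
    (hres : ∀ z, c * z ^ n = -I * (∑ j, h1 j * (z * d1 j) *
      ∏ k ∈ univ.erase j, (1 - z * d1 k)) * ∏ k, (1 - z * d2 k) + (∏ k, (1 - z * d1 k)) * T z)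
    (hgap : (∀ x, ∏ k, (1 - circ x * d1 k) = 0 → deriv (fun z => ∏ k, (1 - z * d1 k)) (circ x) ≠ 0) →
      ∀ x y, x < y → ∏ k, (1 - circ x * d1 k) = 0 → ∏ k, (1 - circ y * d1 k) = 0 →
      (∀ u, x < u → u < y → ∏ k, (1 - circ u * d1 k) ≠ 0) →
      ∃ u v, x < u ∧ u < y ∧ x < v ∧ v < y ∧ e u < 0 ∧ 0 < e v) (j k : ι) : 0 < h1 j * h1 k := by
  set p1 : ℂ → ℂ := fun z => ∏ k, (1 - z * d1 k) with hp1
  set p2 : ℂ → ℂ := fun z => ∏ k, (1 - z * d2 k) with hp2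
  set R : ι → ℂ → ℂ := fun j z => ∏ k ∈ univ.erase j, (1 - z * d1 k) with hR
  have hcirc : ∀ x (n : ℕ), circ (-(n * x)) * circ x ^ n = 1 := fun x n => by
    rw [← circ_nat_mul, mul_comm, circ_mul_circ_neg]
  have hex : ∀ x, (e x : ℂ) = circ (-(n * x)) * (p1 (circ x) * p2 (circ x)) := fun x => by
    rw [← he x, mul_left_comm, hcirc, mul_one]
  have hdiff : ∀ x, ∃ e' : ℝ, HasDerivAt e e' x ∧ ∀ j, 1 - circ x * d1 j = 0 →
      (e' : ℂ) = -2 * π * I * circ (-(n * x)) * R j (circ x) * p2 (circ x) := by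
    intro x
    have hP2 : Differentiable ℂ p2 := by rw [hp2]; fun_prop
    have hP1 : Differentiable ℂ p1 := by rw [hp1]; fun_prop
    have hcx := hasDerivAt_circ x
    have d2' := (hP2 (circ x)).hasDerivAt.comp x hcx
    have d1' := (hP1 (circ x)).hasDerivAt.comp x hcx
    have d3 : HasDerivAt (fun x : ℝ => circ (-(n * x))) (2 * π * I * circ (-(n * x)) * (-(n : ℂ))) x := by
      have h1 : HasDerivAt (fun x : ℝ => -((n : ℝ) * x)) (-(n : ℝ)) x := by
        have h0 := ((hasDerivAt_id x).const_mul (n : ℝ)).fun_neg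
        simpa using h0
      have := (hasDerivAt_circ (-(n * x))).scomp x h1
      refine this.congr_deriv ?_
      simp; ring
    have hE := d3.mul (d1'.mul d2')
    have hE' : HasDerivAt (fun x => (e x : ℂ)) _ x := hE.congr_of_eventuallyEq
      (Filter.Eventually.of_forall fun y => hex y)
    have hre := Complex.reCLM.hasFDerivAt.comp_hasDerivAt x hE'
    refine ⟨_, hre.congr_of_eventuallyEq (Filter.Eventually.of_forall fun y => by simp), fun j hj => ?_⟩
    have huniq := (hre.congr_of_eventuallyEq (f := e) (Filter.Eventually.of_forall fun y => by simp)).ofReal_comp.unique hE'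
    rw [huniq]
    have hp0 : p1 (circ x) = 0 := prod_eq_zero (mem_univ j) hj
    have hder : deriv p1 (circ x) = -d1 j * R j (circ x) := by
      rw [hp1, (hasDerivAt_prod_one_sub d1 j (circ x)).deriv, hj, zero_mul, add_zero]
    simp only [Function.comp, Pi.mul_apply, hp0, hder]
    have : circ x * d1 j = 1 := (sub_eq_zero.1 hj).symm
    linear_combination (-2 * π * I * circ (-(n * x)) * R j (circ x) * p2 (circ x)) * this
  choose e' he' hej using hdiff
  have hweight : ∀ x j, 1 - circ x * d1 j = 0 → h1 j * e' x = 2 * π * c := by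
    intro x j hj
    have hp0 : p1 (circ x) = 0 := prod_eq_zero (mem_univ j) hj
    have h := hres (circ x)
    rw [sum_eq_single j] at h
    · have h2 := hej x j hj
      have h3 := hcirc x n
      have h4 : circ x * d1 j = 1 := (sub_eq_zero.1 hj).symm
      have : ((h1 j * e' x : ℝ) : ℂ) = ((2 * π * c : ℝ) : ℂ) := by
        push_cast
        change (c : ℂ) * circ x ^ n = -I * (h1 j * (circ x * d1 j) * R j (circ x)) * p2 (circ x) + p1 (circ x) * T (circ x) at h
        rw [h4, hp0] at h
        rw [h2]
        linear_combination -(2 * π * circ (-(n * x))) * h + 2 * π * c * h3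
      exact_mod_cast this
    · intro b _ hb
      rw [prod_eq_zero (mem_erase.2 ⟨hb.symm, mem_univ j⟩) hj, mul_zero]
    · simp
  have hne' : ∀ x j, 1 - circ x * d1 j = 0 → e' x ≠ 0 := fun x j hj h => by
    have := hweight x j hj
    rw [h, mul_zero] at this
    have : (2 * π * c) ≠ 0 := by positivity
    exact this (by linarith)
  have hrootex : ∀ x, p1 (circ x) = 0 → ∃ j, 1 - circ x * d1 j = 0 := fun x hx => by
    obtain ⟨j, -, hj⟩ := prod_eq_zero_iff.1 hx
    exact ⟨j, hj⟩
  have hsimple : ∀ x, p1 (circ x) = 0 → deriv p1 (circ x) ≠ 0 := fun x hx h0 => by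
    obtain ⟨j, hj⟩ := hrootex x hx
    have h2 := hej x j hj
    have hder : deriv p1 (circ x) = -d1 j * R j (circ x) := by
      rw [hp1, (hasDerivAt_prod_one_sub d1 j (circ x)).deriv, hj, zero_mul, add_zero]
    rw [hder] at h0
    have hd0 : -d1 j ≠ 0 := by
      rw [neg_ne_zero, ← norm_ne_zero_iff, hd1]; norm_num
    rw [(mul_eq_zero.1 h0).resolve_left hd0, mul_zero, zero_mul] at h2
    exact hne' x j hj (mod_cast h2)
  have hperiod : ∀ x, e (x + 1) = e x := fun x => by
    have h : circ (x + 1) = circ x := by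
      have := circ_add_int x 1; simpa using this
    have h2 : circ (-(n * (x + 1))) = circ (-(n * x)) := by
      have := circ_add_int (-(n * x)) (-n)
      rw [← this]; congr 1; push_cast; ring
    have : (e (x + 1) : ℂ) = e x := by rw [hex, hex, h, h2]
    exact_mod_cast this
  have hsame := same_sign_of_gaps he' hperiod (B := {x | p1 (circ x) = 0}) (C := {x | p2 (circ x) = 0})
    (fun x => by
      have h : circ (x + 1) = circ x := by
        have := circ_add_int x 1; simpa using this
      simp only [mem_ofPred_eq, h])
    (fun x => by
      simp only [mem_ofPred_eq]
      rw [← mul_eq_zero (a := p1 (circ x)), ← he x]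
      have : circ x ^ n ≠ 0 := pow_ne_zero _ (by rw [← norm_ne_zero_iff, norm_circ]; norm_num)
      simp [this])
    (fun x hx => by obtain ⟨j, hj⟩ := hrootex x hx; exact hne' x j hj)
    (fun x hx y hy hxy hno => hgap hsimple x y hxy hx hy fun u h1 h2 h3 => hno u h3 ⟨h1, h2⟩)
    (fun x => by
      obtain ⟨X, -, hX⟩ := exists_roots_eq_range hd1 x
      rw [show {x | p1 (circ x) = 0} ∩ Ico x (x + 1) = _ from hX]; exact Set.finite_range X)
    (fun x => by
      obtain ⟨X, hdX, hX⟩ := exists_roots_eq_range hd1 x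
      obtain ⟨Y, -, hY⟩ := exists_roots_eq_range hd2 x
      rw [show {x | p1 (circ x) = 0} ∩ Ico x (x + 1) = _ from hX,
        show {x | p2 (circ x) = 0} ∩ Ico x (x + 1) = _ from hY]
      refine ⟨Set.finite_range Y, ?_⟩
      have hinj : Function.Injective X := fun a b hab => by
        by_contra hne
        have h0 : 1 - circ (X a) * d1 a = 0 := by rw [hdX a, circ_mul_circ_neg]; simp
        have h0' : 1 - circ (X a) * d1 b = 0 := by rw [hdX b, hab, circ_mul_circ_neg]; simp
        refine hsimple (X a) (prod_eq_zero (mem_univ a) h0) ?_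
        rw [hp1, (hasDerivAt_prod_one_sub d1 a (circ (X a))).deriv, h0, zero_mul, add_zero, prod_eq_zero
          (mem_erase.2 ⟨Ne.symm hne, mem_univ b⟩) h0', mul_zero]
      rw [← Set.image_univ, ← Set.image_univ, Set.ncard_image_of_injective _ hinj]
      exact Set.ncard_image_le Set.finite_univ)
  obtain ⟨X, hX, hdX⟩ : ∃ X : ι → ℝ, (∀ k, 1 - circ (X k) * d1 k = 0) ∧ ∀ k, p1 (circ (X k)) = 0 := by
    choose X hX hdX using fun k => exists_circ_eq (hd1 k) 0
    have : ∀ k, 1 - circ (X k) * d1 k = 0 := fun k => by rw [hdX k, circ_mul_circ_neg]; simp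
    exact ⟨X, this, fun k => prod_eq_zero (mem_univ k) (this k)⟩
  have hpos := hsame _ (hdX j) _ (hdX k)
  have hsq : 0 < (h1 j * h1 k) * (e' (X j) * e' (X k)) := by
    have : (h1 j * h1 k) * (e' (X j) * e' (X k)) = (2 * π * c) ^ 2 := by
      rw [sq]; nth_rewrite 1 [← hweight _ _ (hX j)]; rw [← hweight _ _ (hX k)]; ring
    rw [this]; positivity
  exact (pos_iff_pos_of_mul_pos hsq).2 hpos

omit [DecidableEq ι] in
lemma herglotz_weights {d : ι → ℂ} (hd : ∀ k, ‖d k‖ = 1) {h : ι → ℝ} (hh : ∀ k, 0 ≤ h k) :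
    Herglotz (fun z => ∑ k, (h k : ℂ) * (2 * (1 - z * d k)⁻¹ - 1)) (∑ k, h k) := by
  have hlt : ∀ z ∈ Metric.ball (0 : ℂ) 1, ∀ i, ‖z * d i‖ < 1 := by
    intro z hz i
    rw [norm_mul, hd, mul_one]; simpa using hz
  refine ⟨?_, ?_, ?_⟩
  · intro z hz
    refine DifferentiableWithinAt.fun_sum fun i _ => DifferentiableWithinAt.const_mul ?_ _
    have h1 := re_inv_one_sub_pos (hlt z hz i)
    have h2 : 1 - z * d i ≠ 0 := by intro h; rw [h] at h1; simp at h1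
    have h3 : DifferentiableWithinAt ℂ (fun z : ℂ => (1 - z * d i)⁻¹) (Metric.ball 0 1) z := by
      refine DifferentiableWithinAt.fun_inv ?_ h2
      fun_prop
    exact (h3.const_mul _).sub_const _
  · intro z hz
    rw [re_sum]
    refine Finset.sum_nonneg fun k _ => ?_
    rw [Complex.re_ofReal_mul]
    refine mul_nonneg (hh k) ?_
    have hw := hlt z hz k
    have h1 := re_inv_one_sub_pos hw
    have h2 : 1 - z * d k ≠ 0 := by intro h; rw [h] at h1; simp at h1
    generalize z * d k = w at *
    have h3 : 2 * (1 - w)⁻¹ - 1 = (1 + w) * (1 - w)⁻¹ := by field_simp; ring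
    have h4 : 0 < normSq (1 - w) := normSq_pos.2 h2
    have h5 : w.re ^ 2 + w.im ^ 2 ≤ 1 := by
      have := sq_norm w
      rw [normSq_apply] at this
      nlinarith [norm_nonneg w]
    rw [h3, Complex.inv_def]
    simp
    have : (1 + w.re) * ((1 - w.re) * (normSq (1 - w))⁻¹) - w.im * (w.im * (normSq (1 - w))⁻¹)
      = (1 - (w.re ^ 2 + w.im ^ 2)) * (normSq (1 - w))⁻¹ := by ring
    have h6 := mul_nonneg (sub_nonneg.2 h5) (inv_nonneg.2 h4.le)
    linarith
  · simp; norm_num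

lemma level_measure_le [Nonempty ι] {d1 d2 : ι → ℂ} (hd1 : ∀ k, ‖d1 k‖ = 1) (hd2 : ∀ k, ‖d2 k‖ = 1)
    {h1 h2 : ι → ℝ} (hs1 : ∑ j, h1 j = 2) (hs2 : ∑ j, h2 j = 2)
    (hp1 : ∀ j k, 0 < h1 j * h1 k) (hp2 : ∀ j k, 0 < h2 j * h2 k) {c : ℝ} {n : ℕ}
    (hres : ∀ z, c * z ^ n = -I * (∑ j, h1 j * (z * d1 j) *
      ∏ k ∈ univ.erase j, (1 - z * d1 k)) * ∏ k, (1 - z * d2 k) +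
      (∏ k, (1 - z * d1 k)) * (I * ∑ j, h2 j * (z * d2 j) *
      ∏ k ∈ univ.erase j, (1 - z * d2 k))) {l : ℝ} (hl : 0 < l) :
    volume {s : ℝ | s ∈ Ico (0 : ℝ) 1 ∧
      ‖(∏ k, (1 - circ s * d1 k)) * ∏ k, (1 - circ s * d2 k)‖ * l < 2 * |c|} ≤
      ofReal (6 * sqrt (4 / l)) := by
  have hnn : ∀ h : ι → ℝ, ∑ j, h j = 2 → (∀ j k, 0 < h j * h k) → ∀ j, 0 ≤ h j := by
    intro h hs hp j
    by_contra! hj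
    have : ∑ k, h k ≤ 0 := Finset.sum_nonpos fun k _ => by
      have := hp j k
      nlinarith
    linarith
  have H1 := herglotz_weights hd1 (hnn h1 hs1 hp1)
  have H2 := herglotz_weights hd2 (hnn h2 hs2 hp2)
  rw [hs1] at H1
  rw [hs2] at H2
  refine measure_eventually_le (fun n => H1.weak_type_sub H2 (c' := 4) (by norm_num) (by norm_num) hl (radius_mem n).1 (radius_mem n).2) ?_
  rintro s ⟨hs, h⟩
  have ht : Filter.Tendsto (fun n : ℕ => ((1 - 1 / ((n : ℝ) + 1) : ℝ) : ℂ) * circ s)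
      Filter.atTop (nhds (circ s)) := by
    have := ((Complex.continuous_ofReal.tendsto 1).comp tendsto_radius).mul_const (circ s)
    simpa using this
  have hcont : Continuous fun z : ℂ => ‖(∏ k, (1 - z * d1 k)) * ∏ k, (1 - z * d2 k)‖ * l := by fun_prop
  have hcont2 : Continuous fun z : ℂ => 2 * (|c| * ‖z‖ ^ n) := by fun_prop
  have t1 := (hcont.tendsto _).comp ht
  have t2 := (hcont2.tendsto _).comp ht
  rw [norm_circ, one_pow, mul_one] at t2
  filter_upwards [t1.eventually_lt t2 h] with m hm
  refine ⟨hs, ?_⟩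
  simp only [Function.comp] at hm
  set z := ((1 - 1 / ((m : ℝ) + 1) : ℝ) : ℂ) * circ s with hz0
  have hz : ‖z‖ < 1 := by
    simp only [z, norm_mul, norm_circ, mul_one, norm_real,
      norm_eq_abs, abs_of_nonneg (radius_mem m).1]
    exact (radius_mem m).2
  have hne : ∀ d : ι → ℂ, (∀ k, ‖d k‖ = 1) → ∀ k, 1 - z * d k ≠ 0 := fun d hd k h0 => by
    have : ‖z * d k‖ = 1 := by rw [← sub_eq_zero.1 h0]; simp
    rw [norm_mul, hd, mul_one] at this
    linarith
  have hsum : ∀ (d : ι → ℂ) (h : ι → ℝ), (∀ k, ‖d k‖ = 1) → ∑ j, h j = 2 →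
      2 * ∑ j, (h j : ℂ) * (z * d j) * ∏ k ∈ univ.erase j, (1 - z * d k) =
        (∏ k, (1 - z * d k)) * (∑ k, (h k : ℂ) * (2 * (1 - z * d k)⁻¹ - 1) - 2) := by
    intro d h hd hs
    have hs' : ∑ j, (h j : ℂ) = 2 := mod_cast hs
    have h1 : ∑ k, (h k : ℂ) * (2 * (1 - z * d k)⁻¹ - 1) - 2 =
        ∑ k, ((h k : ℂ) * (2 * (1 - z * d k)⁻¹ - 1) - h k) := by rw [Finset.sum_sub_distrib, hs']
    rw [h1, Finset.mul_sum, Finset.mul_sum]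
    refine sum_congr rfl fun j _ => ?_
    rw [← mul_prod_erase univ (fun k => 1 - z * d k) (mem_univ j)]
    have := hne d hd j
    field_simp
    ring
  have hr := hres z
  have e1 := hsum d1 h1 hd1 hs1
  have e2 := hsum d2 h2 hd2 hs2
  set F := ∑ k, (h1 k : ℂ) * (2 * (1 - z * d1 k)⁻¹ - 1)
  set G := ∑ k, (h2 k : ℂ) * (2 * (1 - z * d2 k)⁻¹ - 1)
  set P := (∏ k, (1 - z * d1 k))
  set Q := (∏ k, (1 - z * d2 k))
  have key : 2 * ((c : ℂ) * z ^ n) = -I * (P * Q) * (F - G) := by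
    rw [hr]
    linear_combination -I * Q * e1 + I * P * e2
  have hk := congrArg norm key
  simp only [norm_mul, norm_neg, Complex.norm_I, one_mul, norm_pow, norm_real, norm_eq_abs, Complex.norm_two] at hk
  rw [hk, ← norm_mul] at hm
  exact lt_of_mul_lt_mul_left hm (norm_nonneg _)

end Level

end

section

section SectorAlgebra
variable {A : Type*} [Ring A] [Algebra ℂ A] {T T' U U' J : A} {c d t : ℂ}

/-- The sector coin factorizes through reflections. -/
lemma sector_coin (hJ : J * J = -1) (hJU : J * U = U' * J) :
    (t • (1 : A) - J) * (c • U - d • J) * (t • 1 - J) * J =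
      (t * c) • (U + U') - (d * (1 - t ^ 2)) • (1 : A) +
        ((t ^ 2 * c) • U - (2 * t * d) • (1 : A) - c • U') * J := by
  have h1 : ∀ a, J * (J * a) = -a := fun a => by rw [← mul_assoc, hJ, neg_one_mul]
  have h2 : ∀ a, J * (U * a) = U' * (J * a) := fun a => by rw [← mul_assoc, hJU, mul_assoc]
  simp only [sub_mul, mul_sub, add_mul, smul_mul_assoc, mul_smul_comm, mul_assoc, one_mul, mul_one,
    smul_smul, hJ, hJU, h1, h2, smul_sub, mul_neg, smul_neg, neg_mul]
  match_scalars <;> ring_nf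

lemma sector_unit (hJ : J * J = -1) (hJT : J * T = T' * J) (hT : T' * T = 1)
    (hcd : c ^ 2 + d ^ 2 = 1) : (c • T' + d • J) * (c • T - d • J) = 1 := by
  have h1 : ∀ a, J * (J * a) = -a := fun a => by rw [← mul_assoc, hJ, neg_one_mul]
  simp only [sub_mul, mul_sub, add_mul, smul_mul_assoc, mul_smul_comm, mul_assoc, one_mul, mul_one,
    smul_smul, hJ, hJT, hT, h1, smul_sub, mul_neg, smul_neg, smul_add, mul_add]
  have : (c ^ 2 + d ^ 2) • (1 : A) = 1 := by rw [hcd, one_smul]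
  refine Eq.trans ?_ this
  module

lemma sector_rot (hJ : J * J = -1) (hJT : J * T = T' * J) (hT : T * T' = 1) (a b : ℂ) :
    (a • (1 : A) + b • (T * J)) * (c • T - d • J) =
      (c * a + d * b) • T - (d * a - c * b) • J := by
  have h1 : T * (T' * J) = J := by rw [← mul_assoc, hT, one_mul]
  simp only [sub_mul, mul_sub, add_mul, smul_mul_assoc, mul_smul_comm, mul_assoc, one_mul, mul_one,
    smul_smul, hJ, hJT, h1, mul_neg, smul_neg]
  module

end SectorAlgebra

section Sector
variable {q : ℕ} [NeZero q] (ψ : AddChar (ZMod q) ℂ)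

/-- The cyclic shift. -/
def cycT (q : ℕ) [NeZero q] : Matrix (ZMod q) (ZMod q) ℂ := shiftMat (addRight 1)

/-- The cyclic reflection. -/
def cycR (q : ℕ) [NeZero q] : Matrix (ZMod q) (ZMod q) ℂ := of fun n m => if n = -m then 1 else 0

/-- Multiplication by the character. -/
def cycU : Matrix (ZMod q) (ZMod q) ℂ := diagonal fun n => ψ n

/-- Multiplication by the conjugate character. -/
def cycU' : Matrix (ZMod q) (ZMod q) ℂ := diagonal fun n => ψ (-n)

lemma cycT_transpose_mul : (cycT q)ᵀ * cycT q = 1 := shiftMat_transpose_mul _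

lemma cycT_mul_transpose : cycT q * (cycT q)ᵀ = 1 := shiftMat_mul_transpose _

lemma cycT_apply (n m : ZMod q) : cycT q n m = if m + 1 = n then 1 else 0 := by
  simp only [cycT, shiftMat, Equiv.coe_addRight]
  congr

lemma cycR_apply (n m : ZMod q) : cycR q n m = if n = -m then 1 else 0 := rfl

lemma cycR_mul (M : Matrix (ZMod q) (ZMod q) ℂ) (n m : ZMod q) : (cycR q * M) n m = M (-n) m := by
  rw [mul_apply, sum_eq_single (-n)]
  · simp [cycR_apply]
  · intro b _ hb
    rw [cycR_apply, if_neg, zero_mul]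
    rintro rfl; simp at hb
  · simp

lemma mul_cycR (M : Matrix (ZMod q) (ZMod q) ℂ) (n m : ZMod q) : (M * cycR q) n m = M n (-m) := by
  rw [mul_apply, sum_eq_single (-m)]
  · simp [cycR_apply]
  · intro b _ hb
    rw [cycR_apply, if_neg hb, mul_zero]
  · simp

lemma cycR_mul_self : cycR q * cycR q = 1 := by
  ext n m
  rw [cycR_mul, cycR_apply, one_apply]
  simp

lemma cycR_mul_cycT : cycR q * cycT q = (cycT q)ᵀ * cycR q := by
  ext n m
  rw [cycR_mul, mul_cycR, transpose_apply, cycT_apply, cycT_apply]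
  congr 1
  rw [eq_iff_iff]
  constructor <;> intro h
  · rw [← neg_eq_iff_eq_neg.2 h]; ring
  · rw [← neg_eq_iff_eq_neg.2 h]; ring

lemma cycR_mul_cycU : cycR q * cycU ψ = cycU' ψ * cycR q := by
  ext n m
  rw [cycR_mul, mul_cycR, cycU, cycU', diagonal_apply, diagonal_apply]
  by_cases h : -n = m
  · subst h; simp
  · rw [if_neg h, if_neg]; rintro rfl; simp at h

lemma cycR_mul_cycU' : cycR q * cycU' ψ = cycU ψ * cycR q := by
  have h := cycR_mul_cycU ψ
  have h2 := congrArg (fun M => cycR q * M * cycR q) h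
  simp only [mul_assoc, cycR_mul_self, mul_one] at h2
  rw [← h2, ← mul_assoc, cycR_mul_self, one_mul]

lemma cycU_mul_cycU' : cycU ψ * cycU' ψ = 1 := by
  rw [cycU, cycU', diagonal_mul_diagonal, ← diagonal_one]
  congr 1
  ext n
  rw [← AddChar.map_add_eq_mul]; simp

lemma cycU'_mul_cycU : cycU' ψ * cycU ψ = 1 := mul_eq_one_comm.1 (cycU_mul_cycU' ψ)

lemma cycT_conjTranspose : (cycT q)ᴴ = (cycT q)ᵀ := by
  ext n m; simp [cycT_apply, apply_ite]

lemma cycR_transpose : (cycR q)ᵀ = cycR q := by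
  ext n m
  rw [transpose_apply, cycR_apply, cycR_apply]
  congr 1
  rw [eq_iff_iff, eq_neg_iff_add_eq_zero, eq_neg_iff_add_eq_zero, add_comm]

lemma cycR_conjTranspose : (cycR q)ᴴ = cycR q := by
  ext n m
  have := congrFun (congrFun (cycR_transpose (q := q)) n) m
  rw [transpose_apply] at this
  rw [conjTranspose_apply, this, cycR_apply]
  split_ifs <;> simp

lemma cycU_conjTranspose : (cycU ψ)ᴴ = cycU' ψ := by
  rw [cycU, cycU', diagonal_conjTranspose]
  congr 1
  ext n
  simp [AddChar.map_neg_eq_conj]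

/-- The complex structure of a reflection sector. -/
def secJ (q : ℕ) [NeZero q] (s : ℂ) : Matrix (ZMod q) (ZMod q) ℂ := s • cycR q

/-- The shift factor of a sector. -/
def secX (q : ℕ) [NeZero q] (s : ℂ) (α : ℝ) : Matrix (ZMod q) (ZMod q) ℂ :=
  (cos α : ℂ) • cycT q - (sin α : ℂ) • secJ q s

/-- The coin factor of a sector. -/
def secY (s : ℂ) (α : ℝ) : Matrix (ZMod q) (ZMod q) ℂ :=
  (cos α : ℂ) • cycU ψ - (sin α : ℂ) • secJ q s

/-- The constant factor of a sector. -/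
def secZ (q : ℕ) [NeZero q] (t : ℝ) (s : ℂ) : Matrix (ZMod q) (ZMod q) ℂ := (t : ℂ) • 1 - secJ q s

/-- The walk on a ring restricted to a reflection sector. -/
def secV (t : ℝ) (s : ℂ) (α β : ℝ) : Matrix (ZMod q) (ZMod q) ℂ :=
  (-(1 / (1 + t ^ 2) : ℝ) : ℂ) • (secX q s α * (secZ q t s * secY ψ s β * secZ q t s * secJ q s))

variable {s : ℂ}

lemma secJ_mul_secJ (hs : s * s = -1) : secJ q s * secJ q s = -1 := by
  rw [secJ, smul_mul_smul_comm, cycR_mul_self, hs, neg_one_smul]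

lemma secJ_mul_cycT (s : ℂ) : secJ q s * cycT q = (cycT q)ᵀ * secJ q s := by
  rw [secJ, smul_mul_assoc, cycR_mul_cycT, mul_smul_comm]

lemma secJ_mul_cycU (s : ℂ) : secJ q s * cycU ψ = cycU' ψ * secJ q s := by
  rw [secJ, smul_mul_assoc, cycR_mul_cycU, mul_smul_comm]

lemma secJ_conjTranspose (hs' : star s = -s) : (secJ q s)ᴴ = -secJ q s := by
  rw [secJ, conjTranspose_smul, cycR_conjTranspose, hs', neg_smul]

lemma ofReal_cos_sq_add (α : ℝ) : (cos α : ℂ) ^ 2 + (sin α : ℂ) ^ 2 = 1 := by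
  exact_mod_cast cos_sq_add_sin_sq α

lemma secX_unitary (hs : s * s = -1) (hs' : star s = -s) (α : ℝ) :
    (secX q s α)ᴴ * secX q s α = 1 := by
  rw [← sector_unit (secJ_mul_secJ hs) (secJ_mul_cycT s) cycT_transpose_mul (ofReal_cos_sq_add α), secX]
  congr 1
  rw [conjTranspose_sub, conjTranspose_smul, conjTranspose_smul, cycT_conjTranspose,
    secJ_conjTranspose hs', star_def, conj_ofReal, conj_ofReal,
    smul_neg, sub_neg_eq_add]

lemma secY_unitary (hs : s * s = -1) (hs' : star s = -s) (α : ℝ) :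
    (secY ψ s α)ᴴ * secY ψ s α = 1 := by
  rw [← sector_unit (secJ_mul_secJ hs) (secJ_mul_cycU ψ s) (cycU'_mul_cycU ψ) (ofReal_cos_sq_add α), secY]
  congr 1
  rw [conjTranspose_sub, conjTranspose_smul, conjTranspose_smul, cycU_conjTranspose,
    secJ_conjTranspose hs', star_def, conj_ofReal, conj_ofReal,
    smul_neg, sub_neg_eq_add]

lemma secZ_conjTranspose (hs' : star s = -s) (t : ℝ) :
    (secZ q t s)ᴴ = (t : ℂ) • 1 + secJ q s := by
  rw [secZ, conjTranspose_sub, conjTranspose_smul, conjTranspose_one, secJ_conjTranspose hs',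
    star_def, conj_ofReal, sub_neg_eq_add]

lemma secZ_conj_mul (hs : s * s = -1) (hs' : star s = -s) (t : ℝ) :
    (secZ q t s)ᴴ * secZ q t s = (1 + t ^ 2 : ℂ) • 1 := by
  rw [secZ_conjTranspose hs', secZ]
  simp only [add_mul, mul_sub, smul_mul_assoc, mul_smul_comm, one_mul, mul_one, secJ_mul_secJ hs]
  module

lemma secV_unitary (hs : s * s = -1) (hs' : star s = -s) (t α β : ℝ) :
    (secV ψ t s α β)ᴴ * secV ψ t s α β = 1 := by
  have hX := secX_unitary (q := q) hs hs' α
  have hY := secY_unitary ψ hs hs' β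
  have hZ := secZ_conj_mul (q := q) hs hs' t
  have hJ : (secJ q s)ᴴ * secJ q s = 1 := by
    rw [secJ_conjTranspose hs', neg_mul, secJ_mul_secJ hs, neg_neg]
  have hne : (1 + t ^ 2 : ℂ) ≠ 0 := by
    have : (1 + t ^ 2 : ℝ) ≠ 0 := by positivity
    exact_mod_cast this
  rw [secV]
  generalize secX q s α = X at *
  generalize secY ψ s β = Y at *
  generalize secZ q t s = Z at *
  generalize secJ q s = J at *
  have h1 : ∀ M, Xᴴ * (X * M) = M := fun M => by rw [← mul_assoc, hX, one_mul]
  have h2 : ∀ M, Yᴴ * (Y * M) = M := fun M => by rw [← mul_assoc, hY, one_mul]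
  have h3 : ∀ M, Zᴴ * (Z * M) = (1 + t ^ 2 : ℂ) • M := fun M => by
    rw [← mul_assoc, hZ, smul_mul_assoc, one_mul]
  simp only [conjTranspose_smul, conjTranspose_mul, mul_assoc, smul_mul_assoc, mul_smul_comm,
    h1, h2, h3, hJ, smul_smul]
  have : (star (-((1 / (1 + t ^ 2) : ℝ) : ℂ)) * (-((1 / (1 + t ^ 2) : ℝ) : ℂ) * ((1 + (t:ℂ) ^ 2) * (1 + (t:ℂ) ^ 2)))) = 1 := by
    rw [star_neg, star_def, conj_ofReal]
    push_cast
    field_simp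
  convert one_smul ℂ (1 : Matrix (ZMod q) (ZMod q) ℂ) using 2
  linear_combination this

end Sector

end

section

section Glue
variable {q : ℕ} [NeZero q] (ψ : AddChar (ZMod q) ℂ) {s : ℂ}

/-- The coin in a reflection sector. -/
lemma secQ_eq (hs : s * s = -1) (t β : ℝ) (x : ZMod q → ℝ) (hx : ∀ n, circ (x n) = ψ n) :
    (-(1 / (1 + t ^ 2) : ℝ) : ℂ) • (secZ q t s * secY ψ s β * secZ q t s * secJ q s) =
      diagonal (fun n => (fA t β (x n) : ℂ)) - diagonal (fun n => gA t β (x n)) * secJ q s := by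
  rw [secZ, secY, sector_coin (secJ_mul_secJ hs) (secJ_mul_cycU ψ s)]
  have hF : diagonal (fun n => (fA t β (x n) : ℂ)) = (-(1 / (1 + t ^ 2) : ℝ) : ℂ) •
      (((t : ℂ) * cos β) • (cycU ψ + cycU' ψ) - ((sin β : ℂ) * (1 - t ^ 2)) • 1) := by
    rw [cycU, cycU', diagonal_add, ← diagonal_one, ← diagonal_smul, ← diagonal_smul, diagonal_sub,
      ← diagonal_smul]
    congr 1
    ext n
    simp only [Pi.smul_apply, smul_eq_mul]
    have hn : ψ (-n) = circ (-(x n)) := by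
      rw [circ_neg_eq_star, hx, AddChar.map_neg_eq_conj, star_def]
    rw [hn, ← hx, circ_add_circ_neg, fA]
    push_cast
    ring
  have hG : diagonal (fun n => gA t β (x n)) = ((1 / (1 + t ^ 2) : ℝ) : ℂ) •
      (((t : ℂ) ^ 2 * cos β) • cycU ψ - (2 * (t : ℂ) * sin β) • 1 -
        (cos β : ℂ) • cycU' ψ) := by
    rw [cycU, cycU', ← diagonal_one, ← diagonal_smul, ← diagonal_smul, ← diagonal_smul, diagonal_sub,
      diagonal_sub, ← diagonal_smul]
    congr 1
    ext n
    simp only [Pi.smul_apply, smul_eq_mul]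
    have hn : ψ (-n) = circ (-(x n)) := by
      rw [circ_neg_eq_star, hx, AddChar.map_neg_eq_conj, star_def]
    rw [hn, ← hx, gA, mul_one]
  rw [hF, hG, smul_add, neg_smul, neg_smul, smul_mul]
  abel

lemma secJ_diag (s : ℂ) (a : ZMod q → ℂ) :
    secJ q s * diagonal a = diagonal (fun n => a (-n)) * secJ q s := by
  rw [secJ, smul_mul_assoc, mul_smul_comm]
  congr 1
  ext n m
  rw [cycR_mul, mul_cycR, diagonal_apply, diagonal_apply]
  by_cases h : -n = m
  · subst h; simp
  · rw [if_neg h, if_neg]; rintro rfl; simp at h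

/-- A ring of coins at equidistributed points splits into its two reflection sectors. -/
lemma chi_sector_split (t α β : ℝ) (x : ZMod q → ℝ) (hx : ∀ n, circ (x n) = ψ n) (z : ℂ) :
    chi (ringOp t (addRight 1) (fun _ => α) (fun _ => β) x) z =
      chi (secV ψ t I α β) z * chi (secV ψ t (-I) α β) z := by
  set F : Matrix (ZMod q) (ZMod q) ℂ := diagonal (fun n => (fA t β (x n) : ℂ)) with hF
  set G : Matrix (ZMod q) (ZMod q) ℂ := diagonal (fun n => gA t β (x n)) with hG
  set G' : Matrix (ZMod q) (ZMod q) ℂ := diagonal (fun n => star (gA t β (x n))) with hG'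
  set W := ringOp t (addRight (1 : ZMod q)) (fun _ => α) (fun _ => β) x with hW
  have hWb : W = fromBlocks ((cos α : ℂ) • cycT q) (-(sin α : ℂ) • 1) ((sin α : ℂ) • 1)
      ((cos α : ℂ) • (cycT q)ᵀ) * fromBlocks F (-G) G' F := by
    rw [hW, ringOp, shiftOp_eq]
    congr 1
    · congr 1
      · ext n m; simp [cycT_apply]
      · ext n m; simp [diagonal_apply, one_apply]
      · ext n m; simp [diagonal_apply, one_apply]
      · ext n m; simp [cycT_apply]
    · rw [coinOp, blk, hF, hG, hG', diagonal_neg]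
  have hxn : ∀ n, circ (x (-n)) = circ (-(x n)) := fun n => by
    rw [circ_neg_eq_star, hx, hx, AddChar.map_neg_eq_conj, star_def]
  have hcirc : ∀ y, circ (-y) = star (circ y) := circ_neg_eq_star
  have hFn : ∀ n, fA t β (x (-n)) = fA t β (x n) := fun n => by
    have h1 := circ_add_circ_neg (x (-n))
    have h2 := circ_add_circ_neg (x n)
    rw [hcirc, hxn, hcirc, star_star, add_comm, ← hcirc, h2] at h1
    have h3 : cos (2 * π * x n) = cos (2 * π * x (-n)) := by
      have := mul_left_cancel₀ (two_ne_zero) h1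
      exact_mod_cast this
    rw [fA, fA, h3]
  have hGn : ∀ n, gA t β (x (-n)) = star (gA t β (x n)) := fun n => by
    have : circ (-x (-n)) = circ (x n) := by rw [hcirc, hxn, hcirc, star_star]
    rw [star_gA, gA, this, hxn]
  have hmul : ∀ s : ℂ, s * s = -1 →
      fromBlocks F (-G) G' F * fromBlocks (1 : Matrix (ZMod q) (ZMod q) ℂ) (0 : Matrix (ZMod q) (ZMod q) ℂ) (secJ q s) 0 =
        fromBlocks (F - G * secJ q s) 0 (secJ q s * (F - G * secJ q s)) 0 := by
    intro s hs
    rw [fromBlocks_multiply]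
    have h1 : secJ q s * F = F * secJ q s := by
      rw [hF, secJ_diag]; simp only [hFn]
    have h2 : secJ q s * (G * secJ q s) = -G' := by
      rw [← mul_assoc, hG, secJ_diag, mul_assoc, secJ_mul_secJ hs, hG']
      simp only [hGn]; simp
    rw [mul_sub, h1, h2]
    congr 1 <;> simp [add_comm, sub_eq_add_neg]
  have hcol : ∀ s : ℂ, s * s = -1 → W * fromBlocks 1 (0 : Matrix (ZMod q) (ZMod q) ℂ) (secJ q s) 0 =
      fromBlocks (secV ψ t s α β) 0 (secJ q s * secV ψ t s α β) 0 := by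
    intro s hs
    have hV : secV ψ t s α β = secX q s α * (F - G * secJ q s) := by
      rw [secV, ← mul_smul_comm, secQ_eq ψ hs t β x hx]
    have hJX : secJ q s * secX q s α = (sin α : ℂ) • 1 + (cos α : ℂ) • ((cycT q)ᵀ * secJ q s) := by
      rw [secX, mul_sub, mul_smul_comm, mul_smul_comm, secJ_mul_secJ hs, secJ_mul_cycT, smul_neg,
        sub_neg_eq_add, add_comm]
    rw [hWb, mul_assoc, hmul s hs, fromBlocks_multiply, hV]
    simp only [mul_zero, zero_add, add_zero]
    congr 1
    · rw [secX, sub_mul]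
      simp only [smul_mul_assoc, one_mul, neg_smul, sub_eq_add_neg, neg_mul]
    · rw [← mul_assoc, ← mul_assoc, ← add_mul, hJX]
      congr 1
      simp [smul_mul_assoc]
  have hI : I * I = -1 := I_mul_I
  have hI' : -I * -I = -1 := by rw [neg_mul_neg, hI]
  set M : Matrix (ZMod q ⊕ ZMod q) (ZMod q ⊕ ZMod q) ℂ :=
    fromBlocks 1 1 (secJ q I) (secJ q (-I)) with hM
  have hJn : secJ q (-I) = -secJ q I := by rw [secJ, secJ, neg_smul]
  set D : Matrix (ZMod q ⊕ ZMod q) (ZMod q ⊕ ZMod q) ℂ :=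
    fromBlocks (secV ψ t I α β) 0 0 (secV ψ t (-I) α β) with hD
  have hWM : W * M = M * D := by
    have h1 := hcol _ hI
    have h2 := hcol _ hI'
    rw [← fromBlocks_toBlocks W, fromBlocks_multiply] at h1 h2
    rw [← fromBlocks_toBlocks W, hM, hD, fromBlocks_multiply, fromBlocks_multiply]
    have a1 := (fromBlocks_inj.1 h1)
    have a2 := (fromBlocks_inj.1 h2)
    simp only [mul_one, mul_zero, add_zero, one_mul, zero_add] at a1 a2 ⊢
    rw [a1.1, a1.2.2.1, a2.1, a2.2.2.1]
  set M' : Matrix (ZMod q ⊕ ZMod q) (ZMod q ⊕ ZMod q) ℂ :=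
    (1 / 2 : ℂ) • fromBlocks 1 (-secJ q I) 1 (secJ q I) with hM'
  have hMM : M' * M = 1 := by
    rw [hM', hM, hJn, smul_mul_assoc, fromBlocks_multiply, ← fromBlocks_one, fromBlocks_smul]
    simp only [neg_mul, mul_neg, secJ_mul_secJ hI, one_mul, neg_neg]
    congr 1 <;> module
  have hWD : W = M * D * M' := by
    rw [← hWM, mul_assoc, mul_eq_one_comm.1 hMM, mul_one]
  rw [hWD, chi_mul_comm, ← mul_assoc, hMM, one_mul, hD, chi, chi, chi,
    ← det_fromBlocks_zero₂₁ _ 0 _, ← fromBlocks_one, fromBlocks_smul,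
    sub_eq_add_neg, fromBlocks_neg, fromBlocks_add]
  simp [sub_eq_add_neg]

end Glue

end

section

section Duality
variable {q : ℕ} [NeZero q] {ψ : AddChar (ZMod q) ℂ} {s : ℂ}

/-- The Fourier matrix. -/
def cycF (ψ : AddChar (ZMod q) ℂ) : Matrix (ZMod q) (ZMod q) ℂ := of fun n m => ψ (n * m)

lemma cycF_mul_cycT : cycF ψ * cycT q = cycU ψ * cycF ψ := by
  ext n m
  rw [mul_apply, sum_eq_single (m + 1), cycU, diagonal_mul]
  · simp [cycF, cycT_apply, mul_add, AddChar.map_add_eq_mul, mul_comm]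
  · intro b _ hb
    rw [cycT_apply, if_neg hb.symm, mul_zero]
  · simp

lemma cycF_mul_cycU : cycF ψ * cycU ψ = (cycT q)ᵀ * cycF ψ := by
  ext n m
  rw [cycU, mul_diagonal, mul_apply, sum_eq_single (n + 1)]
  · simp [cycF, cycT_apply, add_mul, AddChar.map_add_eq_mul]
  · intro b _ hb
    rw [transpose_apply, cycT_apply, if_neg hb.symm, zero_mul]
  · simp

lemma cycF_mul_secJ (s : ℂ) : cycF ψ * secJ q s = secJ q s * cycF ψ := by
  rw [secJ, smul_mul_assoc, mul_smul_comm]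
  congr 1
  ext n m
  rw [cycR_mul, mul_cycR]
  simp [cycF]

lemma exists_cycF_inv (hψ : ψ.IsPrimitive) : ∃ G : Matrix (ZMod q) (ZMod q) ℂ, G * cycF ψ = 1 := by
  refine ⟨(1 / (q : ℂ)) • of fun n m => ψ (-(n * m)), ?_⟩
  have hq : (q : ℂ) ≠ 0 := mod_cast NeZero.ne q
  ext n m
  rw [smul_mul_assoc, Matrix.smul_apply, mul_apply, one_apply]
  have h := AddChar.sum_mulShift (m - n) hψ
  have h2 : ∑ j, (of fun n m => ψ (-(n * m))) n j * cycF ψ j m = ∑ j, ψ (j * (m - n)) := by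
    refine sum_congr rfl fun j _ => ?_
    rw [cycF, of_apply, of_apply, ← AddChar.map_add_eq_mul]
    congr 1; ring
  rw [h2, h, ZMod.card]
  by_cases h : n = m
  · subst h; simp [hq]
  · rw [if_neg h, if_neg (sub_ne_zero.2 (Ne.symm h))]; simp

lemma secJ_transpose (s : ℂ) : (secJ q s)ᵀ = secJ q s := by
  rw [secJ, transpose_smul, cycR_transpose]

lemma secZ_transpose (t : ℝ) (s : ℂ) : (secZ q t s)ᵀ = secZ q t s := by
  rw [secZ, transpose_sub, transpose_smul, transpose_one, secJ_transpose]

lemma secY_transpose (α : ℝ) : (secY ψ s α)ᵀ = secY ψ s α := by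
  rw [secY, transpose_sub, transpose_smul, transpose_smul, secJ_transpose, cycU, diagonal_transpose]

lemma chi_transpose {ι : Type*} [Fintype ι] [DecidableEq ι] (A : Matrix ι ι ℂ) (z : ℂ) :
    chi Aᵀ z = chi A z := by
  rw [chi, chi, ← det_transpose]
  simp

/-- Aubry duality in a reflection sector. -/
lemma chi_secV_comm (hψ : ψ.IsPrimitive) (t : ℝ) (s : ℂ) (α β : ℝ) (z : ℂ) :
    chi (secV ψ t s α β) z = chi (secV ψ t s β α) z := by
  obtain ⟨G, hG⟩ := exists_cycF_inv hψ
  have hX : cycF ψ * secX q s α = secY ψ s α * cycF ψ := by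
    rw [secX, secY, mul_sub, sub_mul, mul_smul_comm, mul_smul_comm, smul_mul_assoc,
      smul_mul_assoc, cycF_mul_cycT, cycF_mul_secJ]
  have hY : cycF ψ * secY ψ s β = (secX q s β)ᵀ * cycF ψ := by
    rw [secX, secY, transpose_sub, transpose_smul, transpose_smul, secJ_transpose,
      mul_sub, sub_mul, mul_smul_comm, mul_smul_comm, smul_mul_assoc,
      smul_mul_assoc, cycF_mul_cycU, cycF_mul_secJ]
  have hZ : cycF ψ * secZ q t s = secZ q t s * cycF ψ := by
    rw [secZ, mul_sub, sub_mul, mul_smul_comm, smul_mul_assoc, cycF_mul_secJ]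
    simp
  have hJ : cycF ψ * secJ q s = secJ q s * cycF ψ := cycF_mul_secJ s
  set B := (-(1 / (1 + t ^ 2) : ℝ) : ℂ) • (secY ψ s α * (secZ q t s * (secX q s β)ᵀ * secZ q t s * secJ q s))
    with hB
  have hFV : cycF ψ * secV ψ t s α β = B * cycF ψ := by
    rw [secV, hB, mul_smul_comm, smul_mul_assoc]
    congr 1
    simp only [mul_assoc]
    rw [← hJ, ← mul_assoc _ (cycF ψ), ← hZ, mul_assoc, ← mul_assoc _ (cycF ψ), ← hY,
      mul_assoc, ← mul_assoc _ (cycF ψ), ← hZ, mul_assoc,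
      ← mul_assoc _ (cycF ψ), ← hX, mul_assoc]
  have hV : secV ψ t s α β = G * (B * cycF ψ) := by
    rw [← hFV, ← mul_assoc, hG, one_mul]
  rw [hV, chi_mul_comm, mul_assoc, mul_eq_one_comm.1 hG, mul_one, ← chi_transpose, hB]
  have : ((-(1 / (1 + t ^ 2) : ℝ) : ℂ) • (secY ψ s α * (secZ q t s * (secX q s β)ᵀ * secZ q t s * secJ q s)))ᵀ =
      ((-(1 / (1 + t ^ 2) : ℝ) : ℂ) • (secJ q s * secZ q t s)) * (secX q s β * secZ q t s * secY ψ s α) := by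
    simp only [transpose_smul, transpose_mul, secJ_transpose, secZ_transpose, secY_transpose,
      transpose_transpose, smul_mul_assoc, mul_assoc]
  have hJZ : secJ q s * secZ q t s = secZ q t s * secJ q s := by
    rw [secZ, mul_sub, sub_mul, mul_smul_comm, smul_mul_assoc]; simp
  rw [this, chi_mul_comm, hJZ, secV, mul_smul_comm]
  simp only [mul_assoc]

end Duality

end

section

section Flip
variable {q : ℕ} [NeZero q] {ψ : AddChar (ZMod q) ℂ} {s : ℂ}

/-- An alternating gauge on a ring of odd length, with its defect at `-(q / 2)`. -/
def altSign (q : ℕ) (n : ZMod q) : ℂ := (-1) ^ (n + ((q / 2 : ℕ) : ZMod q)).val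

lemma altSign_mul_self (n : ZMod q) : altSign q n * altSign q n = 1 := by
  rw [altSign, ← pow_add, ← two_mul, pow_mul]; simp

lemma two_mul_half (hq : Odd q) : (2 : ZMod q) * ((q / 2 : ℕ) : ZMod q) = -1 := by
  have h : ((2 * (q / 2) + 1 : ℕ) : ZMod q) = 0 := by
    rw [Nat.two_mul_div_two_add_one_of_odd hq]; simp
  push_cast at h
  linear_combination h

lemma neg_one_pow_val (hq : Odd q) {a b : ZMod q} (h : a + b = -1) :
    (-1 : ℂ) ^ a.val = (-1) ^ b.val := by
  have h1 : ((a.val + b.val + 1 : ℕ) : ZMod q) = 0 := by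
    push_cast
    rw [ZMod.natCast_zmod_val, ZMod.natCast_zmod_val, h]; ring
  rw [ZMod.natCast_eq_zero_iff] at h1
  have ha := ZMod.val_lt a
  have hb := ZMod.val_lt b
  have h2 : a.val + b.val + 1 = q := by
    obtain ⟨k, hk⟩ := h1
    have : k = 1 := by
      rcases k with _ | _ | k
      · omega
      · rfl
      · nlinarith
    rw [hk, this, mul_one]
  obtain ⟨r, hr⟩ := hq
  have h3 : b.val + a.val = 2 * r := by omega
  have h4 : (-1 : ℂ) ^ b.val * (-1) ^ a.val = 1 := by rw [← pow_add, h3, pow_mul]; simp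
  have h5 : (-1 : ℂ) ^ b.val * (-1) ^ b.val = 1 := by rw [← pow_add, ← two_mul, pow_mul]; simp
  have h6 : (-1 : ℂ) ^ b.val ≠ 0 := by simp
  exact mul_left_cancel₀ h6 (h4.trans h5.symm)

lemma altSign_neg (hq : Odd q) (n : ZMod q) : altSign q (-n) = altSign q n := by
  refine neg_one_pow_val hq ?_
  linear_combination two_mul_half hq

lemma altSign_succ (hq : Odd q) {m : ZMod q} (h : m + 1 ≠ -((q / 2 : ℕ) : ZMod q)) :
    altSign q (m + 1) = -altSign q m := by
  set a := m + ((q / 2 : ℕ) : ZMod q) with ha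
  have h0 : m + 1 + ((q / 2 : ℕ) : ZMod q) = a + 1 := by rw [ha]; ring
  have h1 : a + 1 ≠ 0 := fun h2 => h (by linear_combination h2 + ha)
  have h2 : (a + 1).val = a.val + 1 := by
    have hlt := ZMod.val_lt a
    have hne : a.val + 1 ≠ q := fun h3 => h1 (by
      have := congrArg (Nat.cast : ℕ → ZMod q) h3
      push_cast at this
      rwa [ZMod.natCast_zmod_val, CharP.cast_eq_zero] at this)
    have h4 : a + 1 = ((a.val + 1 : ℕ) : ZMod q) := by push_cast; rw [ZMod.natCast_zmod_val]
    rw [h4, ZMod.val_natCast, Nat.mod_eq_of_lt (by omega)]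
  rw [altSign, altSign, h0, h2, pow_succ, ← ha]
  ring

lemma norm_cos_sub_sin (hs : s * s = -1) (hs' : star s = -s) (α : ℝ) (e : ℝ) (he : e ^ 2 = 1) :
    ‖(e * cos α : ℂ) - sin α * s‖ = 1 := by
  have h : (‖(e * cos α : ℂ) - sin α * s‖ : ℂ) ^ 2 = 1 := by
    rw [← mul_conj', ← star_def, star_sub, star_mul', star_mul', hs']
    simp only [star_def, conj_ofReal]
    have he' : (e : ℂ) ^ 2 = 1 := mod_cast he
    linear_combination (-(sin α : ℂ) ^ 2) * hs + ofReal_cos_sq_add α + (cos α : ℂ) ^ 2 * he'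
  have h2 : ‖(e * cos α : ℂ) - sin α * s‖ ^ 2 = 1 := mod_cast h
  nlinarith [norm_nonneg ((e * cos α : ℂ) - sin α * s)]

/-- Flipping the sign of the transmission amplitude is a rank one perturbation of a sector. -/
lemma chi_secV_flip (hq : Odd q) (hs : s * s = -1) (hs' : star s = -s) (t α β : ℝ) :
    ∃ (i : ZMod q) (τ : ℝ), ∀ z,
      chi (secV ψ t s (π - α) β) z = chi (secV ψ t s α β * rot i τ) z := by
  set ω : ℂ := ((-1 : ℝ) * cos α - sin α * s) / ((1 : ℝ) * cos α - sin α * s) with hω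
  have hn1 := norm_cos_sub_sin hs hs' α (-1) (by norm_num)
  have hn2 := norm_cos_sub_sin hs hs' α 1 (by norm_num)
  have hd : ((1 : ℝ) * cos α - sin α * s : ℂ) ≠ 0 := by
    intro h; rw [h] at hn2; simp at hn2
  have hωn : ‖ω‖ = 1 := by rw [hω, norm_div, hn1, hn2, div_one]
  have hωe : Complex.exp ((arg ω : ℝ) * I) = ω := by
    have := Complex.norm_mul_exp_arg_mul_I ω
    rwa [hωn, ofReal_one, one_mul] at this
  have hωm : ω * (cos α - sin α * s) = -cos α - sin α * s := by
    have := div_mul_cancel₀ ((-1 : ℝ) * cos α - sin α * s : ℂ) hd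
    rw [← hω] at this
    simpa using this
  set i : ZMod q := -((q / 2 : ℕ) : ZMod q) with hi
  refine ⟨i, arg ω, fun z => ?_⟩
  set G : Matrix (ZMod q) (ZMod q) ℂ := diagonal (altSign q) with hG
  have hGG : G * G = 1 := by
    rw [hG, diagonal_mul_diagonal, ← diagonal_one]
    congr 1; ext n; exact altSign_mul_self n
  have hGJ : G * secJ q s = secJ q s * G := by
    rw [hG, secJ_diag]
    congr 2; ext n; exact (altSign_neg hq n).symm
  have hGU : G * cycU ψ = cycU ψ * G := by
    rw [hG, cycU, diagonal_mul_diagonal, diagonal_mul_diagonal]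
    congr 1; ext n; ring
  have hGX : G * secX q s (π - α) * G = rot i (arg ω) * secX q s α := by
    ext n m
    rw [hG, mul_diagonal, diagonal_mul, rot, diagonal_mul, hωe]
    simp only [secX, secJ, Matrix.sub_apply, Matrix.smul_apply, smul_eq_mul, cos_pi_sub,
      sin_pi_sub, cycT_apply, cycR_apply, ofReal_neg]
    by_cases hn : n = i
    · have e1 : (m + 1 = n) ↔ m = -n := by
        rw [hn, hi, neg_neg]
        have := two_mul_half (q := q) hq
        constructor <;> intro h
        · linear_combination h - this
        · linear_combination h + this
      have e2 : (n = -m) ↔ m = -n := by constructor <;> (rintro h; rw [h, neg_neg])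
      simp only [e1, e2]
      rw [hn, Function.update_self]
      by_cases h : m = -i
      · have e3 : altSign q i * altSign q m = 1 := by rw [h, altSign_neg hq i, altSign_mul_self]
        simp only [if_pos h]
        linear_combination (-(cos α : ℂ) - sin α * s) * e3 - hωm
      · rw [if_neg h]; simp
    · rw [Function.update_of_ne hn, Pi.one_apply, one_mul]
      have a1 : altSign q n * altSign q m * (if m + 1 = n then 1 else 0) = -(if m + 1 = n then 1 else 0) := by
        split_ifs with h
        · rw [← h] at hn ⊢
          rw [altSign_succ hq hn, neg_mul, altSign_mul_self]; ring
        · simp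
      have a2 : altSign q n * altSign q m * (if n = -m then 1 else 0) = (if n = -m then 1 else 0) := by
        split_ifs with h
        · rw [h, altSign_neg hq, altSign_mul_self]; ring
        · simp
      linear_combination (-(cos α : ℂ)) * a1 - sin α * s * a2
  have hGZ : G * secZ q t s = secZ q t s * G := by
    rw [secZ, mul_sub, sub_mul, mul_smul_comm, smul_mul_assoc, hGJ]; simp
  have hGY : G * secY ψ s β = secY ψ s β * G := by
    rw [secY, mul_sub, sub_mul, mul_smul_comm, smul_mul_assoc, mul_smul_comm,
      smul_mul_assoc, hGJ, hGU]
  have hV : secV ψ t s (π - α) β = G * (rot i (arg ω) * secV ψ t s α β * G) := by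
    have hX : secX q s (π - α) = G * (rot i (arg ω) * secX q s α) * G := by
      rw [← hGX, mul_assoc, mul_assoc, hGG, mul_one, ← mul_assoc, hGG,
        one_mul]
    rw [secV, secV, hX, mul_smul_comm, smul_mul_assoc, mul_smul_comm]
    congr 1
    simp only [mul_assoc]
    congr 3
    rw [← hGJ, ← mul_assoc (secZ q t s) G, ← hGZ, mul_assoc, ← mul_assoc _ G,
      ← hGY, mul_assoc, ← mul_assoc _ G, ← hGZ, mul_assoc]
  rw [hV, chi_mul_comm, mul_assoc, hGG, mul_one, chi_mul_comm]

end Flip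

end

section

section DetDeriv
variable {ι : Type*} [Fintype ι] [DecidableEq ι]

lemma hasDerivAt_det_of_diagonal {N : ℝ → Matrix ι ι ℂ} {N' : Matrix ι ι ℂ} {x : ℝ} {v : ι → ℂ}
    (hN : ∀ i j, HasDerivAt (fun σ => N σ i j) (N' i j) x) (hx : N x = diagonal v) :
    HasDerivAt (fun σ => (N σ).det) (∑ i, N' i i * ∏ k ∈ univ.erase i, v k) x := by
  simp only [det_apply']
  have h : ∀ e : Perm ι, HasDerivAt (fun σ => ((Perm.sign e : ℤ) : ℂ) * ∏ i, N σ (e i) i)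
      (((Perm.sign e : ℤ) : ℂ) * ∑ i, (∏ j ∈ univ.erase i, N x (e j) j) • N' (e i) i) x :=
    fun e => (HasDerivAt.fun_finsetProd fun i _ => hN (e i) i).const_mul _
  refine (HasDerivAt.fun_sum fun e (_ : e ∈ univ) => h e).congr_deriv ?_
  rw [sum_eq_single (1 : Perm ι)]
  · simp only [Perm.sign_one, Perm.one_apply, hx, diagonal_apply_eq, smul_eq_mul]
    simp [mul_comm]
  · intro e _ he
    rw [sum_eq_zero, mul_zero]
    intro i _
    rw [hx, prod_eq_zero_iff.2, zero_smul]
    by_contra! hcon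
    apply he
    have h1 : ∀ j, j ≠ i → e j = j := fun j hj => by
      by_contra h2
      exact hcon j (mem_erase.2 ⟨hj, mem_univ _⟩) (diagonal_apply_ne _ h2)
    ext j
    rcases eq_or_ne j i with rfl | hj
    · by_contra h3
      have h4 := h1 (e j) h3
      exact h3 (e.injective h4)
    · exact h1 j hj
  · simp

end DetDeriv

section Residue
variable {q : ℕ} [NeZero q] {ψ : AddChar (ZMod q) ℂ} {s : ℂ}

lemma trace_cycT_mul_cycR (hq : Odd q) : (cycT q * cycR q).trace = 1 := by
  have h2 := two_mul_half (q := q) hq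
  simp only [trace, diag, mul_cycR, cycT_apply]
  rw [sum_eq_single (-((q / 2 : ℕ) : ZMod q)), if_pos]
  · linear_combination h2
  · intro b _ hb
    rw [if_neg]
    intro h
    apply hb
    linear_combination b * h2 + ((q / 2 : ℕ) : ZMod q) * h
  · simp

lemma trace_cycU_mul_cycR (hq : Odd q) : (cycU ψ * cycR q).trace = 1 := by
  have h2 := two_mul_half (q := q) hq
  simp only [trace, diag, mul_cycR, cycU, diagonal_apply]
  rw [sum_eq_single (0 : ZMod q)]
  · simp
  · intro b _ hb
    rw [if_neg]
    intro h
    apply hb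
    linear_combination b * h2 - ((q / 2 : ℕ) : ZMod q) * h
  · simp

lemma secV_path (hs : s * s = -1) (hs' : star s = -s) (t α β : ℝ) :
    ∃ M : Matrix (ZMod q) (ZMod q) ℂ, ∀ σ : ℝ, secV ψ t s (α - σ) (β - σ) =
      ((cos σ : ℂ) ^ 2) • secV ψ t s α β + ((cos σ : ℂ) * sin σ * s) •
        ((cycT q * cycR q + (1 / (1 + t ^ 2 : ℂ)) • (secX q s α * secZ q t s * (cycU ψ * cycR q) *
          ((secZ q t s)ᴴ * (secX q s α)ᴴ))) * secV ψ t s α β) + ((sin σ : ℂ) ^ 2) • M := by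
  have hne : (1 + t ^ 2 : ℂ) ≠ 0 := by
    have : (1 + t ^ 2 : ℝ) ≠ 0 := by positivity
    exact_mod_cast this
  have hXs : ∀ σ : ℝ, secX q s (α - σ) =
      ((cos σ : ℂ) • 1 + (sin σ : ℂ) • (cycT q * secJ q s)) * secX q s α := fun σ => by
    rw [show secX q s α = (cos α : ℂ) • cycT q - (sin α : ℂ) • secJ q s from rfl,
      sector_rot (secJ_mul_secJ hs) (secJ_mul_cycT s) cycT_mul_transpose, secX, Real.cos_sub, Real.sin_sub]
    push_cast
    rfl
  have hYs : ∀ σ : ℝ, secY ψ s (β - σ) =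
      ((cos σ : ℂ) • 1 + (sin σ : ℂ) • (cycU ψ * secJ q s)) * secY ψ s β := fun σ => by
    rw [show secY ψ s β = (cos β : ℂ) • cycU ψ - (sin β : ℂ) • secJ q s from rfl,
      sector_rot (secJ_mul_secJ hs) (secJ_mul_cycU ψ s) (cycU_mul_cycU' ψ), secY, Real.cos_sub, Real.sin_sub]
    push_cast
    rfl
  have hX := secX_unitary (q := q) hs hs' α
  have hZ := secZ_conj_mul (q := q) hs hs' t
  set X := secX q s α
  set Z := secZ q t s
  set Y := secY ψ s β
  set κ : ℂ := (-(1 / (1 + t ^ 2) : ℝ) : ℂ)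
  set P := cycT q * secJ q s with hP
  set Q := cycU ψ * secJ q s with hQ
  refine ⟨κ • (P * X * Z * Q * Y * Z * secJ q s), fun σ => ?_⟩
  have hA : ((1 / (1 + t ^ 2 : ℂ)) • (X * Z * (cycU ψ * cycR q) * (Zᴴ * Xᴴ))) * secV ψ t s α β =
      κ • (X * Z * (cycU ψ * cycR q) * Y * Z * secJ q s) := by
    rw [secV]
    have h1 : ∀ M, Xᴴ * (X * M) = M := fun M => by rw [← mul_assoc, hX, one_mul]
    have h3 : ∀ M, Zᴴ * (Z * M) = (1 + t ^ 2 : ℂ) • M := fun M => by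
      rw [← mul_assoc, hZ, smul_mul_assoc, one_mul]
    simp only [smul_mul_assoc, mul_smul_comm, mul_assoc]
    rw [h1, h3]
    simp only [mul_smul_comm, smul_smul]
    congr 1
    field_simp
    rfl
  have e1 : s • (cycT q * cycR q) = P := by rw [hP, secJ, mul_smul_comm]
  have e2 : s • (cycU ψ * cycR q) = Q := by rw [hQ, secJ, mul_smul_comm]
  rw [add_mul, hA, mul_smul, smul_add s, ← smul_mul_assoc s (cycT q * cycR q), e1]
  have e3 : s • κ • (X * Z * (cycU ψ * cycR q) * Y * Z * secJ q s) = κ • (X * Z * Q * Y * Z * secJ q s) := by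
    rw [← e2, smul_comm]
    simp only [smul_mul_assoc, mul_smul_comm]
  have hκ : κ = (-(1 / (1 + t ^ 2) : ℝ) : ℂ) := rfl
  rw [e3, secV, secV, hXs, hYs, ← hκ]
  clear_value κ
  simp only [add_mul, mul_add, smul_mul_assoc, mul_smul_comm, one_mul, smul_smul, smul_add,
    mul_assoc]
  module

/-- Moving both angles rotates a sector by a hermitian generator of trace two. -/
lemma secV_derivative (hq : Odd q) (hs : s * s = -1) (hs' : star s = -s) (t α β : ℝ) :
    ∃ (d : ZMod q → ℂ) (h : ZMod q → ℝ), (∀ k, ‖d k‖ = 1) ∧ ∑ j, h j = 2 ∧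
      (∀ z, chi (secV ψ t s α β) z = ∏ k, (1 - z * d k)) ∧
      ∀ z, HasDerivAt (fun σ : ℝ => chi (secV ψ t s (α - σ) (β - σ)) z)
        (-s * ∑ j, h j * (z * d j) * ∏ k ∈ univ.erase j, (1 - z * d k)) 0 := by
  obtain ⟨M, hM⟩ := secV_path (ψ := ψ) hs hs' t α β
  obtain ⟨U, d, hU1, hU2, hd, hV⟩ := unitary_diagonalization (secV_unitary ψ hs hs' t α β)
  have hne : (1 + t ^ 2 : ℂ) ≠ 0 := by
    have : (1 + t ^ 2 : ℝ) ≠ 0 := by positivity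
    exact_mod_cast this
  have hX := secX_unitary (q := q) hs hs' α
  have hZ := secZ_conj_mul (q := q) hs hs' t
  set X := secX q s α
  set Z := secZ q t s
  set H := cycT q * cycR q + (1 / (1 + t ^ 2 : ℂ)) • (X * Z * (cycU ψ * cycR q) * (Zᴴ * Xᴴ)) with hH
  have hTR : (cycT q * cycR q)ᴴ = cycT q * cycR q := by
    have := congrArg (fun B => cycR q * B * cycR q) (cycR_mul_cycT (q := q))
    simp only [← mul_assoc, cycR_mul_self, one_mul] at this
    simp only [mul_assoc, cycR_mul_self, mul_one] at this
    rw [conjTranspose_mul, cycR_conjTranspose, cycT_conjTranspose, this]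
  have hUR : (cycU ψ * cycR q)ᴴ = cycU ψ * cycR q := by
    rw [conjTranspose_mul, cycR_conjTranspose, cycU_conjTranspose, cycR_mul_cycU']
  have hHh : Hᴴ = H := by
    rw [hH, conjTranspose_add, conjTranspose_smul, hTR]
    congr 1
    have : star (1 / (1 + t ^ 2 : ℂ)) = 1 / (1 + t ^ 2 : ℂ) := by simp
    rw [this, conjTranspose_mul, conjTranspose_mul Zᴴ, conjTranspose_mul (X * Z), hUR, conjTranspose_mul X Z,
      conjTranspose_conjTranspose, conjTranspose_conjTranspose]
    simp only [mul_assoc]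
  have hHt : H.trace = 2 := by
    have h1 : (X * Z * (cycU ψ * cycR q) * (Zᴴ * Xᴴ)).trace = (1 + t ^ 2 : ℂ) := by
      have h2 : Zᴴ * Xᴴ * (X * Z) = (1 + t ^ 2 : ℂ) • 1 := by
        rw [mul_assoc, ← mul_assoc Xᴴ, hX, one_mul, hZ]
      rw [trace_mul_comm, ← mul_assoc, h2, smul_mul_assoc, one_mul, trace_smul,
        trace_cycU_mul_cycR hq, smul_eq_mul, mul_one]
    rw [hH, trace_add, trace_smul, h1, trace_cycT_mul_cycR hq, smul_eq_mul]
    field_simp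
    norm_num
  have hK : (Uᴴ * H * U)ᴴ = Uᴴ * H * U := by
    rw [conjTranspose_mul, conjTranspose_mul, hHh, conjTranspose_conjTranspose, mul_assoc]
  set K := Uᴴ * H * U with hKd
  have hKr : ∀ j, (((K j j).re : ℝ) : ℂ) = K j j := fun j => by
    have := congrFun (congrFun hK j) j
    rw [conjTranspose_apply] at this
    exact Complex.conj_eq_iff_re.1 this
  refine ⟨d, fun j => (K j j).re, hd, ?_, fun z => chi_eq_prod hU2 hV z, fun z => ?_⟩
  · have : ((∑ j, (K j j).re : ℝ) : ℂ) = 2 := by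
      rw [Complex.ofReal_sum, sum_congr rfl fun j _ => hKr j]
      change K.trace = 2
      rw [hKd, trace_mul_comm, ← mul_assoc, hU2, one_mul, hHt]
    exact_mod_cast this
  · have hconj : ∀ σ : ℝ, chi (secV ψ t s (α - σ) (β - σ)) z =
        (1 - z • (Uᴴ * secV ψ t s (α - σ) (β - σ) * U)).det := fun σ => by
      change _ = chi (Uᴴ * secV ψ t s (α - σ) (β - σ) * U) z
      rw [chi_mul_comm, ← mul_assoc, hU2, one_mul]
    have hD : Uᴴ * secV ψ t s α β * U = diagonal d := by
      rw [hV]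
      simp only [← mul_assoc, hU1, one_mul]
      rw [mul_assoc, hU1, mul_one]
    have hHV : Uᴴ * (H * secV ψ t s α β) * U = K * diagonal d := by
      rw [← hD, hKd]
      simp only [← mul_assoc]
      rw [mul_assoc (Uᴴ * H) U, hU2, mul_one]
    have hform : ∀ σ : ℝ, 1 - z • (Uᴴ * secV ψ t s (α - σ) (β - σ) * U) =
        1 - z • (((cos σ : ℂ) ^ 2) • diagonal d + ((cos σ : ℂ) * sin σ * s) •
          (K * diagonal d) + ((sin σ : ℂ) ^ 2) • (Uᴴ * M * U)) := fun σ => by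
      rw [hM σ, ← hHV, ← hD]
      simp only [mul_add, add_mul, mul_smul_comm, smul_mul_assoc]
    simp only [hconj]
    have hc : HasDerivAt (fun σ : ℝ => (cos σ : ℂ)) 0 0 := by
      simpa using (Real.hasDerivAt_cos 0).ofReal_comp
    have hsn : HasDerivAt (fun σ : ℝ => (sin σ : ℂ)) 1 0 := by
      simpa using (Real.hasDerivAt_sin 0).ofReal_comp
    have hmain := hasDerivAt_det_of_diagonal (N := fun σ => 1 - z • (Uᴴ * secV ψ t s (α - σ) (β - σ) * U))
      (N' := -(z • s • (K * diagonal d))) (x := 0) (v := fun k => 1 - z * d k) ?_ ?_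
    · refine hmain.congr_deriv ?_
      rw [Finset.mul_sum]
      refine sum_congr rfl fun j _ => ?_
      rw [hKr j, neg_apply, Matrix.smul_apply, Matrix.smul_apply, mul_diagonal, smul_eq_mul, smul_eq_mul]
      ring
    · intro i j
      simp only [hform]
      simp only [Matrix.sub_apply, Matrix.add_apply, Matrix.smul_apply, smul_eq_mul]
      have h1 := (((hc.fun_pow 2).mul_const (diagonal d i j)).fun_add
        (((hc.fun_mul hsn).mul_const s).mul_const ((K * diagonal d) i j))).fun_add
        ((hsn.fun_pow 2).mul_const ((Uᴴ * M * U) i j))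
      refine ((h1.const_mul z).const_sub ((1 : Matrix (ZMod q) (ZMod q) ℂ) i j)).congr_deriv ?_
      simp
    · simp only [sub_zero, hD]
      rw [← diagonal_one, ← diagonal_smul, diagonal_sub]
      rfl

end Residue

end

section

/-- The ring of length `q` with constant angles and phases `θ + jφ`. -/
def qRing (t α β : ℝ) (q : ℕ) (φ θ : ℝ) : Matrix (Fin q ⊕ Fin q) (Fin q ⊕ Fin q) ℂ :=
  ringN t q (fun _ => α) (fun _ => β) (fun j => θ + j * φ)

lemma qRing_unitary (t α β : ℝ) (q : ℕ) (φ θ : ℝ) :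
    (qRing t α β q φ θ)ᴴ * qRing t α β q φ θ = 1 := ringN_unitary _ _ _ _ _

lemma chi_ringN_eq_trace (t : ℝ) (n : ℕ) (hn : n ≠ 0) (α β x : ℕ → ℝ) (hf : ∀ j, fA t (β j) (x j) ≠ 0)
    (hα : ∀ j, cos (α j) ≠ 0) {z : ℂ} (hz : z ≠ 0) :
    chi (ringN t n α β x) z =
      (segProd (fun j => stepMat (sin (α j)) (gA t (β j) (x j)) z) 0 n).trace -
        2 * z ^ n * ∏ j ∈ range n, ((cos (α j) * fA t (β j) (x j) : ℝ) : ℂ) := by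
  obtain ⟨m, rfl⟩ := Nat.exists_eq_succ_of_ne_zero hn
  exact chi_walk_eq m α (fun j => fA t (β j) (x j)) (fun j => gA t (β j) (x j))
    (fun j => fA_sq_add t (β j) (x j)) hf hα hz

lemma swap_conj (M : Matrix (Fin 2) (Fin 2) ℂ) :
    !![0, 1; 1, 0] * M * !![0, 1; 1, 0] = !![M 1 1, M 1 0; M 0 1, M 0 0] := by
  ext i j
  fin_cases i <;> fin_cases j <;> simp [mul_apply, Fin.sum_univ_two, vecMul, dotProduct]

lemma stepMat_conj_swap (s : ℝ) (g : ℂ) {z : ℂ} (hz : star z * z = 1) :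
    !![0, 1; 1, 0] * (stepMat s g z).map star * !![0, 1; 1, 0] = (star z ^ 2) • stepMat s g z := by
  have h1 : star z ^ 2 * z ^ 2 = 1 := by rw [← mul_pow, hz, one_pow]
  have hs : star (s : ℂ) = s := conj_ofReal s
  rw [swap_conj]
  ext i j
  fin_cases i <;> fin_cases j <;>
    simp only [stepMat, map_apply, mul_apply, Fin.sum_univ_two, Matrix.smul_apply, smul_eq_mul,
      Fin.zero_eta, Fin.mk_one, of_apply, cons_val', cons_val_zero, cons_val_one,
      cons_val_fin_one, star_add, star_mul', star_pow, star_one, star_star, star_def,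
      conj_ofReal] <;> simp only [← star_def, star_add, star_mul', star_pow, star_star, star_one, hs, one_mul, mul_one]
  · linear_combination (-(star z * s * star g)) * hz
  · linear_combination (-(star z * g)) * hz - s * h1
  · linear_combination (-(star z * star g)) * hz
  · linear_combination (-(star z * s * g)) * hz - h1

/-- On the unit circle the characteristic polynomial of a ring is real up to a phase. -/
lemma exists_real_segProd_trace {C : ℕ → Matrix (Fin 2) (Fin 2) ℂ} {z : ℂ} (hz : star z * z = 1)
    (hC : ∀ j, !![0, 1; 1, 0] * (C j).map star * !![0, 1; 1, 0] = (star z ^ 2) • C j) (i n : ℕ) :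
    !![0, 1; 1, 0] * (segProd C i n).map star * !![0, 1; 1, 0] = (star z ^ (2 * n)) • segProd C i n := by
  have hR : (!![0, 1; 1, 0] : Matrix (Fin 2) (Fin 2) ℂ) * !![0, 1; 1, 0] = 1 := by
    ext i j; fin_cases i <;> fin_cases j <;> simp
  induction n generalizing i with
  | zero =>
    rw [segProd_zero]
    have : (1 : Matrix (Fin 2) (Fin 2) ℂ).map star = 1 := by
      ext i j; fin_cases i <;> fin_cases j <;> simp
    rw [this, mul_one, hR]
    simp
  | succ n ih =>
    rw [segProd_succ]
    have hm : (C i * segProd C (i + 1) n).map star = (C i).map star * (segProd C (i + 1) n).map star := by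
      exact Matrix.map_mul (f := starRingEnd ℂ)
    rw [hm]
    calc !![0, 1; 1, 0] * ((C i).map star * (segProd C (i + 1) n).map star) * !![0, 1; 1, 0]
        = (!![0, 1; 1, 0] * (C i).map star * !![0, 1; 1, 0]) *
          (!![0, 1; 1, 0] * (segProd C (i + 1) n).map star * !![0, 1; 1, 0]) := by
          simp only [mul_assoc]
          rw [← mul_assoc !![0, 1; 1, 0] !![0, 1; 1, 0], hR, one_mul]
      _ = _ := by
          rw [hC, ih, smul_mul_smul_comm, ← pow_add]
          congr 2
          ring

lemma star_circ_mul (x : ℝ) : star (circ x) * circ x = 1 := by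
  rw [← circ_neg_eq_star, mul_comm, circ_mul_circ_neg]

lemma circ_ne_zero (x : ℝ) : circ x ≠ 0 := by
  intro h
  have := norm_circ x
  rw [h] at this
  simp at this

lemma exists_real_chi_ringN (t : ℝ) (n : ℕ) (hn : n ≠ 0) (α β x : ℕ → ℝ)
    (hf : ∀ j, fA t (β j) (x j) ≠ 0) (hα : ∀ j, cos (α j) ≠ 0) :
    ∃ e : ℝ → ℝ, ∀ s, (e s : ℂ) * circ s ^ n = chi (ringN t n α β x) (circ s) := by
  suffices h : ∀ s, ∃ r : ℝ, (r : ℂ) * circ s ^ n = chi (ringN t n α β x) (circ s) from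
    ⟨fun s => (h s).choose, fun s => (h s).choose_spec⟩
  intro s
  have hz := star_circ_mul s
  have h1 := exists_real_segProd_trace hz (C := fun j => stepMat (sin (α j)) (gA t (β j) (x j)) (circ s))
    (fun j => stepMat_conj_swap _ _ hz) 0 n
  rw [chi_ringN_eq_trace t n hn α β x hf hα (circ_ne_zero s)]
  set S := segProd (fun j => stepMat (sin (α j)) (gA t (β j) (x j)) (circ s)) 0 n
  have h2 : star S.trace = star (circ s) ^ (2 * n) * S.trace := by
    have := congrArg trace h1
    rw [trace_smul, smul_eq_mul] at this
    rw [← this, swap_conj]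
    simp [trace, Fin.sum_univ_two, add_comm]
  have h3 : star (circ s) ^ n * circ s ^ n = 1 := by rw [← mul_pow, hz, one_pow]
  have h4 : star (star (circ s) ^ n * S.trace) = star (circ s) ^ n * S.trace := by
    rw [star_mul', h2, star_pow, star_star]
    linear_combination (star (circ s) ^ n * S.trace) * h3
  refine ⟨(star (circ s) ^ n * S.trace).re -
    2 * ∏ j ∈ range n, (cos (α j) * fA t (β j) (x j)), ?_⟩
  rw [ofReal_sub, Complex.conj_eq_iff_re.1 h4, ofReal_mul, ofReal_prod]
  simp only [Complex.ofReal_ofNat]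
  linear_combination S.trace * h3

/-- Reflecting the bond angle shifts the characteristic polynomial of an odd ring. -/
lemma chi_qRing_flip (t α β : ℝ) {q : ℕ} (hq : Odd q) (φ θ : ℝ) (hα : cos α ≠ 0)
    (hf : ∀ x, fA t β x ≠ 0) {z : ℂ} (hz : z ≠ 0) :
    chi (qRing t (π - α) β q φ θ) z = chi (qRing t α β q φ θ) z +
      4 * z ^ q * (cos α : ℂ) ^ q * ((∏ j ∈ range q, fA t β (θ + j * φ) : ℝ) : ℂ) := by
  have hq0 : q ≠ 0 := fun h => by simp [h] at hq
  have hα' : cos (π - α) ≠ 0 := by rwa [cos_pi_sub, neg_ne_zero]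
  unfold qRing
  rw [chi_ringN_eq_trace t q hq0 _ _ _ (fun _ => hf _) (fun _ => hα') hz,
    chi_ringN_eq_trace t q hq0 _ _ _ (fun _ => hf _) (fun _ => hα) hz]
  simp only [sin_pi_sub, cos_pi_sub, ofReal_mul, prod_mul_distrib,
    prod_const, card_range, ofReal_neg, hq.neg_pow, ofReal_prod]
  ring

section Rational
variable {q : ℕ} [NeZero q]

/-- The character `n ↦ exp(2πi pn/q)`. -/
def rotChar (q : ℕ) [NeZero q] (p : ℤ) : AddChar (ZMod q) ℂ :=
  (ZMod.stdAddChar (N := q)).mulShift (p : ZMod q)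

lemma rotChar_isPrimitive {p : ℤ} (hp : IsUnit (p : ZMod q)) : (rotChar q p).IsPrimitive := by
  intro a ha
  rw [rotChar, AddChar.mulShift_mulShift]
  exact ZMod.isPrimitive_stdAddChar q (fun h => ha ((hp.mul_right_eq_zero).1 h))

lemma circ_eq_rotChar (p : ℤ) (n : ZMod q) : circ (n.val * (p / q : ℝ)) = rotChar q p n := by
  have h : (p : ZMod q) * n = ((p * n.val : ℤ) : ZMod q) := by
    push_cast
    rw [ZMod.natCast_zmod_val]
  rw [rotChar, AddChar.mulShift_apply, h, ZMod.stdAddChar_coe, circ]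
  congr 1
  push_cast
  ring

lemma chi_qRing_eq_sectors (t α β : ℝ) (p : ℤ) (z : ℂ) :
    chi (qRing t α β q (p / q) 0) z =
      chi (secV (rotChar q p) t I α β) z * chi (secV (rotChar q p) t (-I) α β) z := by
  rw [← chi_sector_split (rotChar q p) t α β (fun n => n.val * (p / q : ℝ)) (circ_eq_rotChar p)]
  obtain ⟨m, rfl⟩ : ∃ m, q = m + 1 := Nat.exists_eq_succ_of_ne_zero (NeZero.ne q)
  refine Eq.trans ?_ (ringOp_reindex t (Equiv.refl (Fin (m + 1)) : Fin (m + 1) ≃ ZMod (m + 1))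
    (finRotate (m + 1)) _ _ _ _ ?_ z).symm
  · rw [qRing, ringN]
    congr 2
    funext i
    simp only [Function.comp, zero_add]
    rfl
  · intro i
    rw [finRotate_apply]
    rfl

lemma chi_qRing_comm (t α β : ℝ) {p : ℤ} (hp : IsUnit (p : ZMod q)) (z : ℂ) :
    chi (qRing t α β q (p / q) 0) z = chi (qRing t β α q (p / q) 0) z := by
  rw [chi_qRing_eq_sectors, chi_qRing_eq_sectors, chi_secV_comm (rotChar_isPrimitive hp) t _ α β,
    chi_secV_comm (rotChar_isPrimitive hp) t _ α β]

lemma isPrimitiveRoot_circ {p : ℤ} (hp : IsUnit (p : ZMod q)) : IsPrimitiveRoot (circ (p / q)) q := by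
  have h := (Complex.isPrimitiveRoot_exp q (NeZero.ne q)).zpow_of_gcd_eq_one p
    (Int.isCoprime_iff_gcd_eq_one.1 ((ZMod.coe_int_isUnit_iff_isCoprime p q).1 hp).symm)
  have e : circ (p / q) = Complex.exp (2 * π * I / q) ^ p := ?_
  · rw [e]
    exact h
  rw [← Complex.exp_int_mul]
  unfold circ
  congr 1
  push_cast
  ring

lemma prod_add_circ (hq : Odd q) {p : ℤ} (hp : IsUnit (p : ZMod q)) (x y : ℂ) :
    ∏ j ∈ range q, (x + circ (j * (p / q)) * y) = x ^ q + y ^ q := by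
  have hr := isPrimitiveRoot_circ hp
  rw [hr.pow_add_pow_eq_prod_add_mul x y hq]
  refine Finset.prod_nbij (fun j => circ (j * (p / q))) ?_ ?_ ?_ fun _ _ => rfl
  · intro j _
    rw [Polynomial.mem_nthRootsFinset (NeZero.pos q), circ_nat_mul, ← pow_mul, mul_comm, pow_mul, hr.pow_eq_one,
      one_pow]
  · intro j hj k hk h
    simp only [circ_nat_mul] at h
    exact hr.pow_inj (mem_range.1 hj) (mem_range.1 hk) h
  · intro w hw
    obtain ⟨i, hi, rfl⟩ := hr.eq_pow_of_pow_eq_one ((Polynomial.mem_nthRootsFinset (NeZero.pos q) 1).1 hw)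
    exact ⟨i, by simpa using hi, by simp only [circ_nat_mul]⟩

end Rational

end

section

/-- The larger root of `y² - Py + b²/4`. -/
def bigRoot (P b : ℝ) : ℝ := (P + sqrt (P ^ 2 - b ^ 2)) / 2

/-- The smaller root of `y² - Py + b²/4`. -/
def smallRoot (P b : ℝ) : ℝ := (P - sqrt (P ^ 2 - b ^ 2)) / 2

lemma bigRoot_pos {P b : ℝ} (h : |b| < P) : 0 < bigRoot P b := by
  have := (abs_nonneg b).trans_lt h
  unfold bigRoot; positivity

lemma sqrt_arg_pos {P b : ℝ} (h : |b| < P) : 0 < P ^ 2 - b ^ 2 := by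
  have := sq_lt_sq' (by linarith [abs_nonneg b]) h
  rw [sq_abs] at this
  linarith

lemma bigRoot_mul_smallRoot {P b : ℝ} (h : |b| < P) : bigRoot P b * smallRoot P b = (b / 2) ^ 2 := by
  have := sq_sqrt (sqrt_arg_pos h).le
  unfold bigRoot smallRoot
  linear_combination (-1 / 4) * this

lemma smallRoot_nonneg {P b : ℝ} (h : |b| < P) : 0 ≤ smallRoot P b := by
  have h1 := bigRoot_mul_smallRoot h
  have h2 := bigRoot_pos h
  by_contra! h3
  nlinarith [sq_nonneg (b / 2)]

lemma smallRoot_le {P b : ℝ} : smallRoot P b ≤ bigRoot P b := by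
  unfold smallRoot bigRoot
  linarith [sqrt_nonneg (P ^ 2 - b ^ 2)]

lemma prod_add_cos {q : ℕ} [NeZero q] (hq : Odd q) {p : ℤ} (hp : IsUnit (p : ZMod q)) {P b : ℝ} (h : |b| < P) :
    ∏ j ∈ range q, (P + b * cos (2 * π * (j * (p / q)))) =
      bigRoot P b ^ q + smallRoot P b ^ q + 2 * (b / 2) ^ q := by
  set y := bigRoot P b with hy
  have hy0 : 0 < y := bigRoot_pos h
  have hym := bigRoot_mul_smallRoot h
  have hsum : y + smallRoot P b = P := by rw [hy, bigRoot, smallRoot]; ring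
  have h1 := prod_add_circ hq hp (y : ℂ) ((b / 2 : ℝ) : ℂ)
  have h2 := prod_add_circ hq (p := -p) (by rw [Int.cast_neg]; exact hp.neg) (y : ℂ) ((b / 2 : ℝ) : ℂ)
  have h3 : ∀ j : ℕ, ((y * (P + b * cos (2 * π * (j * (p / q)))) : ℝ) : ℂ) =
      ((y : ℂ) + circ (j * (p / q)) * ((b / 2 : ℝ) : ℂ)) * ((y : ℂ) + circ (j * ((-p : ℤ) / q)) * ((b / 2 : ℝ) : ℂ)) := by
    intro j
    have e1 := circ_add_circ_neg (j * (p / q) : ℝ)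
    have e2 := circ_mul_circ_neg (j * (p / q) : ℝ)
    have e3 : circ (j * ((-p : ℤ) / q)) = circ (-(j * (p / q) : ℝ)) := by
      congr 1; push_cast; ring
    rw [e3]
    have e4 : (y : ℂ) * P = y ^ 2 + ((b / 2 : ℝ) : ℂ) ^ 2 := by
      have : y * P = y ^ 2 + (b / 2) ^ 2 := by rw [← hsum, ← hym]; ring
      exact_mod_cast this
    rw [ofReal_mul, Complex.ofReal_add, ofReal_mul]
    have e5 : ((b / 2 : ℝ) : ℂ) * 2 = b := by push_cast; ring
    linear_combination e4 - ((b / 2 : ℝ) : ℂ) ^ 2 * e2 - (y : ℂ) * ((b / 2 : ℝ) : ℂ) * e1 -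
      (y : ℂ) * ((cos (2 * π * (j * (p / q))) : ℝ) : ℂ) * e5
  have h4 : y ^ q * ∏ j ∈ range q, (P + b * cos (2 * π * (j * (p / q)))) =
      (y ^ q + (b / 2) ^ q) * (y ^ q + (b / 2) ^ q) := by
    have : ∏ j ∈ range q, ((y * (P + b * cos (2 * π * (j * (p / q)))) : ℝ) : ℂ) =
        ((y : ℂ) ^ q + ((b / 2 : ℝ) : ℂ) ^ q) * ((y : ℂ) ^ q + ((b / 2 : ℝ) : ℂ) ^ q) := by
      rw [prod_congr rfl fun j _ => h3 j, prod_mul_distrib, h1, h2]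
    rw [← ofReal_prod, prod_mul_distrib, prod_const, card_range] at this
    exact_mod_cast this
  have h5 : y ^ q * smallRoot P b ^ q = (b / 2) ^ q * (b / 2) ^ q := by
    rw [← mul_pow, hym, ← mul_pow, sq]
  refine mul_left_cancel₀ (pow_pos hy0 q).ne' ?_
  rw [h4]
  linear_combination -h5

/-- The derivative of the sum of root powers is nonnegative when `P` and `P² - b²` increase. -/
lemma hasDerivAt_rootPowers {P b : ℝ → ℝ} {P' b' x : ℝ} (hP : HasDerivAt P P' x) (hb : HasDerivAt b b' x)
    (h : |b x| < P x) (hP' : 0 ≤ P') (hb' : b x * b' ≤ 0) (q : ℕ) :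
    ∃ D, 0 ≤ D ∧ HasDerivAt (fun s => bigRoot (P s) (b s) ^ q + smallRoot (P s) (b s) ^ q) D x := by
  have hP0 : 0 < P x := (abs_nonneg _).trans_lt h
  have hw := ((hP.fun_pow 2).fun_sub (hb.fun_pow 2)).sqrt (sqrt_arg_pos h).ne'
  obtain ⟨w', hw'⟩ : ∃ w', w' = (((2 : ℕ) : ℝ) * P x ^ (2 - 1) * P' - ((2 : ℕ) : ℝ) * b x ^ (2 - 1) * b') /
    (2 * sqrt (P x ^ 2 - b x ^ 2)) := ⟨_, rfl⟩
  rw [← hw'] at hw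
  have hw0 : 0 ≤ w' := by
    rw [hw']
    apply div_nonneg _ (by positivity)
    norm_num
    nlinarith [mul_nonneg hP0.le hP']
  have hbig := ((hP.fun_add hw).div_const 2).fun_pow q
  have hsmall := ((hP.fun_sub hw).div_const 2).fun_pow q
  refine ⟨_, ?_, hbig.fun_add hsmall⟩
  change 0 ≤ q * bigRoot (P x) (b x) ^ (q - 1) * ((P' + w') / 2) + q * smallRoot (P x) (b x) ^ (q - 1) * ((P' - w') / 2)
  have h1 : smallRoot (P x) (b x) ^ (q - 1) ≤ bigRoot (P x) (b x) ^ (q - 1) :=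
    pow_le_pow_left₀ (smallRoot_nonneg h) smallRoot_le _
  have h2 : 0 ≤ smallRoot (P x) (b x) ^ (q - 1) := pow_nonneg (smallRoot_nonneg h) _
  have h3 : 0 ≤ (q : ℝ) * ((bigRoot (P x) (b x) ^ (q - 1) - smallRoot (P x) (b x) ^ (q - 1)) * ((P' + w') / 2) +
      smallRoot (P x) (b x) ^ (q - 1) * P') := by
    have : 0 ≤ bigRoot (P x) (b x) ^ (q - 1) - smallRoot (P x) (b x) ^ (q - 1) := by linarith
    positivity
  nlinarith [h3]

/-- Parameters in the critical gapped regime, with common angle `α`. -/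
structure Regime (t α : ℝ) : Prop where
  pos : 0 < α
  lt : α < π / 2
  gap : |2 * t * cos α| < (1 - t ^ 2) * sin α

/-- The mean coin parameter. -/
def coinP (t α : ℝ) : ℝ := (1 / (1 + t ^ 2)) * ((1 - t ^ 2) * sin α)

/-- The coin oscillation parameter. -/
def coinB (t α : ℝ) : ℝ := (1 / (1 + t ^ 2)) * (2 * t * cos α)

/-- The exponential growth base of the determinant in the critical regime. -/
def base (t α : ℝ) : ℝ := cos α * bigRoot (coinP t α) (coinB t α)

lemma abs_coinB_lt {t α : ℝ} (h : |2 * t * cos α| < (1 - t ^ 2) * sin α) : |coinB t α| < coinP t α := by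
  rw [coinB, coinP, abs_mul, abs_of_pos (by positivity : (0 : ℝ) < 1 / (1 + t ^ 2))]
  exact mul_lt_mul_of_pos_left h (by positivity)

lemma fA_eq_coin (t α x : ℝ) : fA t α x = coinP t α - coinB t α * cos (2 * π * x) := by
  rw [fA, coinP, coinB]; ring

lemma fA_pi_sub_eq (t α x : ℝ) : fA t (π - α) x = coinP t α + coinB t α * cos (2 * π * x) := by
  rw [fA, coinP, coinB, sin_pi_sub, cos_pi_sub]; ring

lemma fA_pos {t α : ℝ} (h : |2 * t * cos α| < (1 - t ^ 2) * sin α) (x : ℝ) :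
    0 < fA t α x ∧ 0 < fA t (π - α) x := by
  have h1 := abs_lt.1 (abs_coinB_lt h)
  have h2 := abs_le.1 (abs_cos_le_one (2 * π * x))
  rw [fA_eq_coin, fA_pi_sub_eq]
  constructor <;> rcases le_total 0 (coinB t α) with h3 | h3 <;> nlinarith

namespace Regime
variable {t α : ℝ} (h : Regime t α)
include h

lemma cos_pos : 0 < cos α := Real.cos_pos_of_mem_Ioo ⟨by linarith [h.pos, pi_pos], h.lt⟩

lemma sin_pos : 0 < sin α := Real.sin_pos_of_pos_of_lt_pi h.pos (by linarith [h.lt, pi_pos])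

lemma base_pos : 0 < base t α := mul_pos h.cos_pos (bigRoot_pos (abs_coinB_lt h.gap))

lemma one_sub_sq_pos : 0 < 1 - t ^ 2 :=
  pos_of_mul_pos_left ((abs_nonneg _).trans_lt h.gap) h.sin_pos.le

end Regime

lemma prod_fA_pi_sub {q : ℕ} [NeZero q] (hq : Odd q) {p : ℤ} (hp : IsUnit (p : ZMod q)) {t α : ℝ}
    (h : |2 * t * cos α| < (1 - t ^ 2) * sin α) :
    ∏ j ∈ range q, fA t (π - α) (0 + j * (p / q)) =
      bigRoot (coinP t α) (coinB t α) ^ q + smallRoot (coinP t α) (coinB t α) ^ q + 2 * (coinB t α / 2) ^ q := by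
  simp only [zero_add, fA_pi_sub_eq]
  exact prod_add_cos hq hp (abs_coinB_lt h)

lemma hasDerivAt_base_prod {q : ℕ} [NeZero q] (hq : Odd q) {p : ℤ} (hp : IsUnit (p : ZMod q)) {t α : ℝ}
    (h : Regime t α) : ∃ D : ℝ, q * tan α * base t α ^ q ≤ D ∧
      HasDerivAt (fun σ => cos (α - σ) ^ q *
        ∏ j ∈ range q, fA t (π - α - σ) (0 + j * (p / q))) D 0 := by
  have hs : HasDerivAt (fun σ => sin (α + σ)) (cos α) 0 := by
    simpa using ((hasDerivAt_id (0 : ℝ)).const_add α).sin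
  have hc : HasDerivAt (fun σ => cos (α + σ)) (-sin α) 0 := by
    simpa using ((hasDerivAt_id (0 : ℝ)).const_add α).cos
  have hc' : HasDerivAt (fun σ => cos (α - σ)) (sin α) 0 := by
    simpa using ((hasDerivAt_id (0 : ℝ)).const_sub α).cos
  have hP : HasDerivAt (fun σ => coinP t (α + σ)) ((1 / (1 + t ^ 2)) * ((1 - t ^ 2) * cos α)) 0 :=
    (hs.const_mul _).const_mul _
  have hB : HasDerivAt (fun σ => coinB t (α + σ)) ((1 / (1 + t ^ 2)) * (2 * t * -sin α)) 0 :=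
    (hc.const_mul _).const_mul _
  have hC := h.cos_pos
  have hS := h.sin_pos
  have h1 := h.one_sub_sq_pos
  have hB0 : |coinB t (α + 0)| < coinP t (α + 0) := by simpa using abs_coinB_lt h.gap
  obtain ⟨D, hD0, hD⟩ := hasDerivAt_rootPowers hP hB hB0 (by positivity) (by
    simp only [add_zero, coinB]
    have : 0 ≤ (1 / (1 + t ^ 2)) ^ 2 * (2 * t) ^ 2 * (cos α * sin α) := by positivity
    nlinarith [this]) q
  have hE : HasDerivAt (fun σ => 2 * (cos (α - σ) * (coinB t (α + σ) / 2)) ^ q) 0 0 := by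
    refine (((hc'.fun_mul (hB.div_const 2)).fun_pow q).const_mul 2).congr_deriv ?_
    simp only [coinB, add_zero, sub_zero]
    ring
  have hF := ((hc'.fun_pow q).fun_mul hD).fun_add hE
  refine ⟨_, ?_, hF.congr_of_eventuallyEq ?_⟩
  · simp only [sub_zero, add_zero]
    have hy := bigRoot_pos (abs_coinB_lt h.gap)
    have hm := smallRoot_nonneg (abs_coinB_lt h.gap)
    obtain ⟨m, hm'⟩ : ∃ m, q = m + 1 := Nat.exists_eq_succ_of_ne_zero (NeZero.ne q)
    have e1 : q * tan α * base t α ^ q =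
        q * cos α ^ (q - 1) * sin α * bigRoot (coinP t α) (coinB t α) ^ q := by
      have e2 : cos α ^ q = cos α ^ (q - 1) * cos α := by
        rw [hm', Nat.add_sub_cancel, pow_succ]
      rw [Real.tan_eq_sin_div_cos, base, mul_pow, e2]
      field_simp
    rw [e1]
    have e3 : 0 ≤ q * cos α ^ (q - 1) * sin α * smallRoot (coinP t α) (coinB t α) ^ q := by positivity
    have e4 : 0 ≤ cos α ^ q * D := by positivity
    nlinarith [e3, e4]
  · have hev : ∀ᶠ σ in nhds (0 : ℝ), |2 * t * cos (α + σ)| < (1 - t ^ 2) * sin (α + σ) := by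
      refine ContinuousAt.eventually_lt (by fun_prop) (by fun_prop) ?_
      simpa using h.gap
    filter_upwards [hev] with σ hσ
    rw [show π - α - σ = π - (α + σ) by ring, prod_fA_pi_sub hq hp hσ]
    ring

end

section

lemma HasDerivAt.eq_zero_of_even {g : ℝ → ℂ} {D : ℂ} (h : HasDerivAt g D 0)
    (heven : ∀ᶠ σ in nhds (0 : ℝ), g (-σ) = g σ) : D = 0 := by
  have h1 : HasDerivAt (fun σ => g (-σ)) (-D) 0 := by
    have h2 : HasDerivAt g D (-0) := by simpa using h
    exact (h2.scomp (0 : ℝ) (hasDerivAt_neg (0 : ℝ))).congr_deriv (by simp)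
  have h2 := h.unique (h1.congr_of_eventuallyEq (by filter_upwards [heven] with σ hσ; exact hσ.symm))
  have h3 : (2 : ℂ) * D = 0 := by linear_combination h2
  simpa using h3

section Level
variable {q : ℕ} [NeZero q] {t α : ℝ}

lemma qRing_derivative (hq : Odd q) {p : ℤ} (hp : IsUnit (p : ZMod q)) (h : Regime t α) {F' : ℝ}
    (hF : HasDerivAt (fun σ => cos (α - σ) ^ q *
        ∏ j ∈ range q, fA t (π - α - σ) (0 + j * (p / q))) F' 0) {z : ℂ} (hz : z ≠ 0) {D : ℂ}
    (hD : HasDerivAt (fun σ : ℝ => chi (qRing t (α - σ) (π - α - σ) q (p / q) 0) z) D 0) :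
    D = -4 * F' * z ^ q := by
  have hF2 := (hF.ofReal_comp.const_mul (4 * z ^ q))
  have hg := hD.fun_add hF2
  have key : ∀ᶠ σ in nhds (0 : ℝ), chi (qRing t (α - σ) (π - α - σ) q (p / q) 0) z + 4 * z ^ q *
      ((cos (α - σ) ^ q * ∏ j ∈ range q, fA t (π - α - σ) (0 + j * (p / q)) : ℝ) : ℂ) =
      chi (qRing t (π - α + σ) (π - α - σ) q (p / q) 0) z := by
    have h1 : ∀ᶠ σ in nhds (0 : ℝ), |2 * t * cos (α + σ)| < (1 - t ^ 2) * sin (α + σ) := by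
      refine ContinuousAt.eventually_lt (by fun_prop) (by fun_prop) ?_
      simpa using h.gap
    have h2 : ∀ᶠ σ in nhds (0 : ℝ), 0 < cos (α - σ) := by
      refine ContinuousAt.eventually_lt (by fun_prop) (by fun_prop) ?_
      simpa using h.cos_pos
    filter_upwards [h1, h2] with σ h1 h2
    have := chi_qRing_flip t (α - σ) (π - α - σ) hq (p / q) 0 h2.ne'
      (fun x => by rw [show π - α - σ = π - (α + σ) by ring]; exact (fA_pos h1 x).2.ne') hz
    rw [show π - (α - σ) = π - α + σ by ring] at this
    rw [this]
    push_cast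
    ring
  have hzero := (hg.congr_of_eventuallyEq (f₁ := fun σ : ℝ =>
    chi (qRing t (π - α + σ) (π - α - σ) q (p / q) 0) z)
    (by filter_upwards [key] with σ hσ; exact hσ.symm)).eq_zero_of_even
    (Filter.Eventually.of_forall fun σ => by
      rw [chi_qRing_comm t _ _ hp, ← sub_eq_add_neg, sub_neg_eq_add])
  linear_combination hzero

/-- The real form of a rational ring takes both signs between neighbouring roots of one sector. -/
lemma sector_gap (hq : Odd q) (hq1 : 1 < q) {p : ℤ} (hp : IsUnit (p : ZMod q)) (h : Regime t α) {s : ℂ}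
    (hs : s * s = -1) (hs' : star s = -s) {s' : ℂ}
    (hsplit : ∀ α β z, chi (qRing t α β q (p / q) 0) z =
      chi (secV (rotChar q p) t s α β) z * chi (secV (rotChar q p) t s' α β) z) {e : ℝ → ℝ}
    (he : ∀ x, (e x : ℂ) * circ x ^ q = chi (qRing t α (π - α) q (p / q) 0) (circ x))
    (hsimple : ∀ x, chi (secV (rotChar q p) t s α (π - α)) (circ x) = 0 →
      deriv (chi (secV (rotChar q p) t s α (π - α))) (circ x) ≠ 0) {x y : ℝ} (hxy : x < y)
    (hx : chi (secV (rotChar q p) t s α (π - α)) (circ x) = 0)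
    (hy : chi (secV (rotChar q p) t s α (π - α)) (circ y) = 0)
    (hno : ∀ u, x < u → u < y → chi (secV (rotChar q p) t s α (π - α)) (circ u) ≠ 0) :
    ∃ u v, x < u ∧ u < y ∧ x < v ∧ v < y ∧ e u < 0 ∧ 0 < e v := by
  set ψ := rotChar q p
  have hc := h.cos_pos
  have hcard : 1 < card (ZMod q) := by rwa [ZMod.card]
  have hcomm : ∀ z, chi (secV ψ t s (π - α) α) z = chi (secV ψ t s α (π - α)) z := fun z =>
    chi_secV_comm (rotChar_isPrimitive hp) t s _ _ z
  have hcomm' : chi (secV ψ t s (π - α) α) = chi (secV ψ t s α (π - α)) := funext hcomm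
  have hE : ∀ w, e w = 0 ∨ chi (qRing t α (π - α) q (p / q) 0) (circ w) ≠ 0 := fun w => by
    by_cases h0 : e w = 0
    · exact Or.inl h0
    · right
      rw [← he]
      exact mul_ne_zero (mod_cast h0) (pow_ne_zero _ (circ_ne_zero w))
  have hpos1 : 0 < cos α ^ q * ∏ j ∈ range q, fA t (π - α) (0 + j * (p / q)) :=
    mul_pos (pow_pos hc q) (prod_pos fun j _ => (fA_pos h.gap _).2)
  have hpos2 : 0 < cos α ^ q * ∏ j ∈ range q, fA t α (0 + j * (p / q)) :=
    mul_pos (pow_pos hc q) (prod_pos fun j _ => (fA_pos h.gap _).1)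
  have hA : ∀ w, chi (secV ψ t s (π - α) (π - α)) (circ w) = 0 → e w < 0 := fun w hw => by
    have h1 := chi_qRing_flip t α (π - α) hq (p / q) 0 hc.ne' (fun x => (fA_pos h.gap x).2.ne') (circ_ne_zero w)
    rw [hsplit, hw, zero_mul, ← he] at h1
    have h2 : ((e w + 4 * (cos α ^ q * ∏ j ∈ range q, fA t (π - α) (0 + j * (p / q))) : ℝ) : ℂ) *
        circ w ^ q = 0 := by
      push_cast at h1 ⊢
      linear_combination -h1
    have h3 := (mul_eq_zero.1 h2).resolve_right (pow_ne_zero _ (circ_ne_zero w))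
    rw [Complex.ofReal_eq_zero] at h3
    linarith
  have hB : ∀ w, chi (secV ψ t s α α) (circ w) = 0 → 0 < e w := fun w hw => by
    have h1 := chi_qRing_flip t α α hq (p / q) 0 hc.ne' (fun x => (fA_pos h.gap x).1.ne') (circ_ne_zero w)
    rw [chi_qRing_comm t (π - α) α hp, hsplit α α, hw, zero_mul, ← he] at h1
    have h2 : ((e w - 4 * (cos α ^ q * ∏ j ∈ range q, fA t α (0 + j * (p / q))) : ℝ) : ℂ) *
        circ w ^ q = 0 := by
      push_cast at h1 ⊢
      linear_combination h1
    have h3 := (mul_eq_zero.1 h2).resolve_right (pow_ne_zero _ (circ_ne_zero w))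
    rw [Complex.ofReal_eq_zero] at h3
    linarith
  have hroot : ∀ w, chi (secV ψ t s α (π - α)) (circ w) = 0 → e w = 0 := fun w hw => by
    refine (hE w).resolve_right fun h1 => h1 ?_
    rw [hsplit, hw, zero_mul]
  obtain ⟨i, τ, hi⟩ := chi_secV_flip (ψ := ψ) hq hs hs' t α (π - α)
  obtain ⟨i', τ', hi'⟩ := chi_secV_flip (ψ := ψ) hq hs hs' t (π - α) α
  rw [sub_sub_cancel] at hi'
  obtain ⟨u, hu1, hu2, hu⟩ := exists_root_between (secV_unitary ψ hs hs' t α (π - α)) hcard i τ hsimple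
    (fun w hw => by
      rw [← hi]
      intro h1
      exact (hA w h1).ne (hroot w hw)) hxy hx hy hno
  obtain ⟨v, hv1, hv2, hv⟩ := exists_root_between (secV_unitary ψ hs hs' t (π - α) α) hcard i' τ'
    (by rw [hcomm']; exact hsimple)
    (fun w hw => by
      rw [hcomm'] at hw
      rw [← hi']
      intro h1
      exact (hB w h1).ne' (hroot w hw)) hxy (by rw [hcomm', hx]) (by rw [hcomm', hy]) (by rw [hcomm']; exact hno)
  exact ⟨u, v, hu1, hu2, hv1, hv2, hA u (by rw [hi, hu]), hB v (by rw [hi', hv])⟩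

/-- Sublevel sets of the rational determinant have small measure. -/
theorem qRing_level_measure (hq : Odd q) (hq1 : 1 < q) {p : ℤ} (hp : IsUnit (p : ZMod q)) (h : Regime t α)
    {K : ℝ} (hK : 0 < K) :
    volume {s : ℝ | s ∈ Ico (0 : ℝ) 1 ∧
      ‖chi (qRing t α (π - α) q (p / q) 0) (circ s)‖ < K * base t α ^ q} ≤
      ofReal (6 * sqrt (K / (2 * tan α) / q)) := by
  set ψ := rotChar q p with hψ
  have hI : I * I = -1 := I_mul_I
  have hI' : star I = -I := by simp
  have hJ : -I * -I = -1 := by simp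
  have hJ' : star (-I) = - -I := by simp
  obtain ⟨d1, h1, hd1, hs1, hc1, hD1⟩ := secV_derivative (ψ := ψ) hq hI hI' t α (π - α)
  obtain ⟨d2, h2, hd2, hs2, hc2, hD2⟩ := secV_derivative (ψ := ψ) hq hJ hJ' t α (π - α)
  obtain ⟨F', hF', hF⟩ := hasDerivAt_base_prod hq hp h
  obtain ⟨e, he⟩ := exists_real_chi_ringN t q (NeZero.ne q) (fun _ => α) (fun _ => π - α)
    (fun j => 0 + j * (p / q)) (fun _ => (fA_pos h.gap _).2.ne') (fun _ => h.cos_pos.ne')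
  have htan : 0 < tan α := by
    rw [Real.tan_eq_sin_div_cos]; exact div_pos h.sin_pos h.cos_pos
  have hq0 : (0 : ℝ) < q := mod_cast NeZero.pos q
  have ha := h.base_pos
  have hlow : 0 < q * tan α * base t α ^ q := by positivity
  have hF'0 : 0 < F' := hlow.trans_le hF'
  have hsplit : ∀ z, chi (qRing t α (π - α) q (p / q) 0) z =
      (∏ k, (1 - z * d1 k)) * ∏ k, (1 - z * d2 k) := fun z => by
    rw [chi_qRing_eq_sectors, ← hc1, ← hc2]
  have he' : ∀ x, (e x : ℂ) * circ x ^ q = (∏ k, (1 - circ x * d1 k)) * ∏ k, (1 - circ x * d2 k) := fun x => by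
    rw [he, ← hsplit]; rfl
  have hres : ∀ z, ((-4 * F' : ℝ) : ℂ) * z ^ q = -I * (∑ j, h1 j * (z * d1 j) *
      ∏ k ∈ univ.erase j, (1 - z * d1 k)) * ∏ k, (1 - z * d2 k) +
      (∏ k, (1 - z * d1 k)) * (I * ∑ j, h2 j * (z * d2 j) *
      ∏ k ∈ univ.erase j, (1 - z * d2 k)) := fun z => by
    rcases eq_or_ne z 0 with rfl | hz
    · simp [NeZero.ne q]
    · have hD := (hD1 z).fun_mul (hD2 z)
      simp only [sub_zero, ← hc1 z, ← hc2 z] at hD ⊢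
      have := qRing_derivative hq hp h hF hz (hD.congr_of_eventuallyEq
        (Filter.Eventually.of_forall fun σ => chi_qRing_eq_sectors t _ _ p z))
      push_cast
      rw [neg_neg] at this
      rw [← this]
  have hf1 : (fun z => ∏ k, (1 - z * d1 k)) = chi (secV ψ t I α (π - α)) := funext fun z => (hc1 z).symm
  have hf2 : (fun z => ∏ k, (1 - z * d2 k)) = chi (secV ψ t (-I) α (π - α)) :=
    funext fun z => (hc2 z).symm
  have hp1 := weights_mul_pos hd1 hd2 (c := -4 * F') (by nlinarith) he' hres (by
    intro hsim x y hxy hx hy hno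
    rw [hf1] at hsim
    simp only [← hc1] at hsim hx hy hno
    exact sector_gap hq hq1 hp h hI hI' (fun α β z => chi_qRing_eq_sectors t α β p z) he hsim hxy hx hy hno)
  have hp2 := weights_mul_pos (T := fun z => I * ∑ j, h1 j * (z * d1 j) *
      ∏ k ∈ univ.erase j, (1 - z * d1 k)) hd2 hd1 (h1 := h2) (c := 4 * F') (n := q) (e := e) (by nlinarith)
    (fun x => by rw [he', mul_comm]) (fun z => by
      have := hres z
      push_cast at this ⊢
      linear_combination -this) (by
    intro hsim x y hxy hx hy hno
    rw [hf2] at hsim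
    simp only [← hc2] at hsim hx hy hno
    exact sector_gap hq hq1 hp h hJ hJ' (s' := I)
      (fun α β z => by rw [chi_qRing_eq_sectors t α β p z, mul_comm]) he hsim hxy hx hy hno)
  have hlev := level_measure_le hd1 hd2 hs1 hs2 hp1 hp2 hres
    (l := 8 * q * tan α / K) (by positivity)
  refine (measure_mono ?_).trans (hlev.trans (ofReal_le_ofReal ?_))
  · rintro s ⟨hs0, hs⟩
    refine ⟨hs0, ?_⟩
    rw [← hsplit, abs_mul, abs_of_pos hF'0, abs_neg, abs_of_pos (by norm_num : (0 : ℝ) < 4)]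
    calc _ < K * base t α ^ q * (8 * q * tan α / K) := mul_lt_mul_of_pos_right hs (by positivity)
      _ = 2 * (4 * (q * tan α * base t α ^ q)) := by field_simp; ring
      _ ≤ _ := by linarith
  · apply le_of_eq
    congr 2
    field_simp
    ring

end Level

end

lemma trace_pow_of_charpoly {M : Matrix (Fin 2) (Fin 2) ℂ} {y w : ℂ} (htr : M.trace = -(y + w)) (hdet : M.det = y * w)
    (n : ℕ) : (M ^ n).trace = (-y) ^ n + (-w) ^ n := by
  have h2 : M * M = -(y + w) • M - (y * w) • 1 := by
    rw [trace_fin_two] at htr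
    rw [det_fin_two] at hdet
    ext i j
    fin_cases i <;> fin_cases j <;> simp [mul_apply, Fin.sum_univ_two]
    · linear_combination (M 0 0) * htr - hdet
    · linear_combination (M 0 1) * htr
    · linear_combination (M 1 0) * htr
    · linear_combination (M 1 1) * htr - hdet
  induction n using Nat.twoStepInduction with
  | zero => simp [trace_fin_two]; norm_num
  | one => simp only [pow_one, htr]; ring
  | more n ih1 ih2 =>
    have h3 : M ^ (n + 2) = -(y + w) • M ^ (n + 1) - (y * w) • M ^ n := by
      rw [pow_add, sq, h2, mul_sub, mul_smul_comm, mul_smul_comm, mul_one, pow_succ]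
    rw [h3, trace_sub, trace_smul, trace_smul, ih1, ih2, smul_eq_mul, smul_eq_mul]
    ring

lemma segProd_map {M N : Type*} [Monoid M] [Monoid N] (f : M →* N) (C : ℕ → M) (i k : ℕ) :
    f (segProd C i k) = segProd (fun j => f (C j)) i k := by
  induction k generalizing i with
  | zero => simp [segProd_zero]
  | succ k ih => rw [segProd_succ, segProd_succ, map_mul, ih]

lemma segProd_const {M : Type*} [Monoid M] (c : M) (i k : ℕ) : segProd (fun _ => c) i k = c ^ k := by
  induction k generalizing i with
  | zero => simp [segProd_zero]
  | succ k ih => rw [segProd_succ, ih, pow_succ']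

lemma segProd_coeff {C : ℕ → Matrix (Fin 2) (Fin 2) (Polynomial ℂ)} {d : ℕ}
    (hC : ∀ j a b, (C j a b).natDegree ≤ d) (i k : ℕ) :
    (∀ a b, (segProd C i k a b).natDegree ≤ d * k) ∧
      ∀ a b, (segProd C i k a b).coeff (d * k) = segProd (fun j => (C j).map (fun p => p.coeff d)) i k a b := by
  induction k generalizing i with
  | zero =>
    simp only [segProd_zero, mul_zero]
    constructor
    · intro a b
      fin_cases a <;> fin_cases b <;> simp
    · intro a b
      fin_cases a <;> fin_cases b <;> simp
  | succ k ih =>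
    obtain ⟨h1, h2⟩ := ih (i + 1)
    simp only [segProd_succ]
    constructor
    · intro a b
      rw [mul_apply, Fin.sum_univ_two]
      refine Polynomial.natDegree_add_le_of_degree_le ?_ ?_ <;>
        exact Polynomial.natDegree_mul_le.trans
          (by rw [Nat.mul_succ, add_comm]; exact Nat.add_le_add (h1 _ _) (hC _ _ _))
    · intro a b
      rw [mul_apply, mul_apply, Fin.sum_univ_two, Fin.sum_univ_two, coeff_add,
        show d * (k + 1) = d + d * k by ring, Polynomial.coeff_mul_add_eq_of_natDegree_le (hC _ _ _) (h1 _ _),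
        Polynomial.coeff_mul_add_eq_of_natDegree_le (hC _ _ _) (h1 _ _), h2, h2]
      rfl

lemma trace_segProd_rotate {C : ℕ → Matrix (Fin 2) (Fin 2) ℂ} {n : ℕ} (hC : C n = C 0) :
    (segProd C 1 n).trace = (segProd C 0 n).trace := by
  rcases n with _ | n
  · rfl
  · have h1 : segProd C 1 (n + 1) = segProd C 1 n * C (n + 1) := by
      rw [segProd_add, segProd_succ, segProd_zero, mul_one, add_comm 1 n]
    rw [h1, hC, trace_mul_comm, segProd_succ]

lemma segProd_shift {M : Type*} [Monoid M] (C : ℕ → M) (i k : ℕ) :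
    segProd (fun j => C (j + 1)) i k = segProd C (i + 1) k := by
  induction k generalizing i with
  | zero => rfl
  | succ k ih => rw [segProd_succ, segProd_succ, ih]

/-- The step matrix times the phase, as a polynomial in the phase `U = wX`. -/
def stepPoly (t s β : ℝ) (z w : ℂ) : Matrix (Fin 2) (Fin 2) (Polynomial ℂ) :=
  let κ : ℂ := (1 / (1 + t ^ 2) : ℝ)
  let G := Polynomial.C (κ * z * t ^ 2 * cos β * w ^ 2) * Polynomial.X ^ 2 -
    Polynomial.C (κ * z * 2 * t * sin β * w) * Polynomial.X - Polynomial.C (κ * z * cos β)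
  let G' := Polynomial.C (κ * z * t ^ 2 * cos β) -
    Polynomial.C (κ * z * 2 * t * sin β * w) * Polynomial.X -
    Polynomial.C (κ * z * cos β * w ^ 2) * Polynomial.X ^ 2
  let S := Polynomial.C (s : ℂ)
  !![Polynomial.C w * Polynomial.X + S * G', G + S * (Polynomial.C (z ^ 2 * w) * Polynomial.X);
    S * (Polynomial.C w * Polynomial.X) + G', S * G + Polynomial.C (z ^ 2 * w) * Polynomial.X]

lemma stepPoly_eval (t s β : ℝ) (z : ℂ) (x y : ℝ) :
    (stepPoly t s β z (circ y)).map (eval (circ x)) =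
      circ (x + y) • stepMat s (gA t β (x + y)) z := by
  have h := circ_mul_circ_neg (x + y)
  have h1 := circ_add x y
  rw [stepMat, star_gA, gA]
  generalize circ (-(x + y)) = u' at *
  rw [h1] at *
  generalize circ x = a at *
  generalize circ y = b at *
  ext i j
  fin_cases i <;> fin_cases j <;>
    simp only [stepPoly, map_apply, Matrix.smul_apply, mul_apply, Fin.sum_univ_two, Fin.zero_eta, Fin.mk_one,
      of_apply, cons_val', cons_val_zero, cons_val_one, cons_val_fin_one,
      eval_add, Polynomial.eval_sub, eval_mul, eval_C, eval_X,
      Polynomial.eval_pow, smul_eq_mul]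
  · linear_combination (-(s : ℂ) * z * ((1 / (1 + t ^ 2) : ℝ) : ℂ) * t ^ 2 * (cos β : ℝ)) * h
  · linear_combination (z * ((1 / (1 + t ^ 2) : ℝ) : ℂ) * (cos β : ℝ)) * h
  · linear_combination (- z * ((1 / (1 + t ^ 2) : ℝ) : ℂ) * t ^ 2 * (cos β : ℝ)) * h
  · linear_combination ((s : ℂ) * z * ((1 / (1 + t ^ 2) : ℝ) : ℂ) * (cos β : ℝ)) * h

section

variable {q : ℕ} [NeZero q]

lemma prod_fA_phase {q : ℕ} [NeZero q] (hq : Odd q) {p : ℤ} (hp : IsUnit (p : ZMod q)) {t α : ℝ}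
    (h : |2 * t * cos α| < (1 - t ^ 2) * sin α) (θ : ℝ) :
    ∏ j ∈ range q, fA t (π - α) (θ + j * (p / q)) ≤ 4 * bigRoot (coinP t α) (coinB t α) ^ q := by
  have h := abs_coinB_lt h
  simp only [fA_pi_sub_eq]
  generalize coinP t α = P at *
  generalize coinB t α = b at *
  obtain ⟨y, hy⟩ : ∃ y, y = bigRoot P b := ⟨_, rfl⟩
  have hy0 : 0 < y := hy ▸ bigRoot_pos h
  have hym := bigRoot_mul_smallRoot h
  have hsum : y + smallRoot P b = P := by rw [hy, bigRoot, smallRoot]; ring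
  have hyb : |b / 2| ≤ y := by
    rw [abs_div, abs_two, hy, bigRoot]
    have := sqrt_nonneg (P ^ 2 - b ^ 2)
    linarith
  rw [← hy] at hym ⊢
  have h1 := prod_add_circ hq hp (y : ℂ) (circ θ * ((b / 2 : ℝ) : ℂ))
  have h2 := prod_add_circ hq (p := -p) (by rw [Int.cast_neg]; exact hp.neg) (y : ℂ) (circ (-θ) * ((b / 2 : ℝ) : ℂ))
  have h3 : ∀ j : ℕ, ((y * (P + b * cos (2 * π * (θ + j * (p / q)))) : ℝ) : ℂ) =
      ((y : ℂ) + circ (j * (p / q)) * (circ θ * ((b / 2 : ℝ) : ℂ))) *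
        ((y : ℂ) + circ (j * ((-p : ℤ) / q)) * (circ (-θ) * ((b / 2 : ℝ) : ℂ))) := by
    intro j
    have e1 := circ_add_circ_neg (θ + j * (p / q) : ℝ)
    have e2 := circ_mul_circ_neg (θ + j * (p / q) : ℝ)
    have e3 : circ (j * ((-p : ℤ) / q)) * (circ (-θ) * ((b / 2 : ℝ) : ℂ)) =
        circ (-(θ + j * (p / q) : ℝ)) * ((b / 2 : ℝ) : ℂ) := by
      rw [← mul_assoc, ← circ_add]
      congr 2; push_cast; ring
    have e3' : circ (j * (p / q)) * (circ θ * ((b / 2 : ℝ) : ℂ)) =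
        circ (θ + j * (p / q) : ℝ) * ((b / 2 : ℝ) : ℂ) := by
      rw [← mul_assoc, ← circ_add]
      congr 2; ring
    rw [e3, e3']
    have e4 : (y : ℂ) * P = y ^ 2 + ((b / 2 : ℝ) : ℂ) ^ 2 := by
      have : y * P = y ^ 2 + (b / 2) ^ 2 := by rw [← hsum, ← hym]; ring
      exact_mod_cast this
    rw [ofReal_mul, Complex.ofReal_add, ofReal_mul]
    have e5 : ((b / 2 : ℝ) : ℂ) * 2 = b := by push_cast; ring
    linear_combination e4 - ((b / 2 : ℝ) : ℂ) ^ 2 * e2 - (y : ℂ) * ((b / 2 : ℝ) : ℂ) * e1 -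
      (y : ℂ) * ((cos (2 * π * (θ + j * (p / q))) : ℝ) : ℂ) * e5
  have hb : ∀ x : ℝ, ‖(y : ℂ) ^ q + (circ x * ((b / 2 : ℝ) : ℂ)) ^ q‖ ≤ 2 * y ^ q := by
    intro x
    refine (norm_add_le _ _).trans ?_
    rw [norm_pow, norm_pow, norm_mul, norm_circ, one_mul, norm_real, norm_real, norm_eq_abs,
      norm_eq_abs, abs_of_pos hy0]
    have := pow_le_pow_left₀ (abs_nonneg _) hyb q
    linarith
  have h4 : ‖∏ j ∈ range q, ((y * (P + b * cos (2 * π * (θ + j * (p / q)))) : ℝ) : ℂ)‖ ≤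
      (2 * y ^ q) * (2 * y ^ q) := by
    rw [prod_congr rfl fun j _ => h3 j, prod_mul_distrib, h1, h2, norm_mul]
    exact mul_le_mul (hb _) (hb _) (norm_nonneg _) (by positivity)
  rw [← ofReal_prod, norm_real, norm_eq_abs, prod_mul_distrib, prod_const,
    card_range] at h4
  have h5 := (le_abs_self _).trans h4
  have hyq : 0 < y ^ q := by positivity
  refine le_of_mul_le_mul_left (h5.trans (le_of_eq ?_)) hyq
  ring

/-- The transfer trace times the phases, as a polynomial in the phase variable. -/
def chamPoly (t s β φ : ℝ) (z : ℂ) (q : ℕ) : Polynomial ℂ :=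
  (segProd (fun j => stepPoly t s β z (circ (j * φ))) 0 q).trace

lemma chamPoly_eval (t s β φ : ℝ) (z : ℂ) (q : ℕ) (x : ℝ) :
    (chamPoly t s β φ z q).eval (circ x) =
      (∏ j ∈ range q, circ (x + j * φ)) *
        (segProd (fun j => stepMat s (gA t β (x + j * φ)) z) 0 q).trace := by
  have h1 := segProd_map ((evalRingHom (circ x)).mapMatrix (m := Fin 2)).toMonoidHom
    (fun j => stepPoly t s β z (circ (j * φ))) 0 q
  have h2 : (chamPoly t s β φ z q).eval (circ x) =
      (((evalRingHom (circ x)).mapMatrix (m := Fin 2)).toMonoidHom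
        (segProd (fun j => stepPoly t s β z (circ (j * φ))) 0 q)).trace := by
    rw [chamPoly, trace_fin_two, trace_fin_two, eval_add]
    rfl
  have h3 : (fun j : ℕ => ((evalRingHom (circ x)).mapMatrix (m := Fin 2)).toMonoidHom
      (stepPoly t s β z (circ (j * φ)))) = fun j : ℕ => circ (x + j * φ) • stepMat s (gA t β (x + j * φ)) z :=
    funext fun j => stepPoly_eval t s β z x (j * φ)
  rw [h2, h1, h3, segProd_smul, trace_smul, smul_eq_mul]
  simp

lemma stepPoly_natDegree (t s β : ℝ) (z w : ℂ) (a b : Fin 2) : (stepPoly t s β z w a b).natDegree ≤ 2 := by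
  fin_cases a <;> fin_cases b <;>
    simp only [stepPoly, Fin.zero_eta, Fin.mk_one, of_apply, cons_val', cons_val_zero,
      cons_val_one, cons_val_fin_one] <;> compute_degree

lemma stepPoly_coeff_two (t s β : ℝ) (z w : ℂ) :
    (stepPoly t s β z w).map (fun p => p.coeff 2) =
      (w ^ 2) • (((1 / (1 + t ^ 2) : ℝ) * z * cos β : ℂ) • !![-(s : ℂ), (t : ℂ) ^ 2; -1, s * t ^ 2]) := by
  ext a b
  fin_cases a <;> fin_cases b <;>
    simp only [stepPoly, map_apply, Matrix.smul_apply, Fin.zero_eta, Fin.mk_one, of_apply,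
      cons_val', cons_val_zero, cons_val_one, cons_val_fin_one, coeff_add,
      coeff_sub, coeff_C_mul, coeff_X_pow, coeff_X, coeff_C,
      smul_eq_mul] <;> norm_num <;> ring1

lemma stepPoly_coeff_zero (t s β : ℝ) (z w : ℂ) :
    (stepPoly t s β z w).map (fun p => p.coeff 0) =
      ((1 / (1 + t ^ 2) : ℝ) * z * cos β : ℂ) • !![(s : ℂ) * t ^ 2, -1; (t : ℂ) ^ 2, -s] := by
  ext a b
  fin_cases a <;> fin_cases b <;>
    simp only [stepPoly, map_apply, Matrix.smul_apply, Fin.zero_eta, Fin.mk_one, of_apply,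
      cons_val', cons_val_zero, cons_val_one, cons_val_fin_one, coeff_add,
      coeff_sub, coeff_C_mul, coeff_X_pow, coeff_X, coeff_C,
      smul_eq_mul] <;> norm_num <;> ring1

lemma chamPoly_natDegree (t s β φ : ℝ) (z : ℂ) (q : ℕ) : (chamPoly t s β φ z q).natDegree ≤ 2 * q := by
  rw [chamPoly, trace_fin_two]
  have := (segProd_coeff (C := fun j : ℕ => stepPoly t s β z (circ (j * φ)))
    (fun j a b => stepPoly_natDegree _ _ _ _ _ a b) 0 q).1
  exact Polynomial.natDegree_add_le_of_degree_le (this _ _) (this _ _)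

lemma trace_pow_bound {t α : ℝ} (h : |2 * t * cos α| < (1 - t ^ 2) * sin α) (hc : 0 ≤ cos α) {z : ℂ}
    (hz : ‖z‖ = 1) (q : ℕ) {M : Matrix (Fin 2) (Fin 2) ℂ} (htr : M.trace = -(sin α) * (1 - t ^ 2))
    (hdet : M.det = t ^ 2 * cos α ^ 2) :
    ‖(((((1 / (1 + t ^ 2) : ℝ) : ℂ) * z * cos (π - α)) • M) ^ q).trace‖ ≤ 2 * base t α ^ q := by
  have hb := abs_coinB_lt h
  have hy0 := bigRoot_pos hb
  have hw0 := smallRoot_nonneg hb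
  have hwy : smallRoot (coinP t α) (coinB t α) ≤ bigRoot (coinP t α) (coinB t α) := smallRoot_le
  have hym := bigRoot_mul_smallRoot hb
  have hsum : bigRoot (coinP t α) (coinB t α) + smallRoot (coinP t α) (coinB t α) = coinP t α := by
    rw [bigRoot, smallRoot]; ring
  rw [base]
  generalize bigRoot (coinP t α) (coinB t α) = y at *
  generalize smallRoot (coinP t α) (coinB t α) = w at *
  have hsum' : (y : ℂ) + w = ((1 / (1 + t ^ 2) : ℝ) : ℂ) * ((1 - t ^ 2) * sin α) := by
    rw [← Complex.ofReal_add, hsum, coinP, ofReal_mul]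
    push_cast; ring
  have hprod' : (y : ℂ) * w = (((1 / (1 + t ^ 2) : ℝ) : ℂ) * (t * cos α)) ^ 2 := by
    rw [← ofReal_mul, hym, coinB, ← ofReal_mul, ← ofReal_mul, ← ofReal_pow]
    congr 1; ring
  rw [cos_pi_sub, ofReal_neg]
  generalize ((1 / (1 + t ^ 2) : ℝ) : ℂ) = κ at *
  rw [trace_pow_of_charpoly (y := -(z * cos α * y)) (w := -(z * cos α * w))]
  · rw [neg_neg, neg_neg]
    refine (norm_add_le _ _).trans ?_
    rw [norm_pow, norm_pow, norm_mul, norm_mul, norm_mul, norm_mul, hz, norm_real, norm_real,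
      norm_real, norm_eq_abs, norm_eq_abs, norm_eq_abs, abs_of_nonneg hc, abs_of_pos hy0,
      abs_of_nonneg hw0, one_mul]
    have := pow_le_pow_left₀ (mul_nonneg hc hw0) (mul_le_mul_of_nonneg_left hwy hc) q
    linarith
  · rw [trace_smul, htr, smul_eq_mul]
    linear_combination (-z * cos α) * hsum'
  · rw [det_smul, hdet, card_fin]
    linear_combination (-(z * cos α) ^ 2) * hprod'

lemma chamPoly_coeff_ends {t α : ℝ} (h : |2 * t * cos α| < (1 - t ^ 2) * sin α) (hc : 0 ≤ cos α) {z : ℂ}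
    (hz : ‖z‖ = 1) (q : ℕ) (φ : ℝ) :
    ‖(chamPoly t (sin α) (π - α) φ z q).coeff 0‖ ≤ 2 * base t α ^ q ∧
      ‖(chamPoly t (sin α) (π - α) φ z q).coeff (2 * q)‖ ≤ 2 * base t α ^ q := by
  have hsc : (sin α : ℂ) ^ 2 + (cos α : ℂ) ^ 2 = 1 := by
    rw [← ofReal_pow, ← ofReal_pow, ← Complex.ofReal_add, Real.sin_sq_add_cos_sq, ofReal_one]
  constructor
  · have h1 := segProd_map ((evalRingHom (0 : ℂ)).mapMatrix (m := Fin 2)).toMonoidHom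
      (fun j => stepPoly t (sin α) (π - α) z (circ (j * φ))) 0 q
    have h2 : (chamPoly t (sin α) (π - α) φ z q).coeff 0 =
        (((evalRingHom (0 : ℂ)).mapMatrix (m := Fin 2)).toMonoidHom
          (segProd (fun j => stepPoly t (sin α) (π - α) z (circ (j * φ))) 0 q)).trace := by
      rw [chamPoly, trace_fin_two, trace_fin_two, Polynomial.coeff_zero_eq_eval_zero, eval_add]
      rfl
    have h3 : (fun j : ℕ => ((evalRingHom (0 : ℂ)).mapMatrix (m := Fin 2)).toMonoidHom
        (stepPoly t (sin α) (π - α) z (circ (j * φ)))) = fun _ =>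
        ((1 / (1 + t ^ 2) : ℝ) * z * cos (π - α) : ℂ) •
          !![(sin α : ℂ) * t ^ 2, -1; (t : ℂ) ^ 2, -(sin α : ℂ)] :=
      funext fun j => by
        rw [← stepPoly_coeff_zero t (sin α) (π - α) z (circ (j * φ))]
        ext a b
        exact (Polynomial.coeff_zero_eq_eval_zero _).symm
    rw [h2, h1, h3, segProd_const]
    refine trace_pow_bound h hc hz q ?_ ?_
    · simp [trace_fin_two]; ring
    · simp only [det_fin_two_of]
      linear_combination (-(t : ℂ) ^ 2) * hsc
  · have h1 := (segProd_coeff (C := fun j : ℕ => stepPoly t (sin α) (π - α) z (circ (j * φ)))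
      (fun j a b => stepPoly_natDegree _ _ _ _ _ a b) 0 q).2
    have h2 : (chamPoly t (sin α) (π - α) φ z q).coeff (2 * q) =
        (segProd (fun j : ℕ => (stepPoly t (sin α) (π - α) z (circ (j * φ))).map (fun p => p.coeff 2))
          0 q).trace := by
      rw [chamPoly, trace_fin_two, trace_fin_two, coeff_add, h1, h1]
    rw [h2]
    simp only [stepPoly_coeff_two]
    rw [segProd_smul, segProd_const, trace_smul, norm_smul, norm_prod]
    simp only [norm_pow, norm_circ, one_pow, Finset.prod_const_one, one_mul]
    refine trace_pow_bound h hc hz q ?_ ?_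
    · simp [trace_fin_two]; ring
    · simp only [det_fin_two_of]
      linear_combination (-(t : ℂ) ^ 2) * hsc

lemma infinite_range_circ : (Set.range circ).Infinite := by
  have : (circ '' Ioo 0 (1 / 2)).Infinite := by
    refine (Set.Ioo_infinite (by norm_num)).image ?_
    intro x hx y hy hxy
    have e : ∀ x : ℝ, (2 * π * x * I : ℂ).im = 2 * π * x := by
      intro x
      have : (2 * π * x * I : ℂ) = ((2 * π * x : ℝ) : ℂ) * I := by push_cast; ring
      rw [this, im_ofReal_mul, I_im, mul_one]
    have hpi := pi_pos
    have h := Complex.exp_inj_of_neg_pi_lt_of_le_pi (x := 2 * π * x * I) (y := 2 * π * y * I)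
      (by rw [e]; nlinarith [hx.1]) (by rw [e]; nlinarith [hx.2]) (by rw [e]; nlinarith [hy.1])
      (by rw [e]; nlinarith [hy.2]) hxy
    have h' := congrArg im h
    rw [e, e] at h'
    exact mul_left_cancel₀ (by positivity) h'
  exact this.mono (Set.image_subset_range _ _)

lemma chamPoly_coeff_mul (t s β : ℝ) (z : ℂ) (p : ℤ) (m : ℕ) :
    (chamPoly t s β (p / q) z q).coeff m * circ (p / q) ^ m = (chamPoly t s β (p / q) z q).coeff m := by
  have hq0 : (q : ℝ) ≠ 0 := Nat.cast_ne_zero.mpr (NeZero.ne q)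
  have h : (chamPoly t s β (p / q) z q).comp (Polynomial.C (circ (p / q)) * Polynomial.X) =
      chamPoly t s β (p / q) z q := by
    refine Polynomial.eq_of_infinite_eval_eq _ _ (infinite_range_circ.mono ?_)
    rintro _ ⟨x, rfl⟩
    simp only [mem_ofPred_eq, Polynomial.eval_comp, eval_mul, eval_C, eval_X]
    rw [← circ_add, chamPoly_eval, chamPoly_eval]
    have e : ∀ j : ℕ, (p / q : ℝ) + x + j * (p / q) = x + (j + 1 : ℕ) * (p / q) := by
      intro j; push_cast; ring
    simp only [e]
    have hper : (x + (q : ℕ) * (p / q) : ℝ) = x + (0 : ℕ) * (p / q) + p := by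
      rw [mul_div_cancel₀ _ hq0]; push_cast; ring
    congr 1
    · have h1 := prod_range_succ' (fun j : ℕ => circ (x + j * (p / q))) q
      rw [prod_range_succ] at h1
      have h2 : circ (x + (q : ℕ) * (p / q)) = circ (x + (0 : ℕ) * (p / q)) := by
        rw [hper, circ_add_int]
      rw [h2] at h1
      refine (mul_right_cancel₀ (circ_ne_zero _) h1).symm
    · rw [segProd_shift (fun j : ℕ => stepMat s (gA t β (x + j * (p / q))) z) 0 q]
      refine trace_segProd_rotate ?_
      rw [hper, gA_add_int]
  conv_rhs => rw [← h]
  rw [Polynomial.comp_C_mul_X_coeff]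

lemma chamPoly_coeff_eq_zero (t s β : ℝ) (z : ℂ) {p : ℤ} (hp : IsUnit (p : ZMod q)) {m : ℕ} (hm : ¬ q ∣ m) :
    (chamPoly t s β (p / q) z q).coeff m = 0 := by
  have h := chamPoly_coeff_mul t s β z (q := q) p m
  by_contra h0
  have h1 : circ (p / q) ^ m = 1 := mul_left_cancel₀ h0 (by rw [h, mul_one])
  exact hm (((isPrimitiveRoot_circ hp).pow_eq_one_iff_dvd m).mp h1)

lemma chamPoly_eval_eq (t s β : ℝ) (z : ℂ) {p : ℤ} (hp : IsUnit (p : ZMod q)) (u : ℂ) :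
    (chamPoly t s β (p / q) z q).eval u = (chamPoly t s β (p / q) z q).coeff 0 +
      (chamPoly t s β (p / q) z q).coeff q * u ^ q + (chamPoly t s β (p / q) z q).coeff (2 * q) * u ^ (2 * q) := by
  have hq0 : 0 < q := NeZero.pos q
  rw [Polynomial.eval_eq_sum_range' (n := 2 * q + 1) (by have := chamPoly_natDegree t s β (p / q) z q; omega)]
  have hsub : ({0, q, 2 * q} : Finset ℕ) ⊆ range (2 * q + 1) := by
    intro m hm
    simp only [Finset.mem_insert, Finset.mem_singleton] at hm
    rw [mem_range]; omega
  rw [← Finset.sum_subset hsub]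
  · rw [sum_insert (by simp; omega), sum_insert (by simp; omega), Finset.sum_singleton, pow_zero, mul_one]
    ring
  · intro m hm hm'
    rw [chamPoly_coeff_eq_zero t s β z hp, zero_mul]
    rintro ⟨k, rfl⟩
    rw [mem_range] at hm
    apply hm'
    have hk : k < 3 := by
      by_contra hk
      have : q * 3 ≤ q * k := Nat.mul_le_mul_left _ (by omega)
      omega
    interval_cases k <;> simp [mul_comm]

lemma trace_phase_diff {t α : ℝ} (h : |2 * t * cos α| < (1 - t ^ 2) * sin α) (hc : 0 ≤ cos α) {z : ℂ}
    (hz : ‖z‖ = 1) {p : ℤ} (hp : IsUnit (p : ZMod q)) (θ : ℝ) :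
    ‖(segProd (fun j : ℕ => stepMat (sin α) (gA t (π - α) (θ + j * (p / q))) z) 0 q).trace -
      (segProd (fun j : ℕ => stepMat (sin α) (gA t (π - α) (0 + j * (p / q))) z) 0 q).trace‖ ≤
        8 * base t α ^ q := by
  obtain ⟨ρ, hρ⟩ : ∃ ρ, ρ = ∏ j ∈ range q, circ (0 + j * (p / q)) := ⟨_, rfl⟩
  have hρ1 : ‖ρ‖ = 1 := by rw [hρ, norm_prod]; simp [norm_circ]
  have hρ0 : ρ ≠ 0 := by rw [← norm_ne_zero_iff, hρ1]; exact one_ne_zero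
  obtain ⟨T, hT⟩ : ∃ T : ℝ → ℂ, ∀ x, T x =
      (segProd (fun j : ℕ => stepMat (sin α) (gA t (π - α) (x + j * (p / q))) z) 0 q).trace :=
    ⟨_, fun _ => rfl⟩
  rw [← hT, ← hT]
  have key : ∀ x, circ x ^ q * ρ * T x = (chamPoly t (sin α) (π - α) (p / q) z q).eval (circ x) := by
    intro x
    rw [chamPoly_eval, hT, hρ]
    congr 1
    rw [← card_range q, ← prod_const, card_range, ← prod_mul_distrib]
    refine prod_congr rfl fun j _ => ?_
    rw [← circ_add]; congr 1; ring
  obtain ⟨hc0, hc2⟩ := chamPoly_coeff_ends h hc hz q (p / q)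
  have hθ := key θ
  have h0 := key 0
  rw [chamPoly_eval_eq _ _ _ _ hp] at hθ h0
  rw [circ_zero, one_pow, one_pow, one_mul] at h0
  generalize (chamPoly t (sin α) (π - α) (p / q) z q).coeff 0 = c0 at *
  generalize (chamPoly t (sin α) (π - α) (p / q) z q).coeff (2 * q) = c2 at *
  generalize (chamPoly t (sin α) (π - α) (p / q) z q).coeff q = c1 at *
  have hu1 : ‖circ θ ^ q‖ = 1 := by rw [norm_pow, norm_circ, one_pow]
  rw [mul_comm 2 q, pow_mul] at hθ
  generalize circ θ ^ q = u at *
  have e : u * ρ * (T θ - T 0) = c0 * (1 - u) + c2 * (u ^ 2 - u) := by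
    linear_combination hθ - u * h0
  have h1 : ‖u * ρ * (T θ - T 0)‖ = ‖T θ - T 0‖ := by
    rw [norm_mul, norm_mul, hu1, hρ1, one_mul, one_mul]
  rw [← h1, e]
  have h2 : ‖1 - u‖ ≤ 2 := (norm_sub_le _ _).trans (by rw [hu1, norm_one]; norm_num)
  have h3 : ‖u ^ 2 - u‖ ≤ 2 := (norm_sub_le _ _).trans (by rw [norm_pow, hu1]; norm_num)
  refine (norm_add_le _ _).trans ?_
  rw [norm_mul, norm_mul]
  have h4 := mul_le_mul hc0 h2 (norm_nonneg _) ((norm_nonneg _).trans hc0)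
  have h5 := mul_le_mul hc2 h3 (norm_nonneg _) ((norm_nonneg _).trans hc2)
  linarith

lemma chi_qRing_phase_diff (hq : Odd q) {t α : ℝ} (h : Regime t α) {z : ℂ}
    (hz : ‖z‖ = 1) {p : ℤ} (hp : IsUnit (p : ZMod q)) (θ : ℝ) :
    ‖chi (qRing t α (π - α) q (p / q) θ) z - chi (qRing t α (π - α) q (p / q) 0) z‖ ≤
      16 * base t α ^ q := by
  have hz0 : z ≠ 0 := by rw [← norm_ne_zero_iff, hz]; exact one_ne_zero
  have hq0 : q ≠ 0 := NeZero.ne q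
  have hf := fun x => (fA_pos h.gap x).2
  have hb : ∀ x : ℝ, ‖(∏ j ∈ range q,
      ((cos α * fA t (π - α) (x + j * (p / q)) : ℝ) : ℂ))‖ ∈ Set.Icc 0 (4 * base t α ^ q) := by
    intro x
    refine ⟨norm_nonneg _, ?_⟩
    rw [← ofReal_prod, norm_real, norm_eq_abs, abs_of_nonneg (prod_nonneg fun j _ =>
      mul_nonneg h.cos_pos.le (hf _).le), prod_mul_distrib, prod_const, card_range, base, mul_pow]
    have := mul_le_mul_of_nonneg_left (prod_fA_phase hq hp h.gap x) (pow_nonneg h.cos_pos.le q)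
    linarith
  -- the two products are nonnegative reals, so their difference is bounded by the larger one
  have hd : ‖(∏ j ∈ range q, ((cos α * fA t (π - α) (θ + j * (p / q)) : ℝ) : ℂ)) -
      ∏ j ∈ range q, ((cos α * fA t (π - α) (0 + j * (p / q)) : ℝ) : ℂ)‖ ≤ 4 * base t α ^ q := by
    have h1 := (hb θ).2
    have h2 := (hb 0).2
    rw [← ofReal_prod, norm_real, norm_eq_abs, abs_of_nonneg (prod_nonneg fun j _ =>
      mul_nonneg h.cos_pos.le (hf _).le)] at h1 h2
    rw [← ofReal_prod, ← ofReal_prod, ← ofReal_sub, norm_real, norm_eq_abs, abs_le]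
    have h3 : 0 ≤ ∏ j ∈ range q, (cos α * fA t (π - α) (θ + j * (p / q))) :=
      prod_nonneg fun j _ => mul_nonneg h.cos_pos.le (hf _).le
    have h4 : 0 ≤ ∏ j ∈ range q, (cos α * fA t (π - α) (0 + j * (p / q))) :=
      prod_nonneg fun j _ => mul_nonneg h.cos_pos.le (hf _).le
    constructor <;> linarith
  rw [qRing, qRing, chi_ringN_eq_trace t q hq0 _ _ _ (fun j => (hf _).ne') (fun _ => h.cos_pos.ne') hz0,
    chi_ringN_eq_trace t q hq0 _ _ _ (fun j => (hf _).ne') (fun _ => h.cos_pos.ne') hz0]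
  have ht := trace_phase_diff h.gap h.cos_pos.le hz hp θ
  have e : ∀ a b c d w : ℂ, a - w * c - (b - w * d) = (a - b) - w * (c - d) := by intros; ring
  rw [e]
  refine (norm_sub_le _ _).trans ?_
  rw [norm_mul, norm_mul, norm_pow, hz, one_pow, mul_one, Complex.norm_ofNat]
  linarith

end

section

variable {q : ℕ} [NeZero q]

lemma exists_phase_reduction {p : ℤ} (hp : IsUnit (p : ZMod q)) (θ : ℝ) :
    ∃ (j : ℕ) (k : ℤ) (δ : ℝ), 0 ≤ δ ∧ δ ≤ 1 / q ∧ θ + j * (p / q) = k + δ := by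
  have hq0 : (0 : ℝ) < q := Nat.cast_pos.mpr (NeZero.pos q)
  obtain ⟨u, hu⟩ := hp
  have hj : (((-(⌊q * θ⌋ : ZMod q) * (u⁻¹ : (ZMod q)ˣ)).val : ℕ) : ZMod q) * (p : ZMod q) = -(⌊q * θ⌋ : ZMod q) := by
    rw [ZMod.natCast_val, ZMod.cast_id, ← hu, mul_assoc, Units.inv_mul, mul_one]
  obtain ⟨j, hj'⟩ : ∃ j : ℕ, j = (-(⌊q * θ⌋ : ZMod q) * (u⁻¹ : (ZMod q)ˣ)).val := ⟨_, rfl⟩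
  rw [← hj'] at hj
  have hd : (q : ℤ) ∣ ⌊q * θ⌋ + j * p := by
    rw [← ZMod.intCast_zmod_eq_zero_iff_dvd]
    push_cast
    rw [hj]; ring
  obtain ⟨k, hk⟩ := hd
  refine ⟨j, k, Int.fract (q * θ) / q, div_nonneg (Int.fract_nonneg _) hq0.le,
    div_le_div_of_nonneg_right (Int.fract_lt_one _).le hq0.le, ?_⟩
  have hk' : (⌊q * θ⌋ : ℝ) + j * p = q * k := mod_cast hk
  have := Int.floor_add_fract (q * θ)
  generalize Int.fract (q * θ) = fr at *
  field_simp
  linarith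

lemma chi_qRing_translate (t α β : ℝ) (p : ℤ) (θ : ℝ) (j : ℕ) (z : ℂ) :
    chi (qRing t α β q (p / q) (θ + j * (p / q))) z = chi (qRing t α β q (p / q) θ) z := by
  have hq0 : (q : ℝ) ≠ 0 := Nat.cast_ne_zero.mpr (NeZero.ne q)
  induction j with
  | zero => simp
  | succ j ih =>
    rw [← ih, qRing, qRing, ← chi_ringN_translate t q (fun _ => α) (fun _ => β)
      (fun i : ℕ => θ + j * (p / q) + i * (p / q)) p rfl rfl (by field_simp; push_cast; ring)]
    congr 2
    funext i
    push_cast; ring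

lemma phaseRel_qRing_phase (hq1 : 1 < q) (t α β : ℝ) {p : ℤ} (hp : IsUnit (p : ZMod q)) (θ : ℝ) :
    PhaseRel (chi (qRing t α β q (p / q) θ)) (chi (qRing t α β q (p / q) 0)) (2 * π) := by
  have hq0 : (0 : ℝ) < q := Nat.cast_pos.mpr (NeZero.pos q)
  have hq2 : (2 : ℝ) ≤ q := mod_cast hq1
  obtain ⟨j, k, δ, hδ0, hδ1, h⟩ := exists_phase_reduction hp θ
  have h1 : chi (qRing t α β q (p / q) θ) = chi (qRing t α β q (p / q) δ) := by
    funext z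
    rw [← chi_qRing_translate t α β p θ j z, h, qRing, qRing, ← ringN_add_int t q _ _ (fun i : ℕ => δ + i * (p / q))
      (fun _ => k)]
    congr 2
    funext i; ring
  rw [h1]
  have hδ2 : δ ≤ 1 / 2 := hδ1.trans (one_div_le_one_div_of_le two_pos hq2)
  have e : ∀ i : ℕ, |(0 : ℝ) + i * (p / q) - (δ + i * (p / q))| = δ := by
    intro i
    rw [show (0 : ℝ) + i * (p / q) - (δ + i * (p / q)) = -δ by ring, abs_neg, abs_of_nonneg hδ0]
  refine (ringN_x (x := fun i : ℕ => δ + i * (p / q)) (x' := fun i : ℕ => 0 + i * (p / q))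
    fun i _ => by rw [e]; exact hδ2).mono ?_
  simp only [e, sum_const, card_range, nsmul_eq_mul]
  have : (q : ℝ) * δ ≤ 1 := by
    calc (q : ℝ) * δ ≤ q * (1 / q) := mul_le_mul_of_nonneg_left hδ1 hq0.le
      _ = 1 := mul_one_div_cancel hq0.ne'
  nlinarith [pi_pos]

lemma sum_drift_le {m : ℕ} (hm : 0 < m) {c d : ℝ} (hd : |d| ≤ c / m ^ 2) :
    ∑ i ∈ range m, |i * d| ≤ c := by
  have hm0 : (0 : ℝ) < m := Nat.cast_pos.mpr hm
  calc ∑ i ∈ range m, |i * d| ≤ ∑ i ∈ range m, c / m := by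
        refine sum_le_sum fun i hi => ?_
        have : (i : ℝ) ≤ m := mod_cast (mem_range.mp hi).le
        rw [abs_mul, abs_of_nonneg (Nat.cast_nonneg i)]
        calc (i : ℝ) * |d| ≤ m * (c / m ^ 2) := mul_le_mul this hd (abs_nonneg _) hm0.le
          _ = c / m := by field_simp
    _ = c := by rw [sum_const, card_range, nsmul_eq_mul]; field_simp

lemma phaseRel_qRing_block (hq1 : 1 < q) (t α β : ℝ) {p : ℤ} (hp : IsUnit (p : ZMod q)) {φ c : ℝ}
    (hφ : |φ - p / q| ≤ c / q ^ 2) (hc : 2 * c ≤ q) (θ : ℝ) :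
    PhaseRel (chi (qRing t α β q φ θ)) (chi (qRing t α β q (p / q) 0)) (2 * π * (c + 1)) := by
  have hq0 : (0 : ℝ) < q := Nat.cast_pos.mpr (NeZero.pos q)
  have e : ∀ i : ℕ, |θ + i * (p / q) - (θ + i * φ)| = |i * (φ - p / q)| := by
    intro i
    rw [← abs_neg]; congr 1; ring
  have h1 : PhaseRel (chi (qRing t α β q φ θ)) (chi (qRing t α β q (p / q) θ)) (2 * π * c) := by
    refine (ringN_x (x := fun i : ℕ => θ + i * φ) (x' := fun i : ℕ => θ + i * (p / q)) fun i hi => ?_).mono ?_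
    · rw [e, abs_mul, abs_of_nonneg (Nat.cast_nonneg i)]
      have : (i : ℝ) ≤ q := mod_cast hi.le
      calc (i : ℝ) * |φ - p / q| ≤ q * (c / q ^ 2) := mul_le_mul this hφ (abs_nonneg _) hq0.le
        _ = c / q := by field_simp
        _ ≤ 1 / 2 := by rw [div_le_div_iff₀ hq0 two_pos]; linarith
    · simp only [e]
      exact mul_le_mul_of_nonneg_left (sum_drift_le (NeZero.pos q) hφ) (by positivity)
  exact (h1.trans (phaseRel_qRing_phase hq1 t α β hp θ)).mono (by linarith)

/-- A long ring is phase-comparable to copies of a short ring and a remainder. -/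
lemma phaseRel_qRing_blocks (hq1 : 1 < q) (t : ℝ) {α : ℝ} (hα : |α - π / 2| ≤ π / 2) (β : ℝ) {p : ℤ}
    (hp : IsUnit (p : ZMod q)) {φ c : ℝ} (hφ : |φ - p / q| ≤ c / q ^ 2) (hc : 2 * c ≤ q) (θ : ℝ) (k n : ℕ) :
    PhaseRel (chi (qRing t α β (k * q + n) φ θ))
      (fun z => chi (qRing t α β q (p / q) 0) z ^ k * chi (qRing t α β n φ (θ + (k * q : ℕ) * φ)) z)
      (2 * π * (c + 2) * k + 2 * π) := by
  have h1 := ringN_split t (k * q) n (fun _ => α) (fun _ => β) (fun j : ℕ => θ + j * φ) (fun _ => hα)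
  have h2 := ringN_split_blocks t q k (fun _ => α) (fun _ => β) (fun j : ℕ => θ + j * φ) (fun _ => hα)
  have h3 := PhaseRel.prod (p := fun (j : ℕ) z => chi (qRing t α β q φ (θ + (j * q : ℕ) * φ)) z)
    (q := fun (j : ℕ) z => chi (qRing t α β q (p / q) 0) z) (c := fun _ => 2 * π * (c + 1)) k
    fun j _ => phaseRel_qRing_block hq1 t α β hp hφ hc _
  simp only [prod_const, sum_const, card_range, nsmul_eq_mul] at h3
  have h4 : PhaseRel (chi (ringN t (k * q) (fun _ => α) (fun _ => β) (fun j : ℕ => θ + j * φ)))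
      (fun z => chi (qRing t α β q (p / q) 0) z ^ k) (2 * π * k + k * (2 * π * (c + 1))) := by
    refine PhaseRel.trans ?_ h3
    refine (h2.trans (PhaseRel.of_eq fun z => ?_)).mono (by rw [add_zero])
    refine prod_congr rfl fun j _ => ?_
    rw [qRing]
    congr 2
    funext i; push_cast; ring
  have h5 := h4.mul (PhaseRel.refl (chi (qRing t α β n φ (θ + (k * q : ℕ) * φ))))
  refine PhaseRel.mono (h1.trans ((PhaseRel.of_eq fun z => ?_).trans h5)) ?_
  · rw [qRing]
    congr 3
    funext i; push_cast; ring
  · apply le_of_eq; ring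

end

/-- An odd-denominator rational approximation of quality `6 / q²`. -/
structure Approx (Φ : ℝ) (q : ℕ) (p : ℤ) : Prop where
  odd : Odd q
  unit : IsUnit (p : ZMod q)
  one_lt : 1 < q
  close : |Φ - p / q| ≤ 6 / q ^ 2

lemma Approx.dist {Φ : ℝ} {q₀ q : ℕ} {p₀ p : ℤ} (h₀ : Approx Φ q₀ p₀) (h : Approx Φ q p) (hq : q₀ ≤ q) :
    |(p / q : ℝ) - p₀ / q₀| ≤ 12 / q₀ ^ 2 := by
  have h1 : (6 : ℝ) / q ^ 2 ≤ 6 / q₀ ^ 2 := by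
    have : (0 : ℝ) < q₀ := by have := h₀.one_lt; exact_mod_cast (by omega : 0 < q₀)
    have h2 : (q₀ : ℝ) ≤ q := mod_cast hq
    gcongr
  have h2 := h₀.close
  have h3 := h.close
  rw [abs_le] at *
  have e : (12 : ℝ) / q₀ ^ 2 = 6 / q₀ ^ 2 + 6 / q₀ ^ 2 := by ring
  constructor <;> linarith

lemma base_le_one {t α : ℝ} (h : Regime t α) : base t α ≤ 1 := by
  have hb := abs_coinB_lt h.gap
  have h1 : bigRoot (coinP t α) (coinB t α) ≤ coinP t α := by
    have := smallRoot_nonneg hb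
    have e : bigRoot (coinP t α) (coinB t α) + smallRoot (coinP t α) (coinB t α) = coinP t α := by
      rw [bigRoot, smallRoot]; ring
    linarith
  have h2 : coinP t α ≤ 1 := by
    rw [coinP, one_div, inv_mul_le_iff₀ (by positivity)]
    have := Real.sin_le_one α
    have := h.one_sub_sq_pos
    nlinarith [sq_nonneg t, h.sin_pos]
  rw [base]
  have := (bigRoot_pos hb).le
  nlinarith [Real.cos_le_one α, h.cos_pos]

lemma Regime.abs_sub_le {t α : ℝ} (h : Regime t α) : |α - π / 2| ≤ π / 2 := by
  rw [abs_le]; constructor <;> linarith [h.pos, h.lt, pi_pos]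

lemma sqrt_six_le {x ε : ℝ} (hε : 0 ≤ ε) (h : x ≤ (ε / 6) ^ 2) : 6 * sqrt x ≤ ε := by
  have := sqrt_le_sqrt h
  rw [sqrt_sq (by positivity)] at this
  linarith

lemma growth_exponent_le {M B q₁ q k r : ℝ} (hM : 0 < M) (hB : 24 ≤ B) (hq₁ : 0 < q₁) (hk1 : 1 ≤ k) (hk : q₁ ≤ k)
    (hq : q = k * q₁ + r) (hr : r ≤ q₁) :
    M * B / (4 * q₁) * q + M * (B * k) + 6 * M * q₁ ≤ 2 * M * B * k := by
  have e1 : M * B / (4 * q₁) * q ≤ M * B * k / 2 := by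
    have h1 : q ≤ 2 * k * q₁ := by rw [hq]; nlinarith
    calc M * B / (4 * q₁) * q ≤ M * B / (4 * q₁) * (2 * k * q₁) := mul_le_mul_of_nonneg_left h1 (by positivity)
      _ = M * B * k / 2 := by field_simp; norm_num
  have e2 : 6 * M * q₁ ≤ M * B * k / 2 := by
    have : 12 * q₁ ≤ B * k := by nlinarith
    have := mul_le_mul_of_nonneg_left this hM.le
    linarith
  linarith

/-- The determinant of a short ring raised to a power, times a remainder, bounds the determinant of a long ring below
outside a set of small measure. -/
lemma exists_growth {t α Φ : ℝ} (h : Regime t α) (hinf : ∀ N : ℕ, ∃ q ≥ N, ∃ p, Approx Φ q p) {ε : ℝ} (hε : 0 < ε) :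
    ∃ κ > 0, ∃ Q : ℕ, ∀ q ≥ Q, ∀ p, Approx Φ q p →
      volume {s : ℝ | s ∈ Ico (0 : ℝ) 1 ∧ ‖chi (qRing t α (π - α) q (p / q) 0) (circ s)‖ <
        exp (κ * q) * base t α ^ q} ≤ ofReal ε := by
  obtain ⟨M, hM⟩ : ∃ M, M = (18 / ε) ^ 2 := ⟨_, rfl⟩
  have hM0 : 0 < M := by rw [hM]; positivity
  have hMi : 1 / M ≤ (ε / 3 / 6) ^ 2 := by
    rw [hM]; apply le_of_eq; field_simp; norm_num
  obtain ⟨B, hB⟩ : ∃ B, B = 30 * π := ⟨_, rfl⟩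
  have hB0 : 24 ≤ B := by rw [hB]; linarith [Real.pi_gt_three]
  obtain ⟨K, hK⟩ : ∃ K, K = exp (2 * M * B) := ⟨_, rfl⟩
  have hK0 : 0 < K := hK ▸ exp_pos _
  have htan : 0 < tan α := by rw [Real.tan_eq_sin_div_cos]; exact div_pos h.sin_pos h.cos_pos
  obtain ⟨N, hN⟩ := exists_nat_gt (K / (2 * tan α) / (ε / 3 / 6) ^ 2)
  obtain ⟨q₁, hq₁, p₁, ha⟩ := hinf (max N 24)
  haveI : NeZero q₁ := ⟨by have := ha.one_lt; omega⟩
  have hq₁0 : (0 : ℝ) < q₁ := Nat.cast_pos.mpr (NeZero.pos q₁)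
  have hq₁24 : (24 : ℝ) ≤ q₁ := mod_cast (le_max_right _ _).trans hq₁
  have hlev : 6 * sqrt (K / (2 * tan α) / q₁) ≤ ε / 3 := by
    refine sqrt_six_le (by positivity) ?_
    rw [div_le_iff₀ hq₁0]
    rw [div_lt_iff₀ (by positivity)] at hN
    have : (N : ℝ) ≤ q₁ := mod_cast (le_max_left _ _).trans hq₁
    nlinarith [sq_nonneg (ε / 3 / 6)]
  refine ⟨M * B / (4 * q₁), by positivity, q₁ * q₁, fun q hq p hp => ?_⟩
  haveI : NeZero q := ⟨by have := hp.one_lt; omega⟩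
  have hqq : q₁ ≤ q := (Nat.le_mul_self q₁).trans hq
  obtain ⟨k, hk⟩ : ∃ k, k = q / q₁ := ⟨_, rfl⟩
  obtain ⟨r, hr⟩ : ∃ r, r = q % q₁ := ⟨_, rfl⟩
  have hkr : q = k * q₁ + r := by rw [hk, hr, mul_comm]; exact (Nat.div_add_mod q q₁).symm
  have hrl : r < q₁ := by rw [hr]; exact Nat.mod_lt _ (NeZero.pos q₁)
  have hkq : q₁ ≤ k := by rw [hk]; exact (Nat.le_div_iff_mul_le (NeZero.pos q₁)).mpr hq
  have hkq' : (q₁ : ℝ) ≤ k := mod_cast hkq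
  have hk0 : (0 : ℝ) < k := by linarith
  have hrel := phaseRel_qRing_blocks (q := q₁) ha.one_lt t h.abs_sub_le (π - α) ha.unit (ha.dist hp hqq)
    (by linarith) 0 k r
  rw [← hkr] at hrel
  have hrel' := hrel.mono (d := B * k) (by rw [hB]; nlinarith [pi_pos])
  have hcont : ∀ n φ θ, Continuous (chi (qRing t α (π - α) n φ θ)) := fun n φ θ => continuous_chi _
  have hw := hrel'.weak_type (hcont _ _ _) (((hcont _ _ _).pow k).mul (hcont _ _ _)) (by positivity)
    (l := M * (B * k)) (by positivity)
  have hw' : 6 * sqrt (B * k / (M * (B * k))) ≤ ε / 3 := by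
    refine sqrt_six_le (by positivity) (le_trans (le_of_eq ?_) hMi)
    field_simp
  have hrem : volume {s : ℝ | s ∈ Ico (0 : ℝ) 1 ∧
      ‖chi (qRing t α (π - α) r (p / q) (0 + (k * q₁ : ℕ) * (p / q))) (circ s)‖ * exp (6 * M * q₁) < 1} ≤
      ofReal (ε / 3) := by
    rcases Nat.eq_zero_or_pos r with hr0 | hr0
    · subst hr0
      have : {s : ℝ | s ∈ Ico (0 : ℝ) 1 ∧
        ‖chi (qRing t α (π - α) 0 (p / q) (0 + (k * q₁ : ℕ) * (p / q))) (circ s)‖ *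
          exp (6 * M * q₁) < 1} = ∅ := by
        ext s
        simp only [mem_ofPred_eq, Set.mem_empty_iff_false, iff_false, not_and, not_lt]
        intro _
        rw [qRing, chi_ringN_zero, norm_one, one_mul]
        exact Real.one_le_exp (by positivity)
      rw [this, measure_empty]
      exact zero_le
    · haveI : NeZero r := ⟨hr0.ne'⟩
      refine (chi_lower_weak_type (qRing_unitary _ _ _ _ _ _) (by positivity)).trans (ofReal_le_ofReal ?_)
      refine sqrt_six_le (by positivity) (le_trans ?_ hMi)
      rw [card_sum, card_fin, div_le_div_iff₀ (by positivity) hM0]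
      have : (r : ℝ) ≤ q₁ := mod_cast hrl.le
      push_cast
      nlinarith
  have hlv := qRing_level_measure ha.odd ha.one_lt ha.unit h hK0
  refine (measure_mono (t := _ ∪ _ ∪ _) ?_).trans ((measure_union_le _ _).trans
    (add_le_add ((measure_union_le _ _).trans (add_le_add (hw.trans (ofReal_le_ofReal hw'))
      (hlv.trans (ofReal_le_ofReal hlev)))) hrem) |>.trans (le_of_eq ?_))
  · rintro s ⟨hs, hlt⟩
    by_contra hcon
    simp only [Set.mem_union, mem_ofPred_eq, not_or, not_and, not_lt] at hcon
    obtain ⟨⟨h1, h2⟩, h3⟩ := hcon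
    have h1 := h1 hs
    have h2 := h2 hs
    have h3 := h3 hs
    rw [norm_mul, norm_pow] at h1
    have hb0 := h.base_pos
    have h4 := pow_le_pow_left₀ (by positivity) h2 k
    rw [mul_pow, ← pow_mul] at h4
    have h5 : base t α ^ q ≤ base t α ^ (q₁ * k) :=
      pow_le_pow_of_le_one hb0.le (base_le_one h) (by rw [hkr, mul_comm]; omega)
    have h6 : K ^ k = exp (2 * M * B * k) := by rw [hK, ← exp_nat_mul]; congr 1; ring
    have h7 : M * B / (4 * q₁) * q + M * (B * k) + 6 * M * q₁ ≤ 2 * M * B * k := by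
      refine growth_exponent_le hM0 hB0 hq₁0 (by linarith) hkq' (r := r) (mod_cast hkr) (mod_cast hrl.le)
    have h8 := exp_le_exp.mpr h7
    rw [Real.exp_add, Real.exp_add, ← h6] at h8
    generalize exp (M * B / (4 * q₁) * q) = E1 at *
    have hE2 := exp_pos (M * (B * k))
    have hE3 := exp_pos (6 * M * q₁)
    generalize exp (M * (B * k)) = E2 at *
    generalize exp (6 * M * q₁) = E3 at *
    generalize ‖chi (qRing t α (π - α) q (p / q) 0) (circ s)‖ = X at *
    generalize ‖chi (qRing t α (π - α) r (p / q) (0 + (k * q₁ : ℕ) * (p / q))) (circ s)‖ = R at *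
    have c1 : E1 * E2 * E3 * base t α ^ q ≤ K ^ k * base t α ^ (q₁ * k) :=
      mul_le_mul h8 h5 (by positivity) (by positivity)
    have c2 : K ^ k * base t α ^ (q₁ * k) * 1 ≤ ‖chi (qRing t α (π - α) q₁ (p₁ / q₁) 0) (circ s)‖ ^ k * (R * E3) :=
      mul_le_mul h4 h3 zero_le_one (by positivity)
    have c3 : E1 * E2 * E3 * base t α ^ q ≤ X * E2 * E3 := by
      rw [mul_one, ← mul_assoc] at c2
      exact c1.trans (c2.trans (mul_le_mul_of_nonneg_right h1 hE3.le))
    have c4 : X * E2 * E3 < E1 * E2 * E3 * base t α ^ q := by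
      have := mul_lt_mul_of_pos_right hlt (mul_pos hE2 hE3)
      linarith
    linarith
  · rw [← ofReal_add (by positivity) (by positivity), ← ofReal_add (by positivity) (by positivity)]
    congr 1; ring

lemma exists_int_of_circ_eq {x y : ℝ} (h : circ x = circ y) : ∃ n : ℤ, x = y + n := by
  obtain ⟨n, hn⟩ := Complex.exp_eq_exp_iff_exists_int.mp h
  refine ⟨n, ?_⟩
  have h1 := congrArg im hn
  have e : ∀ x : ℝ, (2 * π * x * I : ℂ) = ((2 * π * x : ℝ) : ℂ) * I := by
    intro x; push_cast; ring
  have e2 : (2 * π * y * I + n * (2 * π * I) : ℂ) =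
      ((2 * π * (y + n) : ℝ) : ℂ) * I := by push_cast; ring
  rw [e, e2, im_ofReal_mul, im_ofReal_mul, I_im, mul_one, mul_one] at h1
  exact mul_left_cancel₀ (by positivity) h1

lemma volume_near_circ_fiber (w : ℂ) {δ : ℝ} (hδ : δ ≤ 1) :
    volume {s : ℝ | s ∈ Ico (0 : ℝ) 1 ∧ ∃ s', |s - s'| < δ ∧ circ s' = w} ≤ ofReal (6 * δ) := by
  by_cases hw : ∃ s', circ s' = w
  · obtain ⟨s₀, rfl⟩ := hw
    obtain ⟨u, hu⟩ : ∃ u, u = Int.fract s₀ := ⟨_, rfl⟩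
    have hu0 : 0 ≤ u := hu ▸ Int.fract_nonneg _
    have hu1 : u < 1 := hu ▸ Int.fract_lt_one _
    have hcu : circ u = circ s₀ := by
      rw [hu, ← circ_add_int (Int.fract s₀) ⌊s₀⌋, Int.fract_add_floor]
    refine (measure_mono (t := Metric.ball (u - 1) δ ∪ Metric.ball u δ ∪ Metric.ball (u + 1) δ) ?_).trans
      ((measure_union_le _ _).trans (add_le_add (measure_union_le _ _) le_rfl) |>.trans ?_)
    · rintro s ⟨hs, s', hss, hc⟩
      obtain ⟨n, hn⟩ := exists_int_of_circ_eq (hc.trans hcu.symm)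
      have h1 := abs_lt.mp hss
      have hlo : (-2 : ℝ) < n := by linarith [hs.1]
      have hhi : (n : ℝ) < 2 := by linarith [hs.2]
      have hlo' : -2 < n := mod_cast hlo
      have hhi' : n < 2 := mod_cast hhi
      simp only [Set.mem_union, Metric.mem_ball, Real.dist_eq]
      obtain rfl | rfl | rfl : n = -1 ∨ n = 0 ∨ n = 1 := by omega
      · refine Or.inl (Or.inl ?_)
        rw [hn] at hss; push_cast at hss; exact hss
      · refine Or.inl (Or.inr ?_)
        rw [hn] at hss; push_cast at hss; rw [add_zero] at hss; exact hss
      · refine Or.inr ?_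
        rw [hn] at hss; push_cast at hss; exact hss
    · rw [Real.volume_ball, Real.volume_ball, Real.volume_ball]
      rcases le_or_gt δ 0 with h | h
      · rw [ENNReal.ofReal_of_nonpos (by linarith)]; simp
      · rw [← ofReal_add (by positivity) (by positivity), ← ofReal_add (by positivity) (by positivity)]
        apply le_of_eq; congr 1; ring
  · have : {s : ℝ | s ∈ Ico (0 : ℝ) 1 ∧ ∃ s', |s - s'| < δ ∧ circ s' = w} = ∅ := by
      ext s
      simp only [mem_ofPred_eq, Set.mem_empty_iff_false, iff_false]
      rintro ⟨_, s', _, h⟩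
      exact hw ⟨s', h⟩
    rw [this, measure_empty]; exact zero_le

lemma exists_root_finset {ι : Type*} [Fintype ι] [DecidableEq ι] {A : Matrix ι ι ℂ} (hA : Aᴴ * A = 1) {n : ℕ}
    (hn : n ≠ 0) (hcard : n ≤ card ι) (c : ℂ) :
    ∃ S : Finset ℂ, S.card ≤ card ι ∧ ∀ z, chi A z = c * z ^ n → z ∈ S := by
  classical
  obtain ⟨d, _, hd⟩ := exists_chi_eq_prod hA
  obtain ⟨P, hP⟩ : ∃ P : Polynomial ℂ, P = ∏ i, (1 - Polynomial.X * Polynomial.C (d i)) -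
    Polynomial.C c * Polynomial.X ^ n := ⟨_, rfl⟩
  have heval : ∀ z, P.eval z = chi A z - c * z ^ n := by
    intro z
    rw [hP, hd]
    simp [Polynomial.eval_prod]
    exact prod_congr rfl fun i _ => by rw [mul_comm]
  have hP0 : P ≠ 0 := by
    intro h0
    have := heval 0
    rw [h0, chi_zero, zero_pow hn] at this
    simp at this
  have hdeg : P.natDegree ≤ card ι := by
    rw [hP]
    refine (Polynomial.natDegree_sub_le _ _).trans (max_le ?_ ?_)
    · refine (Polynomial.natDegree_prod_le _ _).trans ?_
      have h1 : ∀ i ∈ (univ : Finset ι), (1 - Polynomial.X * Polynomial.C (d i)).natDegree ≤ 1 := by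
        intro i _
        compute_degree
      exact (Finset.sum_le_card_nsmul _ _ 1 h1).trans (by simp)
    · exact (Polynomial.natDegree_C_mul_X_pow_le c n).trans hcard
  refine ⟨P.roots.toFinset, (Multiset.toFinset_card_le _).trans ((Polynomial.card_roots' P).trans hdeg), fun z hz => ?_⟩
  rw [Multiset.mem_toFinset, Polynomial.mem_roots hP0, IsRoot, heval, hz, sub_self]

/-- Points near a sublevel set of the determinant are in a larger sublevel set or near a finite set. -/
lemma near_level_measure {q : ℕ} [NeZero q] (hq : Odd q) (hq1 : 1 < q) {p : ℤ} (hp : IsUnit (p : ZMod q)) {t α : ℝ}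
    (h : Regime t α) {K : ℝ} (hK : 0 < K) {δ : ℝ} (hδ0 : 0 < δ) (hδ : δ ≤ 1) :
    volume {s : ℝ | s ∈ Ico (0 : ℝ) 1 ∧ ∃ s', |s - s'| < δ ∧
      ‖chi (qRing t α (π - α) q (p / q) 0) (circ s')‖ ≤ K * base t α ^ q} ≤
      ofReal (6 * sqrt (2 * K / (2 * tan α) / q)) + ofReal (24 * q * δ) := by
  classical
  have hb0 := h.base_pos
  obtain ⟨c, hc⟩ : ∃ c, c = K * base t α ^ q := ⟨_, rfl⟩
  have hc0 : 0 < c := by rw [hc]; positivity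
  have hcard : card (Fin q ⊕ Fin q) = 2 * q := by rw [card_sum, card_fin]; ring
  obtain ⟨e, he⟩ := exists_real_chi_ringN t q (NeZero.ne q) (fun _ => α) (fun _ => π - α)
    (fun j : ℕ => 0 + j * (p / q)) (fun _ => (fA_pos h.gap _).2.ne') (fun _ => h.cos_pos.ne')
  have he' : ∀ s, (e s : ℂ) * circ s ^ q = chi (qRing t α (π - α) q (p / q) 0) (circ s) := he
  have hen : ∀ s, ‖chi (qRing t α (π - α) q (p / q) 0) (circ s)‖ = |e s| := by
    intro s
    rw [← he', norm_mul, norm_pow, norm_circ, one_pow, mul_one, norm_real, norm_eq_abs]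
  obtain ⟨S₁, hS₁, hr₁⟩ := exists_root_finset (qRing_unitary t α (π - α) q (p / q) 0) (NeZero.ne q)
    (by rw [hcard]; omega) (c : ℂ)
  obtain ⟨S₂, hS₂, hr₂⟩ := exists_root_finset (qRing_unitary t α (π - α) q (p / q) 0) (NeZero.ne q)
    (by rw [hcard]; omega) (-c : ℂ)
  rw [hcard] at hS₁ hS₂
  have hlev := qRing_level_measure hq hq1 hp h (K := 2 * K) (by positivity)
  refine (measure_mono (t := _ ∪ ⋃ w ∈ S₁ ∪ S₂,
    {s : ℝ | s ∈ Ico (0 : ℝ) 1 ∧ ∃ s', |s - s'| < δ ∧ circ s' = w}) ?_).trans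
      ((measure_union_le _ _).trans (add_le_add hlev ?_))
  · rintro s ⟨hs, s', hss, hle⟩
    by_cases hlt : ‖chi (qRing t α (π - α) q (p / q) 0) (circ s)‖ < 2 * K * base t α ^ q
    · exact Or.inl ⟨hs, hlt⟩
    right
    push Not at hlt
    have hcont : Continuous fun s => ‖chi (qRing t α (π - α) q (p / q) 0) (circ s)‖ :=
      ((continuous_chi _).comp continuous_circ).norm
    have hmem : c ∈ Set.uIcc ‖chi (qRing t α (π - α) q (p / q) 0) (circ s')‖
        ‖chi (qRing t α (π - α) q (p / q) 0) (circ s)‖ := by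
      refine Set.Icc_subset_uIcc ⟨hc ▸ hle, ?_⟩
      rw [hc]
      refine le_trans ?_ hlt
      have := hc ▸ hc0
      linarith
    obtain ⟨s₁, hs₁, hs₁c⟩ := intermediate_value_uIcc (a := s') (b := s) hcont.continuousOn hmem
    have hd : |s - s₁| < δ := by
      refine lt_of_le_of_lt ?_ hss
      exact (Set.abs_sub_right_of_mem_uIcc hs₁)
    refine Set.mem_biUnion (x := circ s₁) ?_ ⟨hs, s₁, hd, rfl⟩
    simp only at hs₁c
    rw [hen] at hs₁c
    rw [Finset.mem_coe, Finset.mem_union]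
    rcases (abs_eq hc0.le).mp hs₁c with h1 | h1
    · left; apply hr₁; rw [← he', h1]
    · right; apply hr₂; rw [← he', h1]; push_cast; ring
  · refine (measure_biUnion_finset_le _ _).trans ?_
    refine (sum_le_sum fun w _ => volume_near_circ_fiber w hδ).trans ?_
    rw [sum_const, nsmul_eq_mul, ← ENNReal.ofReal_natCast, ← ENNReal.ofReal_mul (Nat.cast_nonneg _)]
    refine ofReal_le_ofReal ?_
    have h1 : (S₁ ∪ S₂).card ≤ 4 * q := (Finset.card_union_le _ _).trans (by omega)
    have h2 : ((S₁ ∪ S₂).card : ℝ) ≤ 4 * q := mod_cast h1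
    nlinarith

lemma fA_le_one (t β x : ℝ) : fA t β x ≤ 1 := by
  have := fA_sq_add t β x
  nlinarith [sq_nonneg ‖gA t β x‖, sq_nonneg (fA t β x - 1)]

lemma coin_factor_mem {t α : ℝ} (h : Regime t α) (x : ℝ) :
    0 < cos α * fA t (π - α) x ∧ cos α * fA t (π - α) x ≤ 1 :=
  ⟨mul_pos h.cos_pos (fA_pos h.gap x).2,
    mul_le_one₀ (Real.cos_le_one α) (fA_pos h.gap x).2.le (fA_le_one _ _ _)⟩

lemma exists_fA_le_mul_exp {t α : ℝ} (h : Regime t α) :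
    ∃ K : ℝ, 0 ≤ K ∧ ∀ x y, fA t (π - α) x ≤ fA t (π - α) y * exp (K * |x - y|) := by
  have hb := abs_coinB_lt h.gap
  have hm : 0 < coinP t α - |coinB t α| := by linarith
  refine ⟨2 * π * |coinB t α| / (coinP t α - |coinB t α|), by positivity, fun x y => ?_⟩
  have hf := (fA_pos h.gap y).2
  have hfm : coinP t α - |coinB t α| ≤ fA t (π - α) y := by
    rw [fA_pi_sub_eq]
    have h1 : |coinB t α * cos (2 * π * y)| ≤ |coinB t α| := by
      rw [abs_mul]; exact mul_le_of_le_one_right (abs_nonneg _) (abs_cos_le_one _)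
    have := (abs_le.mp h1).1
    linarith
  have hc : |cos (2 * π * x) - cos (2 * π * y)| ≤ 2 * π * |x - y| := by
    have h1 := Real.abs_cos_sub_cos_le (2 * π * x) (2 * π * y)
    rwa [← mul_sub, abs_mul, abs_of_pos Real.two_pi_pos] at h1
  have hd : fA t (π - α) x - fA t (π - α) y ≤ |coinB t α| * (2 * π * |x - y|) := by
    rw [fA_pi_sub_eq, fA_pi_sub_eq]
    calc _ = coinB t α * (cos (2 * π * x) - cos (2 * π * y)) := by ring
      _ ≤ |coinB t α * (cos (2 * π * x) - cos (2 * π * y))| := le_abs_self _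
      _ ≤ _ := by rw [abs_mul]; gcongr
  have he := add_one_le_exp (2 * π * |coinB t α| / (coinP t α - |coinB t α|) * |x - y|)
  have h3 : |coinB t α| * (2 * π * |x - y|) ≤
      fA t (π - α) y * (2 * π * |coinB t α| / (coinP t α - |coinB t α|) * |x - y|) := by
    calc _ = (coinP t α - |coinB t α|) * (2 * π * |coinB t α| / (coinP t α - |coinB t α|) * |x - y|) := by
          field_simp
      _ ≤ _ := by gcongr
  nlinarith [mul_le_mul_of_nonneg_left he hf.le]

/-- Products of coin factors along an orbit decay like the base. -/
lemma exists_prod_coin_le {t α : ℝ} (h : Regime t α) :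
    ∃ C : ℝ, 0 ≤ C ∧ ∀ (q : ℕ) (_ : Odd q) (_ : 1 < q) (p : ℤ) (_ : IsUnit (p : ZMod q)) (φ : ℝ)
      (_ : |φ - p / q| ≤ 12 / q ^ 2) (k n : ℕ) (y : ℝ),
      ∏ j ∈ range (k * q + n), (cos α * fA t (π - α) (y + j * φ)) ≤
        (exp C * base t α ^ q) ^ k := by
  obtain ⟨K, hK, hL⟩ := exists_fA_le_mul_exp h
  refine ⟨log 4 + 12 * K, by positivity, fun q hq hq1 p hp φ hφ k n y => ?_⟩
  have : NeZero q := ⟨by omega⟩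
  rw [prod_range_add]
  have hblock : ∀ y, ∏ j ∈ range q, (cos α * fA t (π - α) (y + j * φ)) ≤
      exp (log 4 + 12 * K) * base t α ^ q := by
    intro y
    have h1 : ∏ j ∈ range q, (cos α * fA t (π - α) (y + j * φ)) ≤
        ∏ j ∈ range q, (cos α * (fA t (π - α) (y + j * (p / q)) *
          exp (K * |j * (φ - p / q)|))) := by
      refine prod_le_prod (fun j _ => (coin_factor_mem h _).1.le) fun j _ => ?_
      have := hL (y + j * φ) (y + j * (p / q))
      rw [show y + j * φ - (y + j * (p / q)) = j * (φ - p / q) by ring] at this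
      have := h.cos_pos
      gcongr
    refine h1.trans ?_
    rw [prod_mul_distrib, prod_mul_distrib, ← exp_sum, ← Finset.mul_sum, prod_const,
      card_range, base, mul_pow, Real.exp_add, exp_log (by norm_num)]
    have h2 := prod_fA_phase hq hp h.gap y
    have h3 := sum_drift_le (m := q) (by omega) hφ
    have h4 : K * ∑ i ∈ range q, |i * (φ - p / q)| ≤ 12 * K := by nlinarith
    have h5 : 0 < bigRoot (coinP t α) (coinB t α) := by
      have := h.base_pos
      rw [base] at this
      exact (mul_pos_iff_of_pos_left h.cos_pos).mp this
    calc cos α ^ q * ((∏ j ∈ range q, fA t (π - α) (y + j * (p / q))) *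
          exp (K * ∑ i ∈ range q, |i * (φ - p / q)|))
        ≤ cos α ^ q * ((4 * bigRoot (coinP t α) (coinB t α) ^ q) * exp (12 * K)) := by
          have := h.cos_pos
          gcongr
      _ = _ := by ring
  have hk : ∀ k : ℕ, ∏ j ∈ range (k * q), (cos α * fA t (π - α) (y + j * φ)) ≤
      (exp (log 4 + 12 * K) * base t α ^ q) ^ k := by
    intro k
    induction k with
    | zero => simp
    | succ k ih =>
      rw [add_mul, one_mul, prod_range_add, pow_succ]
      refine mul_le_mul ih ?_ (prod_nonneg fun j _ => (coin_factor_mem h _).1.le) (by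
        have := h.base_pos; positivity)
      refine le_trans (le_of_eq ?_) (hblock (y + (k * q : ℕ) * φ))
      refine prod_congr rfl fun j _ => ?_
      congr 2; push_cast; ring
  refine le_trans (mul_le_of_le_one_right (prod_nonneg fun j _ => (coin_factor_mem h _).1.le) ?_) (hk k)
  exact Finset.prod_le_one (fun j _ => (coin_factor_mem h _).1.le) fun j _ => (coin_factor_mem h _).2

lemma two_div_le_exp {η : ℝ} (h0 : 0 < η) (h1 : η ≤ 1 / 2) : 2 / (1 + (1 - η)) ≤ exp η := by
  refine le_trans ?_ (add_one_le_exp η)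
  rw [div_le_iff₀ (by linarith)]
  nlinarith

lemma norm_chi_le_exp_radius {ι : Type*} [Fintype ι] [DecidableEq ι] {A : Matrix ι ι ℂ} (hA : Aᴴ * A = 1) {η : ℝ}
    (h0 : 0 < η) (h1 : η ≤ 1 / 2) {z : ℂ} (hz : ‖z‖ = 1) :
    ‖chi A z‖ ≤ exp (η * card ι) * ‖chi A ((1 - η : ℝ) * z)‖ := by
  refine (norm_chi_le_radius hA (by linarith : 0 ≤ 1 - η) hz).trans ?_
  rw [mul_comm η, exp_nat_mul]
  gcongr
  · exact div_nonneg (by norm_num) (by linarith)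
  · exact two_div_le_exp h0 h1

lemma PhaseRel.norm_le_radius {p q : ℂ → ℂ} {c : ℝ} (h : PhaseRel p q c) {η : ℝ} (h0 : 0 < η) (h1 : η ≤ 1 / 2)
    {z : ℂ} (hz : ‖z‖ = 1) :
    ‖q ((1 - η : ℝ) * z)‖ ≤ ‖p ((1 - η : ℝ) * z)‖ * exp (2 * c / η) := by
  have hn : ‖((1 - η : ℝ) : ℂ) * z‖ = 1 - η := by
    rw [norm_mul, hz, mul_one, norm_real, norm_eq_abs, abs_of_pos (by linarith)]
  refine (h.norm_le (by rw [hn]; linarith)).trans ?_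
  gcongr
  rw [hn, mul_comm 2 c, mul_div_assoc]
  have := h.nonneg
  gcongr
  · linarith
  · linarith

lemma card_ring (q : ℕ) : card (Fin q ⊕ Fin q) = 2 * q := by
  rw [card_sum, card_fin]; ring

lemma le_norm_chi_qRing {t α β φ x η : ℝ} {n q : ℕ} (hn : n ≤ q) (h0 : 0 < η) (h1 : η ≤ 1 / 2)
    {z : ℂ} (hz : ‖z‖ = 1) :
    1 ≤ exp (2 * q * log (1 / η)) * ‖chi (qRing t α β n φ x) ((1 - η : ℝ) * z)‖ := by
  have hnz : ‖((1 - η : ℝ) : ℂ) * z‖ = 1 - η := by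
    rw [norm_mul, hz, mul_one, norm_real, norm_eq_abs, abs_of_pos (by linarith)]
  have h2 := le_norm_chi (qRing_unitary t α β n φ x) (r := 1 - η) (by linarith) hnz.le
  rw [card_ring, sub_sub_cancel] at h2
  have h3 : exp (2 * q * log (1 / η)) = (1 / η) ^ (2 * q) := by
    rw [show (2 * q * log (1 / η) : ℝ) = ((2 * q : ℕ) : ℝ) * log (1 / η) by push_cast; ring,
      exp_nat_mul, exp_log (by positivity)]
  rw [h3]
  have h4 : η ^ (2 * q) ≤ η ^ (2 * n) := pow_le_pow_of_le_one h0.le (by linarith) (by omega)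
  calc (1 : ℝ) = (1 / η) ^ (2 * q) * η ^ (2 * q) := by
        rw [← mul_pow, one_div, inv_mul_cancel₀ h0.ne', one_pow]
    _ ≤ _ := by gcongr; exact h4.trans h2

/-- The coin products are exponentially small compared with the determinants of segments. -/
lemma prod_coin_le_norm_chi {t α : ℝ} (h : Regime t α) {C : ℝ} {q : ℕ} {φ : ℝ}
    (hq1 : 1 < q) {p : ℤ} (hp : IsUnit (p : ZMod q)) (hφ : |φ - p / q| ≤ 12 / q ^ 2) (hq24 : 24 ≤ q)
    {k n : ℕ} (hn : n ≤ q) (y : ℝ)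
    (hC : ∏ j ∈ range (k * q + n), (cos α * fA t (π - α) (y + j * φ)) ≤
        (exp C * base t α ^ q) ^ k)
    {η κ : ℝ} (h0 : 0 < η) (h1 : η ≤ 1 / 2) {z : ℂ} (hz : ‖z‖ = 1)
    (hg : exp (κ * q) * base t α ^ q ≤ ‖chi (qRing t α (π - α) q (p / q) 0) z‖) :
    ∏ j ∈ range (k * q + n), (cos α * fA t (π - α) (y + j * φ)) ≤
      exp (C * k - (κ - 2 * η) * (q * k) + 2 * q * log (1 / η) + 4 * π * (14 * k + 1) / η) *
        ‖chi (qRing t α (π - α) (k * q + n) φ y) ((1 - η : ℝ) * z)‖ := by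
  have : NeZero q := ⟨by omega⟩
  have hb := h.base_pos
  have e1 := norm_chi_le_exp_radius (qRing_unitary t α (π - α) q (p / q) 0) h0 h1 hz
  rw [card_ring] at e1
  have e2 := (phaseRel_qRing_blocks hq1 t h.abs_sub_le (π - α) hp hφ
    (by have : (24 : ℝ) ≤ q := mod_cast hq24
        linarith) y k n).norm_le_radius h0 h1 hz
  beta_reduce at e2
  have e3 := le_norm_chi_qRing (t := t) (α := α) (β := π - α) (φ := φ) (x := y + (k * q : ℕ) * φ) hn h0 h1 hz
  generalize chi (qRing t α (π - α) n φ (y + (k * q : ℕ) * φ)) ((1 - η : ℝ) * z) = X at *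
  generalize chi (qRing t α (π - α) (k * q + n) φ y) ((1 - η : ℝ) * z) = Y at *
  generalize chi (qRing t α (π - α) q (p / q) 0) ((1 - η : ℝ) * z) = D at *
  have e4 : base t α ^ q ≤ exp (-(κ * q) + η * (2 * q : ℕ)) * ‖D‖ := by
    have := hg.trans e1
    calc base t α ^ q = exp (-(κ * q)) * (exp (κ * q) * base t α ^ q) := by
          rw [← mul_assoc, ← Real.exp_add]; simp
      _ ≤ exp (-(κ * q)) * (exp (η * (2 * q : ℕ)) * ‖D‖) := by gcongr
      _ = _ := by rw [Real.exp_add]; ring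
  rw [norm_mul, norm_pow] at e2
  calc _ ≤ (exp C * base t α ^ q) ^ k := hC
    _ ≤ (exp C * (exp (-(κ * q) + η * (2 * q : ℕ)) * ‖D‖)) ^ k := by gcongr
    _ ≤ (exp C * (exp (-(κ * q) + η * (2 * q : ℕ)) * ‖D‖)) ^ k *
        (exp (2 * q * log (1 / η)) * ‖X‖) := le_mul_of_one_le_right (by positivity) e3
    _ = exp (k * C + k * (-(κ * q) + η * (2 * q : ℕ)) + 2 * q * log (1 / η)) * (‖D‖ ^ k * ‖X‖) := by
        rw [Real.exp_add (k * C + k * (-(κ * q) + η * (2 * q : ℕ))), Real.exp_add (k * C), exp_nat_mul,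
          exp_nat_mul]
        ring
    _ ≤ exp (k * C + k * (-(κ * q) + η * (2 * q : ℕ)) + 2 * q * log (1 / η)) *
        (‖Y‖ * exp (2 * (2 * π * (12 + 2) * k + 2 * π) / η)) := by gcongr
    _ = _ := by
        rw [mul_comm ‖Y‖, ← mul_assoc, ← Real.exp_add]
        congr 2; push_cast; ring

/-- One-sided decay: a segment determinant times the complementary coin product, compared to the full ring. -/
lemma segment_decay {t α : ℝ} (h : Regime t α) {q : ℕ} (hq : Odd q) (hq1 : 1 < q) {p : ℤ}
    (hp : IsUnit (p : ZMod q)) {E E' : ℝ} {l R : ℕ} (hlR : l + R = q) (x : ℝ)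
    {η : ℝ} (h0 : 0 < η) (h1 : η ≤ 1 / 2) {z : ℂ} (hz : ‖z‖ = 1)
    (hE : ∏ j ∈ range R, (cos α * fA t (π - α) (x + (l + j : ℕ) * (p / q))) ≤
      exp E * ‖chi (qRing t α (π - α) R (p / q) (x + l * (p / q))) ((1 - η : ℝ) * z)‖)
    (hr : ‖chi (qRing t α (π - α) q (p / q) 0) ((1 - η : ℝ) * z)‖ ≤
      exp E' * ‖chi (qRing t α (π - α) q (p / q) 0) z‖)
    (hb : 32 * base t α ^ q ≤ ‖chi (qRing t α (π - α) q (p / q) 0) z‖) :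
    ‖chi (qRing t α (π - α) l (p / q) x) ((1 - η : ℝ) * z)‖ *
      ∏ j ∈ range R, (cos α * fA t (π - α) (x + (l + j : ℕ) * (p / q))) ≤
      2 * exp (E + E' + 8 * π / η) * ‖chi (qRing t α (π - α) q (p / q) x) z‖ := by
  have : NeZero q := ⟨by omega⟩
  have e1 : PhaseRel (chi (qRing t α (π - α) q (p / q) x))
      (fun z => chi (qRing t α (π - α) l (p / q) x) z *
        chi (qRing t α (π - α) R (p / q) (x + l * (p / q))) z) (2 * π) := by
    have := ringN_split t l R (fun _ => α) (fun _ => π - α) (fun j : ℕ => x + j * (p / q))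
      (fun _ => h.abs_sub_le)
    rw [hlR] at this
    refine (this.trans (PhaseRel.of_eq fun z => ?_)).mono (by rw [add_zero])
    simp only [qRing]
    congr 3
    funext i; push_cast; ring
  have e2 := e1.norm_le_radius h0 h1 hz
  have e3 := (phaseRel_qRing_phase hq1 t α (π - α) hp x).symm.norm_le_radius h0 h1 hz
  have e4 := chi_qRing_phase_diff hq h hz hp x
  beta_reduce at e2
  generalize chi (qRing t α (π - α) l (p / q) x) ((1 - η : ℝ) * z) = X at *
  generalize chi (qRing t α (π - α) R (p / q) (x + l * (p / q))) ((1 - η : ℝ) * z) = Y at *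
  generalize chi (qRing t α (π - α) q (p / q) 0) ((1 - η : ℝ) * z) = D at *
  generalize chi (qRing t α (π - α) q (p / q) x) ((1 - η : ℝ) * z) = D' at *
  have e5 : ‖chi (qRing t α (π - α) q (p / q) 0) z‖ ≤ 2 * ‖chi (qRing t α (π - α) q (p / q) x) z‖ := by
    have := norm_sub_norm_le (chi (qRing t α (π - α) q (p / q) 0) z) (chi (qRing t α (π - α) q (p / q) x) z)
    rw [norm_sub_rev] at this
    linarith
  rw [norm_mul] at e2
  calc _ ≤ ‖X‖ * (exp E * ‖Y‖) := by gcongr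
    _ = exp E * (‖X‖ * ‖Y‖) := by ring
    _ ≤ exp E * (((exp E' * (2 * ‖chi (qRing t α (π - α) q (p / q) x) z‖)) *
          exp (2 * (2 * π) / η)) * exp (2 * (2 * π) / η)) := by
        have e6 : ‖D'‖ ≤ (exp E' * (2 * ‖chi (qRing t α (π - α) q (p / q) x) z‖)) *
            exp (2 * (2 * π) / η) := by
          refine e3.trans ?_
          gcongr
          refine hr.trans ?_
          gcongr
        refine mul_le_mul_of_nonneg_left (e2.trans ?_) (exp_pos _).le
        gcongr
    _ = _ := by
        rw [show E + E' + 8 * π / η = E + E' + 2 * (2 * π) / η + 2 * (2 * π) / η by ring,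
          Real.exp_add, Real.exp_add, Real.exp_add]
        ring

/-- The hypotheses on a spectral point `z` at the scale `q`. -/
structure GoodPoint (t α κ ρ η : ℝ) (q₀ : ℕ) (p₀ : ℤ) (q : ℕ) (p : ℤ) (z : ℂ) : Prop where
  unit : ‖z‖ = 1
  growth : exp (κ * q₀) * base t α ^ q₀ ≤ ‖chi (qRing t α (π - α) q₀ (p₀ / q₀) 0) z‖
  radius : ‖chi (qRing t α (π - α) q (p / q) 0) ((1 - η : ℝ) * z)‖ ≤
      exp (κ * ρ / 8 * q) * ‖chi (qRing t α (π - α) q (p / q) 0) z‖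
  large : 32 * base t α ^ q ≤ ‖chi (qRing t α (π - α) q (p / q) 0) z‖

lemma exists_decay {t α Φ κ ρ η : ℝ} (h : Regime t α) (hκ : 0 < κ) (hρ : 0 < ρ) (hρ1 : ρ ≤ 1) (h0 : 0 < η)
    (h1 : η ≤ 1 / 2) (h2 : η ≤ κ * ρ / 32) :
    ∃ Q₀ : ℕ, ∀ q₀ ≥ Q₀, ∀ p₀, Approx Φ q₀ p₀ → ∀ δ > 0, ∃ Q : ℕ, ∀ q ≥ Q, ∀ p, Approx Φ q p →
      ∀ z, GoodPoint t α κ ρ η q₀ p₀ q p z → ∀ x, ∀ l R : ℕ, l + R = q → ρ * q ≤ R →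
      exp (4 * π / η + 2 * η * (q + 1)) * (‖chi (qRing t α (π - α) l (p / q) x) ((1 - η : ℝ) * z)‖ *
      ∏ j ∈ range R, (cos α * fA t (π - α) (x + (l + j : ℕ) * (p / q)))) ≤
      δ * ‖chi (qRing t α (π - α) q (p / q) x) z‖ := by
  obtain ⟨C, hC0, hC⟩ := exists_prod_coin_le h
  refine ⟨max 24 ⌈4 * (C + 56 * π / η) / κ⌉₊, fun q₀ hq₀ p₀ ha₀ δ hδ => ?_⟩
  have hq24 : 24 ≤ q₀ := (le_max_left _ _).trans hq₀
  have hqB : C + 56 * π / η ≤ κ / 4 * q₀ := by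
    have := (Nat.le_ceil _).trans (Nat.cast_le (α := ℝ).mpr ((le_max_right _ _).trans hq₀))
    rw [div_le_iff₀ hκ] at this
    linarith
  obtain ⟨M, hM⟩ : ∃ M : ℝ, M = κ / 2 * q₀ + 2 * q₀ * log (1 / η) + 4 * π / η + 8 * π / η +
    4 * π / η + 2 * η := ⟨_, rfl⟩
  refine ⟨max q₀ ⌈(M - log (δ / 2)) / (κ * ρ / 4)⌉₊, fun q hq p ha z hz x l R hlR hR => ?_⟩
  have hqq : q₀ ≤ q := (le_max_left _ _).trans hq
  have hqM : M - log (δ / 2) ≤ κ * ρ / 4 * q := by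
    have := (Nat.le_ceil _).trans (Nat.cast_le (α := ℝ).mpr ((le_max_right _ _).trans hq))
    rw [div_le_iff₀ (by positivity)] at this
    linarith
  obtain ⟨k, n, hkn, hn⟩ : ∃ k n, R = k * q₀ + n ∧ n ≤ q₀ :=
    ⟨R / q₀, R % q₀, (Nat.div_add_mod' R q₀).symm, (Nat.mod_lt _ (by omega)).le⟩
  have hE := prod_coin_le_norm_chi h (C := C) ha₀.one_lt ha₀.unit (Approx.dist ha₀ ha hqq) hq24 (k := k) hn
    (x + l * (p / q)) (hC q₀ ha₀.odd ha₀.one_lt p₀ ha₀.unit _ (Approx.dist ha₀ ha hqq) k n _) h0 h1 hz.unit hz.growth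
  rw [← hkn] at hE
  have hpc : ∏ j ∈ range R, (cos α * fA t (π - α) (x + l * (p / q) + j * (p / q))) =
      ∏ j ∈ range R, (cos α * fA t (π - α) (x + (l + j : ℕ) * (p / q))) :=
    prod_congr rfl fun j _ => by congr 2; push_cast; ring
  rw [hpc] at hE
  have hD := segment_decay h ha.odd ha.one_lt ha.unit hlR x h0 h1 hz.unit hE hz.radius hz.large
  refine (mul_le_mul_of_nonneg_left hD (exp_pos _).le).trans ?_
  rw [← mul_assoc]
  refine mul_le_mul_of_nonneg_right ?_ (norm_nonneg _)
  have hexp : ∀ a b : ℝ, exp a * (2 * exp b) = 2 * exp (a + b) := by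
    intro a b; rw [Real.exp_add]; ring
  rw [hexp]
  have hkR : (R : ℝ) ≤ k * q₀ + q₀ := by
    have : R ≤ k * q₀ + q₀ := by omega
    exact_mod_cast this
  have hk0 : (0 : ℝ) ≤ k := Nat.cast_nonneg k
  have hfin : 4 * π / η + 2 * η * (q + 1) + (C * k - (κ - 2 * η) * (q₀ * k) + 2 * q₀ * log (1 / η) +
      4 * π * (14 * k + 1) / η + κ * ρ / 8 * q + 8 * π / η) ≤ log (δ / 2) := by
    have a1 : C * k + 4 * π * (14 * k + 1) / η = (C + 56 * π / η) * k + 4 * π / η := by ring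
    have a2 : (C + 56 * π / η) * k ≤ κ / 4 * q₀ * k := by gcongr
    have a3 : 2 * η * (q₀ * k) ≤ κ / 16 * (q₀ * k) := by
      gcongr
      nlinarith
    have a4 : 2 * η * q ≤ κ * ρ / 16 * q := by gcongr; linarith
    have a5 : κ / 2 * (ρ * q) ≤ κ / 2 * (k * q₀ + q₀) := by gcongr; linarith
    have a6 : 0 ≤ κ * (q₀ * k) := by positivity
    have a7 : 0 ≤ κ * ρ * q := by positivity
    nlinarith
  calc _ ≤ 2 * exp (log (δ / 2)) := by gcongr
    _ = δ := by rw [exp_log (by positivity)]; ring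

lemma stepMat_eq_smul (s : ℝ) (g : ℂ) {z : ℂ} (hz : star z * z = 1) :
    stepMat s g z = z • !![star z + s * star g, g + s * z; star (g + s * z), star (star z + s * star g)] := by
  have hs : star (s : ℂ) = s := conj_ofReal s
  have hz' : (starRingEnd ℂ) z * z = 1 := hz
  rw [stepMat]
  simp only [star_add, star_mul', star_star, hs]
  ext i j
  fin_cases i <;> fin_cases j <;> simp [mul_apply, Fin.sum_univ_two]
  · linear_combination -hz'
  · ring
  · linear_combination (-s : ℂ) * hz'
  · ring

lemma exists_segProd_stepMat (s : ℝ) (g : ℕ → ℂ) {z : ℂ} (hz : star z * z = 1) (i k : ℕ) :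
    ∃ a b : ℂ, segProd (fun j => stepMat s (g j) z) i k = z ^ k • !![a, b; star b, star a] := by
  induction k generalizing i with
  | zero =>
    refine ⟨1, 0, ?_⟩
    rw [segProd_zero, pow_zero, one_smul]
    ext i j
    fin_cases i <;> fin_cases j <;> simp
  | succ k ih =>
    obtain ⟨a, b, hab⟩ := ih (i + 1)
    rw [segProd_succ, hab, stepMat_eq_smul s (g i) hz]
    generalize star z + s * star (g i) = c
    generalize g i + s * z = d
    refine ⟨c * a + d * star b, c * b + d * star a, ?_⟩
    rw [smul_mul_smul_comm, pow_succ']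
    congr 1
    ext i j
    fin_cases i <;> fin_cases j <;> simp [mul_apply, Fin.sum_univ_two]
    · ring
    · ring

lemma det_stepMat (s : ℝ) (g z : ℂ) : (stepMat s g z).det = ((1 - s ^ 2) * (1 - ‖g‖ ^ 2) : ℝ) * z ^ 2 := by
  have h : star g * g = ((‖g‖ ^ 2 : ℝ) : ℂ) := by
    rw [mul_comm]
    exact (mul_conj g).trans (by rw [normSq_eq_norm_sq])
  rw [stepMat, det_mul, det_fin_two_of, det_fin_two_of]
  push_cast at h ⊢
  linear_combination (-(1 - s ^ 2) * z ^ 2) * h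

/-- Entries of products of transfer matrices are controlled by two traces. -/
lemma norm_entry_le_of_traces {s X : ℝ} {a b : ℂ} (hab : ‖b‖ ≤ ‖a‖) (h1 : |2 * a.re| ≤ X)
    (h2 : |2 * (a * star (circ s)).re| ≤ X) (i j : Fin 2) :
    ‖(!![a, b; star b, star a] : Matrix (Fin 2) (Fin 2) ℂ) i j‖ * |sin (2 * π * s)| ≤ 2 * X := by
  have hc : circ s = (cos (2 * π * s) : ℂ) + sin (2 * π * s) * I := by
    rw [circ, show (2 * π * s * I : ℂ) = ((2 * π * s : ℝ) : ℂ) * I by push_cast; ring,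
      exp_mul_I, ofReal_cos, ofReal_sin]
  have hre : (a * star (circ s)).re = a.re * cos (2 * π * s) + a.im * sin (2 * π * s) := by
    rw [hc]
    simp [mul_re, -ofReal_cos, -ofReal_sin]
  rw [hre] at h2
  have hX : 0 ≤ X := (abs_nonneg _).trans h1
  have k1 : |a.re| * |cos (2 * π * s)| ≤ X / 2 := by
    rw [abs_mul, abs_two] at h1
    nlinarith [abs_cos_le_one (2 * π * s), abs_nonneg a.re]
  have k2 : |a.im| * |sin (2 * π * s)| ≤ X := by
    rw [abs_mul, abs_two] at h2
    have h3 := abs_add_le (a.re * cos (2 * π * s) + a.im * sin (2 * π * s))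
      (-(a.re * cos (2 * π * s)))
    rw [abs_neg, abs_mul a.re, add_comm (a.re * _), add_neg_cancel_right, abs_mul] at h3
    rw [add_comm (a.im * _)] at h3
    linarith
  have k3 : |a.re| * |sin (2 * π * s)| ≤ X / 2 := by
    rw [abs_mul, abs_two] at h1
    nlinarith [abs_sin_le_one (2 * π * s), abs_nonneg a.re]
  have k4 : ‖a‖ * |sin (2 * π * s)| ≤ 2 * X := by
    have := mul_le_mul_of_nonneg_right (Complex.norm_le_abs_re_add_abs_im a) (abs_nonneg (sin (2 * π * s)))
    rw [add_mul] at this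
    linarith
  have k5 : ‖b‖ * |sin (2 * π * s)| ≤ 2 * X :=
    (mul_le_mul_of_nonneg_right hab (abs_nonneg _)).trans k4
  fin_cases i <;> fin_cases j
  · simpa using k4
  · simpa using k5
  · simpa using k5
  · simpa using k4

/-- The coin angle at which the coin is trivial at phase zero. -/
def trivialAngle (t : ℝ) : ℝ := arccos (-(2 * t) / (1 + t ^ 2))

lemma fA_trivialAngle {t : ℝ} (ht : t ^ 2 ≤ 1) : fA t (trivialAngle t) 0 = 1 := by
  have hp : (0 : ℝ) < 1 + t ^ 2 := by positivity
  have h1 : -1 ≤ -(2 * t) / (1 + t ^ 2) := by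
    rw [le_div_iff₀ hp]; nlinarith [sq_nonneg (t - 1)]
  have h2 : -(2 * t) / (1 + t ^ 2) ≤ 1 := by
    rw [div_le_iff₀ hp]; nlinarith [sq_nonneg (t + 1)]
  have h3 : √(1 - (-(2 * t) / (1 + t ^ 2)) ^ 2) = (1 - t ^ 2) / (1 + t ^ 2) := by
    rw [show 1 - (-(2 * t) / (1 + t ^ 2)) ^ 2 = ((1 - t ^ 2) / (1 + t ^ 2)) ^ 2 by field_simp; ring]
    exact sqrt_sq (div_nonneg (by linarith) hp.le)
  rw [fA, trivialAngle, Real.sin_arccos, Real.cos_arccos h1 h2, h3, mul_zero, cos_zero]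
  field_simp
  ring

lemma gA_trivialAngle {t : ℝ} (ht : t ^ 2 ≤ 1) : gA t (trivialAngle t) 0 = 0 := by
  have := fA_sq_add t (trivialAngle t) 0
  rw [fA_trivialAngle ht] at this
  have h : ‖gA t (trivialAngle t) 0‖ ^ 2 = 0 := by linarith
  exact norm_eq_zero.mp (pow_eq_zero_iff two_ne_zero |>.mp h)

/-- The transfer matrix of `k` consecutive sites starting at `i`. -/
def transfer (t α φ x : ℝ) (z : ℂ) (i k : ℕ) : Matrix (Fin 2) (Fin 2) ℂ :=
  segProd (fun j : ℕ => stepMat (sin α) (gA t (π - α) (x + j * φ)) z) i k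

/-- The product of the coin factors of `k` consecutive sites starting at `i`. -/
def coinProd (t α φ x : ℝ) (i k : ℕ) : ℝ :=
  ∏ j ∈ range k, (cos α * fA t (π - α) (x + (i + j : ℕ) * φ))

lemma coinProd_pos {t α : ℝ} (h : Regime t α) (φ x : ℝ) (i k : ℕ) : 0 < coinProd t α φ x i k :=
  prod_pos fun _ _ => (coin_factor_mem h _).1

lemma coinProd_add (t α φ x : ℝ) (i k l : ℕ) :
    coinProd t α φ x i (k + l) = coinProd t α φ x i k * coinProd t α φ x (i + k) l := by
  rw [coinProd, prod_range_add]
  congr 1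
  exact prod_congr rfl fun j _ => by rw [add_assoc]

lemma transfer_add (t α φ x : ℝ) (z : ℂ) (i k l : ℕ) :
    transfer t α φ x z i (k + l) = transfer t α φ x z i k * transfer t α φ x z (i + k) l := segProd_add _ _ _ _

lemma det_transfer {t α : ℝ} (φ x : ℝ) {z : ℂ} (i k : ℕ) :
    (transfer t α φ x z i k).det = ((coinProd t α φ x i k ^ 2 : ℝ) : ℂ) * z ^ (2 * k) := by
  rw [transfer, det_segProd, coinProd, ← Finset.prod_pow, ofReal_prod, pow_mul,
    ← card_range k, ← prod_const, card_range, ← prod_mul_distrib]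
  refine prod_congr rfl fun j _ => ?_
  rw [det_stepMat]
  congr 2
  have h1 := fA_sq_add t (π - α) (x + (i + j : ℕ) * φ)
  have h2 := Real.sin_sq_add_cos_sq α
  rw [mul_pow]
  rw [show 1 - sin α ^ 2 = cos α ^ 2 by linarith]
  congr 1; linarith

/-- Entries of transfer matrices are controlled by the determinant of the segment inside the disc. -/
lemma transfer_entry_le {t α : ℝ} (ht : t ^ 2 ≤ 1) (h : Regime t α) (φ x : ℝ) {l : ℕ} (hl : l ≠ 0) {s η : ℝ}
    (h0 : 0 < η) (h1 : η ≤ 1 / 2) (i j : Fin 2) :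
    ‖transfer t α φ x (circ s) 0 l i j‖ * |sin (2 * π * s)| ≤
      2 * (4 * exp (4 * π / η + 2 * η * (l + 1)) *
        ‖chi (qRing t α (π - α) l φ x) ((1 - η : ℝ) * circ s)‖ + 2 * coinProd t α φ x 0 l) := by
  have hz1 : ‖circ s‖ = 1 := norm_circ s
  have hz : star (circ s) * circ s = 1 := by
    rw [← circ_neg_eq_star, mul_comm, circ_mul_circ_neg]
  have hcs := h.cos_pos
  have hP := coinProd_pos h φ x 0 l
  obtain ⟨a, b, hab⟩ := exists_segProd_stepMat (sin α) (fun j : ℕ => gA t (π - α) (x + j * φ)) hz 0 l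
  have hT : transfer t α φ x (circ s) 0 l = circ s ^ l • !![a, b; star b, star a] := hab
  have hdet := det_transfer (t := t) (α := α) φ x (z := circ s) 0 l
  have hba : ‖b‖ ≤ ‖a‖ := by
    rw [hT, det_smul, card_fin, det_fin_two_of, ← pow_mul, mul_comm l 2, mul_comm] at hdet
    have h2 := mul_right_cancel₀ (pow_ne_zero _ (circ_ne_zero s)) hdet
    have e : ∀ c : ℂ, c * star c = ((‖c‖ ^ 2 : ℝ) : ℂ) := fun c =>
      (mul_conj c).trans (by rw [normSq_eq_norm_sq])
    rw [e, e, ← ofReal_sub] at h2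
    have h3 := ofReal_injective h2
    nlinarith [norm_nonneg a, norm_nonneg b, sq_nonneg (coinProd t α φ x 0 l)]
  obtain ⟨S, hS⟩ : ∃ S, S = ‖chi (qRing t α (π - α) l φ x) ((1 - η : ℝ) * circ s)‖ := ⟨_, rfl⟩
  obtain ⟨G, hG⟩ : ∃ G, G = exp (4 * π / η + 2 * η * (l + 1)) := ⟨_, rfl⟩
  have hS0 : 0 ≤ S := hS ▸ norm_nonneg _
  have hG0 : 0 < G := hG ▸ exp_pos _
  have hpi : 0 < π := pi_pos
  -- the segment itself
  have htr1 : ‖(transfer t α φ x (circ s) 0 l).trace‖ ≤ 4 * G * S + 2 * coinProd t α φ x 0 l := by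
    have e1 := chi_ringN_eq_trace t l hl (fun _ => α) (fun _ => π - α) (fun j : ℕ => x + j * φ)
      (fun _ => (fA_pos h.gap _).2.ne') (fun _ => hcs.ne') (circ_ne_zero s)
    have e2 := norm_chi_le_exp_radius (qRing_unitary t α (π - α) l φ x) h0 h1 hz1
    rw [card_ring, ← hS] at e2
    have e3 : ‖chi (qRing t α (π - α) l φ x) (circ s)‖ ≤ 4 * G * S := by
      refine e2.trans ?_
      have : exp (η * (2 * l : ℕ)) ≤ G := by
        rw [hG]
        apply exp_le_exp.mpr
        push_cast
        have : 0 ≤ 4 * π / η := by positivity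
        nlinarith
      nlinarith
    rw [← ofReal_prod] at e1
    have e4 : (transfer t α φ x (circ s) 0 l).trace = chi (qRing t α (π - α) l φ x) (circ s) +
        2 * circ s ^ l * (coinProd t α φ x 0 l : ℂ) := by
      rw [qRing, e1, transfer, coinProd]
      simp only [zero_add, sub_add_cancel]
    rw [e4]
    refine (norm_add_le _ _).trans ?_
    rw [norm_mul, norm_mul, norm_pow, hz1, one_pow, norm_real, norm_eq_abs, abs_of_pos hP]
    norm_num
    linarith
  -- the segment with a transparent site appended
  have htr2 : ‖(transfer t α φ x (circ s) 0 l * !![1, 0; 0, circ s ^ 2]).trace‖ ≤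
      4 * G * S + 2 * coinProd t α φ x 0 l := by
    obtain ⟨α', hα'⟩ : ∃ α' : ℕ → ℝ, α' = fun j => if j < l then α else 0 := ⟨_, rfl⟩
    obtain ⟨β', hβ'⟩ : ∃ β' : ℕ → ℝ, β' = fun j => if j < l then π - α else trivialAngle t := ⟨_, rfl⟩
    obtain ⟨x', hx'⟩ : ∃ x' : ℕ → ℝ, x' = fun j : ℕ => if j < l then x + j * φ else 0 := ⟨_, rfl⟩
    have c1 : ∀ j, j < l → α' j = α ∧ β' j = π - α ∧ x' j = x + j * φ := by
      intro j hj; rw [hα', hβ', hx']; simp [hj]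
    have c2 : ∀ j, l ≤ j → α' j = 0 ∧ β' j = trivialAngle t ∧ x' j = 0 := by
      intro j hj; rw [hα', hβ', hx']; simp [not_lt.mpr hj]
    have hf : ∀ j, fA t (β' j) (x' j) ≠ 0 := by
      intro j
      rcases lt_or_ge j l with hj | hj
      · rw [(c1 j hj).2.1]; exact (fA_pos h.gap _).2.ne'
      · rw [(c2 j hj).2.1, (c2 j hj).2.2, fA_trivialAngle ht]; exact one_ne_zero
    have hca : ∀ j, cos (α' j) ≠ 0 := by
      intro j
      rcases lt_or_ge j l with hj | hj
      · rw [(c1 j hj).1]; exact hcs.ne'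
      · rw [(c2 j hj).1, cos_zero]; exact one_ne_zero
    have hα2 : ∀ i, |α' i - π / 2| ≤ π / 2 := by
      intro j
      rcases lt_or_ge j l with hj | hj
      · rw [(c1 j hj).1]; exact h.abs_sub_le
      · rw [(c2 j hj).1, zero_sub, abs_neg, abs_of_pos (by positivity)]
    have e1 := chi_ringN_eq_trace t (l + 1) (by omega) α' β' x' hf hca (circ_ne_zero s)
    have e2 := norm_chi_le_exp_radius (ringN_unitary t (l + 1) α' β' x') h0 h1 hz1
    rw [card_ring] at e2
    have e3 := (ringN_split t l 1 α' β' x' hα2).symm.norm_le_radius h0 h1 hz1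
    beta_reduce at e3
    have e4 : ringN t l α' β' x' = qRing t α (π - α) l φ x :=
      ringN_congr (fun j hj => (c1 j hj).1) (fun j hj => (c1 j hj).2.1) (fun j hj => (c1 j hj).2.2)
    rw [e4, norm_mul, ← hS] at e3
    have hn : ‖((1 - η : ℝ) : ℂ) * circ s‖ = 1 - η := by
      rw [norm_mul, hz1, mul_one, norm_real, norm_eq_abs, abs_of_pos (by linarith)]
    have e5 := norm_chi_le_two_pow (ringN_unitary t 1 (fun i => α' (l + i)) (fun i => β' (l + i)) (fun i => x' (l + i)))
      (z := ((1 - η : ℝ) : ℂ) * circ s) (by rw [hn]; linarith)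
    rw [card_ring] at e5
    have e6 : ‖chi (ringN t (l + 1) α' β' x') (circ s)‖ ≤ 4 * G * S := by
      calc _ ≤ _ := e2
        _ ≤ exp (η * (2 * (l + 1) : ℕ)) * (S * 2 ^ (2 * 1) * exp (2 * (2 * π) / η)) := by
            refine mul_le_mul_of_nonneg_left (e3.trans ?_) (exp_pos _).le
            gcongr
        _ = _ := by
            rw [hG, Real.exp_add, show 4 * π / η = 2 * (2 * π) / η by ring,
              show 2 * η * (l + 1) = η * (2 * (l + 1) : ℕ) by push_cast; ring]
            ring
    rw [← ofReal_prod] at e1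
    have e7 : (segProd (fun j => stepMat (sin (α' j)) (gA t (β' j) (x' j)) (circ s)) 0 (l + 1)) =
        transfer t α φ x (circ s) 0 l * !![1, 0; 0, circ s ^ 2] := by
      rw [segProd_add, transfer]
      congr 1
      · refine segProd_congr fun j _ hj => ?_
        obtain ⟨k1, k2, k3⟩ := c1 j (by omega)
        rw [k1, k2, k3]
      · obtain ⟨k1, k2, k3⟩ := c2 l le_rfl
        rw [segProd_succ, segProd_zero, mul_one, zero_add, k1, k2, k3, gA_trivialAngle ht, Real.sin_zero, stepMat]
        ext i j
        fin_cases i <;> fin_cases j <;> simp [mul_apply, Fin.sum_univ_two]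
    have e8 : ∏ j ∈ range (l + 1), (cos (α' j) * fA t (β' j) (x' j)) = coinProd t α φ x 0 l := by
      rw [prod_range_succ, (c2 l le_rfl).1, (c2 l le_rfl).2.1, (c2 l le_rfl).2.2, fA_trivialAngle ht,
        cos_zero, mul_one, mul_one, coinProd]
      refine prod_congr rfl fun j hj => ?_
      obtain ⟨k1, k2, k3⟩ := c1 j (mem_range.mp hj)
      rw [k1, k2, k3, zero_add]
    rw [e7, e8] at e1
    rw [eq_add_of_sub_eq e1.symm]
    refine (norm_add_le _ _).trans ?_
    rw [norm_mul, norm_mul, norm_pow, hz1, one_pow, norm_real, norm_eq_abs, abs_of_pos hP]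
    norm_num
    linarith
  rw [hT] at htr1 htr2 ⊢
  rw [Matrix.smul_apply, norm_smul, norm_pow, hz1, one_pow, one_mul, ← hG, ← hS]
  refine norm_entry_le_of_traces hba ?_ ?_ i j
  · have : (circ s ^ l • !![a, b; star b, star a] : Matrix (Fin 2) (Fin 2) ℂ).trace = circ s ^ l * ((2 * a.re : ℝ) : ℂ) := by
      rw [trace_smul, trace_fin_two_of, smul_eq_mul]
      congr 1
      rw [show star a = (starRingEnd ℂ) a from rfl, add_conj]
    rw [this, norm_mul, norm_pow, hz1, one_pow, one_mul, norm_real, norm_eq_abs] at htr1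
    exact htr1
  · have : (circ s ^ l • !![a, b; star b, star a] * !![1, 0; 0, circ s ^ 2] : Matrix (Fin 2) (Fin 2) ℂ).trace =
        circ s ^ (l + 1) * ((2 * (a * star (circ s)).re : ℝ) : ℂ) := by
      rw [smul_mul, trace_smul, smul_eq_mul, pow_succ (circ s) l, mul_assoc]
      congr 1
      rw [← add_conj, map_mul, show (starRingEnd ℂ) (star (circ s)) = circ s from star_star _]
      simp only [trace_fin_two, mul_apply, Fin.sum_univ_two, Fin.zero_eta, Fin.mk_one, of_apply, cons_val', cons_val_zero, cons_val_one, cons_val_fin_one]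
      rw [show star a = (starRingEnd ℂ) a from rfl]
      linear_combination (-a) * hz
    rw [this, norm_mul, norm_pow, hz1, one_pow, one_mul, norm_real, norm_eq_abs] at htr2
    exact htr2

/-- Transfer matrices of long segments are small relative to the determinant of the ring. -/
lemma transfer_entry_le_ring {t α : ℝ} (ht : t ^ 2 ≤ 1) (h : Regime t α) {φ x δ ρ : ℝ} {q : ℕ} {s η : ℝ}
    (hρ1 : ρ ≤ 1) (h0 : 0 < η) (h1 : η ≤ 1 / 2)
    (hdec : ∀ l R : ℕ, l + R = q → ρ * q ≤ R →
      exp (4 * π / η + 2 * η * (q + 1)) *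
        (‖chi (qRing t α (π - α) l φ x) ((1 - η : ℝ) * circ s)‖ * coinProd t α φ x l R) ≤
      δ * ‖chi (qRing t α (π - α) q φ x) (circ s)‖)
    {l R : ℕ} (hl : l ≠ 0) (hlR : l + R = q) (hR : ρ * q ≤ R) (i j : Fin 2) :
    ‖transfer t α φ x (circ s) 0 l i j‖ * |sin (2 * π * s)| * coinProd t α φ x l R ≤
      12 * δ * ‖chi (qRing t α (π - α) q φ x) (circ s)‖ := by
  have e1 := transfer_entry_le ht h φ x hl (s := s) h0 h1 i j
  have e2 := hdec l R hlR hR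
  have e3 := hdec 0 q (zero_add q) (by nlinarith [(Nat.cast_nonneg q : (0 : ℝ) ≤ q)])
  have hP := coinProd_pos h φ x l R
  have hPq := coinProd_pos h φ x 0 q
  rw [qRing, chi_ringN_zero, norm_one, one_mul] at e3
  have hpi := pi_pos
  have e4 : coinProd t α φ x 0 q ≤ exp (4 * π / η + 2 * η * (q + 1)) * coinProd t α φ x 0 q :=
    le_mul_of_one_le_left hPq.le (Real.one_le_exp (by positivity))
  have e5 : coinProd t α φ x 0 l * coinProd t α φ x l R = coinProd t α φ x 0 q := by
    rw [← hlR, coinProd_add, zero_add]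
  have e6 : exp (4 * π / η + 2 * η * (l + 1)) ≤ exp (4 * π / η + 2 * η * (q + 1)) := by
    have : (l : ℝ) ≤ q := mod_cast (by omega : l ≤ q)
    apply exp_le_exp.mpr
    gcongr
  have hS := norm_nonneg (chi (qRing t α (π - α) l φ x) ((1 - η : ℝ) * circ s))
  have e7 := mul_le_mul_of_nonneg_right e6 (mul_nonneg hS hP.le)
  refine (mul_le_mul_of_nonneg_right e1 hP.le).trans ?_
  have e8 : 2 * (4 * exp (4 * π / η + 2 * η * (l + 1)) *
        ‖chi (qRing t α (π - α) l φ x) ((1 - η : ℝ) * circ s)‖ + 2 * coinProd t α φ x 0 l) * coinProd t α φ x l R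
      = 8 * (exp (4 * π / η + 2 * η * (l + 1)) *
        (‖chi (qRing t α (π - α) l φ x) ((1 - η : ℝ) * circ s)‖ * coinProd t α φ x l R)) +
        4 * coinProd t α φ x 0 q := by rw [← e5]; ring
  rw [e8]
  linarith

lemma chain_no_source {C : ℕ → Matrix (Fin 2) (Fin 2) ℂ} {μ : ℕ → ℂ} {V σ : ℕ → Fin 2 → ℂ}
    (h : ∀ n, μ n • V n = C n *ᵥ V (n + 1) + σ n) (i k : ℕ) (h0 : ∀ n, i ≤ n → n < i + k → σ n = 0) :
    (∏ j ∈ range k, μ (i + j)) • V i = segProd C i k *ᵥ V (i + k) := by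
  induction k generalizing i with
  | zero => simp [segProd_zero]
  | succ k ih =>
    have h1 := ih (i + 1) fun n hn hn' => h0 n (by omega) (by omega)
    have h2 := h i
    rw [h0 i le_rfl (by omega), add_zero] at h2
    rw [prod_range_succ', add_zero, mul_smul, h2, segProd_succ, ← mulVec_mulVec,
      show i + (k + 1) = i + 1 + k by ring, ← h1, mulVec_smul]
    congr 1
    exact prod_congr rfl fun j _ => by congr 1; ring

lemma add_adjugate_fin_two (T : Matrix (Fin 2) (Fin 2) ℂ) : T + T.adjugate = T.trace • (1 : Matrix (Fin 2) (Fin 2) ℂ) := by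
  rw [adjugate_fin_two]
  ext i j
  fin_cases i <;> fin_cases j <;> simp [trace_fin_two]
  ring

lemma single_source_solve {T₁ T₂ : Matrix (Fin 2) (Fin 2) ℂ} {μ₁ μ₂ μ ν : ℂ} {X Y σ : Fin 2 → ℂ}
    (h1 : μ₁ • Y = T₁ *ᵥ X + ν • σ) (h2 : μ₂ • X = T₂ *ᵥ Y) (d1 : T₁.det = μ₁ ^ 2) (d2 : T₂.det = μ₂ ^ 2)
    (hμ : μ₁ = μ * ν) (n1 : μ₁ ≠ 0) (n2 : μ₂ ≠ 0) :
    (μ * ((T₂ * T₁).trace - 2 * μ₁ * μ₂)) • X = (μ₂ • T₁.adjugate - μ₁ • T₂) *ᵥ σ := by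
  have e1 : (μ₁ * μ₂) • X = (T₂ * T₁) *ᵥ X + ν • (T₂ *ᵥ σ) := by
    rw [mul_smul, h2, ← mulVec_smul, h1, mulVec_add, mulVec_mulVec, mulVec_smul]
  obtain ⟨T, hT⟩ : ∃ T, T = T₂ * T₁ := ⟨_, rfl⟩
  have hdet : T.det = (μ₁ * μ₂) ^ 2 := by rw [hT, det_mul, d1, d2]; ring
  have hadj : T.adjugate * T₂ = μ₂ ^ 2 • T₁.adjugate := by
    rw [hT, adjugate_mul_distrib, mul_assoc, adjugate_mul, d2, Matrix.mul_smul, mul_one]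
  rw [← hT] at e1 ⊢
  have e2 : T *ᵥ X + T.adjugate *ᵥ X = T.trace • X := by
    rw [← add_mulVec, add_adjugate_fin_two, smul_mulVec, one_mulVec]
  have e3 : T.adjugate *ᵥ (T *ᵥ X) = (μ₁ * μ₂) ^ 2 • X := by
    rw [mulVec_mulVec, adjugate_mul, hdet, smul_mulVec, one_mulVec]
  have e4 : T.adjugate *ᵥ (T₂ *ᵥ σ) = μ₂ ^ 2 • (T₁.adjugate *ᵥ σ) := by
    rw [mulVec_mulVec, hadj, smul_mulVec]
  have e5 := congrArg (fun v => T.adjugate *ᵥ v) e1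
  simp only [mulVec_add, mulVec_smul, e3, e4] at e5
  rw [sub_mulVec, smul_mulVec, smul_mulVec]
  have hn : ν * μ₂ ≠ 0 := by
    refine mul_ne_zero (fun h0 => n1 ?_) n2
    rw [hμ, h0, mul_zero]
  funext i
  have f1 := congrFun e1 i
  have f2 := congrFun e2 i
  have f5 := congrFun e5 i
  simp only [Pi.add_apply, Pi.smul_apply, Pi.sub_apply, smul_eq_mul] at f1 f2 f5 ⊢
  refine mul_left_cancel₀ hn ?_
  generalize (T *ᵥ X) i = a at *
  generalize (T.adjugate *ᵥ X) i = b at *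
  generalize (T₂ *ᵥ σ) i = c at *
  generalize (T₁.adjugate *ᵥ σ) i = d at *
  have hb : b = T.trace * X i - a := by linear_combination f2
  subst hb
  have ha : a = μ₁ * μ₂ * X i - ν * c := by linear_combination -f1
  subst ha
  subst hμ
  linear_combination f5

lemma norm_mulVec_fin_two_le {M : Matrix (Fin 2) (Fin 2) ℂ} {B : ℝ} (hM : ∀ i j, ‖M i j‖ ≤ B) (v : Fin 2 → ℂ) (i : Fin 2) :
    ‖(M *ᵥ v) i‖ ≤ B * (‖v 0‖ + ‖v 1‖) := by
  rw [mulVec, dotProduct, Fin.sum_univ_two]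
  refine (norm_add_le _ _).trans ?_
  rw [norm_mul, norm_mul, mul_add]
  have := hM i 0
  have := hM i 1
  gcongr

lemma norm_adjugate_fin_two_le {M : Matrix (Fin 2) (Fin 2) ℂ} {B : ℝ} (hM : ∀ i j, ‖M i j‖ ≤ B) (i j : Fin 2) :
    ‖M.adjugate i j‖ ≤ B := by
  rw [adjugate_fin_two]
  fin_cases i <;> fin_cases j <;> simp [hM]

section

section
variable {ι : Type*} [Fintype ι] [DecidableEq ι]

/-- The upper component after the coin. -/
def coinUp (f : ι → ℝ) (g : ι → ℂ) (u : ι ⊕ ι → ℂ) (n : ι) : ℂ := f n * u (Sum.inl n) - g n * u (Sum.inr n)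

/-- The lower component after the coin. -/
def coinDown (f : ι → ℝ) (g : ι → ℂ) (u : ι ⊕ ι → ℂ) (n : ι) : ℂ := star (g n) * u (Sum.inl n) + f n * u (Sum.inr n)

lemma fromBlocks_mulVec_inl (A B C D : Matrix ι ι ℂ) (u : ι ⊕ ι → ℂ) (n : ι) :
    (fromBlocks A B C D *ᵥ u) (Sum.inl n) = (A *ᵥ fun i => u (Sum.inl i)) n + (B *ᵥ fun i => u (Sum.inr i)) n := by
  simp [mulVec, dotProduct, sum_sum_type]

lemma fromBlocks_mulVec_inr (A B C D : Matrix ι ι ℂ) (u : ι ⊕ ι → ℂ) (n : ι) :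
    (fromBlocks A B C D *ᵥ u) (Sum.inr n) = (C *ᵥ fun i => u (Sum.inl i)) n + (D *ᵥ fun i => u (Sum.inr i)) n := by
  simp [mulVec, dotProduct, sum_sum_type]

lemma shiftMat_mulVec (σ : Perm ι) (v : ι → ℂ) (n : ι) : (shiftMat σ *ᵥ v) n = v (σ.symm n) := by
  simp only [mulVec, dotProduct, shiftMat, ite_mul, one_mul, zero_mul]
  rw [sum_eq_single (σ.symm n)]
  · simp
  · intro b _ hb
    rw [if_neg]
    rintro rfl
    simp at hb
  · simp

lemma shiftMat_transpose_mulVec (σ : Perm ι) (v : ι → ℂ) (n : ι) : ((shiftMat σ)ᵀ *ᵥ v) n = v (σ n) := by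
  simp only [mulVec, dotProduct, shiftMat, transpose_apply, ite_mul, one_mul, zero_mul]
  simp

lemma walk_mulVec (σ : Perm ι) (α : ℝ) (f : ι → ℝ) (g : ι → ℂ) (u : ι ⊕ ι → ℂ) (n : ι) :
    ((shiftOp σ (fun _ => α) * coinOp f g) *ᵥ u) (Sum.inl n) =
      cos α * coinUp f g u (σ.symm n) - sin α * coinDown f g u n ∧
    ((shiftOp σ (fun _ => α) * coinOp f g) *ᵥ u) (Sum.inr n) =
      sin α * coinUp f g u n + cos α * coinDown f g u (σ n) := by
  have h1 : ∀ n, (coinOp f g *ᵥ u) (Sum.inl n) = coinUp f g u n := by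
    intro n
    rw [coinOp, blk, fromBlocks_mulVec_inl, mulVec_diagonal, mulVec_diagonal, coinUp]; ring
  have h2 : ∀ n, (coinOp f g *ᵥ u) (Sum.inr n) = coinDown f g u n := by
    intro n
    rw [coinOp, blk, fromBlocks_mulVec_inr, mulVec_diagonal, mulVec_diagonal, coinDown]
  rw [← mulVec_mulVec, shiftOp, ← mulVec_mulVec, ← mulVec_mulVec]
  constructor
  · rw [fromBlocks_mulVec_inl, one_mulVec, zero_mulVec, Pi.zero_apply, add_zero, blk,
      fromBlocks_mulVec_inl, mulVec_diagonal, mulVec_diagonal, fromBlocks_mulVec_inl,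
      fromBlocks_mulVec_inr, one_mulVec, zero_mulVec, zero_mulVec, Pi.zero_apply, add_zero,
      zero_add, shiftMat_mulVec, h1, h2]
    push_cast; ring
  · rw [fromBlocks_mulVec_inr, shiftMat_transpose_mulVec, zero_mulVec, Pi.zero_apply, zero_add, blk,
      fromBlocks_mulVec_inr, mulVec_diagonal, mulVec_diagonal, fromBlocks_mulVec_inl,
      fromBlocks_mulVec_inr, one_mulVec, zero_mulVec, zero_mulVec, Pi.zero_apply, add_zero,
      zero_add, shiftMat_mulVec, h1, h2, symm_apply_apply]

lemma transfer_relation {f s c : ℝ} {g z wp up um wp' um' rp rm : ℂ} (hs : s ^ 2 + c ^ 2 = 1) (hf : f ≠ 0)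
    (hfg : (f : ℂ) ^ 2 + star g * g = 1) (hz : z ≠ 0)
    (hwp : wp = f * up - g * um)
    (h1 : rp = up - z * (c * wp' - s * (star g * up + f * um)))
    (h2 : rm = um' - z * (s * wp' + c * (star g * up + f * um))) :
    (z * (c * f : ℝ)) • (![wp', um' / z] : Fin 2 → ℂ) = stepMat s g z *ᵥ ![wp, um / z] +
      ![-f * rp, -s * f * rp + f * c * rm] := by
  have hfc : (f : ℂ) ≠ 0 := mod_cast hf
  have hsc : (s : ℂ) ^ 2 + (c : ℂ) ^ 2 = 1 := mod_cast hs
  funext i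
  fin_cases i
  · simp only [stepMat, mulVec, dotProduct, Fin.sum_univ_two, mul_apply, Fin.zero_eta, Pi.add_apply,
      Pi.smul_apply, smul_eq_mul, Fin.mk_one, of_apply, cons_val', cons_val_zero,
      cons_val_one, cons_val_fin_one]
    subst hwp h1
    field_simp
    push_cast
    linear_combination (s * z * um + f * 0) * hfg
  · simp only [stepMat, mulVec, dotProduct, Fin.sum_univ_two, mul_apply, Fin.zero_eta, Pi.add_apply,
      Pi.smul_apply, smul_eq_mul, Fin.mk_one, of_apply, cons_val', cons_val_zero,
      cons_val_one, cons_val_fin_one]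
    subst hwp h1 h2
    field_simp
    push_cast
    linear_combination (z * um + f * 0) * hfg + (f * z * star g * up + f ^ 2 * z * um) * hsc

end

/-- The site of the ring under the natural number `n`. -/
def site (q : ℕ) [NeZero q] (n : ℕ) : Fin q := ⟨n % q, Nat.mod_lt _ (NeZero.pos q)⟩

lemma finRotate_site (q : ℕ) [NeZero q] (n : ℕ) : finRotate q (site q n) = site q (n + 1) := by
  rw [Fin.ext_iff, coe_finRotate_eq]
  change (if n % q + 1 = q then 0 else n % q + 1) = (n + 1) % q
  have := Nat.mod_lt n (NeZero.pos q)
  split_ifs with h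
  · rw [← Nat.mod_add_mod n q 1, h, Nat.mod_self]
  · rw [← Nat.mod_add_mod n q 1, Nat.mod_eq_of_lt (a := n % q + 1) (by omega)]

lemma finRotate_symm_site (q : ℕ) [NeZero q] (n : ℕ) : (finRotate q).symm (site q (n + 1)) = site q n := by
  rw [← finRotate_site, symm_apply_apply]

lemma exists_site_phase (q : ℕ) [NeZero q] (p : ℤ) (x : ℝ) (n : ℕ) :
    ∃ k : ℤ, x + n * (p / q) = x + ((site q n : Fin q) : ℕ) * (p / q) + k := by
  refine ⟨((n / q : ℕ) : ℤ) * p, ?_⟩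
  have hq : (q : ℝ) ≠ 0 := mod_cast NeZero.ne q
  have h0 : n = n % q + q * (n / q) := (Nat.mod_add_div n q).symm
  change x + n * (p / q) = x + ((n % q : ℕ) : ℝ) * (p / q) + _
  generalize n % q = b at *
  generalize n / q = a at *
  subst h0
  push_cast
  field_simp
  ring

lemma fA_site (q : ℕ) [NeZero q] (t β : ℝ) (p : ℤ) (x : ℝ) (n : ℕ) :
    fA t β (x + ((site q n : Fin q) : ℕ) * (p / q)) = fA t β (x + n * (p / q)) := by
  obtain ⟨k, hk⟩ := exists_site_phase q p x n
  rw [hk, fA_add_int]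

lemma gA_site (q : ℕ) [NeZero q] (t β : ℝ) (p : ℤ) (x : ℝ) (n : ℕ) :
    gA t β (x + ((site q n : Fin q) : ℕ) * (p / q)) = gA t β (x + n * (p / q)) := by
  obtain ⟨k, hk⟩ := exists_site_phase q p x n
  rw [hk, gA_add_int]

end

lemma transfer_shift (t α φ x : ℝ) (z : ℂ) (i k : ℕ) :
    transfer t α φ x z i k = transfer t α φ (x + i * φ) z 0 k := by
  rw [transfer, transfer]
  generalize hC : (fun j : ℕ => stepMat (sin α) (gA t (π - α) (x + j * φ)) z) = C
  generalize hD : (fun j : ℕ => stepMat (sin α) (gA t (π - α) (x + i * φ + j * φ)) z) = D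
  have h : ∀ n, D n = C (i + n) := by
    intro n
    rw [← hC, ← hD]
    beta_reduce
    congr 2
    push_cast
    ring
  have h2 : ∀ (k a : ℕ), segProd C (i + a) k = segProd D a k := by
    intro k
    induction k with
    | zero => intro a; rfl
    | succ k ih => intro a; rw [segProd_succ, segProd_succ, h, add_assoc, ih]
  exact h2 k 0

lemma coinProd_shift (t α φ x : ℝ) (a i k : ℕ) :
    coinProd t α φ x (a + i) k = coinProd t α φ (x + a * φ) i k := by
  rw [coinProd, coinProd]
  refine prod_congr rfl fun j _ => ?_
  congr 2
  push_cast
  ring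

lemma coinProd_period (t α : ℝ) (q : ℕ) [NeZero q] (p : ℤ) (x : ℝ) (i k : ℕ) :
    coinProd t α (p / q) x (q + i) k = coinProd t α (p / q) x i k := by
  have hq : (q : ℝ) ≠ 0 := mod_cast NeZero.ne q
  rw [coinProd, coinProd]
  refine prod_congr rfl fun j _ => ?_
  rw [← fA_add_int _ _ (x + (i + j : ℕ) * (p / q)) p]
  congr 2
  push_cast
  field_simp
  ring

lemma chi_qRing_eq_transfer {t α : ℝ} (h : Regime t α) (q : ℕ) (hq : q ≠ 0) (φ x : ℝ) {z : ℂ} (hz : z ≠ 0) :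
    chi (qRing t α (π - α) q φ x) z =
      (transfer t α φ x z 0 q).trace - 2 * z ^ q * (coinProd t α φ x 0 q : ℝ) := by
  rw [qRing, chi_ringN_eq_trace t q hq _ _ _ (fun j => ((fA_pos h.gap _).2).ne') (fun _ => h.cos_pos.ne') hz,
    transfer, coinProd]
  push_cast
  congr 2
  exact prod_congr rfl fun j _ => by rw [zero_add]

lemma chain_green {t α : ℝ} (ht : t ^ 2 ≤ 1) (h : Regime t α) {q : ℕ} [NeZero q] {p : ℤ} {δ ρ s η : ℝ}
    (hρ1 : ρ ≤ 1) (h0 : 0 < η) (h1 : η ≤ 1 / 2)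
    (hdec : ∀ x, ∀ l R : ℕ, l + R = q → ρ * q ≤ R →
      exp (4 * π / η + 2 * η * (q + 1)) *
        (‖chi (qRing t α (π - α) l (p / q) x) ((1 - η : ℝ) * circ s)‖ * coinProd t α (p / q) x l R) ≤
      δ * ‖chi (qRing t α (π - α) q (p / q) x) (circ s)‖) {x : ℝ}
    (hS : sin (2 * π * s) ≠ 0) (hD : chi (qRing t α (π - α) q (p / q) x) (circ s) ≠ 0) {V σ : ℕ → Fin 2 → ℂ}
    (hV : V q = V 0)
    (hrel : ∀ n : ℕ, (circ s * (cos α * fA t (π - α) (x + n * (p / q)) : ℝ)) • V n =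
      stepMat (sin α) (gA t (π - α) (x + n * (p / q))) (circ s) *ᵥ V (n + 1) + σ n)
    (hσ : ∀ n, 0 < n → n < q → σ n = 0) {a : ℕ} (ha : a ≠ 0) (haq : a < q) (ha1 : ρ * q ≤ a)
    (ha2 : ρ * q ≤ (q - a : ℕ)) (i : Fin 2) :
    cos α * fA t (π - α) x * |sin (2 * π * s)| * ‖V a i‖ ≤
      24 * δ * (‖σ 0 0‖ + ‖σ 0 1‖) := by
  obtain ⟨R, rfl⟩ : ∃ R, R = q - a := ⟨_, rfl⟩
  obtain ⟨b, rfl⟩ : ∃ b, a = b + 1 := ⟨a - 1, by omega⟩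
  obtain ⟨z, hz⟩ : ∃ z, z = circ s := ⟨_, rfl⟩
  have hz1 : ‖z‖ = 1 := by rw [hz, norm_circ]
  have hz0 : z ≠ 0 := by rintro rfl; simp at hz1
  obtain ⟨C, hC⟩ : ∃ C : ℕ → Matrix (Fin 2) (Fin 2) ℂ, C = fun n : ℕ =>
      stepMat (sin α) (gA t (π - α) (x + n * (p / q))) (circ s) := ⟨_, rfl⟩
  obtain ⟨μ, hμ⟩ : ∃ μ : ℕ → ℂ, μ = fun n : ℕ =>
      circ s * (cos α * fA t (π - α) (x + n * (p / q)) : ℝ) := ⟨_, rfl⟩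
  have hrel' : ∀ n, μ n • V n = C n *ᵥ V (n + 1) + σ n := by
    intro n; rw [hC, hμ]; exact hrel n
  have hprod : ∀ i k, ∏ j ∈ range k, μ (i + j) = z ^ k * (coinProd t α (p / q) x i k : ℝ) := by
    intro i k
    rw [hμ, coinProd, hz]
    push_cast
    rw [prod_mul_distrib, prod_const, card_range]
  have hT : ∀ i k, segProd C i k = transfer t α (p / q) x z i k := by
    intro i k; rw [hC, transfer, hz]
  have c1 := chain_no_source hrel' 1 b fun n hn hn' => hσ n (by omega) (by omega)
  have c2 := chain_no_source hrel' (b + 1) (q - (b + 1)) fun n hn hn' => hσ n (by omega) (by omega)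
  rw [show b + 1 + (q - (b + 1)) = q by omega, hV] at c2
  have e1 : (∏ j ∈ range (b + 1), μ (0 + j)) • V 0 = segProd C 0 (b + 1) *ᵥ V (b + 1) +
      (∏ j ∈ range b, μ (1 + j)) • σ 0 := by
    have e := hrel' 0
    rw [prod_range_succ', mul_smul, zero_add, e, smul_add, ← mulVec_smul, zero_add,
      segProd_succ, ← mulVec_mulVec, zero_add, add_comm b 1, ← c1]
    congr 3
    · exact prod_congr rfl fun j _ => by congr 1; ring
    · funext j; congr 1; ring
  have hμ1 : ∏ j ∈ range (b + 1), μ (0 + j) = μ 0 * ∏ j ∈ range b, μ (1 + j) := by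
    rw [prod_range_succ', mul_comm, zero_add]
    congr 1
    exact prod_congr rfl fun j _ => by congr 1; ring
  have hne : ∀ i k, ∏ j ∈ range k, μ (i + j) ≠ 0 := by
    intro i k
    rw [hprod]
    exact mul_ne_zero (pow_ne_zero _ hz0) (mod_cast (coinProd_pos h _ _ _ _).ne')
  have hdet : ∀ i k, (segProd C i k).det = (∏ j ∈ range k, μ (i + j)) ^ 2 := by
    intro i k
    rw [hT, det_transfer, hprod]
    push_cast
    ring
  have key := single_source_solve e1 c2 (hdet _ _) (hdet _ _) hμ1 (hne _ _) (hne _ _)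
  have hchi : chi (qRing t α (π - α) q (p / q) x) z =
      (segProd C (b + 1) (q - (b + 1)) * segProd C 0 (b + 1)).trace - 2 * (∏ j ∈ range (b + 1), μ (0 + j)) *
        ∏ j ∈ range (q - (b + 1)), μ (b + 1 + j) := by
    have hq : b + 1 + (q - (b + 1)) = q := by omega
    rw [chi_qRing_eq_transfer h q (NeZero.ne q) _ _ hz0, trace_mul_comm, hT, hT, hprod, hprod]
    conv_lhs => rw [← hq]
    have e2 := transfer_add t α (p / q) x z 0 (b + 1) (q - (b + 1))
    have e3 := coinProd_add t α (p / q) x 0 (b + 1) (q - (b + 1))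
    rw [zero_add] at e2 e3
    rw [hq] at e2 e3 ⊢
    rw [e2, e3]
    conv_lhs => rw [← hq, pow_add]
    rw [hq]
    push_cast
    ring
  have hcs : 0 < |sin (2 * π * s)| := abs_pos.2 hS
  have b1 : ∀ i j, ‖segProd C 0 (b + 1) i j‖ ≤ 12 * δ * ‖chi (qRing t α (π - α) q (p / q) x) z‖ /
      (|sin (2 * π * s)| * coinProd t α (p / q) x (b + 1) (q - (b + 1))) := by
    intro i j
    rw [le_div_iff₀ (mul_pos hcs (coinProd_pos h _ _ _ _)), ← mul_assoc, hT, hz]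
    exact transfer_entry_le_ring ht h hρ1 h0 h1 (hdec x) (by omega) (by omega) ha2 i j
  have hx' : chi (qRing t α (π - α) q (p / q) (x + (b + 1 : ℕ) * (p / q))) z =
      chi (qRing t α (π - α) q (p / q) x) z := chi_qRing_translate t α _ p x (b + 1) z
  have b2 : ∀ i j, ‖segProd C (b + 1) (q - (b + 1)) i j‖ ≤
      12 * δ * ‖chi (qRing t α (π - α) q (p / q) x) z‖ /
      (|sin (2 * π * s)| * coinProd t α (p / q) x 0 (b + 1)) := by
    intro i j
    have := transfer_entry_le_ring ht h hρ1 h0 h1 (hdec (x + (b + 1 : ℕ) * (p / q))) (l := q - (b + 1)) (R := b + 1)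
      (by omega) (by omega) ha1 i j
    rw [← hz, hx', ← transfer_shift, ← coinProd_shift, show b + 1 + (q - (b + 1)) = q + 0 by omega,
      coinProd_period] at this
    rw [le_div_iff₀ (mul_pos hcs (coinProd_pos h _ _ _ _)), ← mul_assoc, hT]
    exact this
  have hD0 : 0 < ‖chi (qRing t α (π - α) q (p / q) x) z‖ := by rw [hz]; exact norm_pos_iff.2 hD
  have hm1 : ‖∏ j ∈ range (b + 1), μ (0 + j)‖ = coinProd t α (p / q) x 0 (b + 1) := by
    rw [hprod, norm_mul, norm_pow, hz1, one_pow, one_mul, norm_real, norm_of_nonneg (coinProd_pos h _ _ _ _).le]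
  have hm2 : ‖∏ j ∈ range (q - (b + 1)), μ (b + 1 + j)‖ = coinProd t α (p / q) x (b + 1) (q - (b + 1)) := by
    rw [hprod, norm_mul, norm_pow, hz1, one_pow, one_mul, norm_real, norm_of_nonneg (coinProd_pos h _ _ _ _).le]
  have hm0 : ‖μ 0‖ = cos α * fA t (π - α) x := by
    rw [hμ, norm_mul, norm_circ, one_mul, norm_real, Nat.cast_zero, zero_mul, add_zero,
      norm_of_nonneg (mul_pos h.cos_pos (fA_pos h.gap x).2).le]
  have hkey := congrFun key i
  have hM : ∀ i j, ‖((∏ j ∈ range (q - (b + 1)), μ (b + 1 + j)) • (segProd C 0 (b + 1)).adjugate -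
      (∏ j ∈ range (b + 1), μ (0 + j)) • segProd C (b + 1) (q - (b + 1))) i j‖ ≤
      24 * δ * ‖chi (qRing t α (π - α) q (p / q) x) z‖ / |sin (2 * π * s)| := by
    intro i j
    rw [Matrix.sub_apply, Matrix.smul_apply, Matrix.smul_apply, smul_eq_mul, smul_eq_mul]
    refine (norm_sub_le _ _).trans ?_
    rw [norm_mul, norm_mul, hm1, hm2]
    have p1 := coinProd_pos h (p / q) x 0 (b + 1)
    have p2 := coinProd_pos h (p / q) x (b + 1) (q - (b + 1))
    refine (add_le_add (mul_le_mul_of_nonneg_left (norm_adjugate_fin_two_le b1 i j) p2.le)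
      (mul_le_mul_of_nonneg_left (b2 i j) p1.le)).trans (le_of_eq ?_)
    field_simp
    ring
  have hfin := norm_mulVec_fin_two_le hM (σ 0) i
  rw [← hkey, Pi.smul_apply, smul_eq_mul, norm_mul, norm_mul, ← hchi, hm0, div_mul_eq_mul_div, le_div_iff₀ hcs] at hfin
  refine le_of_mul_le_mul_right ?_ hD0
  linarith

section

lemma fA_lower (t α x : ℝ) : coinP t α - |coinB t α| ≤ fA t (π - α) x := by
  rw [fA_pi_sub_eq]
  have h1 : |coinB t α * cos (2 * π * x)| ≤ |coinB t α| := by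
    rw [abs_mul]
    exact mul_le_of_le_one_right (abs_nonneg _) (abs_cos_le_one _)
  have := neg_le_of_abs_le h1
  linarith

lemma norm_gA_le_one (t β x : ℝ) : ‖gA t β x‖ ≤ 1 := by
  have := fA_sq_add t β x
  nlinarith [sq_nonneg (fA t β x), norm_nonneg (gA t β x)]

lemma fA_sq_add_complex (t β x : ℝ) : (fA t β x : ℂ) ^ 2 + star (gA t β x) * gA t β x = 1 := by
  have h := fA_sq_add t β x
  have h2 : star (gA t β x) * gA t β x = ((‖gA t β x‖ ^ 2 : ℝ) : ℂ) := by
    push_cast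
    exact conj_mul' _
  rw [h2]
  exact_mod_cast congrArg (fun y : ℝ => (y : ℂ)) h

section
variable {q : ℕ} [NeZero q]

lemma qRing_mulVec_inl (t α : ℝ) (p : ℤ) (x : ℝ) (u : Fin q ⊕ Fin q → ℂ) (n : ℕ) :
    (qRing t α (π - α) q (p / q) x *ᵥ u) (Sum.inl (site q (n + 1))) =
      cos α * (fA t (π - α) (x + n * (p / q)) * u (Sum.inl (site q n)) -
        gA t (π - α) (x + n * (p / q)) * u (Sum.inr (site q n))) -
      sin α * (star (gA t (π - α) (x + (n + 1 : ℕ) * (p / q))) * u (Sum.inl (site q (n + 1))) +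
        fA t (π - α) (x + (n + 1 : ℕ) * (p / q)) * u (Sum.inr (site q (n + 1)))) := by
  have h := (walk_mulVec (finRotate q) α (fun j : Fin q => fA t (π - α) (x + (j : ℕ) * (p / q)))
    (fun j : Fin q => gA t (π - α) (x + (j : ℕ) * (p / q))) u (site q (n + 1))).1
  rw [finRotate_symm_site, coinUp, coinDown] at h
  simp only [fA_site, gA_site] at h
  exact h

lemma qRing_mulVec_inr (t α : ℝ) (p : ℤ) (x : ℝ) (u : Fin q ⊕ Fin q → ℂ) (n : ℕ) :
    (qRing t α (π - α) q (p / q) x *ᵥ u) (Sum.inr (site q n)) =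
      sin α * (fA t (π - α) (x + n * (p / q)) * u (Sum.inl (site q n)) -
        gA t (π - α) (x + n * (p / q)) * u (Sum.inr (site q n))) +
      cos α * (star (gA t (π - α) (x + (n + 1 : ℕ) * (p / q))) * u (Sum.inl (site q (n + 1))) +
        fA t (π - α) (x + (n + 1 : ℕ) * (p / q)) * u (Sum.inr (site q (n + 1)))) := by
  have h := (walk_mulVec (finRotate q) α (fun j : Fin q => fA t (π - α) (x + (j : ℕ) * (p / q)))
    (fun j : Fin q => gA t (π - α) (x + (j : ℕ) * (p / q))) u (site q n)).2
  rw [finRotate_site, coinUp, coinDown] at h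
  simp only [fA_site, gA_site] at h
  exact h

lemma site_add_self (n : ℕ) : site q (n + q) = site q n := by
  rw [Fin.ext_iff]
  exact Nat.add_mod_right n q

lemma site_ne {n m : ℕ} (h : n % q ≠ m % q) : site q n ≠ site q m := by
  intro h'
  exact h (congrArg Fin.val h')

lemma site_add_ne (k n : ℕ) (hn : 0 < n) (hnq : n < q) : site q (k + n) ≠ site q k := by
  refine site_ne fun h => ?_
  have h1 : k + n ≡ k + 0 [MOD q] := h
  have h2 := (Nat.modEq_zero_iff_dvd).1 (Nat.ModEq.add_left_cancel' k h1)
  exact absurd (Nat.le_of_dvd hn h2) (by omega)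

lemma ring_green {t α : ℝ} (ht : t ^ 2 ≤ 1) (h : Regime t α) {p : ℤ} {δ ρ s η : ℝ}
    (hρ1 : ρ ≤ 1) (h0 : 0 < η) (h1 : η ≤ 1 / 2)
    (hdec : ∀ x, ∀ l R : ℕ, l + R = q → ρ * q ≤ R →
      exp (4 * π / η + 2 * η * (q + 1)) *
        (‖chi (qRing t α (π - α) l (p / q) x) ((1 - η : ℝ) * circ s)‖ * coinProd t α (p / q) x l R) ≤
      δ * ‖chi (qRing t α (π - α) q (p / q) x) (circ s)‖) {x : ℝ}
    (hS : sin (2 * π * s) ≠ 0)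
    (hD : chi (qRing t α (π - α) q (p / q) x) (circ s) ≠ 0) {u r : Fin q ⊕ Fin q → ℂ}
    (hr : r = u - circ s • (qRing t α (π - α) q (p / q) x *ᵥ u)) (m : ℕ)
    (hl : ∀ n, n ≠ site q m → r (Sum.inl n) = 0) (hr' : ∀ n, n ≠ site q (m + q - 1) → r (Sum.inr n) = 0)
    {a : ℕ} (ha : a + 1 < q) (ha1 : ρ * q ≤ (a + 1 : ℕ))
    (ha2 : ρ * q ≤ (q - (a + 1) : ℕ)) (hδ : 0 ≤ δ) :
    cos α * (coinP t α - |coinB t α|) * |sin (2 * π * s)| *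
      (‖u (Sum.inl (site q (m + a)))‖ + ‖u (Sum.inr (site q (m + a)))‖) ≤
      144 * δ * (‖r (Sum.inl (site q m))‖ + ‖r (Sum.inr (site q (m + q - 1)))‖) := by
  have hq := NeZero.pos q
  obtain ⟨z, hz⟩ : ∃ z, z = circ s := ⟨_, rfl⟩
  have hz1 : ‖z‖ = 1 := by rw [hz, norm_circ]
  have hz0 : z ≠ 0 := by rintro rfl; simp at hz1
  obtain ⟨f, hf⟩ : ∃ f : ℕ → ℝ, ∀ n : ℕ, f n = fA t (π - α) (x + n * (p / q)) := ⟨_, fun _ => rfl⟩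
  obtain ⟨g, hg⟩ : ∃ g : ℕ → ℂ, ∀ n : ℕ, g n = gA t (π - α) (x + n * (p / q)) := ⟨_, fun _ => rfl⟩
  obtain ⟨w, hw⟩ : ∃ w : ℕ → ℂ, ∀ n : ℕ, w n = f n * u (Sum.inl (site q n)) - g n * u (Sum.inr (site q n)) :=
    ⟨_, fun _ => rfl⟩
  have hfpos : ∀ n, 0 < f n := fun n => by rw [hf]; exact (fA_pos h.gap _).2
  have hrl : ∀ n, r (Sum.inl (site q (n + 1))) = u (Sum.inl (site q (n + 1))) - z * (cos α * w n -
      sin α * (star (g (n + 1)) * u (Sum.inl (site q (n + 1))) + f (n + 1) * u (Sum.inr (site q (n + 1))))) := by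
    intro n
    rw [hr, Pi.sub_apply, Pi.smul_apply, qRing_mulVec_inl, hw, hf, hg, hf, hg, smul_eq_mul, ← hz]
  have hrr : ∀ n, r (Sum.inr (site q n)) = u (Sum.inr (site q n)) - z * (sin α * w n +
      cos α * (star (g (n + 1)) * u (Sum.inl (site q (n + 1))) + f (n + 1) * u (Sum.inr (site q (n + 1))))) := by
    intro n
    rw [hr, Pi.sub_apply, Pi.smul_apply, qRing_mulVec_inr, hw, hf, hg, hf, hg, smul_eq_mul, ← hz]
  have hrel : ∀ n, (z * (cos α * f (n + 1) : ℝ)) • (![w n, u (Sum.inr (site q n)) / z] : Fin 2 → ℂ) =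
      stepMat (sin α) (g (n + 1)) z *ᵥ ![w (n + 1), u (Sum.inr (site q (n + 1))) / z] +
      ![-f (n + 1) * r (Sum.inl (site q (n + 1))), -sin α * f (n + 1) * r (Sum.inl (site q (n + 1))) +
        f (n + 1) * cos α * r (Sum.inr (site q n))] := by
    intro n
    refine transfer_relation (Real.sin_sq_add_cos_sq α) (hfpos _).ne' ?_ hz0 (hw _) (hrl n) (hrr n)
    rw [hf, hg]
    exact fA_sq_add_complex _ _ _
  obtain ⟨M, hM⟩ : ∃ M, m + q = M + 1 := ⟨m + q - 1, by omega⟩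
  have hM' : m + q - 1 = M := by omega
  rw [hM'] at hr' ⊢
  have hsM : site q (M + 1) = site q m := by rw [← hM, site_add_self]
  have hfper : ∀ n, f (n + q) = f n := fun n => by
    rw [hf, hf, ← fA_site, ← fA_site q t _ p x n, site_add_self]
  have hgper : ∀ n, g (n + q) = g n := fun n => by
    rw [hg, hg, ← gA_site, ← gA_site q t _ p x n, site_add_self]
  have hwper : ∀ n, w (n + q) = w n := fun n => by
    rw [hw, hw, hfper, hgper, site_add_self]
  have hphase : ∀ n : ℕ, x + (M + 1 : ℕ) * (p / q) + n * (p / q) = x + (M + n + 1 : ℕ) * ((p : ℝ) / q) := by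
    intro n; push_cast; ring
  have hD' : chi (qRing t α (π - α) q (p / q) (x + (M + 1 : ℕ) * (p / q))) (circ s) ≠ 0 := by
    rw [chi_qRing_translate]; exact hD
  have key := fun i => chain_green ht h hρ1 h0 h1 hdec hS hD'
    (V := fun n => ![w (M + n), u (Sum.inr (site q (M + n))) / z])
    (σ := fun n => ![-f (M + n + 1) * r (Sum.inl (site q (M + n + 1))),
      -sin α * f (M + n + 1) * r (Sum.inl (site q (M + n + 1))) +
        f (M + n + 1) * cos α * r (Sum.inr (site q (M + n)))])
    (by
      beta_reduce
      rw [hwper, site_add_self, add_zero])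
    (by
      intro n
      rw [hphase, ← hf, ← hg, ← hz]
      exact hrel (M + n))
    (by
      intro n hn hnq
      beta_reduce
      rw [hl (site q (M + n + 1)), hr' (site q (M + n))]
      · simp
      · exact site_add_ne _ _ hn hnq
      · rw [← hsM, add_right_comm]
        exact site_add_ne _ _ hn hnq) (a := a + 1) (by omega) ha ha1 ha2 i
  have k0 := key 0
  have k1 := key 1
  simp only [cons_val_zero, cons_val_one, cons_val_fin_one, add_zero, hsM] at k0 k1
  have hidx : M + (a + 1) = m + a + q := by omega
  rw [hidx, hwper] at k0
  rw [hidx, site_add_self, norm_div, hz1, div_one] at k1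
  have hfM : fA t (π - α) (x + (M + 1 : ℕ) * (p / q)) = f (M + 1) := by rw [hf]
  rw [hfM] at k0 k1
  have hφ := hfpos (M + 1)
  generalize f (M + 1) = φ at k0 k1 hφ
  have hc := h.cos_pos
  have hs := h.sin_pos
  have hσ : ‖-(φ : ℂ) * r (Sum.inl (site q m))‖ + ‖-(sin α : ℂ) * φ * r (Sum.inl (site q m)) +
      φ * cos α * r (Sum.inr (site q M))‖ ≤
      2 * φ * (‖r (Sum.inl (site q m))‖ + ‖r (Sum.inr (site q M))‖) := by
    have e1 := norm_add_le (-(sin α : ℂ) * φ * r (Sum.inl (site q m))) (φ * cos α * r (Sum.inr (site q M)))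
    simp only [norm_mul, norm_neg, norm_real, norm_of_nonneg hφ.le, norm_of_nonneg hc.le,
      norm_of_nonneg hs.le] at e1 ⊢
    have a1 := norm_nonneg (r (Sum.inl (site q m)))
    have a2 := norm_nonneg (r (Sum.inr (site q M)))
    have e2 : sin α * (φ * ‖r (Sum.inl (site q m))‖) ≤ 1 * (φ * ‖r (Sum.inl (site q m))‖) :=
      mul_le_mul_of_nonneg_right (Real.sin_le_one _) (by positivity)
    have e3 : cos α * (φ * ‖r (Sum.inr (site q M))‖) ≤ 1 * (φ * ‖r (Sum.inr (site q M))‖) :=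
      mul_le_mul_of_nonneg_right (Real.cos_le_one _) (by positivity)
    have e4 := mul_nonneg hφ.le a2
    linarith
  have hfin : ∀ y : ℝ, cos α * φ * |sin (2 * π * s)| * y ≤
      24 * δ * (‖-(φ : ℂ) * r (Sum.inl (site q m))‖ + ‖-(sin α : ℂ) * φ * r (Sum.inl (site q m)) +
      φ * cos α * r (Sum.inr (site q M))‖) → cos α * |sin (2 * π * s)| * y ≤
      48 * δ * (‖r (Sum.inl (site q m))‖ + ‖r (Sum.inr (site q M))‖) := by
    intro y hy
    refine le_of_mul_le_mul_right ?_ hφ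
    have := mul_le_mul_of_nonneg_left hσ (by positivity : 0 ≤ 24 * δ)
    linarith
  have j0 := hfin _ k0
  have j1 := hfin _ k1
  obtain ⟨f₀, hf0⟩ : ∃ f₀, f₀ = coinP t α - |coinB t α| := ⟨_, rfl⟩
  have hf0pos : 0 < f₀ := by rw [hf0]; linarith [abs_coinB_lt h.gap]
  have hf0le : f₀ ≤ f (m + a) := by rw [hf0, hf]; exact fA_lower _ _ _
  have hfle : f (m + a) ≤ 1 := by rw [hf]; exact fA_le_one _ _ _
  have hgle : ‖g (m + a)‖ ≤ 1 := by rw [hg]; exact norm_gA_le_one _ _ _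
  rw [← hf0]
  have hU : f₀ * ‖u (Sum.inl (site q (m + a)))‖ ≤ ‖w (m + a)‖ + ‖u (Sum.inr (site q (m + a)))‖ := by
    have e : (f (m + a) : ℂ) * u (Sum.inl (site q (m + a))) = w (m + a) + g (m + a) * u (Sum.inr (site q (m + a))) := by
      rw [hw]; ring
    have e2 := norm_add_le (w (m + a)) (g (m + a) * u (Sum.inr (site q (m + a))))
    rw [← e, norm_mul, norm_mul, norm_real, norm_of_nonneg (hfpos _).le] at e2
    have e3 := mul_le_mul_of_nonneg_right hf0le (norm_nonneg (u (Sum.inl (site q (m + a)))))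
    have e4 := mul_le_mul_of_nonneg_right hgle (norm_nonneg (u (Sum.inr (site q (m + a)))))
    linarith
  have hL : f₀ * ‖u (Sum.inr (site q (m + a)))‖ ≤ 1 * ‖u (Sum.inr (site q (m + a)))‖ :=
    mul_le_mul_of_nonneg_right (hf0le.trans hfle) (norm_nonneg _)
  have hcs : 0 ≤ cos α * |sin (2 * π * s)| := by positivity
  have := mul_le_mul_of_nonneg_left (add_le_add hU hL) hcs
  linarith

end

end

section

lemma abs_le_norm_circ_sub {s s' : ℝ} (h : |s - s'| ≤ 1 / 2) : |s - s'| ≤ ‖circ s - circ s'‖ := by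
  have h1 : circ s - circ s' = circ s' * (Complex.exp (I * (2 * π * (s - s') : ℝ)) - 1) := by
    rw [circ, circ, mul_sub, ← exp_add, mul_one]
    congr 2
    push_cast
    ring
  rw [h1, norm_mul, norm_circ, one_mul, Complex.norm_exp_I_mul_ofReal_sub_one, norm_mul, norm_eq_abs, norm_eq_abs,
    abs_two]
  have hπ := pi_pos
  have hx : |2 * π * (s - s') / 2| = π * |s - s'| := by
    rw [show 2 * π * (s - s') / 2 = π * (s - s') by ring, abs_mul, abs_of_pos hπ]
  have h2 : |2 * π * (s - s') / 2| ≤ π / 2 := by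
    rw [hx]; nlinarith
  have h3 := Real.mul_abs_le_abs_sin h2
  rw [hx] at h3
  have h4 : 2 / π * (π * |s - s'|) = 2 * |s - s'| := by field_simp
  have := abs_nonneg (s - s')
  linarith

lemma exists_circ_eq_near {w : ℂ} (hw : ‖w‖ = 1) (s : ℝ) : ∃ s', circ s' = w ∧ |s - s'| ≤ ‖circ s - w‖ := by
  obtain ⟨y, hy⟩ : ∃ y, circ y = w := by
    refine ⟨w.arg / (2 * π), ?_⟩
    have := Complex.norm_mul_exp_arg_mul_I w
    rw [hw, ofReal_one, one_mul] at this
    refine Eq.trans ?_ this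
    rw [circ]
    congr 1
    have : (π : ℂ) ≠ 0 := mod_cast pi_ne_zero
    push_cast
    field_simp
  have h1 : circ (y + round (s - y)) = w := by rw [circ_add_int, hy]
  refine ⟨y + round (s - y), h1, ?_⟩
  have h2 := abs_sub_round (s - y)
  rw [← h1]
  refine abs_le_norm_circ_sub ?_
  rwa [← sub_sub]

section
variable {ι : Type*} [Fintype ι] [DecidableEq ι]

lemma normSq_le_of_far {A : Matrix ι ι ℂ} (hA : Aᴴ * A = 1) {z : ℂ} {η : ℝ} (hη : 0 ≤ η)
    (hfar : ∀ w : ℂ, ‖w‖ = 1 → chi A w = 0 → η ≤ ‖z - w‖) (u : ι → ℂ) :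
    η ^ 2 * ∑ k, normSq (u k) ≤ ∑ k, normSq ((u - z • (A *ᵥ u)) k) := by
  obtain ⟨U, d, h1, h2, h3, h4⟩ := unitary_diagonalization hA
  have hUs : (Uᴴ)ᴴ * Uᴴ = 1 := by rw [conjTranspose_conjTranspose, h2]
  obtain ⟨v, hv⟩ : ∃ v, v = Uᴴ *ᵥ u := ⟨_, rfl⟩
  have e1 : Uᴴ *ᵥ (u - z • (A *ᵥ u)) = fun k => (1 - z * d k) * v k := by
    rw [mulVec_sub, mulVec_smul, mulVec_mulVec, h4, ← mul_assoc, ← mul_assoc, h1,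
      one_mul, ← mulVec_mulVec, ← hv]
    funext k
    simp only [Pi.sub_apply, Pi.smul_apply, smul_eq_mul, mulVec_diagonal]
    ring
  rw [← sum_normSq_mulVec hUs u, ← sum_normSq_mulVec hUs (u - z • (A *ᵥ u)), e1, ← hv, Finset.mul_sum]
  refine sum_le_sum fun k _ => ?_
  rw [normSq_mul]
  refine mul_le_mul_of_nonneg_right ?_ (normSq_nonneg _)
  have hd : (starRingEnd ℂ) (d k) * d k = 1 := by
    rw [conj_mul', h3, ofReal_one, one_pow]
  have hroot : chi A ((starRingEnd ℂ) (d k)) = 0 := by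
    rw [chi_eq_prod h2 h4]
    exact prod_eq_zero (mem_univ k) (by rw [hd, sub_self])
  have h5 := hfar _ (by rw [RCLike.norm_conj, h3]) hroot
  have h6 : ‖z - (starRingEnd ℂ) (d k)‖ = ‖1 - z * d k‖ := by
    have : 1 - z * d k = -((z - (starRingEnd ℂ) (d k)) * d k) := by
      linear_combination (-1 : ℂ) * hd
    rw [this, norm_neg, norm_mul, h3, mul_one]
  rw [normSq_eq_norm_sq, ← h6]
  exact pow_le_pow_left₀ hη h5 2

end

section
variable {q : ℕ} [NeZero q]

lemma norm_chi_le_of_root (hq : Odd q) {t α : ℝ} (h : Regime t α) {p : ℤ} (hp : IsUnit (p : ZMod q)) {x : ℝ} {w : ℂ}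
    (hw : ‖w‖ = 1) (h0 : chi (qRing t α (π - α) q (p / q) x) w = 0) :
    ‖chi (qRing t α (π - α) q (p / q) 0) w‖ ≤ 32 * base t α ^ q := by
  have h1 := chi_qRing_phase_diff hq h hw hp x
  rw [h0, zero_sub, norm_neg] at h1
  have := pow_pos h.base_pos q
  linarith

lemma ring_resolvent (hq : Odd q) {t α : ℝ} (h : Regime t α) {p : ℤ} (hp : IsUnit (p : ZMod q)) {s δ : ℝ} (hδ : 0 < δ)
    (hfar : ¬ ∃ s', |s - s'| < δ ∧ ‖chi (qRing t α (π - α) q (p / q) 0) (circ s')‖ ≤ 32 * base t α ^ q) (x : ℝ) :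
    chi (qRing t α (π - α) q (p / q) x) (circ s) ≠ 0 ∧ ∀ u : Fin q ⊕ Fin q → ℂ,
      δ ^ 2 * ∑ k, normSq (u k) ≤
        ∑ k, normSq ((u - circ s • (qRing t α (π - α) q (p / q) x *ᵥ u)) k) := by
  refine ⟨fun h0 => hfar ⟨s, by simpa using hδ, norm_chi_le_of_root hq h hp (norm_circ s) h0⟩, fun u => ?_⟩
  refine normSq_le_of_far (qRing_unitary _ _ _ _ _ _) hδ.le (fun w hw h0 => ?_) u
  obtain ⟨s', hs', hss'⟩ := exists_circ_eq_near hw s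
  by_contra hlt
  push Not at hlt
  refine hfar ⟨s', hss'.trans_lt hlt, ?_⟩
  rw [hs']
  exact norm_chi_le_of_root hq h hp hw h0

end

end

lemma norm_circ_sub_le (x y : ℝ) : ‖circ x - circ y‖ ≤ 7 * |x - y| := by
  have h1 : circ x - circ y = circ y * (Complex.exp (I * (2 * π * (x - y) : ℝ)) - 1) := by
    rw [circ, circ, mul_sub, ← exp_add, mul_one]
    congr 2
    push_cast
    ring
  rw [h1, norm_mul, norm_circ, one_mul]
  refine (Real.norm_exp_I_mul_ofReal_sub_one_le).trans ?_
  rw [norm_eq_abs, abs_mul, abs_of_pos Real.two_pi_pos]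
  refine mul_le_mul_of_nonneg_right ?_ (abs_nonneg _)
  have := Real.pi_lt_d2
  linarith

lemma norm_gA_sub_le (t β x y : ℝ) : ‖gA t β x - gA t β y‖ ≤ 7 * |x - y| := by
  have h1 : gA t β x - gA t β y = ((1 / (1 + t ^ 2) * cos β : ℝ) : ℂ) *
      ((t ^ 2 : ℝ) * (circ x - circ y) - (circ (-x) - circ (-y))) := by
    rw [gA, gA]; push_cast; ring
  have h2 := norm_circ_sub_le x y
  have h3 := norm_circ_sub_le (-x) (-y)
  rw [show -x - -y = -(x - y) by ring, abs_neg] at h3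
  have h4 : ‖((t ^ 2 : ℝ) : ℂ) * (circ x - circ y) - (circ (-x) - circ (-y))‖ ≤ (1 + t ^ 2) * (7 * |x - y|) := by
    refine (norm_sub_le _ _).trans ?_
    rw [norm_mul, norm_real, norm_of_nonneg (sq_nonneg t)]
    have := mul_le_mul_of_nonneg_left h2 (sq_nonneg t)
    linarith
  have ht : 0 < 1 + t ^ 2 := by positivity
  rw [h1, norm_mul, norm_real, norm_eq_abs, abs_mul, abs_of_pos (by positivity)]
  calc 1 / (1 + t ^ 2) * |cos β| * _ ≤ 1 / (1 + t ^ 2) * 1 * ((1 + t ^ 2) * (7 * |x - y|)) := by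
        gcongr
        exact abs_cos_le_one _
    _ = _ := by field_simp

lemma abs_fA_sub_le (t β x y : ℝ) : |fA t β x - fA t β y| ≤ 7 * |x - y| := by
  have hc : ∀ w : ℝ, cos (2 * π * w) = (circ w).re := by
    intro w
    rw [circ, show (2 * π * w * I : ℂ) = ((2 * π * w : ℝ) : ℂ) * I by push_cast; ring,
      Complex.exp_ofReal_mul_I_re]
  have h1 : fA t β x - fA t β y = (-(2 * t) / (1 + t ^ 2)) * cos β * (circ x - circ y).re := by
    rw [fA, fA, hc, hc, sub_re]; ring
  have ht : 0 < 1 + t ^ 2 := by positivity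
  have h2 : |-(2 * t) / (1 + t ^ 2)| ≤ 1 := by
    rw [abs_div, abs_of_pos ht, div_le_one ht, abs_le]
    constructor <;> nlinarith [sq_nonneg (t - 1), sq_nonneg (t + 1)]
  rw [h1, abs_mul, abs_mul]
  calc _ ≤ 1 * 1 * (7 * |x - y|) := by
        gcongr
        · exact abs_cos_le_one _
        · exact (abs_re_le_norm _).trans (norm_circ_sub_le x y)
    _ = _ := by ring

lemma normSq_perturb {R r : ℂ} {κ n₁ n₂ n₃ n₄ : ℝ} (h : ‖R - r‖ ≤ κ * (n₁ + n₂ + n₃ + n₄)) :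
    normSq R ≤ 2 * normSq r + 8 * κ ^ 2 * (n₁ ^ 2 + n₂ ^ 2 + n₃ ^ 2 + n₄ ^ 2) := by
  rw [normSq_eq_norm_sq, normSq_eq_norm_sq]
  have h1 : ‖R‖ ≤ ‖r‖ + ‖R - r‖ := by
    have := norm_add_le r (R - r)
    rwa [add_sub_cancel] at this
  have h2 : ‖R‖ ^ 2 ≤ 2 * ‖r‖ ^ 2 + 2 * ‖R - r‖ ^ 2 := by
    nlinarith [norm_nonneg R, norm_nonneg r, sq_nonneg (‖r‖ - ‖R - r‖), norm_nonneg (R - r)]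
  have h3 : ‖R - r‖ ^ 2 ≤ κ ^ 2 * (n₁ + n₂ + n₃ + n₄) ^ 2 := by
    rw [← mul_pow]; exact pow_le_pow_left₀ (norm_nonneg _) h 2
  have h4 : (n₁ + n₂ + n₃ + n₄) ^ 2 ≤ 4 * (n₁ ^ 2 + n₂ ^ 2 + n₃ ^ 2 + n₄ ^ 2) := by
    nlinarith [sq_nonneg (n₁ - n₂), sq_nonneg (n₁ - n₃), sq_nonneg (n₁ - n₄), sq_nonneg (n₂ - n₃),
      sq_nonneg (n₂ - n₄), sq_nonneg (n₃ - n₄)]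
  have := mul_le_mul_of_nonneg_left h4 (sq_nonneg κ)
  linarith

lemma norm_coin_diff_le {F F' κ : ℝ} {G G' a b : ℂ} (hF : |F' - F| ≤ κ) (hG : ‖G' - G‖ ≤ κ) :
    ‖(F' * a - G' * b) - (F * a - G * b)‖ ≤ κ * (‖a‖ + ‖b‖) ∧
    ‖(star G' * a + F' * b) - (star G * a + F * b)‖ ≤ κ * (‖a‖ + ‖b‖) := by
  have hF' : ‖((F' - F : ℝ) : ℂ)‖ ≤ κ := by rw [norm_real]; exact hF
  have hG' : ‖star (G' - G)‖ ≤ κ := by rw [norm_star]; exact hG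
  constructor
  · rw [show (F' * a - G' * b) - (F * a - G * b) = ((F' - F : ℝ) : ℂ) * a - (G' - G) * b by push_cast; ring]
    refine (norm_sub_le _ _).trans ?_
    rw [norm_mul, norm_mul, mul_add]
    gcongr
  · rw [show (star G' * a + F' * b) - (star G * a + F * b) = star (G' - G) * a + ((F' - F : ℝ) : ℂ) * b by
      rw [star_sub]; push_cast; ring]
    refine (norm_add_le _ _).trans ?_
    rw [norm_mul, norm_mul, mul_add]
    gcongr

lemma norm_shift_diff_le {c s : ℝ} (hc : |c| ≤ 1) (hs : |s| ≤ 1) {z : ℂ} (hz : ‖z‖ = 1) {e X X' Y Y' : ℂ} :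
    ‖(e - z * (c * X' - s * Y')) - (e - z * (c * X - s * Y))‖ ≤ ‖X' - X‖ + ‖Y' - Y‖ ∧
    ‖(e - z * (s * X' + c * Y')) - (e - z * (s * X + c * Y))‖ ≤ ‖X' - X‖ + ‖Y' - Y‖ := by
  have hc' : ‖(c : ℂ)‖ ≤ 1 := by rw [norm_real]; exact hc
  have hs' : ‖(s : ℂ)‖ ≤ 1 := by rw [norm_real]; exact hs
  constructor
  · rw [show (e - z * (c * X' - s * Y')) - (e - z * (c * X - s * Y)) = -(z * (c * (X' - X) - s * (Y' - Y))) by ring,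
      norm_neg, norm_mul, hz, one_mul]
    refine (norm_sub_le _ _).trans ?_
    rw [norm_mul, norm_mul]
    exact add_le_add (mul_le_of_le_one_left (norm_nonneg _) hc') (mul_le_of_le_one_left (norm_nonneg _) hs')
  · rw [show (e - z * (s * X' + c * Y')) - (e - z * (s * X + c * Y)) = -(z * (s * (X' - X) + c * (Y' - Y))) by ring,
      norm_neg, norm_mul, hz, one_mul]
    refine (norm_add_le _ _).trans ?_
    rw [norm_mul, norm_mul]
    exact add_le_add (mul_le_of_le_one_left (norm_nonneg _) hs') (mul_le_of_le_one_left (norm_nonneg _) hc')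

lemma norm_coin_le {F : ℝ} {G a b : ℂ} (hF : |F| ≤ 1) (hG : ‖G‖ ≤ 1) :
    ‖F * a - G * b‖ ≤ ‖a‖ + ‖b‖ ∧ ‖star G * a + F * b‖ ≤ ‖a‖ + ‖b‖ := by
  have hF' : ‖(F : ℂ)‖ ≤ 1 := by rw [norm_real]; exact hF
  have hG' : ‖star G‖ ≤ 1 := by rw [norm_star]; exact hG
  constructor
  · refine (norm_sub_le _ _).trans ?_
    rw [norm_mul, norm_mul]
    exact add_le_add (mul_le_of_le_one_left (norm_nonneg _) hF') (mul_le_of_le_one_left (norm_nonneg _) hG)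
  · refine (norm_add_le _ _).trans ?_
    rw [norm_mul, norm_mul]
    exact add_le_add (mul_le_of_le_one_left (norm_nonneg _) hG') (mul_le_of_le_one_left (norm_nonneg _) hF')

section

/-- The upper component of `(1 - z W) ψ` for the walk with coin angle `π - α`. -/
def resUp (t α Φ θ : ℝ) (z : ℂ) (a b : ℤ → ℂ) (n : ℤ) : ℂ :=
  a n - z * (cos α * (fA t (π - α) (θ + (n - 1 : ℤ) * Φ) * a (n - 1) -
      gA t (π - α) (θ + (n - 1 : ℤ) * Φ) * b (n - 1)) -
    sin α * (star (gA t (π - α) (θ + n * Φ)) * a n + fA t (π - α) (θ + n * Φ) * b n))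

/-- The lower component of `(1 - z W) ψ` for the walk with coin angle `π - α`. -/
def resDown (t α Φ θ : ℝ) (z : ℂ) (a b : ℤ → ℂ) (n : ℤ) : ℂ :=
  b n - z * (sin α * (fA t (π - α) (θ + n * Φ) * a n - gA t (π - α) (θ + n * Φ) * b n) +
    cos α * (star (gA t (π - α) (θ + (n + 1 : ℤ) * Φ)) * a (n + 1) +
      fA t (π - α) (θ + (n + 1 : ℤ) * Φ) * b (n + 1)))

/-- The restriction of a state to the window of `N` sites starting at `m`, placed on a ring of `q` sites. -/
def win (q N : ℕ) (m : ℤ) (a b : ℤ → ℂ) : Fin q ⊕ Fin q → ℂ :=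
  Sum.elim (fun j => if (j : ℕ) < N then a (m + (j : ℕ)) else 0) (fun j => if (j : ℕ) < N then b (m + (j : ℕ)) else 0)

section
variable {q : ℕ} [NeZero q]

lemma win_inl {N : ℕ} (m : ℤ) (a b : ℤ → ℂ) {n : ℕ} (hn : n < q) :
    win q N m a b (Sum.inl (site q n)) = if n < N then a (m + n) else 0 := by
  simp only [win, Sum.elim_inl, site, Nat.mod_eq_of_lt hn]

lemma win_inr {N : ℕ} (m : ℤ) (a b : ℤ → ℂ) {n : ℕ} (hn : n < q) :
    win q N m a b (Sum.inr (site q n)) = if n < N then b (m + n) else 0 := by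
  simp only [win, Sum.elim_inr, site, Nat.mod_eq_of_lt hn]

lemma phase_dist (Φ θ y : ℝ) (m : ℤ) {n N : ℕ} (hn : n ≤ N) :
    7 * |(θ + m * Φ + n * y) - (θ + (m + n : ℤ) * Φ)| ≤ 7 * N * |Φ - y| := by
  rw [show (θ + m * Φ + n * y) - (θ + (m + n : ℤ) * Φ) = -(n * (Φ - y)) by push_cast; ring, abs_neg, abs_mul,
    Nat.abs_cast, mul_assoc]
  gcongr

/-- The residual of a window of `a, b` on the ring. -/
def winRes (t α θ Φ : ℝ) (z : ℂ) (q : ℕ) (p : ℤ) (N : ℕ) (m : ℤ) (a b : ℤ → ℂ) : Fin q ⊕ Fin q → ℂ :=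
  win q N m a b - z • (qRing t α (π - α) q (p / q) (θ + m * Φ) *ᵥ win q N m a b)

variable {t α θ Φ : ℝ} {z : ℂ} {p : ℤ} {N : ℕ} {m : ℤ} {a b : ℤ → ℂ}

lemma winRes_inl_interior (hz : ‖z‖ = 1) (hN : N < q) {k : ℕ} (hk : k + 1 < N) :
    ‖winRes t α θ Φ z q p N m a b (Sum.inl (site q (k + 1))) - resUp t α Φ θ z a b (m + (k + 1 : ℕ))‖ ≤
      7 * N * |Φ - p / q| * (‖a (m + k)‖ + ‖b (m + k)‖ + ‖a (m + (k + 1 : ℕ))‖ + ‖b (m + (k + 1 : ℕ))‖) := by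
  have d0 := phase_dist Φ θ (p / q) m (n := k) (N := N) (by omega)
  have d1 := phase_dist Φ θ (p / q) m (n := k + 1) (N := N) (by omega)
  have e0 := norm_coin_diff_le (a := a (m + k)) (b := b (m + k))
    ((abs_fA_sub_le t (π - α) _ _).trans d0) ((norm_gA_sub_le t (π - α) _ _).trans d0)
  have e1 := norm_coin_diff_le (a := a (m + (k + 1 : ℕ))) (b := b (m + (k + 1 : ℕ)))
    ((abs_fA_sub_le t (π - α) _ _).trans d1) ((norm_gA_sub_le t (π - α) _ _).trans d1)
  rw [winRes, Pi.sub_apply, Pi.smul_apply, smul_eq_mul, qRing_mulVec_inl, win_inl _ _ _ (by omega), win_inl _ _ _ (by omega),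
    win_inr _ _ _ (by omega), win_inr _ _ _ (by omega), if_pos hk, if_pos (by omega), if_pos hk, if_pos (by omega), resUp,
    show m + ((k + 1 : ℕ) : ℤ) - 1 = m + k by push_cast; ring]
  refine (norm_shift_diff_le (abs_cos_le_one _) (abs_sin_le_one _) hz).1.trans
    ((add_le_add e0.1 e1.2).trans (le_of_eq ?_))
  ring

lemma winRes_inr_interior (hz : ‖z‖ = 1) (hN : N < q) {k : ℕ} (hk : k + 1 < N) :
    ‖winRes t α θ Φ z q p N m a b (Sum.inr (site q k)) - resDown t α Φ θ z a b (m + k)‖ ≤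
      7 * N * |Φ - p / q| * (‖a (m + k)‖ + ‖b (m + k)‖ + ‖a (m + (k + 1 : ℕ))‖ + ‖b (m + (k + 1 : ℕ))‖) := by
  have d0 := phase_dist Φ θ (p / q) m (n := k) (N := N) (by omega)
  have d1 := phase_dist Φ θ (p / q) m (n := k + 1) (N := N) (by omega)
  have e0 := norm_coin_diff_le (a := a (m + k)) (b := b (m + k))
    ((abs_fA_sub_le t (π - α) _ _).trans d0) ((norm_gA_sub_le t (π - α) _ _).trans d0)
  have e1 := norm_coin_diff_le (a := a (m + (k + 1 : ℕ))) (b := b (m + (k + 1 : ℕ)))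
    ((abs_fA_sub_le t (π - α) _ _).trans d1) ((norm_gA_sub_le t (π - α) _ _).trans d1)
  rw [winRes, Pi.sub_apply, Pi.smul_apply, smul_eq_mul, qRing_mulVec_inr, win_inl _ _ _ (by omega), win_inl _ _ _ (by omega),
    win_inr _ _ _ (by omega), win_inr _ _ _ (by omega), if_pos hk, if_pos (by omega), if_pos hk, if_pos (by omega), resDown,
    show m + (k : ℤ) + 1 = m + (k + 1 : ℕ) by push_cast; ring]
  refine (norm_shift_diff_le (abs_cos_le_one _) (abs_sin_le_one _) hz).2.trans
    ((add_le_add e0.1 e1.2).trans (le_of_eq ?_))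
  ring

lemma abs_fA_le_one (t β x : ℝ) : |fA t β x| ≤ 1 := by
  have := fA_sq_add t β x
  rw [abs_le]
  constructor <;> nlinarith [sq_nonneg (‖gA t β x‖)]

lemma norm_unit_mul_le {c : ℝ} (hc : |c| ≤ 1) (hz : ‖z‖ = 1) {X e : ℂ} {n : ℝ} (hX : ‖X‖ ≤ n) :
    ‖e - z * (c * X)‖ ≤ ‖e‖ + n := by
  refine (norm_sub_le _ _).trans ?_
  rw [norm_mul, norm_mul, hz, one_mul, norm_real]
  have := mul_le_of_le_one_left (norm_nonneg X) hc
  rw [norm_eq_abs]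
  linarith

lemma winRes_inl_zero (hz : ‖z‖ = 1) (hN0 : 0 < N) (hN : N + 1 < q) :
    ‖winRes t α θ Φ z q p N m a b (Sum.inl (site q 0))‖ ≤ 2 * (‖a m‖ + ‖b m‖) := by
  obtain ⟨k, hk⟩ : ∃ k, q = k + 1 := ⟨q - 1, by omega⟩
  have hs : site q 0 = site q (k + 1) := by
    rw [← hk]
    exact ((congrArg (site q) (zero_add q)).symm.trans (site_add_self 0)).symm
  have e := (norm_coin_le (a := a m) (b := b m) (abs_fA_le_one t (π - α) (θ + m * Φ + (k + 1 : ℕ) * (p / q)))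
    (norm_gA_le_one t (π - α) (θ + m * Φ + (k + 1 : ℕ) * (p / q)))).2
  have hu := win_inl (q := q) (N := N) m a b (n := 0) (by omega)
  have hv := win_inr (q := q) (N := N) m a b (n := 0) (by omega)
  rw [if_pos hN0, Nat.cast_zero, add_zero, hs] at hu hv
  rw [winRes, Pi.sub_apply, Pi.smul_apply, smul_eq_mul, hs, qRing_mulVec_inl, hu, hv, win_inl _ _ _ (by omega),
    win_inr _ _ _ (by omega), if_neg (by omega), if_neg (by omega), mul_zero, mul_zero, sub_zero, mul_zero, zero_sub,
    ← neg_mul]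
  have := norm_unit_mul_le (e := a m) (c := -sin α) (by rw [abs_neg]; exact abs_sin_le_one _) hz e
  push_cast at this ⊢
  linarith [norm_nonneg (b m)]

lemma winRes_inr_last (hz : ‖z‖ = 1) (hN0 : 0 < N) (hN : N + 1 < q) :
    ‖winRes t α θ Φ z q p N m a b (Sum.inr (site q (q - 1)))‖ ≤ ‖a m‖ + ‖b m‖ := by
  obtain ⟨k, hk⟩ : ∃ k, q = k + 1 := ⟨q - 1, by omega⟩
  have hs : site q 0 = site q (k + 1) := by
    rw [← hk]
    exact ((congrArg (site q) (zero_add q)).symm.trans (site_add_self 0)).symm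
  have e := (norm_coin_le (a := a m) (b := b m) (abs_fA_le_one t (π - α) (θ + m * Φ + (k + 1 : ℕ) * (p / q)))
    (norm_gA_le_one t (π - α) (θ + m * Φ + (k + 1 : ℕ) * (p / q)))).2
  have hu := win_inl (q := q) (N := N) m a b (n := 0) (by omega)
  have hv := win_inr (q := q) (N := N) m a b (n := 0) (by omega)
  rw [if_pos hN0, Nat.cast_zero, add_zero, hs] at hu hv
  rw [show q - 1 = k by omega, winRes, Pi.sub_apply, Pi.smul_apply, smul_eq_mul, qRing_mulVec_inr, hu, hv,
    win_inl _ _ _ (by omega), win_inr _ _ _ (by omega), if_neg (by omega), if_neg (by omega), mul_zero, mul_zero,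
    sub_zero, mul_zero, zero_add]
  have := norm_unit_mul_le (e := 0) (c := cos α) (abs_cos_le_one _) hz e
  rwa [norm_zero, zero_add] at this

lemma winRes_inl_end (hz : ‖z‖ = 1) (hN : N + 2 < q) :
    ‖winRes t α θ Φ z q p (N + 1) m a b (Sum.inl (site q (N + 1)))‖ ≤ ‖a (m + N)‖ + ‖b (m + N)‖ := by
  have e := (norm_coin_le (a := a (m + N)) (b := b (m + N)) (abs_fA_le_one t (π - α) (θ + m * Φ + N * (p / q)))
    (norm_gA_le_one t (π - α) (θ + m * Φ + N * (p / q)))).1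
  rw [winRes, Pi.sub_apply, Pi.smul_apply, smul_eq_mul, qRing_mulVec_inl, win_inl _ _ _ (by omega), win_inl _ _ _ (by omega),
    win_inr _ _ _ (by omega), win_inr _ _ _ (by omega), if_neg (show ¬ N + 1 < N + 1 by omega),
    if_neg (show ¬ N + 1 < N + 1 by omega), if_pos (show N < N + 1 by omega), if_pos (show N < N + 1 by omega), mul_zero, mul_zero, add_zero, mul_zero, sub_zero]
  have := norm_unit_mul_le (e := 0) (c := cos α) (abs_cos_le_one _) hz e
  rwa [norm_zero, zero_add] at this

lemma winRes_inr_end (hz : ‖z‖ = 1) (hN : N + 2 < q) :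
    ‖winRes t α θ Φ z q p (N + 1) m a b (Sum.inr (site q N))‖ ≤ 2 * (‖a (m + N)‖ + ‖b (m + N)‖) := by
  have e := (norm_coin_le (a := a (m + N)) (b := b (m + N)) (abs_fA_le_one t (π - α) (θ + m * Φ + N * (p / q)))
    (norm_gA_le_one t (π - α) (θ + m * Φ + N * (p / q)))).1
  rw [winRes, Pi.sub_apply, Pi.smul_apply, smul_eq_mul, qRing_mulVec_inr, win_inl _ _ _ (by omega), win_inl _ _ _ (by omega),
    win_inr _ _ _ (by omega), win_inr _ _ _ (by omega), if_neg (show ¬ N + 1 < N + 1 by omega),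
    if_neg (show ¬ N + 1 < N + 1 by omega), if_pos (show N < N + 1 by omega), if_pos (show N < N + 1 by omega), mul_zero, mul_zero, add_zero, mul_zero, add_zero]
  have := norm_unit_mul_le (e := b (m + N)) (c := sin α) (abs_sin_le_one _) hz e
  linarith [norm_nonneg (a (m + N))]

lemma winRes_inl_outside {k : ℕ} (hk : N ≤ k) (hkq : k + 1 < q) :
    winRes t α θ Φ z q p N m a b (Sum.inl (site q (k + 1))) = 0 := by
  rw [winRes, Pi.sub_apply, Pi.smul_apply, smul_eq_mul, qRing_mulVec_inl, win_inl _ _ _ (by omega), win_inl _ _ _ (by omega),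
    win_inr _ _ _ (by omega), win_inr _ _ _ (by omega), if_neg (by omega), if_neg (by omega), if_neg (by omega),
    if_neg (by omega)]
  ring

lemma winRes_inr_outside {k : ℕ} (hk : N ≤ k) (hkq : k + 1 < q) :
    winRes t α θ Φ z q p N m a b (Sum.inr (site q k)) = 0 := by
  rw [winRes, Pi.sub_apply, Pi.smul_apply, smul_eq_mul, qRing_mulVec_inr, win_inl _ _ _ (by omega), win_inl _ _ _ (by omega),
    win_inr _ _ _ (by omega), win_inr _ _ _ (by omega), if_neg (by omega), if_neg (by omega), if_neg (by omega),
    if_neg (by omega)]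
  ring

end

end

section

/-- Localization bounds for the resolvent of the ring of `q` sites at `circ s`. -/
structure RingBound (t α : ℝ) (q : ℕ) [NeZero q] (p : ℤ) (ρ s E τ : ℝ) : Prop where
  nonneg : 0 ≤ E
  pos : 0 < τ
  green : ∀ (x : ℝ) (u r : Fin q ⊕ Fin q → ℂ), r = u - circ s • (qRing t α (π - α) q (p / q) x *ᵥ u) →
    ∀ m a : ℕ, (∀ n, n ≠ site q m → r (Sum.inl n) = 0) → (∀ n, n ≠ site q (m + q - 1) → r (Sum.inr n) = 0) →
    a + 1 < q → ρ * q ≤ (a + 1 : ℕ) → ρ * q ≤ (q - (a + 1) : ℕ) →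
    ‖u (Sum.inl (site q (m + a)))‖ + ‖u (Sum.inr (site q (m + a)))‖ ≤
      E * (‖r (Sum.inl (site q m))‖ + ‖r (Sum.inr (site q (m + q - 1)))‖)
  inv : ∀ x : ℝ, chi (qRing t α (π - α) q (p / q) x) (circ s) ≠ 0
  resolvent : ∀ (x : ℝ) (u : Fin q ⊕ Fin q → ℂ), τ ^ 2 * ∑ k, normSq (u k) ≤
    ∑ k, normSq ((u - circ s • (qRing t α (π - α) q (p / q) x *ᵥ u)) k)

/-- The squared norm at a site. -/
def nu (a b : ℤ → ℂ) (n : ℤ) : ℝ := ‖a n‖ ^ 2 + ‖b n‖ ^ 2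

lemma nu_nonneg (a b : ℤ → ℂ) (n : ℤ) : 0 ≤ nu a b n := by rw [nu]; positivity

section
variable {q : ℕ} [NeZero q]

lemma sum_range_site (F : Fin q → ℝ) : ∑ i, F i = ∑ n ∈ range q, F (site q n) := by
  rw [← Fin.sum_univ_eq_sum_range (fun n => F (site q n)) q]
  refine sum_congr rfl fun i _ => ?_
  congr 1
  rw [Fin.ext_iff]
  exact (Nat.mod_eq_of_lt i.2).symm

lemma sum_normSq_le_of_site {d : Fin q ⊕ Fin q → ℂ} {N : ℕ} {X Y : ℕ → ℝ} (hN : N ≤ q)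
    (hX : ∀ n < q, normSq (d (Sum.inl (site q n))) ≤ if n < N then X n else 0)
    (hY : ∀ n < q, normSq (d (Sum.inr (site q n))) ≤ if n < N then Y n else 0) :
    ∑ k, normSq (d k) ≤ ∑ n ∈ range N, (X n + Y n) := by
  have h : ∀ Z : ℕ → ℝ, ∑ n ∈ range q, (if n < N then Z n else 0) = ∑ n ∈ range N, Z n := by
    intro Z
    rw [← Finset.sum_filter]
    congr 1
    ext n
    simp only [mem_filter, mem_range]
    omega
  rw [sum_sum_type, sum_range_site fun i => normSq (d (Sum.inl i)),
    sum_range_site fun i => normSq (d (Sum.inr i)), sum_add_distrib, ← h X, ← h Y]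
  exact add_le_add (sum_le_sum fun n hn => hX n (mem_range.1 hn))
    (sum_le_sum fun n hn => hY n (mem_range.1 hn))

lemma sum_le_sum_normSq (d : Fin q ⊕ Fin q → ℂ) {L : ℕ} (h : 2 * L ≤ q) :
    ∑ j ∈ range L, (‖d (Sum.inl (site q (L + j)))‖ ^ 2 + ‖d (Sum.inr (site q (L + j)))‖ ^ 2) ≤
      ∑ k, normSq (d k) := by
  rw [sum_sum_type, sum_range_site fun i => normSq (d (Sum.inl i)),
    sum_range_site fun i => normSq (d (Sum.inr i)), ← sum_add_distrib]
  have h1 := Finset.sum_Ico_eq_sum_range (fun n => normSq (d (Sum.inl (site q n))) +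
    normSq (d (Sum.inr (site q n)))) L (2 * L)
  rw [show 2 * L - L = L by omega] at h1
  simp only [← normSq_eq_norm_sq]
  rw [← h1]
  refine Finset.sum_le_sum_of_subset_of_nonneg (fun n hn => ?_) fun n _ _ =>
    add_nonneg (normSq_nonneg _) (normSq_nonneg _)
  rw [Finset.mem_Ico] at hn
  rw [mem_range]
  omega

lemma exists_resolvent {A : Matrix (Fin q ⊕ Fin q) (Fin q ⊕ Fin q) ℂ} {z : ℂ} (h : chi A z ≠ 0)
    {φ b₁ b₂ d : Fin q ⊕ Fin q → ℂ} (hφ : φ - z • (A *ᵥ φ) = b₁ + b₂ + d) :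
    ∃ u₁ u₂ u₃ : Fin q ⊕ Fin q → ℂ, φ = u₁ + u₂ + u₃ ∧ b₁ = u₁ - z • (A *ᵥ u₁) ∧ b₂ = u₂ - z • (A *ᵥ u₂) ∧
      d = u₃ - z • (A *ᵥ u₃) := by
  have hM : ∀ u, u - z • (A *ᵥ u) = (1 - z • A) *ᵥ u := by
    intro u
    rw [sub_mulVec, one_mulVec, smul_mulVec]
  have hu : IsUnit (1 - z • A).det := isUnit_iff_ne_zero.2 h
  have hR : ∀ r, r = (1 - z • A) *ᵥ ((1 - z • A)⁻¹ *ᵥ r) := by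
    intro r
    rw [mulVec_mulVec, mul_nonsing_inv _ hu, one_mulVec]
  refine ⟨(1 - z • A)⁻¹ *ᵥ b₁, (1 - z • A)⁻¹ *ᵥ b₂, (1 - z • A)⁻¹ *ᵥ d, ?_, ?_, ?_, ?_⟩
  · rw [← mulVec_add, ← mulVec_add, ← hφ, hM, mulVec_mulVec, nonsing_inv_mul _ hu,
      one_mulVec]
  all_goals rw [hM]; exact hR _

end

end

section

section
variable {q : ℕ} [NeZero q]

lemma site_inj {a b : ℕ} (ha : a < q) (hb : b < q) : site q a = site q b ↔ a = b := by
  rw [Fin.ext_iff]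
  change a % q = b % q ↔ a = b
  rw [Nat.mod_eq_of_lt ha, Nat.mod_eq_of_lt hb]

lemma normSq_add_three_le (x y w : ℂ) : ‖x + y + w‖ ^ 2 ≤ 3 * (‖x‖ ^ 2 + ‖y‖ ^ 2 + ‖w‖ ^ 2) := by
  have h : ‖x + y + w‖ ≤ ‖x‖ + ‖y‖ + ‖w‖ := norm_add₃_le
  have h2 := pow_le_pow_left₀ (norm_nonneg _) h 2
  nlinarith [sq_nonneg (‖x‖ - ‖y‖), sq_nonneg (‖x‖ - ‖w‖), sq_nonneg (‖y‖ - ‖w‖)]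

lemma sq_add_sq_le_of_add_le {x y A B E c : ℝ} (hx : 0 ≤ x) (hy : 0 ≤ y) (h : x + y ≤ E * c)
    (hE : 0 ≤ E) (hc : c ≤ 3 * (A + B)) (hA : 0 ≤ A) (hB : 0 ≤ B) : x ^ 2 + y ^ 2 ≤ 18 * E ^ 2 * (A ^ 2 + B ^ 2) := by
  have h1 : x + y ≤ E * (3 * (A + B)) := h.trans (mul_le_mul_of_nonneg_left hc hE)
  have h2 : (x + y) ^ 2 ≤ (E * (3 * (A + B))) ^ 2 := pow_le_pow_left₀ (by positivity) h1 2
  have h3 : (A + B) ^ 2 ≤ 2 * (A ^ 2 + B ^ 2) := by nlinarith [sq_nonneg (A - B)]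
  have h4 := mul_le_mul_of_nonneg_left h3 (by positivity : 0 ≤ 9 * E ^ 2)
  nlinarith [mul_nonneg hx hy]

lemma window_bound {t α ρ s E τ Φ θ : ℝ} {p : ℤ} (hB : RingBound t α q p ρ s E τ) {L : ℕ} (hL : 0 < L)
    (hLq : 3 * L + 1 < q) (h1 : ρ * q ≤ L) (h2 : ρ * q ≤ (q - 3 * L : ℕ)) (a b : ℤ → ℂ) (m : ℤ) :
    ∑ j ∈ range L, nu a b (m + (L + j : ℕ)) ≤
      54 * L * E ^ 2 * (nu a b m + nu a b (m + (3 * L - 1 : ℕ))) + 3 / τ ^ 2 *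
        ∑ n ∈ range (3 * L), (2 * nu (resUp t α Φ θ (circ s) a b) (resDown t α Φ θ (circ s) a b) (m + n) +
          8 * (7 * (3 * L : ℕ) * |Φ - p / q|) ^ 2 * (nu a b (m + n - 1) + 2 * nu a b (m + n) + nu a b (m + n + 1))) := by
  obtain ⟨N, hN⟩ : ∃ N, 3 * L = N + 1 := ⟨3 * L - 1, by omega⟩
  rw [hN] at hLq h2 ⊢
  rw [show N + 1 - 1 = N by omega]
  have hz := norm_circ s
  have hτ := hB.pos
  obtain ⟨κ, hκ⟩ : ∃ κ : ℝ, κ = 7 * (N + 1 : ℕ) * |Φ - p / q| := ⟨_, rfl⟩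
  obtain ⟨R, hR⟩ : ∃ R, R = winRes t α θ Φ (circ s) q p (N + 1) m a b := ⟨_, rfl⟩
  obtain ⟨b₁, hb₁⟩ : ∃ b₁ : Fin q ⊕ Fin q → ℂ, b₁ = Sum.elim (fun i => if i = site q 0 then R (Sum.inl i) else 0)
    (fun i => if i = site q (q - 1) then R (Sum.inr i) else 0) := ⟨_, rfl⟩
  obtain ⟨b₂, hb₂⟩ : ∃ b₂ : Fin q ⊕ Fin q → ℂ, b₂ = Sum.elim (fun i => if i = site q (N + 1) then R (Sum.inl i) else 0)
    (fun i => if i = site q N then R (Sum.inr i) else 0) := ⟨_, rfl⟩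
  obtain ⟨d, hd⟩ : ∃ d, d = R - b₁ - b₂ := ⟨_, rfl⟩
  have hsum : winRes t α θ Φ (circ s) q p (N + 1) m a b = b₁ + b₂ + d := by rw [← hR, hd]; abel
  obtain ⟨u₁, u₂, u₃, hφ, e1, e2, e3⟩ := exists_resolvent (hB.inv (θ + m * Φ)) hsum
  have hdsum : ∑ k, normSq (d k) ≤ ∑ n ∈ range (N + 1),
      ((2 * normSq (resUp t α Φ θ (circ s) a b (m + n)) + 8 * κ ^ 2 * (nu a b (m + n - 1) + nu a b (m + n))) +
      (2 * normSq (resDown t α Φ θ (circ s) a b (m + n)) + 8 * κ ^ 2 * (nu a b (m + n) + nu a b (m + n + 1)))) := by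
    have hnn : ∀ n, 0 ≤ nu a b n := nu_nonneg a b
    refine sum_normSq_le_of_site (by omega) (fun n hn => ?_) fun n hn => ?_
    · have hdn : d (Sum.inl (site q n)) = if n = 0 ∨ n = N + 1 then 0 else R (Sum.inl (site q n)) := by
        rw [hd, hb₁, hb₂]
        simp only [Pi.sub_apply, Sum.elim_inl, site_inj hn (NeZero.pos q), site_inj hn (show N + 1 < q by omega)]
        by_cases c1 : n = 0
        · rw [if_pos c1, if_neg (by omega), if_pos (Or.inl c1)]; ring
        · by_cases c2 : n = N + 1
          · rw [if_neg c1, if_pos c2, if_pos (Or.inr c2)]; ring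
          · rw [if_neg c1, if_neg c2, if_neg (by tauto)]; ring
      rw [hdn]
      have hX : 0 ≤ 2 * normSq (resUp t α Φ θ (circ s) a b (m + n)) +
          8 * κ ^ 2 * (nu a b (m + n - 1) + nu a b (m + n)) :=
        add_nonneg (mul_nonneg zero_le_two (normSq_nonneg _))
          (mul_nonneg (by positivity) (add_nonneg (hnn _) (hnn _)))
      by_cases c : n = 0 ∨ n = N + 1
      · rw [if_pos c, normSq_zero]
        split_ifs
        · exact hX
        · exact le_rfl
      · rw [if_neg c]
        obtain ⟨k, rfl⟩ : ∃ k, n = k + 1 := ⟨n - 1, by omega⟩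
        by_cases c3 : k + 1 < N + 1
        · rw [if_pos c3, hR]
          have := normSq_perturb (winRes_inl_interior (t := t) (α := α) (θ := θ) (Φ := Φ) (p := p) (m := m) (a := a)
            (b := b) hz (show N + 1 < q by omega) c3)
          rw [← hκ] at this
          refine this.trans (le_of_eq ?_)
          rw [nu, nu, show m + ((k + 1 : ℕ) : ℤ) - 1 = m + k by push_cast; ring]
          ring
        · rw [if_neg c3, hR, winRes_inl_outside (by omega) hn, normSq_zero]
    · have hdn : d (Sum.inr (site q n)) = if n = q - 1 ∨ n = N then 0 else R (Sum.inr (site q n)) := by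
        rw [hd, hb₁, hb₂]
        simp only [Pi.sub_apply, Sum.elim_inr, site_inj hn (show q - 1 < q by omega), site_inj hn (show N < q by omega)]
        by_cases c1 : n = q - 1
        · rw [if_pos c1, if_neg (by omega), if_pos (Or.inl c1)]; ring
        · by_cases c2 : n = N
          · rw [if_neg c1, if_pos c2, if_pos (Or.inr c2)]; ring
          · rw [if_neg c1, if_neg c2, if_neg (by tauto)]; ring
      rw [hdn]
      have hX : 0 ≤ 2 * normSq (resDown t α Φ θ (circ s) a b (m + n)) +
          8 * κ ^ 2 * (nu a b (m + n) + nu a b (m + n + 1)) :=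
        add_nonneg (mul_nonneg zero_le_two (normSq_nonneg _))
          (mul_nonneg (by positivity) (add_nonneg (hnn _) (hnn _)))
      by_cases c : n = q - 1 ∨ n = N
      · rw [if_pos c, normSq_zero]
        split_ifs
        · exact hX
        · exact le_rfl
      · rw [if_neg c]
        by_cases c3 : n + 1 < N + 1
        · rw [if_pos (by omega), hR]
          have := normSq_perturb (winRes_inr_interior (t := t) (α := α) (θ := θ) (Φ := Φ) (p := p) (m := m) (a := a)
            (b := b) hz (show N + 1 < q by omega) c3)
          rw [← hκ] at this
          refine this.trans (le_of_eq ?_)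
          rw [nu, nu, show m + (n : ℤ) + 1 = m + (n + 1 : ℕ) by push_cast; ring]
          ring
        · rw [if_neg (by omega), hR, winRes_inr_outside (by omega) (by omega), normSq_zero]
  have hu3 : ∑ j ∈ range L, (‖u₃ (Sum.inl (site q (L + j)))‖ ^ 2 + ‖u₃ (Sum.inr (site q (L + j)))‖ ^ 2) ≤
      1 / τ ^ 2 * ∑ k, normSq (d k) := by
    refine (sum_le_sum_normSq u₃ (by omega)).trans ?_
    have := hB.resolvent (θ + m * Φ) u₃
    rw [← e3] at this
    rw [one_div, ← div_eq_inv_mul, le_div_iff₀ (by positivity)]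
    linarith
  have hb₁l : ‖b₁ (Sum.inl (site q 0))‖ + ‖b₁ (Sum.inr (site q (0 + q - 1)))‖ ≤ 3 * (‖a m‖ + ‖b m‖) := by
    rw [hb₁, Sum.elim_inl, Sum.elim_inr, if_pos rfl, zero_add, if_pos rfl, hR]
    have f1 := winRes_inl_zero (t := t) (α := α) (θ := θ) (Φ := Φ) (p := p) (m := m) (a := a)
            (b := b) hz (Nat.succ_pos N) hLq
    have f2 := winRes_inr_last (t := t) (α := α) (θ := θ) (Φ := Φ) (p := p) (m := m) (a := a)
            (b := b) hz (Nat.succ_pos N) hLq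
    linarith
  have hsN : site q (N + 1 + q - 1) = site q N := by
    rw [show N + 1 + q - 1 = N + q by omega, site_add_self]
  have hb₂l : ‖b₂ (Sum.inl (site q (N + 1)))‖ + ‖b₂ (Sum.inr (site q (N + 1 + q - 1)))‖ ≤
      3 * (‖a (m + N)‖ + ‖b (m + N)‖) := by
    rw [hsN, hb₂, Sum.elim_inl, Sum.elim_inr, if_pos rfl, if_pos rfl, hR]
    have f1 := winRes_inl_end (t := t) (α := α) (θ := θ) (Φ := Φ) (p := p) (m := m) (a := a)
            (b := b) hz hLq
    have f2 := winRes_inr_end (t := t) (α := α) (θ := θ) (Φ := Φ) (p := p) (m := m) (a := a)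
            (b := b) hz hLq
    linarith
  have hpt : ∀ j ∈ range L, nu a b (m + (L + j : ℕ)) ≤ 54 * E ^ 2 * (nu a b m + nu a b (m + N)) +
      3 * (‖u₃ (Sum.inl (site q (L + j)))‖ ^ 2 + ‖u₃ (Sum.inr (site q (L + j)))‖ ^ 2) := by
    intro j hj
    rw [mem_range] at hj
    have g1 := hB.green _ u₁ b₁ e1 0 (L + j)
      (by intro n hn; rw [hb₁, Sum.elim_inl, if_neg hn])
      (by intro n hn; rw [zero_add] at hn; rw [hb₁, Sum.elim_inr, if_neg hn]) (by omega)
      (h1.trans (mod_cast (by omega : L ≤ L + j + 1)))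
      (h2.trans (mod_cast (by omega : q - (N + 1) ≤ q - (L + j + 1))))
    have g2 := hB.green _ u₂ b₂ e2 (N + 1) (q - (N + 1) + (L + j))
      (by intro n hn; rw [hb₂, Sum.elim_inl, if_neg hn])
      (by intro n hn; rw [hsN] at hn; rw [hb₂, Sum.elim_inr, if_neg hn]) (by omega)
      (h2.trans (mod_cast (by omega : q - (N + 1) ≤ q - (N + 1) + (L + j) + 1)))
      (h1.trans (mod_cast (by omega : L ≤ q - (q - (N + 1) + (L + j) + 1))))
    rw [zero_add] at g1
    rw [show N + 1 + (q - (N + 1) + (L + j)) = L + j + q by omega, site_add_self] at g2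
    have k1 := sq_add_sq_le_of_add_le (norm_nonneg _) (norm_nonneg _) g1 hB.nonneg hb₁l (norm_nonneg _) (norm_nonneg _)
    have k2 := sq_add_sq_le_of_add_le (norm_nonneg _) (norm_nonneg _) g2 hB.nonneg hb₂l (norm_nonneg _) (norm_nonneg _)
    have f1 := congrFun hφ (Sum.inl (site q (L + j)))
    have f2 := congrFun hφ (Sum.inr (site q (L + j)))
    rw [win_inl _ _ _ (by omega), if_pos (by omega)] at f1
    rw [win_inr _ _ _ (by omega), if_pos (by omega)] at f2
    rw [nu, f1, f2]
    have l1 := normSq_add_three_le (u₁ (Sum.inl (site q (L + j)))) (u₂ (Sum.inl (site q (L + j))))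
      (u₃ (Sum.inl (site q (L + j))))
    have l2 := normSq_add_three_le (u₁ (Sum.inr (site q (L + j)))) (u₂ (Sum.inr (site q (L + j))))
      (u₃ (Sum.inr (site q (L + j))))
    rw [nu, nu]
    simp only [Pi.add_apply]
    linarith
  refine (sum_le_sum hpt).trans ?_
  rw [sum_add_distrib, sum_const, card_range, ← Finset.mul_sum, nsmul_eq_mul]
  have hfin := mul_le_mul_of_nonneg_left hdsum (by positivity : 0 ≤ 1 / τ ^ 2)
  have heq : ∀ n : ℕ, ((2 * normSq (resUp t α Φ θ (circ s) a b (m + n)) +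
      8 * κ ^ 2 * (nu a b (m + n - 1) + nu a b (m + n))) +
      (2 * normSq (resDown t α Φ θ (circ s) a b (m + n)) + 8 * κ ^ 2 * (nu a b (m + n) + nu a b (m + n + 1)))) =
      2 * nu (resUp t α Φ θ (circ s) a b) (resDown t α Φ θ (circ s) a b) (m + n) +
          8 * κ ^ 2 * (nu a b (m + n - 1) + 2 * nu a b (m + n) + nu a b (m + n + 1)) := by
    intro n
    rw [nu.eq_def (resUp t α Φ θ (circ s) a b), normSq_eq_norm_sq, normSq_eq_norm_sq]
    ring
  simp only [heq] at hfin
  rw [← hκ, show 3 / τ ^ 2 = 3 * (1 / τ ^ 2) by ring]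
  linarith

end

end

section

lemma hasSum_shift {v : ℤ → ℝ} {P : ℝ} (hv : HasSum v P) (k : ℤ) : HasSum (fun m => v (m + k)) P :=
  (addRight k).hasSum_iff.2 hv

/-- Summing a window estimate over all positions of the window. -/
lemma sum_window_le {v r : ℤ → ℝ} {P R A B C : ℝ} {L N : ℕ} {k : ℤ} (hv : HasSum v P) (hr : HasSum r R)
    (h : ∀ m : ℤ, ∑ j ∈ range L, v (m + (L + j : ℕ)) ≤ A * (v m + v (m + k)) +
      B * ∑ n ∈ range N, (2 * r (m + n) + C * (v (m + n - 1) + 2 * v (m + n) + v (m + n + 1)))) :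
    L * P ≤ 2 * A * P + B * (N * (2 * R + 4 * C * P)) := by
  have h1 : HasSum (fun m => ∑ j ∈ range L, v (m + (L + j : ℕ))) (L * P) := by
    have := hasSum_sum (s := range L) fun j _ => hasSum_shift hv (L + j : ℕ)
    rwa [sum_const, card_range, nsmul_eq_mul] at this
  have h2 : HasSum (fun m : ℤ => ∑ n ∈ range N,
      (2 * r (m + n) + C * (v (m + n - 1) + 2 * v (m + n) + v (m + n + 1)))) (N * (2 * R + C * (P + 2 * P + P))) := by
    have := hasSum_sum (s := range N) fun n _ => ((hasSum_shift hr n).mul_left 2).add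
      ((((hasSum_shift hv (n - 1)).add ((hasSum_shift hv n).mul_left 2)).add (hasSum_shift hv (n + 1))).mul_left C)
    rw [sum_const, card_range, nsmul_eq_mul] at this
    simpa only [add_assoc, add_sub_assoc] using this
  have := hasSum_le h h1 (((hv.add (hasSum_shift hv k)).mul_left A).add (h2.mul_left B))
  linarith

variable {q : ℕ} [NeZero q] {t α Φ θ ρ s E τ : ℝ} {p : ℤ}

/-- A ring bound makes `1 - z W` bounded below. -/
lemma sum_nu_le (hB : RingBound t α q p ρ s E τ) {L : ℕ} (hL : 0 < L) (hLq : 3 * L + 1 < q) (h1 : ρ * q ≤ L)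
    (h2 : ρ * q ≤ (q - 3 * L : ℕ)) (hE : 432 * E ^ 2 ≤ 1)
    (hκ : 1152 * (21 * L * |Φ - p / q|) ^ 2 ≤ τ ^ 2) {a b : ℤ → ℂ} {P R : ℝ} (hv : HasSum (nu a b) P)
    (hr : HasSum (nu (resUp t α Φ θ (circ s) a b) (resDown t α Φ θ (circ s) a b)) R) :
    P ≤ 36 / τ ^ 2 * R := by
  have h := sum_window_le hv hr (A := 54 * L * E ^ 2) (B := 3 / τ ^ 2) (C := 8 * (7 * (3 * L : ℕ) * |Φ - p / q|) ^ 2)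
    (L := L) (N := 3 * L) (k := (3 * L - 1 : ℕ)) fun m => window_bound hB hL hLq h1 h2 a b m
  have hτ := hB.pos
  have hP : 0 ≤ P := hv.nonneg fun n => nu_nonneg a b n
  have hL' : (0 : ℝ) < L := mod_cast hL
  push_cast at h
  have e1 : 2 * (54 * L * E ^ 2) * P ≤ 1 / 4 * L * P := by
    have := mul_le_mul_of_nonneg_right hE (by positivity : 0 ≤ 1 / 4 * L * P)
    linarith
  have e2 : 3 / τ ^ 2 * (3 * L * (4 * (8 * (7 * (3 * L) * |Φ - p / q|) ^ 2) * P)) ≤ 1 / 4 * L * P := by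
    rw [div_mul_eq_mul_div, div_le_iff₀ (by positivity)]
    have := mul_le_mul_of_nonneg_right hκ (by positivity : 0 ≤ 1 / 4 * L * P)
    linarith
  have e3 : L * P ≤ L * (36 / τ ^ 2 * R) := by
    have : 3 / τ ^ 2 * (3 * L * (2 * R + 4 * (8 * (7 * (3 * L) * |Φ - p / q|) ^ 2) * P)) =
      3 / τ ^ 2 * (3 * L * (4 * (8 * (7 * (3 * L) * |Φ - p / q|) ^ 2) * P)) + 1 / 2 * (L * (36 / τ ^ 2 * R)) := by ring
    rw [this] at h
    linarith
  exact le_of_mul_le_mul_left e3 hL'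

end

lemma isUnit_one_sub_of_bound {X : Type*} [NormedAddCommGroup X] [NormedSpace ℂ X] [CompleteSpace X]
    {W : X →L[ℂ] X} (hW : ∀ ψ, ‖W ψ‖ ≤ ‖ψ‖) {z : ℂ} (hz : ‖z‖ = 1) {C : ℝ} (hC : ∀ ψ, ‖ψ‖ ≤ C * ‖ψ - z • W ψ‖) :
    IsUnit (1 - z • W) := by
  obtain ⟨K, hK, hKb⟩ : ∃ K : ℝ, 1 ≤ K ∧ ∀ ψ, ‖ψ‖ ≤ K * ‖ψ - z • W ψ‖ :=
    ⟨max 1 C, le_max_left _ _, fun ψ => (hC ψ).trans (by gcongr; exact le_max_right _ _)⟩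
  have hWn : ‖W‖ ≤ 1 := W.opNorm_le_bound zero_le_one fun ψ => by rw [one_mul]; exact hW ψ
  obtain ⟨e, he⟩ : ∃ e : ℝ, e = 1 / (4 * K) := ⟨_, rfl⟩
  have he0 : 0 < e := by rw [he]; positivity
  have heK : K * e = 1 / 4 := by rw [he]; field_simp
  have he1 : e ≤ 1 / 4 := by nlinarith
  have hr : ‖((1 - e : ℝ) * z) • W‖ < 1 := by
    rw [norm_smul, norm_mul, hz, norm_real, norm_of_nonneg (by linarith)]
    nlinarith
  obtain ⟨u, hu⟩ := isUnit_one_sub_of_norm_lt_one hr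
  have hui : ‖(↑u⁻¹ : X →L[ℂ] X)‖ ≤ 2 * K := by
    refine ContinuousLinearMap.opNorm_le_bound _ (by positivity) fun φ => ?_
    obtain ⟨ψ, hψ⟩ : ∃ ψ, ψ = (↑u⁻¹ : X →L[ℂ] X) φ := ⟨_, rfl⟩
    have h1 : (1 - ((1 - e : ℝ) * z) • W) ψ = φ := by
      rw [← hu, hψ]
      change ((u : X →L[ℂ] X) * (↑u⁻¹ : X →L[ℂ] X)) φ = φ
      rw [u.mul_inv]
      rfl
    rw [← hψ]
    have h2 : ψ - z • W ψ = φ - ((e : ℂ) * z) • W ψ := by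
      rw [← h1]
      simp only [_root_.sub_apply, ContinuousLinearMap.one_apply, ContinuousLinearMap.smul_apply]
      push_cast
      module
    have h3 := hKb ψ
    rw [h2] at h3
    have h4 : ‖φ - ((e : ℂ) * z) • W ψ‖ ≤ ‖φ‖ + e * ‖ψ‖ := by
      refine (norm_sub_le _ _).trans ?_
      rw [norm_smul, norm_mul, hz, norm_real, norm_of_nonneg he0.le, mul_one]
      gcongr
      exact hW ψ
    have h5 : ‖ψ‖ ≤ K * (‖φ‖ + e * ‖ψ‖) := h3.trans (by gcongr)
    have h6 : K * (‖φ‖ + e * ‖ψ‖) = K * ‖φ‖ + 1 / 4 * ‖ψ‖ := by rw [← heK]; ring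
    have h7 : 0 ≤ K * ‖φ‖ := by positivity
    linarith
  have hs : ‖(↑u⁻¹ : X →L[ℂ] X) * (((e : ℂ) * z) • W)‖ < 1 := by
    refine (norm_mul_le _ _).trans_lt ?_
    rw [norm_smul, norm_mul, hz, norm_real, norm_of_nonneg he0.le, mul_one]
    have : ‖(↑u⁻¹ : X →L[ℂ] X)‖ * (e * ‖W‖) ≤ 2 * K * (e * 1) := by gcongr
    linarith
  have key : (1 - z • W) = u * (1 - (↑u⁻¹ : X →L[ℂ] X) * (((e : ℂ) * z) • W)) := by
    rw [mul_sub, ← mul_assoc, u.mul_inv, mul_one, one_mul, hu]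
    push_cast
    module
  rw [key]
  exact u.isUnit.mul (isUnit_one_sub_of_norm_lt_one hs)

lemma notMem_spectrum_of_bound {X : Type*} [NormedAddCommGroup X] [NormedSpace ℂ X] [CompleteSpace X]
    {W : X →L[ℂ] X} (hW : ∀ ψ, ‖W ψ‖ ≤ ‖ψ‖) {z w : ℂ} (hz : ‖z‖ = 1) (hw : w * z = 1) {C : ℝ}
    (hC : ∀ ψ, ‖ψ‖ ≤ C * ‖ψ - z • W ψ‖) : w ∉ spectrum ℂ W := by
  rw [spectrum.notMem_iff]
  have h := isUnit_one_sub_of_bound hW hz hC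
  have : algebraMap ℂ (X →L[ℂ] X) w - W = algebraMap ℂ (X →L[ℂ] X) w * (1 - z • W) := by
    rw [Algebra.algebraMap_eq_smul_one, smul_mul_assoc, one_mul, smul_sub, smul_smul, hw, one_smul]
  rw [this]
  refine IsUnit.mul ?_ h
  exact (isUnit_iff_ne_zero.2 (left_ne_zero_of_mul_eq_one hw)).map _

lemma regime_arccos {t l : ℝ} (ht : t ∈ Ioo (-1 : ℝ) 1)
    (hl : l ∈ Ioo (0 : ℝ) ((1 - t ^ 2) / (1 + t ^ 2))) :
    Regime t (arccos l) ∧ cos (arccos l) = l ∧ sin (arccos l) = sq1 l := by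
  obtain ⟨h0, h1⟩ := hl
  have ht2 : t ^ 2 < 1 := by nlinarith [ht.1, ht.2]
  rw [lt_div_iff₀ (by positivity)] at h1
  have hl1 : l < 1 := by nlinarith [sq_nonneg t]
  have hc : cos (arccos l) = l := Real.cos_arccos (by linarith) hl1.le
  have hs : sin (arccos l) = sq1 l := Real.sin_arccos l
  refine ⟨⟨Real.arccos_pos.2 hl1, Real.arccos_lt_pi_div_two.2 h0, ?_⟩, hc, hs⟩
  rw [hc, hs, sq1]
  have h2 : 0 < 1 - l ^ 2 := by nlinarith
  refine abs_lt_of_sq_lt_sq ?_ (mul_nonneg (by linarith) (sqrt_nonneg _))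
  rw [mul_pow, mul_pow (1 - t ^ 2), sq_sqrt h2.le]
  nlinarith [mul_pos h0 (by positivity : 0 < 1 + t ^ 2)]

lemma circ_half : circ (1 / 2) = -1 := by
  rw [circ, ← Complex.exp_pi_mul_I]
  congr 1
  push_cast
  ring

lemma fA_pi_sub_add_half (t α x : ℝ) : fA t (π - α) (x + 1 / 2) = fA t α x := by
  rw [fA, fA, sin_pi_sub, cos_pi_sub, show 2 * π * (x + 1 / 2) = 2 * π * x + π by ring,
    Real.cos_add_pi]
  ring

lemma gA_pi_sub_add_half (t α x : ℝ) : gA t (π - α) (x + 1 / 2) = gA t α x := by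
  rw [gA, gA, sin_pi_sub, cos_pi_sub, circ_neg_eq_star (x + 1 / 2), circ_add, circ_half, star_mul, star_neg, star_one,
    ← circ_neg_eq_star]
  push_cast
  ring

lemma fS_eq {t l α : ℝ} (hc : cos α = l) (hs : sin α = sq1 l) (x : ℝ) :
    fS t l x = fA t (π - α) (x + 1 / 2) := by
  rw [fA_pi_sub_add_half, fS, fA, hc, hs, one_div_neg_eq_neg_one_div]
  ring

lemma gS_eq {t l α : ℝ} (hc : cos α = l) (hs : sin α = sq1 l) (x : ℝ) :
    gS t l x = gA t (π - α) (x + 1 / 2) := by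
  rw [gA_pi_sub_add_half, gS, gA, hc, hs, one_div_neg_eq_neg_one_div, circ, circ]
  push_cast
  rw [show -(2 * (π : ℂ) * x) * I = 2 * π * -x * I by ring]
  ring

/-- The components of `ψ - z W ψ`. -/
lemma residual_eq {t l α Φ θ : ℝ} (hc : cos α = l) (hs : sin α = sq1 l) (z : ℂ)
    (ψ : ℤ → EuclideanSpace ℂ (Fin 2)) (n : ℤ) :
    ψ n 0 - z * wPlus t l l Φ θ ψ n = resUp t α Φ (θ + 1 / 2) z (fun n => ψ n 0) (fun n => ψ n 1) n ∧
    ψ n 1 - z * wMinus t l l Φ θ ψ n = resDown t α Φ (θ + 1 / 2) z (fun n => ψ n 0) (fun n => ψ n 1) n := by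
  have e : ∀ y : ℝ, θ + y * Φ + 1 / 2 = θ + 1 / 2 + y * Φ := fun y => by ring
  rw [wPlus, wMinus, resUp, resDown]
  simp only [fS_eq hc hs, gS_eq hc hs, e, hc, hs]
  push_cast
  constructor
  · rfl
  · rw [add_comm ((l : ℂ) * _)]
    rfl

lemma norm_sq_coin {f : ℝ} {g a b : ℂ} (h : f ^ 2 + ‖g‖ ^ 2 = 1) :
    ‖f * a - g * b‖ ^ 2 + ‖(starRingEnd ℂ) g * a + f * b‖ ^ 2 = ‖a‖ ^ 2 + ‖b‖ ^ 2 := by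
  have : (((‖f * a - g * b‖ ^ 2 + ‖(starRingEnd ℂ) g * a + f * b‖ ^ 2 : ℝ)) : ℂ) =
      ((f ^ 2 + ‖g‖ ^ 2 : ℝ) : ℂ) * ((‖a‖ ^ 2 + ‖b‖ ^ 2 : ℝ) : ℂ) := by
    push_cast
    simp only [← conj_mul', map_sub, map_add, map_mul, conj_ofReal, Complex.conj_conj]
    ring
  rw [h, ofReal_one, one_mul] at this
  exact_mod_cast this

lemma norm_sq_rot {c s : ℝ} {a b : ℂ} (h : c ^ 2 + s ^ 2 = 1) :
    ‖c * a - s * b‖ ^ 2 + ‖c * b + s * a‖ ^ 2 = ‖a‖ ^ 2 + ‖b‖ ^ 2 := by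
  have h' : c ^ 2 + ‖(s : ℂ)‖ ^ 2 = 1 := by rwa [norm_real, norm_eq_abs, sq_abs]
  rw [← norm_sq_coin (a := a) (b := b) h', conj_ofReal, add_comm ((s : ℂ) * a)]

lemma hasSum_norm_sq (ψ : H2) : HasSum (nu (fun n => ψ n 0) (fun n => ψ n 1)) (‖ψ‖ ^ 2) := by
  have h := lp.hasSum_norm (p := 2) (by norm_num) ψ
  have e : ∀ x : ℝ, x ^ (2 : ENNReal).toReal = x ^ 2 := fun x => by
    rw [ENNReal.toReal_ofNat]; exact_mod_cast Real.rpow_natCast x 2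
  simp only [e] at h
  convert h using 2 with n
  rw [EuclideanSpace.norm_sq_eq, Fin.sum_univ_two, nu]

lemma sub_smul_apply_apply (ψ χ : H2) (z : ℂ) (n : ℤ) (i : Fin 2) : (ψ - z • χ) n i = ψ n i - z * χ n i := rfl

lemma norm_walk {t l Φ θ : ℝ} (hl : l ^ 2 ≤ 1) (hf : ∀ x, fS t l x ^ 2 + ‖gS t l x‖ ^ 2 = 1)
    {W : H2 →L[ℂ] H2} (hW : ∀ (ψ : H2) (n : ℤ), W ψ n 0 = wPlus t l l Φ θ (fun m => ψ m) n ∧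
      W ψ n 1 = wMinus t l l Φ θ (fun m => ψ m) n) (ψ : H2) : ‖W ψ‖ = ‖ψ‖ := by
  obtain ⟨u, hu⟩ : ∃ u : ℤ → ℂ, u = fun n : ℤ => (fS t l (θ + (n : ℝ) * Φ) : ℂ) * ψ n 0 - gS t l (θ + (n : ℝ) * Φ) * ψ n 1 :=
    ⟨_, rfl⟩
  obtain ⟨d, hd⟩ : ∃ d : ℤ → ℂ, d = fun n : ℤ => (starRingEnd ℂ) (gS t l (θ + (n : ℝ) * Φ)) * ψ n 0 +
      (fS t l (θ + (n : ℝ) * Φ) : ℂ) * ψ n 1 := ⟨_, rfl⟩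
  have h1 : HasSum (nu u d) (‖ψ‖ ^ 2) := by
    have : nu u d = nu (fun n => ψ n 0) (fun n => ψ n 1) := by
      funext n
      simp only [nu, hu, hd]
      exact norm_sq_coin (hf _)
    rw [this]
    exact hasSum_norm_sq ψ
  have e1 : ∀ n, W ψ n 0 = l * u (n - 1) - sq1 l * d n := fun n => by
    rw [(hW ψ n).1, wPlus, hu, hd]; push_cast; rfl
  have e2 : ∀ n, W ψ n 1 = l * d (n + 1) + sq1 l * u n := fun n => by
    rw [(hW ψ n).2, wMinus, hu, hd]; push_cast; rfl
  have hcs : l ^ 2 + sq1 l ^ 2 = 1 := by rw [sq1, sq_sqrt (by linarith)]; ring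
  have hsu : Summable fun n => ‖u n‖ ^ 2 := h1.summable.of_nonneg_of_le (fun n => by positivity)
    fun n => by rw [nu]; linarith [sq_nonneg ‖d n‖]
  have hsd : Summable fun n => ‖d n‖ ^ 2 := h1.summable.of_nonneg_of_le (fun n => by positivity)
    fun n => by rw [nu]; linarith [sq_nonneg ‖u n‖]
  have hWs := hasSum_norm_sq (W ψ)
  have hs0 : Summable fun n => ‖W ψ n 0‖ ^ 2 := hWs.summable.of_nonneg_of_le (fun n => by positivity)
    fun n => by rw [nu]; linarith [sq_nonneg ‖W ψ n 1‖]
  have hs1 : Summable fun n => ‖W ψ n 1‖ ^ 2 := hWs.summable.of_nonneg_of_le (fun n => by positivity)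
    fun n => by rw [nu]; linarith [sq_nonneg ‖W ψ n 0‖]
  have k1 : HasSum (fun n : ℤ => ‖W ψ n 0‖ ^ 2 + ‖W ψ (n + -1) 1‖ ^ 2) (‖W ψ‖ ^ 2) := by
    rw [hWs.unique (hs0.hasSum.add hs1.hasSum)]
    exact hs0.hasSum.add (hasSum_shift hs1.hasSum (-1))
  have k2 : HasSum (fun n : ℤ => ‖u (n + -1)‖ ^ 2 + ‖d n‖ ^ 2) (‖ψ‖ ^ 2) := by
    rw [h1.unique (hsu.hasSum.add hsd.hasSum)]
    exact (hasSum_shift hsu.hasSum (-1)).add hsd.hasSum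
  have k3 : (fun n : ℤ => ‖W ψ n 0‖ ^ 2 + ‖W ψ (n + -1) 1‖ ^ 2) = fun n : ℤ => ‖u (n + -1)‖ ^ 2 + ‖d n‖ ^ 2 := by
    funext n
    rw [e1, e2, neg_add_cancel_right]
    exact norm_sq_rot hcs
  rw [k3] at k1
  exact (sq_eq_sq₀ (norm_nonneg _) (norm_nonneg _)).1 (k1.unique k2)

/-- If `1 - z W` is bounded below on the model, `z⁻¹` lies off the spectrum. -/
lemma notMem_spectrum_walk {t l α Φ θ : ℝ} (hc : cos α = l) (hs : sin α = sq1 l)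
    {W : H2 →L[ℂ] H2} (hW : ∀ (ψ : H2) (n : ℤ), W ψ n 0 = wPlus t l l Φ θ (fun m => ψ m) n ∧
      W ψ n 1 = wMinus t l l Φ θ (fun m => ψ m) n) {s C : ℝ}
    (hC : ∀ (a b : ℤ → ℂ) (P R : ℝ), HasSum (nu a b) P →
      HasSum (nu (resUp t α Φ (θ + 1 / 2) (circ s) a b) (resDown t α Φ (θ + 1 / 2) (circ s) a b)) R → P ≤ C * R) :
    circ (-s) ∉ spectrum ℂ W := by
  have hl : l ^ 2 ≤ 1 := by rw [← hc]; exact Real.cos_sq_le_one α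
  have hf : ∀ x, fS t l x ^ 2 + ‖gS t l x‖ ^ 2 = 1 := fun x => by
    rw [fS_eq hc hs, gS_eq hc hs]; exact fA_sq_add _ _ _
  refine notMem_spectrum_of_bound (fun ψ => (norm_walk hl hf hW ψ).le) (norm_circ s)
    (by rw [mul_comm]; exact circ_mul_circ_neg s) (C := sqrt C) fun ψ => ?_
  obtain ⟨χ, hχ⟩ : ∃ χ, χ = ψ - circ s • W ψ := ⟨_, rfl⟩
  have e0 : (fun n => χ n 0) = resUp t α Φ (θ + 1 / 2) (circ s) (fun n => ψ n 0) (fun n => ψ n 1) := by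
    funext n
    rw [← (residual_eq hc hs (circ s) (fun m => ψ m) n).1, ← (hW ψ n).1, hχ, sub_smul_apply_apply]
  have e1 : (fun n => χ n 1) = resDown t α Φ (θ + 1 / 2) (circ s) (fun n => ψ n 0) (fun n => ψ n 1) := by
    funext n
    rw [← (residual_eq hc hs (circ s) (fun m => ψ m) n).2, ← (hW ψ n).2, hχ, sub_smul_apply_apply]
  have h1 := hasSum_norm_sq χ
  rw [e0, e1] at h1
  rw [← hχ]
  have h3 := sqrt_le_sqrt (hC _ _ _ _ (hasSum_norm_sq ψ) h1)
  rwa [sqrt_sq (norm_nonneg _), Real.sqrt_mul' _ (sq_nonneg _), sqrt_sq (norm_nonneg _)] at h3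

lemma exists_pos_le_abs_mul_sub {x : ℝ} (hx : Irrational x) (N : ℕ) :
    ∃ δ > 0, ∀ k : ℕ, 0 < k → k < N → ∀ j : ℤ, δ ≤ |k * x - j| := by
  induction N with
  | zero => exact ⟨1, one_pos, fun k _ h => absurd h (by omega)⟩
  | succ N ih =>
    obtain ⟨δ, hδ, h⟩ := ih
    rcases Nat.eq_zero_or_pos N with rfl | hN
    · exact ⟨1, one_pos, fun k h1 h2 => absurd h2 (by omega)⟩
    · refine ⟨min δ |N * x - round (N * x)|, lt_min hδ (abs_pos.2 ?_), fun k hk hkN j => ?_⟩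
      · exact sub_ne_zero.2 ((hx.natCast_mul hN.ne').ne_int _)
      · rcases Nat.lt_succ_iff_lt_or_eq.1 hkN with hlt | rfl
        · exact (min_le_left _ _).trans (h k hk hlt j)
        · exact (min_le_right _ _).trans (round_le _ _)

lemma exists_rat_close {x : ℝ} (hx : Irrational x) (N : ℕ) :
    ∃ r : ℚ, N ≤ r.den ∧ |x - r.num / r.den| ≤ 1 / (r.den : ℝ) ^ 2 := by
  obtain ⟨δ, hδ, h⟩ := exists_pos_le_abs_mul_sub hx N
  obtain ⟨n, hn⟩ := exists_nat_one_div_lt hδ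
  obtain ⟨r, hr, hrd⟩ := Real.exists_rat_abs_sub_le_and_den_le x (n := n + 1) (by omega)
  have hd : (0 : ℝ) < r.den := mod_cast r.den_pos
  have hr' : (r : ℝ) = r.num / r.den := mod_cast (Rat.num_div_den r).symm
  rw [hr'] at hr
  have hrd' : (r.den : ℝ) ≤ n + 1 := mod_cast hrd
  refine ⟨r, ?_, hr.trans ?_⟩
  · by_contra hlt
    have h1 := h r.den r.den_pos (by omega) r.num
    have h2 : |r.den * x - r.num| = r.den * |x - r.num / r.den| := by
      rw [← abs_of_pos hd, ← abs_mul, abs_of_pos hd]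
      congr 1
      field_simp
    have h3 : (r.den : ℝ) * |x - r.num / r.den| ≤ r.den * (1 / (((n + 1 : ℕ) + 1) * r.den)) := by gcongr
    have h4 : (r.den : ℝ) * (1 / (((n + 1 : ℕ) + 1) * r.den)) = 1 / ((n + 1 : ℕ) + 1) := by field_simp
    have h5 : 1 / (((n + 1 : ℕ) : ℝ) + 1) ≤ 1 / (n + 1) := by
      push_cast
      gcongr
      linarith
    linarith
  · rw [sq]
    push_cast
    gcongr
    linarith

/-- Irrational numbers have arbitrarily good rational approximants with odd denominator. -/
lemma exists_approx {Φ : ℝ} (hΦ : Irrational Φ) (N : ℕ) : ∃ q ≥ N, ∃ p, Approx Φ q p := by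
  obtain ⟨r, hr, hc⟩ := exists_rat_close hΦ (N + 2)
  obtain ⟨k, hk⟩ : ∃ k, k = r.den := ⟨_, rfl⟩
  obtain ⟨j, hj⟩ : ∃ j, j = r.num := ⟨_, rfl⟩
  have hco : IsCoprime j (k : ℤ) := by
    rw [hj, hk, Int.isCoprime_iff_gcd_eq_one]
    exact r.reduced
  rw [← hk] at hr hc
  rw [← hj] at hc
  have hk0 : (0 : ℝ) < k := mod_cast (by omega : 0 < k)
  obtain ⟨a, b, hab⟩ := hco
  rcases Nat.even_or_odd k with he | ho
  · have hu0 := Int.emod_nonneg a (by omega : (k : ℤ) ≠ 0)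
    have hu1 := Int.emod_lt_of_pos a (by omega : (0 : ℤ) < k)
    obtain ⟨u, hu⟩ := Int.eq_ofNat_of_zero_le hu0
    have hdm := Int.emod_add_mul_ediv a k
    obtain ⟨p, hp⟩ : ∃ p, p = j - b - (a / k) * j := ⟨_, rfl⟩
    have hqp : ((k + u : ℕ) : ℤ) * j - k * p = 1 := by
      rw [hp]
      push_cast
      rw [← hu]
      linear_combination j * hdm + hab
    refine ⟨k + u, by omega, p, ?_, ?_, by omega, ?_⟩
    · by_contra hne
      rw [Nat.not_odd_iff_even] at hne
      obtain ⟨c, hc⟩ := hne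
      obtain ⟨d, hd⟩ := he
      have h2 : (2 : ℤ) ∣ 1 := ⟨c * j - d * p, by
        rw [← hqp, hc, hd]
        push_cast
        ring⟩
      omega
    · have := congrArg (Int.cast : ℤ → ZMod (k + u)) hqp
      push_cast at this
      have h0 : ((k : ZMod (k + u)) + u) = 0 := mod_cast ZMod.natCast_self (k + u)
      rw [h0, zero_mul, zero_sub] at this
      exact IsUnit.of_mul_eq_one (-(k : ZMod (k + u))) (by rw [← this]; ring)
    · have hq0 : (0 : ℝ) < (k + u : ℕ) := mod_cast (by omega : 0 < k + u)
      have hq2 : ((k + u : ℕ) : ℝ) ≤ 2 * k := mod_cast (by omega : k + u ≤ 2 * k)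
      have hR : ((k + u : ℕ) : ℝ) * j - k * p = 1 := mod_cast hqp
      have hsub : (j : ℝ) / k - p / (k + u : ℕ) = 1 / (k * (k + u : ℕ)) := by
        rw [div_sub_div _ _ hk0.ne' hq0.ne', ← hR]
        ring
      have h1 : 1 / (k : ℝ) ^ 2 ≤ 4 / ((k + u : ℕ) : ℝ) ^ 2 := by
        rw [div_le_div_iff₀ (by positivity) (by positivity)]
        nlinarith
      have h2 : 1 / ((k : ℝ) * (k + u : ℕ)) ≤ 2 / ((k + u : ℕ) : ℝ) ^ 2 := by
        rw [div_le_div_iff₀ (by positivity) (by positivity)]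
        nlinarith
      calc |Φ - p / (k + u : ℕ)| = |(Φ - j / k) + (j / k - p / (k + u : ℕ))| := by congr 1; ring
        _ ≤ |Φ - j / k| + |(j : ℝ) / k - p / (k + u : ℕ)| := abs_add_le _ _
        _ ≤ 4 / ((k + u : ℕ) : ℝ) ^ 2 + 2 / ((k + u : ℕ) : ℝ) ^ 2 := by
          refine add_le_add (hc.trans h1) ?_
          rw [hsub, abs_of_pos (by positivity)]
          exact h2
        _ = _ := by ring
  · refine ⟨k, by omega, j, ho, ?_, by omega, hc.trans (by gcongr; norm_num)⟩
    have := congrArg (Int.cast : ℤ → ZMod k) hab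
    push_cast at this
    rw [ZMod.natCast_self, mul_zero, add_zero] at this
    exact IsUnit.of_mul_eq_one _ (by rw [mul_comm]; exact this)

/-- The model walk `1 - z W` is bounded below at `z = circ s`. -/
def Coercive (t α Φ θ s : ℝ) : Prop :=
  ∃ C : ℝ, ∀ (a b : ℤ → ℂ) (P R : ℝ), HasSum (nu a b) P →
    HasSum (nu (resUp t α Φ θ (circ s) a b) (resDown t α Φ θ (circ s) a b)) R → P ≤ C * R

lemma coercive_of_ringBound {q : ℕ} [NeZero q] {t α Φ θ ρ s ε : ℝ} {p : ℤ} (ha : Approx Φ q p) (hρ : 0 < ρ)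
    (hε1 : ε ≤ 1) (hρε : ρ ≤ ε / 20000) (hq : 1 ≤ ρ * q) (hB : RingBound t α q p ρ s (1 / 21) (ε / q)) :
    Coercive t α Φ θ s := by
  have hq0 : (0 : ℝ) < q := by exact_mod_cast (by have := ha.one_lt; omega : 0 < q)
  obtain ⟨L, hL⟩ : ∃ L : ℕ, L = ⌈ρ * q⌉₊ := ⟨_, rfl⟩
  have hL1 : ρ * q ≤ L := hL ▸ Nat.le_ceil _
  have hL2 : (L : ℝ) ≤ 2 * (ρ * q) := by
    have := Nat.ceil_lt_add_one (by positivity : 0 ≤ ρ * q)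
    rw [← hL] at this
    linarith
  have hρq : 20000 * (ρ * q) ≤ q := by nlinarith
  have hLq : 3 * L + 1 < q := by
    have : ((3 * L + 1 : ℕ) : ℝ) < q := by push_cast; linarith
    exact_mod_cast this
  refine ⟨_, fun a b P R hv hr => sum_nu_le hB (L := L) (Nat.ceil_pos.2 (by positivity) |> fun h => hL ▸ h) hLq hL1 ?_
    (by norm_num) ?_ hv hr⟩
  · rw [Nat.cast_sub (by omega)]
    push_cast
    linarith
  · have h1 : 21 * L * |Φ - p / q| ≤ 252 / 20000 * (ε / q) :=
      calc 21 * L * |Φ - p / q| ≤ 21 * (2 * (ε / 20000 * q)) * (6 / q ^ 2) := by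
            have hε0 : 0 < ε := by linarith
            gcongr
            · exact hL2.trans (by gcongr)
            · exact ha.close
        _ = _ := by field_simp; ring
    have h2 := pow_le_pow_left₀ (by positivity) h1 2
    have h3 : 0 ≤ (ε / q) ^ 2 := sq_nonneg _
    rw [mul_pow] at h2
    linarith

lemma exists_coercive {t α Φ κ ρ η ε σ : ℝ} (ht : t ^ 2 ≤ 1) (h : Regime t α) (hκ : 0 < κ) (hρ : 0 < ρ)
    (h0 : 0 < η) (h1 : η ≤ 1 / 2) (h2 : η ≤ κ * ρ / 32) (hε : 0 < ε) (hε1 : ε ≤ 1) (hρε : ρ ≤ ε / 20000) (hσ : 0 < σ) :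
    ∃ Q₀ : ℕ, ∀ q₀ ≥ Q₀, ∀ p₀, Approx Φ q₀ p₀ → ∃ Q : ℕ, ∀ q ≥ Q, ∀ p, Approx Φ q p →
      ∀ s, GoodPoint t α κ ρ η q₀ p₀ q p (circ s) →
      (¬ ∃ s', |s - s'| < ε / q ∧ ‖chi (qRing t α (π - α) q (p / q) 0) (circ s')‖ ≤ 32 * base t α ^ q) →
      σ ≤ |sin (2 * π * s)| → ∀ θ, Coercive t α Φ θ s := by
  obtain ⟨Q₀, hQ₀⟩ := exists_decay (Φ := Φ) h hκ hρ (by linarith) h0 h1 h2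
  refine ⟨Q₀, fun q₀ hq₀ p₀ ha₀ => ?_⟩
  obtain ⟨G, hG⟩ : ∃ G, G = cos α * (coinP t α - |coinB t α|) := ⟨_, rfl⟩
  have hG0 : 0 < G := hG ▸ mul_pos h.cos_pos (sub_pos.2 (abs_coinB_lt h.gap))
  obtain ⟨Q, hQ⟩ := hQ₀ q₀ hq₀ p₀ ha₀ (G * σ / 3024) (by positivity)
  refine ⟨max Q ⌈1 / ρ⌉₊, fun q hq p ha s hg hfar hs θ => ?_⟩
  have hq0 : 0 < q := by have := ha.one_lt; omega
  haveI : NeZero q := ⟨hq0.ne'⟩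
  have hρq : 1 ≤ ρ * q := by
    have : 1 / ρ ≤ q := (Nat.le_ceil _).trans (by exact_mod_cast (le_max_right _ _).trans hq)
    rwa [div_le_iff₀ hρ, mul_comm] at this
  have hτ : 0 < ε / q := div_pos hε (by exact_mod_cast hq0)
  have hdec := hQ q ((le_max_left _ _).trans hq) p ha _ hg
  have hres := ring_resolvent ha.odd h ha.unit hτ hfar
  have hs0 : 0 < |sin (2 * π * s)| := hσ.trans_le hs
  refine coercive_of_ringBound ha hρ hε1 hρε hρq ⟨by norm_num, hτ, ?_, fun x => (hres x).1, fun x => (hres x).2⟩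
  intro x u r hr m a hl hr' ha' ha1 ha2
  have key := ring_green ht h (by linarith) h0 h1 hdec (abs_pos.1 hs0) (hres x).1 hr m hl hr' ha' ha1 ha2 (by positivity)
  rw [← hG] at key
  obtain ⟨X, hX⟩ : ∃ X, X = ‖u (Sum.inl (site q (m + a)))‖ + ‖u (Sum.inr (site q (m + a)))‖ := ⟨_, rfl⟩
  obtain ⟨Y, hY⟩ : ∃ Y, Y = ‖r (Sum.inl (site q m))‖ + ‖r (Sum.inr (site q (m + q - 1)))‖ := ⟨_, rfl⟩
  rw [← hX, ← hY] at key ⊢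
  have hX0 : 0 ≤ X := hX ▸ by positivity
  have h3 : G * σ * X ≤ G * |sin (2 * π * s)| * X := by gcongr
  have h4 : G * σ * X ≤ G * σ * (1 / 21 * Y) := by
    refine h3.trans (key.trans (le_of_eq ?_))
    ring
  exact le_of_mul_le_mul_left h4 (by positivity)

lemma measure_not_coercive_le {t α Φ ε σ : ℝ} (ht : t ^ 2 ≤ 1) (h : Regime t α) (hΦ : Irrational Φ) (hε : 0 < ε)
    (hε1 : ε ≤ 1) (hσ : 0 < σ) (θ : ℝ) :
    volume {s : ℝ | s ∈ Ico (0 : ℝ) 1 ∧ σ ≤ |sin (2 * π * s)| ∧ ¬ Coercive t α Φ θ s} ≤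
      ofReal (27 * ε) := by
  obtain ⟨κ, hκ, Qg, hgrow⟩ := exists_growth (Φ := Φ) h (exists_approx hΦ) hε
  obtain ⟨ρ, hρ⟩ : ∃ ρ, ρ = ε / 20000 := ⟨_, rfl⟩
  have hρ0 : 0 < ρ := by rw [hρ]; positivity
  obtain ⟨η, h0, h1, h2, h3⟩ : ∃ η : ℝ, 0 < η ∧ η ≤ 1 / 2 ∧ η ≤ κ * ρ / 32 ∧ η ≤ (κ * ρ / 48 * (ε / 6) ^ 2) ^ 2 :=
    ⟨min (1 / 2) (min (κ * ρ / 32) ((κ * ρ / 48 * (ε / 6) ^ 2) ^ 2)),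
      lt_min (by norm_num) (lt_min (by positivity) (by positivity)), min_le_left _ _,
      (min_le_right _ _).trans (min_le_left _ _), (min_le_right _ _).trans (min_le_right _ _)⟩
  obtain ⟨Q₀, hQ₀⟩ := exists_coercive (Φ := Φ) ht h hκ hρ0 h0 h1 h2 hε hε1 hρ.le hσ
  obtain ⟨q₀, hq₀, p₀, ha₀⟩ := exists_approx hΦ (max Q₀ Qg)
  obtain ⟨Q, hQ⟩ := hQ₀ q₀ ((le_max_left _ _).trans hq₀) p₀ ha₀
  obtain ⟨q, hq, p, ha⟩ := exists_approx hΦ (max Q ⌈2 * 32 / (2 * tan α) / (ε / 6) ^ 2⌉₊)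
  have hq1 := ha.one_lt
  haveI : NeZero q := ⟨by omega⟩
  have hq0 : (0 : ℝ) < q := by exact_mod_cast (by omega : 0 < q)
  have hqN : 2 * 32 / (2 * tan α) / q ≤ (ε / 6) ^ 2 := by
    have : 2 * 32 / (2 * tan α) / (ε / 6) ^ 2 ≤ q :=
      (Nat.le_ceil _).trans (by exact_mod_cast (le_max_right _ _).trans hq)
    rw [div_le_iff₀ (by positivity)] at this
    rw [div_le_iff₀ hq0]
    linarith
  have m1 := hgrow q₀ ((le_max_right _ _).trans hq₀) p₀ ha₀
  have m2 : volume {s : ℝ | s ∈ Ico (0 : ℝ) 1 ∧ ‖chi (qRing t α (π - α) q (p / q) 0) (circ s)‖ *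
      exp (κ * ρ / 8 * q) < ‖chi (qRing t α (π - α) q (p / q) 0) ((1 - η : ℝ) * circ s)‖} ≤
      ofReal ε := by
    refine (chi_radius_weak_type (qRing_unitary t α (π - α) q (p / q) 0) (by linarith) (by positivity)).trans
      (ofReal_le_ofReal (sqrt_six_le hε.le ?_))
    have hsq : sqrt η ≤ κ * ρ / 48 * (ε / 6) ^ 2 := sqrt_le_iff.2 ⟨by positivity, h3⟩
    rw [card_ring, sub_sub_cancel, div_le_iff₀ (by positivity)]
    push_cast
    calc 3 * sqrt η * (2 * q) ≤ 3 * (κ * ρ / 48 * (ε / 6) ^ 2) * (2 * q) := by gcongr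
      _ = _ := by ring
  have hεq : ε / q ≤ 1 := by
    rw [div_le_one hq0]
    exact hε1.trans (by exact_mod_cast hq1.le)
  have m3 := near_level_measure (t := t) ha.odd hq1 ha.unit h (K := 32) (by norm_num) (div_pos hε hq0) hεq
  have m3' := m3.trans (add_le_add (ofReal_le_ofReal (sqrt_six_le hε.le hqN))
    (ofReal_le_ofReal (le_of_eq (by field_simp : 24 * q * (ε / q) = 24 * ε))))
  refine (measure_mono (t := _ ∪ (_ ∪ _)) fun s hs => ?_).trans ((measure_union_le _ _).trans
    ((add_le_add m1 ((measure_union_le _ _).trans (add_le_add m2 m3'))).trans (le_of_eq ?_)))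
  · rw [mem_ofPred_eq] at hs
    obtain ⟨hI, hsin, hnc⟩ := hs
    by_contra hout
    simp only [Set.mem_union, mem_ofPred_eq, hI, true_and, not_or] at hout
    obtain ⟨g1, g2, g3⟩ := hout
    refine hnc (hQ q ((le_max_left _ _).trans hq) p ha s ⟨norm_circ s, not_lt.1 g1, ?_, ?_⟩ g3 hsin θ)
    · rw [mul_comm (exp _)]
      exact not_lt.1 g2
    · by_contra hlt
      exact g3 ⟨s, by rw [sub_self, abs_zero]; exact div_pos hε hq0, (not_le.1 hlt).le⟩
  · rw [← ofReal_add hε.le (by positivity), ← ofReal_add hε.le (by positivity),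
      ← ofReal_add hε.le (by positivity)]
    congr 1
    ring

lemma measure_not_coercive {t α Φ : ℝ} (ht : t ^ 2 ≤ 1) (h : Regime t α) (hΦ : Irrational Φ) (θ : ℝ) :
    volume {s : ℝ | s ∈ Ico (0 : ℝ) 1 ∧ ¬ Coercive t α Φ θ s} = 0 := by
  have h1 : ∀ n : ℕ, volume {s : ℝ | s ∈ Ico (0 : ℝ) 1 ∧ 1 / ((n : ℝ) + 1) ≤ |sin (2 * π * s)| ∧
      ¬ Coercive t α Φ θ s} = 0 := by
    intro n
    refine le_antisymm (ge_of_tendsto' (f := fun m : ℕ => ofReal (27 * (1 / ((m : ℝ) + 1))))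
      (x := Filter.atTop) ?_ fun m => ?_) bot_le
    · have := (tendsto_one_div_add_atTop_nhds_zero_nat (𝕜 := ℝ)).const_mul 27
      rw [mul_zero] at this
      simpa using ENNReal.tendsto_ofReal this
    · refine measure_not_coercive_le ht h hΦ (by positivity) ?_ (by positivity) θ
      rw [div_le_one (by positivity)]
      linarith [(Nat.cast_nonneg m : (0 : ℝ) ≤ m)]
  have h2 : volume (Set.range fun n : ℤ => (n / 2 : ℝ)) = 0 := (Set.countable_range _).measure_zero _
  refine measure_mono_null (fun s hs => ?_) (measure_union_null (measure_iUnion_null h1) h2)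
  rw [mem_ofPred_eq] at hs
  by_cases h0 : sin (2 * π * s) = 0
  · right
    obtain ⟨n, hn⟩ := Real.sin_eq_zero_iff.1 h0
    refine ⟨n, ?_⟩
    have hpi := pi_pos.ne'
    beta_reduce
    field_simp
    exact mul_right_cancel₀ hpi (by linarith)
  · left
    obtain ⟨n, hn⟩ := exists_nat_one_div_lt (abs_pos.2 h0)
    exact Set.mem_iUnion.2 ⟨n, hs.1, hn.le, hs.2⟩

end


/-- Zero-measure spectrum in the critical region: for `λ₁ = λ₂ ∈ (0, (1−t²)/(1+t²))` and
`Φ` irrational, the spectrum of the walk operator `W = W_{λ₁,λ₁,Φ,θ}`, viewed through the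
parametrization `s ↦ e^{2πis}` of the unit circle, has zero Lebesgue measure. -/
theorem zero_measure_spectrum_critical
    (t l1 Φ θ : ℝ)
    (ht : t ∈ Set.Ioo (-1 : ℝ) 1)
    (hl1 : l1 ∈ Set.Ioo (0 : ℝ) ((1 - t ^ 2) / (1 + t ^ 2)))
    (hΦ : Irrational Φ)
    (W : H2 →L[ℂ] H2)
    (hW : ∀ (ψ : H2) (n : ℤ),
      W ψ n 0 = wPlus t l1 l1 Φ θ (fun m => ψ m) n ∧
      W ψ n 1 = wMinus t l1 l1 Φ θ (fun m => ψ m) n) :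
    volume {s : ℝ | s ∈ Set.Ico (0 : ℝ) 1 ∧
      Complex.exp (2 * Real.pi * s * Complex.I) ∈ spectrum ℂ W} = 0 := by
  obtain ⟨hreg, hc, hs⟩ := regime_arccos ht hl1
  have hnull := measure_not_coercive (t := t) (by nlinarith [ht.1, ht.2]) hreg hΦ (θ + 1 / 2)
  have hpre := (Measure.measurePreserving_sub_left volume (1 : ℝ)).quasiMeasurePreserving.preimage_null hnull
  refine measure_mono_null (fun s hsp => ?_) (measure_union_null hpre (measure_singleton (0 : ℝ)))
  rw [Set.mem_ofPred_eq] at hsp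
  obtain ⟨hI, hsp⟩ := hsp
  rcases hI.1.eq_or_lt with h0 | h0
  · right
    exact h0.symm
  · left
    refine ⟨⟨by linarith [hI.2], by linarith⟩, fun ⟨C, hC⟩ => ?_⟩
    refine notMem_spectrum_walk hc hs hW hC ?_
    rw [show -(1 - s) = s + (-1 : ℤ) by push_cast; ring, circ_add, circ_intCast, mul_one]
    exact hsp

end
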